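/- Let p and q be primes with p ≡ q ≡ 3 (mod 8), set d = pq, and let r ≥ 0 be the integer with 2^r = h₂(-2pq). Then for every integer n ≥ 1, the 2-class group of L_{n,d} is isomorphic to (ℤ/2^{n+r-2}ℤ) × (ℤ/2ℤ). -/

import Mathlib

open IntermediateField NumberField

/-- The quadratic field `ℚ(√m)` realized inside `ℂ` (for `m` of either sign). -/
noncomputable def quadField (m : ℤ) : IntermediateField ℚ ℂ :=
  IntermediateField.adjoin ℚ {z : ℂ | z ^ 2 = (m : ℂ)}

/-- The 2-class group of a number field `K ⊆ ℂ`: the 2-primary component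
(= 2-Sylow subgroup) of the ideal class group of its ring of integers. -/
noncomputable def twoClassGroup (K : IntermediateField ℚ ℂ) :
    Subgroup (ClassGroup (𝓞 K)) :=
  CommGroup.primaryComponent _ 2

/-- `h₂(m)`: the 2-class number of the quadratic field `ℚ(√m)`. -/
noncomputable def h2 (m : ℤ) : ℕ := Nat.card (twoClassGroup (quadField m))

/-- `L_{n,d} = ℚ(ζ_{2^{n+2}}, √d)`, the `n`-th layer of the cyclotomic
`ℤ₂`-extension of `ℚ(√d, √-1)`. -/
noncomputable def Lfield (n : ℕ) (d : ℤ) : IntermediateField ℚ ℂ :=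
  IntermediateField.adjoin ℚ
    ({z : ℂ | z ^ 2 ^ (n + 2) = 1} ∪ {z : ℂ | z ^ 2 = (d : ℂ)})

/-- `ℚ(ζ_{2^{n+2}} + ζ_{2^{n+2}}⁻¹, √d) = ℚ(2cos(2π/2^{n+2}), √d)`.
For `d > 0` this is the maximal real subfield `L_{n,d}⁺` of `L_{n,d}`;
for `d < 0` it is the `n`-th layer `K_{n,|d|}` of the cyclotomic
`ℤ₂`-extension of the imaginary quadratic field `ℚ(√d)`. -/
noncomputable def LplusField (n : ℕ) (d : ℤ) : IntermediateField ℚ ℂ :=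
  IntermediateField.adjoin ℚ
    ({((2 * Real.cos (2 * Real.pi / 2 ^ (n + 2)) : ℝ) : ℂ)} ∪ {z : ℂ | z ^ 2 = (d : ℂ)})

namespace TC

/-! ### Abstract group theory -/

theorem relIndex_eq_of_corr {A B : Type*} [CommGroup A] [CommGroup B] (A1 A0 : Subgroup A)
    (B1 B0 : Subgroup B) (R : Subgroup (A × B))
    (hA : ∀ a ∈ A0, ∃ b ∈ B0, (a, b) ∈ R) (hB : ∀ b ∈ B0, ∃ a ∈ A0, (a, b) ∈ R)
    (h : ∀ a ∈ A0, ∀ b ∈ B0, (a, b) ∈ R → (a ∈ A1 ↔ b ∈ B1)) :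
    A1.relIndex A0 = B1.relIndex B0 := by
  let R' : Subgroup (A × B) := R ⊓ A0.prod B0
  let f : R' →* A := (MonoidHom.fst A B).comp R'.subtype
  let g : R' →* B := (MonoidHom.snd A B).comp R'.subtype
  have hf : f.range = A0 := by
    ext a
    constructor
    · rintro ⟨⟨x, hx⟩, rfl⟩
      exact hx.2.1
    · intro ha
      obtain ⟨b, hb, hab⟩ := hA a ha
      exact ⟨⟨(a, b), hab, ha, hb⟩, rfl⟩
  have hg : g.range = B0 := by
    ext a
    constructor
    · rintro ⟨⟨x, hx⟩, rfl⟩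
      exact hx.2.2
    · intro ha
      obtain ⟨b, hb, hab⟩ := hB a ha
      exact ⟨⟨(b, a), hab, hb, ha⟩, rfl⟩
  rw [← hf, ← hg, ← Subgroup.index_comap, ← Subgroup.index_comap]
  congr 1
  ext ⟨⟨a, b⟩, hx⟩
  exact h a hx.2.1 b hx.2.2 hx.1

section Herbrand
variable {E : Type*} [CommGroup E] (g : E →* E)

/-- fixed subgroup -/
def fixS : Subgroup E where
  carrier := {x | g x = x}
  mul_mem' := by intro a b ha hb; simp_all
  one_mem' := by simp
  inv_mem' := by intro a ha; simp_all

/-- norm hom -/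
def nmS : E →* E where
  toFun x := x * g x
  map_one' := by simp
  map_mul' := by intro a b; rw [map_mul]; exact mul_mul_mul_comm _ _ _ _

/-- difference hom -/
def dfS : E →* E where
  toFun x := x / g x
  map_one' := by simp
  map_mul' := by intro a b; rw [map_mul]; exact mul_div_mul_comm _ _ _ _

@[simp] theorem mem_fixS {x : E} : x ∈ fixS g ↔ g x = x := Iff.rfl
@[simp] theorem nmS_apply (x : E) : nmS g x = x * g x := rfl
@[simp] theorem dfS_apply (x : E) : dfS g x = x / g x := rfl

/-- squares of a subgroup -/
def sqS (H : Subgroup E) : Subgroup E := H.map (powMonoidHom 2)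

theorem mem_sqS {H : Subgroup E} {x : E} : x ∈ sqS H ↔ ∃ y ∈ H, y ^ 2 = x := Iff.rfl

theorem sqS_le (H : Subgroup E) : sqS H ≤ H := by
  rintro _ ⟨y, hy, rfl⟩; exact H.pow_mem hy 2

/-- order of `Ĥ⁰` -/
noncomputable def h0 : ℕ := (nmS g).range.relIndex (fixS g)
/-- order of `H¹` -/
noncomputable def h1 : ℕ := (dfS g).range.relIndex (nmS g).ker


theorem nm_range_le (hg : ∀ x, g (g x) = x) :
    (nmS g).range ≤ fixS g := by
  rintro _ ⟨x, rfl⟩; simp [hg, mul_comm]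

theorem df_range_le (hg : ∀ x, g (g x) = x) :
    (dfS g).range ≤ (nmS g).ker := by
  rintro _ ⟨x, rfl⟩; simp [MonoidHom.mem_ker, hg]

theorem sq_fix_le : sqS (fixS g) ≤ (nmS g).range := by
  rintro _ ⟨x, hx, rfl⟩
  refine ⟨x, ?_⟩
  have : g x = x := hx
  simp [this, sq]

theorem sq_ker_le : sqS (nmS g).ker ≤ (dfS g).range := by
  rintro _ ⟨x, hx, rfl⟩
  refine ⟨x, ?_⟩
  have : x * g x = 1 := hx
  have h2 : (g x) = x⁻¹ := (eq_inv_of_mul_eq_one_right this)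
  simp [h2, sq]

theorem herb_aux1 : (sqS (fixS g)).relIndex (nmS g).range = (fixS g ⊔ (nmS g).ker).index := by
  rw [← Subgroup.index_comap]
  congr 1
  ext x
  rw [Subgroup.mem_comap, mem_sqS, Subgroup.mem_sup]
  constructor
  · rintro ⟨y, hy, hyx⟩
    refine ⟨y, hy, x / y, ?_, by simp⟩
    have hy : g y = y := hy
    rw [MonoidHom.mem_ker, map_div, ← hyx]
    simp [hy, sq]
  · rintro ⟨y, hy, z, hz, rfl⟩
    refine ⟨y, hy, ?_⟩
    have hy : g y = y := hy
    rw [map_mul, MonoidHom.mem_ker.1 hz]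
    simp [hy, sq]

theorem herb_aux2 : (sqS (nmS g).ker).relIndex (dfS g).range = (fixS g ⊔ (nmS g).ker).index := by
  rw [← Subgroup.index_comap]
  congr 1
  ext x
  rw [Subgroup.mem_comap, mem_sqS, Subgroup.mem_sup]
  constructor
  · rintro ⟨y, hy, hyx⟩
    refine ⟨x / y, ?_, y, hy, by simp⟩
    have hy : y * g y = 1 := hy
    have h2 : (g y) = y⁻¹ := (eq_inv_of_mul_eq_one_right hy)
    rw [mem_fixS, map_div, h2]
    have : y ^ 2 = x / g x := hyx
    have h3 : x = y ^ 2 * g x := by rw [this]; simp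
    conv_rhs => rw [h3]
    rw [sq, div_inv_eq_mul, mul_assoc, mul_div_assoc, mul_comm (g x), mul_div_assoc', mul_comm]
    simp
  · rintro ⟨y, hy, z, hz, rfl⟩
    refine ⟨z, hz, ?_⟩
    have hy : g y = y := hy
    have hz : z * g z = 1 := hz
    have h2 : (g z) = z⁻¹ := (eq_inv_of_mul_eq_one_right hz)
    simp [hy, h2, sq]

theorem herb1 (hg : ∀ x, g (g x) = x) :
    (sqS (fixS g)).relIndex (fixS g) = (fixS g ⊔ (nmS g).ker).index * h0 g := by
  rw [← Subgroup.relIndex_mul_relIndex _ _ _ (sq_fix_le g) (nm_range_le g hg), herb_aux1 g, h0]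

theorem herb2 (hg : ∀ x, g (g x) = x) :
    (sqS (nmS g).ker).relIndex (nmS g).ker = (fixS g ⊔ (nmS g).ker).index * h1 g := by
  rw [← Subgroup.relIndex_mul_relIndex _ _ _ (sq_ker_le g) (df_range_le g hg), herb_aux2 g, h1]

theorem relIndex_zpowers_of_mem {H : Subgroup E} {e : E} (he : e ∈ H) :
    H.relIndex (Subgroup.zpowers e) = 1 := by
  rw [Subgroup.relIndex_eq_one]; simpa using he

theorem relIndex_zpowers_of_notMem {H : Subgroup E} {e : E} (he : e ∉ H) (h2 : e ^ 2 = 1) :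
    H.relIndex (Subgroup.zpowers e) = 2 := by
  rw [Subgroup.relIndex_eq_two_iff]
  refine ⟨e, Subgroup.mem_zpowers e, ?_⟩
  intro b hb
  obtain ⟨k, rfl⟩ := Subgroup.mem_zpowers_iff.1 hb
  rcases Int.even_or_odd' k with ⟨m, rfl | rfl⟩
  · right
    rw [zpow_mul]
    have : e ^ (2 : ℤ) = 1 := by exact_mod_cast h2
    simp [this, he, H.one_mem]
  · left
    rw [zpow_add, zpow_mul]
    have : e ^ (2 : ℤ) = 1 := by exact_mod_cast h2
    rw [sq] at h2
    simp [this, he, H.one_mem, h2]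

theorem herb3 (e : E) (he : e ^ 2 = 1) (hge : g e = e) (he1 : e ≠ 1)
    (hall : ∀ x : E, x ^ 2 = 1 → x = 1 ∨ x = e) :
    (sqS (fixS g)).relIndex (fixS g) * (sqS (nmS g).ker).relIndex (nmS g).ker =
      2 * (sqS (fixS g ⊔ (nmS g).ker)).relIndex (fixS g ⊔ (nmS g).ker) := by
  set F := fixS g with hF
  set N := (nmS g).ker with hN
  have heF : e ∈ F := hge
  have heN : e ∈ N := by
    rw [hN, MonoidHom.mem_ker]; simp [hge, ← sq, he]
  have hFN : ∀ x ∈ F, x ∈ N → x = 1 ∨ x = e := by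
    intro x hx hy
    apply hall
    have hx : g x = x := hx
    have hy : x * g x = 1 := hy
    rw [hx] at hy; rw [sq, hy]
  have hsq : sqS (F ⊔ N) = sqS F ⊔ sqS N := Subgroup.map_sup _ _ _
  set V2 := sqS F ⊔ sqS N with hV2
  have hle1 : V2 ≤ F ⊔ sqS N := sup_le_sup_right (sqS_le F) _
  have hle2 : F ⊔ sqS N ≤ F ⊔ N := sup_le_sup_left (sqS_le N) _
  rw [hsq, ← Subgroup.relIndex_mul_relIndex _ _ _ hle1 hle2]
  have e1 : F ⊔ N = (F ⊔ sqS N) ⊔ N := by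
    rw [sup_assoc, sup_eq_right.2 (sqS_le N)]
  have e2 : F ⊔ sqS N = V2 ⊔ F := by
    rw [hV2, sup_right_comm, sup_eq_right.2 (sqS_le F)]
  have i1 : (F ⊔ sqS N).relIndex (F ⊔ N) = (sqS N ⊔ Subgroup.zpowers e).relIndex N := by
    rw [e1, Subgroup.relIndex_sup_left]
    rw [← Subgroup.inf_relIndex_right, ← Subgroup.inf_relIndex_right (sqS N ⊔ Subgroup.zpowers e)]
    congr 1
    ext x
    simp only [Subgroup.mem_inf, and_congr_left_iff]
    intro hx
    rw [Subgroup.mem_sup, Subgroup.mem_sup]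
    constructor
    · rintro ⟨y, hy, z, hz, rfl⟩
      refine ⟨z, hz, y, ?_, mul_comm _ _⟩
      have : y ∈ N := by
        have := N.mul_mem hx (N.inv_mem (sqS_le N hz)); simpa using this
      rcases hFN y hy this with rfl | rfl
      · exact Subgroup.one_mem _
      · exact Subgroup.mem_zpowers _
    · rintro ⟨y, hy, z, hz, rfl⟩
      refine ⟨z, ?_, y, hy, mul_comm _ _⟩
      exact (Subgroup.zpowers_le.2 heF) hz
  have i2 : V2.relIndex (F ⊔ sqS N) = (V2 ⊓ F).relIndex F := by
    rw [e2, Subgroup.relIndex_sup_left, Subgroup.inf_relIndex_right]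
  have j1 : sqS N ≤ sqS N ⊔ Subgroup.zpowers e := le_sup_left
  have j2 : sqS N ⊔ Subgroup.zpowers e ≤ N :=
    sup_le (sqS_le N) (Subgroup.zpowers_le.2 heN)
  rw [i1, i2, ← Subgroup.relIndex_mul_relIndex _ _ _ j1 j2, Subgroup.relIndex_sup_left]
  have key : ∀ x ∈ V2 ⊓ F, ∃ y ∈ sqS F, x = y ∨ (x = y * e ∧ e ∈ sqS N) := by
    rintro x ⟨hx, hxF⟩
    obtain ⟨y, hy, z, hz, rfl⟩ := Subgroup.mem_sup.1 hx
    refine ⟨y, hy, ?_⟩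
    have : z ∈ F := by
      have := F.mul_mem (F.inv_mem (sqS_le F hy)) hxF; simpa using this
    rcases hFN z this (sqS_le N hz) with rfl | rfl
    · simp
    · right; exact ⟨rfl, hz⟩
  by_cases hc : e ∈ sqS N
  · have hd : e ∉ sqS F := by
      rintro ⟨y, hy, hye⟩
      obtain ⟨z, hz, hze⟩ := hc
      have hye : y ^ 2 = e := hye
      have hze : z ^ 2 = e := hze
      have : (y / z) ^ 2 = 1 := by rw [div_pow, hye, hze]; simp
      have hyN : y ∈ N := by
        rcases hall _ this with h | h
        · rw [div_eq_one] at h; rwa [h]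
        · rw [div_eq_iff_eq_mul] at h; rw [h]; exact N.mul_mem heN hz
      rcases hFN y hy hyN with rfl | rfl
      · apply he1; rw [← hye]; simp
      · apply he1; rw [← hye]; exact he
    have : V2 ⊓ F = sqS F ⊔ Subgroup.zpowers e := by
      apply le_antisymm
      · intro x hx
        obtain ⟨y, hy, h | h⟩ := key x hx
        · rw [h]; exact Subgroup.mem_sup_left hy
        · rw [h.1]; exact Subgroup.mul_mem_sup hy (Subgroup.mem_zpowers _)
      · refine sup_le (le_inf le_sup_left (sqS_le F)) (Subgroup.zpowers_le.2 ⟨?_, heF⟩)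
        exact Subgroup.mem_sup_right hc
    rw [this, relIndex_zpowers_of_mem hc]
    rw [← Subgroup.relIndex_mul_relIndex (sqS F) (sqS F ⊔ Subgroup.zpowers e) F le_sup_left
      (sup_le (sqS_le F) (Subgroup.zpowers_le.2 heF)), Subgroup.relIndex_sup_left,
      relIndex_zpowers_of_notMem hd he]
    ring
  · have : V2 ⊓ F = sqS F := by
      apply le_antisymm
      · intro x hx
        obtain ⟨y, hy, h | h⟩ := key x hx
        · rw [h]; exact hy
        · exact absurd h.2 hc
      · exact (le_inf le_sup_left (sqS_le F))
    rw [this, relIndex_zpowers_of_notMem hc he]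
    ring

/-- Herbrand quotient of units. -/
theorem herbrand (hg : ∀ x, g (g x) = x) (e : E) (he : e ^ 2 = 1) (hge : g e = e) (he1 : e ≠ 1)
    (hall : ∀ x : E, x ^ 2 = 1 → x = 1 ∨ x = e) {rK rk : ℕ}
    (hK : (sqS (⊤ : Subgroup E)).index = 2 ^ (rK + 1))
    (hk : (sqS (fixS g)).relIndex (fixS g) = 2 ^ (rk + 1)) :
    h0 g * 2 ^ rK = h1 g * 2 ^ (2 * rk) ∧ h0 g ≠ 0 := by
  have a1 := herb1 g hg
  have a2 := herb2 g hg
  have a3 := herb3 g e he hge he1 hall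
  set V := fixS g ⊔ (nmS g).ker with hV
  have hm : V.index ≠ 0 := by
    intro h; rw [hk, h, zero_mul] at a1; exact absurd a1 (by positivity)
  have hVV : (sqS V).relIndex V = (sqS (⊤ : Subgroup E)).index := by
    have b1 : (sqS V).relIndex V * V.index = (sqS V).index :=
      Subgroup.relIndex_mul_index (sqS_le V)
    have b2 : (sqS V).relIndex (sqS ⊤) * (sqS (⊤ : Subgroup E)).index = (sqS V).index :=
      Subgroup.relIndex_mul_index (Subgroup.map_mono le_top)
    have b3 : (sqS V).relIndex (sqS ⊤) = V.index := by
      rw [sqS, sqS, Subgroup.relIndex_map_map, top_sup_eq, Subgroup.relIndex_top_right]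
      congr 1
      apply sup_eq_left.2
      intro x hx
      rcases hall x hx with rfl | rfl
      · exact V.one_mem
      · exact Subgroup.mem_sup_left hge
    rw [b3] at b2
    rw [← b1, mul_comm] at b2
    exact (Nat.eq_of_mul_eq_mul_right (Nat.pos_of_ne_zero hm) b2).symm
  rw [hVV, hK, hk, a2] at a3
  rw [hk] at a1
  refine ⟨?_, ?_⟩
  · have hpos : 0 < 2 * V.index * 2 ^ (rk + 1) * 2 := by positivity
    have : 2 ^ (rk + 1) * (V.index * h1 g) * (V.index * h0 g)
        = 2 * 2 ^ (rK + 1) * (V.index * h0 g) := by rw [a3]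
    rw [← a1] at this
    have h2 : (0:ℕ) < V.index * 4 := by positivity
    apply Nat.eq_of_mul_eq_mul_left h2
    have e3 : 2 ^ (rk + 1) * (V.index * h1 g) * 2 ^ (rk + 1)
       = V.index * 4 * (h1 g * 2 ^ (2 * rk)) := by ring
    rw [← e3, this, a1]; ring
  · intro h; rw [h, mul_zero] at a1; exact absurd a1 (by positivity)

end Herbrand

section Chevalley
variable {X I : Type*} [CommGroup X] [CommGroup I] (gX : X →* X) (gI : I →* I) (φ : X →* I)

/-- ideals with ambiguous class -/
def ambS : Subgroup I := (φ.range).comap (dfS gI)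

theorem chev1 (hX : ∀ x, gX (gX x) = x) (hI : ∀ x, gI (gI x) = x)
    (hφ : ∀ x, φ (gX x) = gI (φ x))
    (h90X : ∀ x, x * gX x = 1 → ∃ y, x = y / gX y)
    (h90I : ∀ x, x * gI x = 1 → ∃ y, x = y / gI y) :
    (fixS gI ⊔ φ.range).relIndex (ambS gI φ) =
      (φ.ker.map (nmS gX)).relIndex ((nmS gX).range ⊓ φ.ker) := by
  have hE : ∀ x ∈ φ.ker, gX x ∈ φ.ker := by
    intro x hx; rw [MonoidHom.mem_ker] at *; rw [hφ, hx, map_one]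
  let R : Subgroup (I × X) :=
    { carrier := {z | ∃ x, φ x = z.1 / gI z.1 ∧ z.2 = x * gX x}
      mul_mem' := by
        rintro a b ⟨x, h1, h2⟩ ⟨y, h3, h4⟩
        refine ⟨x * y, ?_, ?_⟩
        · simp [h1, h3, mul_div_mul_comm]
        · simp [h2, h4, mul_mul_mul_comm]
      one_mem' := ⟨1, by simp, by simp⟩
      inv_mem' := by
        rintro a ⟨x, h1, h2⟩
        refine ⟨x⁻¹, ?_, ?_⟩
        · simp [h1, div_eq_mul_inv, mul_comm]
        · simp [h2, mul_comm] }
  refine relIndex_eq_of_corr _ _ _ _ R ?_ ?_ ?_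
  · rintro a ⟨x, hx⟩
    have hx : φ x = a / gI a := hx
    refine ⟨x * gX x, ⟨⟨x, rfl⟩, ?_⟩, x, hx, rfl⟩
    show φ (x * gX x) = 1
    rw [map_mul, hφ, hx, map_div, hI]; simp
  · rintro _ ⟨⟨x, rfl⟩, hx⟩
    have hx : φ (x * gX x) = 1 := hx
    rw [map_mul, hφ] at hx
    obtain ⟨y, hy⟩ := h90I _ hx
    exact ⟨y, ⟨x, hy⟩, x, hy, rfl⟩
  · rintro a ha b ⟨-, hb⟩ ⟨x, hx, hbx⟩
    simp only at hx hbx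
    constructor
    · intro haa
      obtain ⟨c, hc, _, ⟨y, rfl⟩, rfl⟩ := Subgroup.mem_sup.1 haa
      have hc : gI c = c := hc
      refine ⟨x / (y / gX y), ?_, ?_⟩
      · show φ _ = 1
        rw [map_div, map_div, hφ, hx]
        simp [hc]
      · rw [hbx]
        simp only [nmS_apply, map_div, hX, mul_comm (gX y) y]; simp
    · rintro ⟨e, he, heb⟩
      have he : φ e = 1 := he
      have : (x / e) * gX (x / e) = 1 := by
        have : e * gX e = b := heb
        rw [map_div, div_mul_div_comm, this, hbx]; simp
      obtain ⟨y, hy⟩ := h90X _ this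
      refine Subgroup.mem_sup.2 ⟨a / φ y, ?_, φ y, ⟨y, rfl⟩, by simp⟩
      have h4 : φ (x / e) = φ (y / gX y) := by rw [hy]
      rw [map_div, he, div_one, hx, map_div, hφ] at h4
      rw [mem_fixS, map_div]
      rw [div_eq_div_iff_div_eq_div] at h4
      exact h4.symm

theorem chev2 (hX : ∀ x, gX (gX x) = x)
    (hφ : ∀ x, φ (gX x) = gI (φ x))
    (h90X : ∀ x, x * gX x = 1 → ∃ y, x = y / gX y) :
    ((fixS gX).map φ).relIndex (fixS gI ⊓ φ.range) =
      (φ.ker.map (dfS gX)).relIndex ((nmS gX).ker ⊓ φ.ker) := by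
  let R : Subgroup (I × X) :=
    { carrier := {z | ∃ x, φ x = z.1 ∧ z.2 = x / gX x}
      mul_mem' := by
        rintro a b ⟨x, h1, h2⟩ ⟨y, h3, h4⟩
        refine ⟨x * y, ?_, ?_⟩
        · simp [h1, h3]
        · simp [h2, h4, mul_div_mul_comm]
      one_mem' := ⟨1, by simp, by simp⟩
      inv_mem' := by
        rintro a ⟨x, h1, h2⟩
        refine ⟨x⁻¹, ?_, ?_⟩
        · simp [h1]
        · simp [h2, div_eq_mul_inv, mul_comm] }
  refine relIndex_eq_of_corr _ _ _ _ R ?_ ?_ ?_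
  · rintro _ ⟨ha, ⟨x, rfl⟩⟩
    have ha : gI (φ x) = φ x := ha
    refine ⟨x / gX x, ⟨?_, ?_⟩, x, rfl, rfl⟩
    · show (x / gX x) * gX (x / gX x) = 1
      simp [hX]
    · show φ _ = 1
      rw [map_div, hφ, ha]; simp
  · rintro b ⟨hb, hb2⟩
    obtain ⟨y, rfl⟩ := h90X b hb
    refine ⟨φ y, ⟨?_, ⟨y, rfl⟩⟩, y, rfl, rfl⟩
    have : φ (y / gX y) = 1 := hb2
    rw [map_div, div_eq_one, hφ] at this
    exact this.symm
  · rintro a ⟨ha, -⟩ b ⟨hb, -⟩ ⟨x, hx, hbx⟩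
    simp only at hx hbx
    subst hx hbx
    constructor
    · rintro ⟨y, hy, hyx⟩
      have hy : gX y = y := hy
      refine ⟨x / y, ?_, ?_⟩
      · show φ _ = 1
        rw [map_div, hyx]; simp
      · simp [hy]
    · rintro ⟨e, he, hee⟩
      have he : φ e = 1 := he
      have hee : e / gX e = x / gX x := hee
      refine ⟨x / e, ?_, ?_⟩
      · show gX _ = _
        rw [map_div]
        rw [div_eq_div_iff_div_eq_div] at hee ⊢
        rw [div_eq_div_iff_mul_eq_mul] at hee ⊢
        rw [mul_comm e] at hee
        rw [mul_comm (gX x) e, mul_comm]; exact hee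
      · simp [he]

theorem chev_units {E : Type*} [CommGroup E] (gE : E →* E) (ι : E →* X)
    (hι : Function.Injective ι) (hr : ι.range = φ.ker) (hgι : ∀ e, ι (gE e) = gX (ι e)) :
    h0 gE = (φ.ker.map (nmS gX)).relIndex (fixS gX ⊓ φ.ker) ∧
    h1 gE = (φ.ker.map (dfS gX)).relIndex ((nmS gX).ker ⊓ φ.ker) := by
  constructor
  · rw [h0, ← Subgroup.relIndex_map_map_of_injective _ _ hι]
    congr 1
    · ext x
      rw [← hr]
      constructor
      · rintro ⟨_, ⟨e, rfl⟩, rfl⟩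
        exact ⟨ι e, ⟨e, rfl⟩, by simp [hgι]⟩
      · rintro ⟨_, ⟨e, rfl⟩, rfl⟩
        exact ⟨_, ⟨e, rfl⟩, by simp [hgι]⟩
    · ext x
      rw [← hr]
      constructor
      · rintro ⟨e, he, rfl⟩
        have he : gE e = e := he
        exact ⟨by show gX _ = _; rw [← hgι, he], ⟨e, rfl⟩⟩
      · rintro ⟨he, ⟨e, rfl⟩⟩
        have he : gX (ι e) = ι e := he
        rw [← hgι] at he
        exact ⟨e, hι he, rfl⟩
  · rw [h1, ← Subgroup.relIndex_map_map_of_injective _ _ hι]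
    congr 1
    · ext x
      rw [← hr]
      constructor
      · rintro ⟨_, ⟨e, rfl⟩, rfl⟩
        exact ⟨ι e, ⟨e, rfl⟩, by simp [hgι]⟩
      · rintro ⟨_, ⟨e, rfl⟩, rfl⟩
        exact ⟨_, ⟨e, rfl⟩, by simp [hgι]⟩
    · ext x
      rw [← hr]
      constructor
      · rintro ⟨e, he, rfl⟩
        have he : e * gE e = 1 := he
        exact ⟨by show _ * gX _ = _; rw [← hgι, ← map_mul, he, map_one], ⟨e, rfl⟩⟩
      · rintro ⟨he, ⟨e, rfl⟩⟩
        have he : ι e * gX (ι e) = 1 := he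
        rw [← hgι, ← map_mul] at he
        exact ⟨e, hι (he.trans (map_one ι).symm), rfl⟩

/-- The ambiguous class number formula, abstractly. -/
theorem chevalley {E : Type*} [CommGroup E] (gE : E →* E) (ι : E →* X)
    (hι : Function.Injective ι) (hr : ι.range = φ.ker) (hgι : ∀ e, ι (gE e) = gX (ι e))
    (I0 : Subgroup I) (hI0 : I0 ≤ fixS gI) (hP : (fixS gX).map φ ≤ I0)
    (hX : ∀ x, gX (gX x) = x) (hI : ∀ x, gI (gI x) = x)
    (hφ : ∀ x, φ (gX x) = gI (φ x))
    (h90X : ∀ x, x * gX x = 1 → ∃ y, x = y / gX y)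
    (h90I : ∀ x, x * gI x = 1 → ∃ y, x = y / gI y) :
    φ.range.relIndex (ambS gI φ) * ((nmS gX).range ⊓ φ.ker).relIndex (fixS gX ⊓ φ.ker) * h1 gE
      = I0.relIndex (fixS gI) * ((fixS gX).map φ).relIndex I0 * h0 gE ∧
    h1 gE ∣ I0.relIndex (fixS gI) * ((fixS gX).map φ).relIndex I0 ∧
    h1 gE = ((fixS gX).map φ).relIndex (fixS gI ⊓ φ.range) := by
  obtain ⟨e0, e1⟩ := chev_units gX φ gE ι hι hr hgι
  have c1 := chev1 gX gI φ hX hI hφ h90X h90I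
  have c2 := chev2 gX gI φ hX hφ h90X
  rw [← e1] at c2
  have hPle : (fixS gX).map φ ≤ fixS gI ⊓ φ.range := by
    refine le_inf (hP.trans hI0) ?_
    rintro _ ⟨x, -, rfl⟩; exact ⟨x, rfl⟩
  have d1 : ((fixS gX).map φ).relIndex I0 * I0.relIndex (fixS gI)
      = ((fixS gX).map φ).relIndex (fixS gI) := Subgroup.relIndex_mul_relIndex _ _ _ hP hI0
  have d2 : ((fixS gX).map φ).relIndex (fixS gI ⊓ φ.range) * (fixS gI ⊓ φ.range).relIndex (fixS gI)
      = ((fixS gX).map φ).relIndex (fixS gI) := Subgroup.relIndex_mul_relIndex _ _ _ hPle inf_le_left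
  have d3 : φ.range.relIndex (fixS gI ⊔ φ.range) * (fixS gI ⊔ φ.range).relIndex (ambS gI φ)
      = φ.range.relIndex (ambS gI φ) := by
    refine Subgroup.relIndex_mul_relIndex _ _ _ le_sup_right (sup_le ?_ ?_)
    · intro x hx
      have hx : gI x = x := hx
      refine ⟨1, ?_⟩
      simp [hx]
    · rintro _ ⟨x, rfl⟩
      exact ⟨x / gX x, by simp [hφ]⟩
  have d4 : φ.range.relIndex (fixS gI ⊔ φ.range) = (fixS gI ⊓ φ.range).relIndex (fixS gI) := by
    rw [Subgroup.relIndex_sup_right, inf_comm, Subgroup.inf_relIndex_right]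
  have d5 : (φ.ker.map (nmS gX)).relIndex ((nmS gX).range ⊓ φ.ker) *
      ((nmS gX).range ⊓ φ.ker).relIndex (fixS gX ⊓ φ.ker) = h0 gE := by
    rw [e0]
    refine Subgroup.relIndex_mul_relIndex _ _ _ (le_inf ?_ ?_) (inf_le_inf_right _ (nm_range_le gX hX))
    · rintro _ ⟨x, -, rfl⟩; exact ⟨x, rfl⟩
    · rintro _ ⟨x, hx, rfl⟩
      have hx : φ x = 1 := hx
      show φ (x * gX x) = 1
      rw [map_mul, hφ, hx]; simp
  refine ⟨?_, ?_, c2.symm⟩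
  · rw [← d3, d4, c1, mul_comm (I0.relIndex _), d1, ← d2, c2, ← d5]; ring
  · rw [mul_comm, d1, ← d2, c2]; exact dvd_mul_right _ _

end Chevalley

/-- an index of an elementary-2 quotient is a power of 2 -/
theorem relIndex_two_pow {G : Type*} [CommGroup G] (H K : Subgroup G)
    (h : ∀ x ∈ K, x ^ 2 ∈ H) (h0 : H.relIndex K ≠ 0) : ∃ t, H.relIndex K = 2 ^ t := by
  have hpg : IsPGroup 2 (K ⧸ H.subgroupOf K) := by
    intro x
    refine ⟨1, ?_⟩
    induction x using QuotientGroup.induction_on with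
    | H x =>
      rw [← QuotientGroup.mk_pow, QuotientGroup.eq_one_iff]
      exact h x x.2
  have : Finite (K ⧸ H.subgroupOf K) := Subgroup.index_ne_zero_iff_finite.1 h0
  have : Fact (Nat.Prime 2) := ⟨Nat.prime_two⟩
  exact IsPGroup.iff_card.1 hpg

/-- a quotient generated by `t` elements of order two -/
theorem relIndex_dvd_of_gen {G : Type*} [CommGroup G] (H K : Subgroup G) (S : Finset G)
    (h : ∀ x ∈ K, x ^ 2 ∈ H)
    (hS : ∀ x ∈ K, ∃ y ∈ H, ∃ U ⊆ S, x = y * ∏ z ∈ U, z) :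
    H.relIndex K ∣ 2 ^ S.card := by
  classical
  have hle : H.relIndex K ≤ 2 ^ S.card ∧ H.relIndex K ≠ 0 := by
    have : ∀ x : K ⧸ H.subgroupOf K, ∃ U : S.powerset, ∀ y : K, (QuotientGroup.mk y) = x →
        ∃ z ∈ H, (y : G) = z * ∏ w ∈ U.1, w := by
      intro x
      induction x using QuotientGroup.induction_on with
      | H x =>
        obtain ⟨y, hy, U, hU, hxy⟩ := hS x x.2
        refine ⟨⟨U, Finset.mem_powerset.2 hU⟩, ?_⟩
        intro w hw
        rw [QuotientGroup.eq] at hw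
        have hw : (w⁻¹ * x : G) ∈ H := hw
        refine ⟨(w * (x:G)⁻¹) * y, H.mul_mem ?_ hy, ?_⟩
        · have := H.inv_mem hw; simpa [mul_comm] using this
        · rw [mul_assoc, ← hxy]; simp
    choose f hf using this
    have hinj : Function.Injective f := by
      intro a b hab
      induction a using QuotientGroup.induction_on with
      | H a =>
      induction b using QuotientGroup.induction_on with
      | H b =>
      obtain ⟨z, hz, h1⟩ := hf _ a rfl
      obtain ⟨w, hw, h2⟩ := hf _ b rfl
      rw [QuotientGroup.eq]
      show ((a:G)⁻¹ * b : G) ∈ H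
      rw [h1, h2, hab]
      have : (z * ∏ w ∈ (f (QuotientGroup.mk b)).1, w)⁻¹ * (w * ∏ w ∈ (f (QuotientGroup.mk b)).1, w)
          = z⁻¹ * w := by
        rw [mul_inv, mul_mul_mul_comm]; simp
      rw [this]
      exact H.mul_mem (H.inv_mem hz) hw
    have : Finite (K ⧸ H.subgroupOf K) := Finite.of_injective f hinj
    refine ⟨?_, Subgroup.index_ne_zero_of_finite⟩
    have := Nat.card_le_card_of_injective f hinj
    rwa [Nat.card_eq_fintype_card (α := S.powerset), Fintype.card_coe, Finset.card_powerset] at this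
  obtain ⟨t, ht⟩ := relIndex_two_pow H K h hle.2
  rw [ht] at hle ⊢
  exact pow_dvd_pow 2 ((Nat.pow_le_pow_iff_right (by norm_num)).1 hle.1)

theorem h0_pow_two {E : Type*} [CommGroup E] (g : E →* E) (hne : h0 g ≠ 0) : ∃ t, h0 g = 2 ^ t := by
  refine relIndex_two_pow _ _ ?_ hne
  intro x hx
  have hx : g x = x := hx
  exact ⟨x, by simp [hx, sq]⟩

theorem h1_pow_two {E : Type*} [CommGroup E] (g : E →* E) (hne : h1 g ≠ 0) : ∃ t, h1 g = 2 ^ t := by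
  refine relIndex_two_pow _ _ ?_ hne
  intro x hx
  have hx : x * g x = 1 := hx
  exact ⟨x, by simp [eq_inv_of_mul_eq_one_right hx, sq]⟩

end TC

namespace TC

/-! ### Ideals, classes and field homomorphisms -/

section Ext
open scoped nonZeroDivisors

variable {k K L : Type} [Field k] [NumberField k] [Field K] [NumberField K]
  [Field L] [NumberField L]

/-- restriction to integers -/
noncomputable abbrev oi (f : k →+* K) : 𝓞 k →+* 𝓞 K := RingOfIntegers.mapRingHom f

theorem oi_inj (f : k →+* K) : Function.Injective (oi f) := by
  intro x y h
  have := congrArg (fun z : 𝓞 K => (z : K)) h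
  simp only [oi, RingOfIntegers.mapRingHom_apply] at this
  exact RingOfIntegers.ext (f.injective this)

theorem oi_le (f : k →+* K) : (𝓞 k)⁰ ≤ Submonoid.comap (oi f) (𝓞 K)⁰ :=
  nonZeroDivisors_le_comap_nonZeroDivisors_of_injective _ (oi_inj f)

/-- nonzero fractional ideals -/
abbrev FId (K : Type) [Field K] [NumberField K] := (FractionalIdeal (𝓞 K)⁰ K)ˣ

/-- extension of fractional ideals -/
noncomputable def extI (f : k →+* K) : FId k →* FId K :=
  Units.map (FractionalIdeal.extendedHom' K (oi_le f) :
    FractionalIdeal (𝓞 k)⁰ k →+* FractionalIdeal (𝓞 K)⁰ K).toMonoidHom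

theorem coe_extI (f : k →+* K) (I : FId k) :
    (extI f I : FractionalIdeal (𝓞 K)⁰ K) = FractionalIdeal.extended K (oi_le f) I.1 := rfl

theorem extI_comp (f : k →+* K) (h : K →+* L) (I : FId k) :
    extI h (extI f I) = extI (h.comp f) I := by
  ext1
  rw [coe_extI, coe_extI, coe_extI, FractionalIdeal.extended_extended]
  rfl

theorem isLoc_map_eq (f : k →+* K) (x : k) :
    IsLocalization.map (M := (𝓞 k)⁰) (T := (𝓞 K)⁰) (S := k) K (oi f) (oi_le f) x = f x := by
  have : (IsLocalization.map (M := (𝓞 k)⁰) (T := (𝓞 K)⁰) (S := k) K (oi f) (oi_le f)) = f := by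
    apply IsLocalization.ringHom_ext (𝓞 k)⁰
    ext x
    simp [IsLocalization.map_eq]
  rw [this]

theorem extI_id (I : FId K) : extI (RingHom.id K) I = I := by
  ext1
  apply FractionalIdeal.coeToSubmodule_injective
  beta_reduce
  rw [coe_extI, FractionalIdeal.coe_extended_eq_span]
  apply le_antisymm
  · rw [Submodule.span_le]
    rintro _ ⟨x, hx, rfl⟩
    rw [isLoc_map_eq]; exact hx
  · intro x hx
    apply Submodule.subset_span
    exact ⟨x, hx, by rw [isLoc_map_eq]; rfl⟩

/-- principal ideal -/
noncomputable abbrev pr : Kˣ →* FId K := toPrincipalIdeal (𝓞 K) K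

theorem extI_pr (f : k →+* K) (x : kˣ) : extI f (pr x) = pr (Units.map (f : k →* K) x) := by
  ext1
  rw [coe_extI, coe_toPrincipalIdeal, coe_toPrincipalIdeal, FractionalIdeal.extended_spanSingleton,
    isLoc_map_eq]
  rfl

theorem map_ne_bot (f : k →+* K) {I : Ideal (𝓞 k)} (hI : I ≠ ⊥) : I.map (oi f) ≠ ⊥ :=
  (Ideal.map_eq_bot_iff_of_injective (oi_inj f)).not.2 hI

/-- class of ideal (junk for zero) -/
noncomputable def idI (I : (Ideal (𝓞 K))⁰) : FId K := FractionalIdeal.mk0 K I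

/-- extension of nonzero ideals -/
noncomputable def exI (f : k →+* K) (I : (Ideal (𝓞 k))⁰) : (Ideal (𝓞 K))⁰ :=
  ⟨I.1.map (oi f), mem_nonZeroDivisors_iff_ne_zero.2
    (map_ne_bot f (mem_nonZeroDivisors_iff_ne_zero.1 I.2))⟩

theorem extI_idI (f : k →+* K) (I : (Ideal (𝓞 k))⁰) : extI f (idI I) = idI (exI f I) := by
  ext1
  rw [coe_extI, idI, idI, FractionalIdeal.coe_mk0, FractionalIdeal.coe_mk0,
    FractionalIdeal.extended_coeIdeal_eq_map]
  rfl

theorem ker_mk : (ClassGroup.mk K : FId K →* ClassGroup (𝓞 K)).ker = (pr (K := K)).range := by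
  ext I
  rw [MonoidHom.mem_ker, ClassGroup.mk_eq_one_iff, MonoidHom.mem_range]
  constructor
  · intro h
    obtain ⟨x, hx⟩ := h.principal
    have hx' : (I : FractionalIdeal (𝓞 K)⁰ K) = FractionalIdeal.spanSingleton (𝓞 K)⁰ x := by
      apply Subtype.coe_injective
      simp only [FractionalIdeal.val_eq_coe, hx, FractionalIdeal.coe_spanSingleton]
    refine ⟨Units.mk0 x ?_, ?_⟩
    · rintro rfl; apply Units.ne_zero I; simp [hx']
    · ext1; simp [hx']
  · rintro ⟨x, rfl⟩
    rw [coe_toPrincipalIdeal, FractionalIdeal.coe_spanSingleton]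
    exact ⟨⟨_, rfl⟩⟩

theorem mk_surj : Function.Surjective (ClassGroup.mk K : FId K →* ClassGroup (𝓞 K)) := by
  intro c
  obtain ⟨I, rfl⟩ := ClassGroup.mk0_surjective c
  exact ⟨idI I, ClassGroup.mk_mk0 K I⟩

/-- induced map on class groups -/
noncomputable def extC (f : k →+* K) : ClassGroup (𝓞 k) →* ClassGroup (𝓞 K) :=
  (MonoidHom.liftOfSurjective (ClassGroup.mk k : FId k →* ClassGroup (𝓞 k)) mk_surj)
    ⟨(ClassGroup.mk K).comp (extI f), by
      rw [ker_mk]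
      rintro _ ⟨x, rfl⟩
      rw [MonoidHom.mem_ker, MonoidHom.comp_apply, extI_pr, ← MonoidHom.mem_ker, ker_mk]
      exact ⟨_, rfl⟩⟩

theorem extC_mk (f : k →+* K) (I : FId k) :
    extC f (ClassGroup.mk k I) = ClassGroup.mk K (extI f I) := by
  unfold extC MonoidHom.liftOfSurjective
  exact MonoidHom.liftOfRightInverse_comp_apply _ _ (Function.rightInverse_surjInv mk_surj) _ I

theorem extC_mk0 (f : k →+* K) (I : (Ideal (𝓞 k))⁰) :
    extC f (ClassGroup.mk0 I) = ClassGroup.mk0 (exI f I) := by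
  rw [← ClassGroup.mk_mk0 k, ← ClassGroup.mk_mk0 K, extC_mk]
  congr 1
  exact extI_idI f I

theorem extC_comp (f : k →+* K) (h : K →+* L) (c : ClassGroup (𝓞 k)) :
    extC h (extC f c) = extC (h.comp f) c := by
  obtain ⟨I, rfl⟩ := mk_surj c
  rw [extC_mk, extC_mk, extC_mk, extI_comp]

theorem extC_id (c : ClassGroup (𝓞 K)) : extC (RingHom.id K) c = c := by
  obtain ⟨I, rfl⟩ := mk_surj c
  rw [extC_mk, extI_id]

end Ext
end TC

namespace TC
set_option linter.unusedSectionVars false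

/-! ### Quadratic extensions -/

section Quad
open scoped nonZeroDivisors

/-- `g` is the nontrivial automorphism of the quadratic extension `K/k` -/
structure Quad (k K : Type) [Field k] [Field K] [Algebra k K] (g : K →+* K) : Prop where
  rank2 : Module.finrank k K = 2
  invol : ∀ x, g (g x) = x
  fix : ∀ x, g x = x → ∃ y : k, algebraMap k K y = x
  comm : ∀ y, g (algebraMap k K y) = algebraMap k K y
  nontriv : ∃ x, g x ≠ x

variable {k K : Type} [Field k] [NumberField k] [Field K] [NumberField K] [Algebra k K]
  {g : K →+* K}

theorem Quad.of_rank (h : Module.finrank k K = 2) : ∃ g, Quad k K g := by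
  have : Algebra.IsQuadraticExtension k K := ⟨h⟩
  have hc : Nat.card (K ≃ₐ[k] K) = 2 := by rw [IsGalois.card_aut_eq_finrank, h]
  obtain ⟨a, ha, hall⟩ := (Nat.card_eq_two_iff' (1 : K ≃ₐ[k] K)).1 hc
  refine ⟨(a : K →ₐ[k] K), h, ?_, ?_, ?_, ?_⟩
  · intro x
    have : a * a = 1 := by
      have := pow_card_eq_one' (x := a)
      rwa [hc, sq] at this
    exact DFunLike.congr_fun this x
  · intro x hx
    have := (IsGalois.mem_bot_iff_fixed (F := k) (E := K) x).2 (by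
      intro f
      by_cases hf : f = 1
      · subst hf; rfl
      · rw [hall f hf]; exact hx)
    exact IntermediateField.mem_bot.1 this
  · intro y; exact a.commutes y
  · by_contra hcon
    push Not at hcon
    exact ha (AlgEquiv.ext hcon)

theorem Quad.of_inv (h : Module.finrank k K = 2) (h1 : ∃ x, g x ≠ x)
    (h2 : ∀ y, g (algebraMap k K y) = algebraMap k K y) : Quad k K g := by
  obtain ⟨a, ha⟩ := Quad.of_rank h
  have : Algebra.IsQuadraticExtension k K := ⟨h⟩
  have hc : Nat.card (K ≃ₐ[k] K) = 2 := by rw [IsGalois.card_aut_eq_finrank, h]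
  let f (b : K →+* K) (hb : ∀ y, b (algebraMap k K y) = algebraMap k K y) : K ≃ₐ[k] K :=
    AlgEquiv.ofBijective { b with commutes' := hb } 
      (Algebra.IsAlgebraic.algHom_bijective (K := k) (L := K) { b with commutes' := hb } )
  have hf : ∀ b hb x, f b hb x = b x := fun b hb x => rfl
  obtain ⟨c, hc, hall⟩ := (Nat.card_eq_two_iff' (1 : K ≃ₐ[k] K)).1 hc
  have e1 : f a ha.comm = c := hall _ (fun h => by
    obtain ⟨x, hx⟩ := ha.nontriv
    exact hx (by rw [← hf a ha.comm, h]; rfl))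
  have e2 : f g h2 = c := hall _ (fun h => by
    obtain ⟨x, hx⟩ := h1
    exact hx (by rw [← hf g h2, h]; rfl))
  have : g = a := by
    ext x
    rw [← hf g h2, ← hf a ha.comm, e1, e2]
  rw [this]; exact ha

theorem Quad.neg_of_sq (hg : Quad k K g) {z : K} {y : k} (h : z ^ 2 = algebraMap k K y)
    (hz : g z ≠ z) : g z = - z := by
  have : g z ^ 2 = z ^ 2 := by rw [← map_pow, h, hg.comm]
  rcases sq_eq_sq_iff_eq_or_eq_neg.1 this with h | h
  · exact absurd h hz
  · exact h

theorem Quad.norm (hg : Quad k K g) (x : K) : algebraMap k K (Algebra.norm k x) = x * g x := by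
  have : Algebra.IsQuadraticExtension k K := ⟨hg.rank2⟩
  have hc : Nat.card (K ≃ₐ[k] K) = 2 := by rw [IsGalois.card_aut_eq_finrank, hg.rank2]
  classical
  let f : K ≃ₐ[k] K :=
    AlgEquiv.ofBijective { g with commutes' := hg.comm } 
      (Algebra.IsAlgebraic.algHom_bijective (K := k) (L := K) { g with commutes' := hg.comm } )
  have hf : ∀ x, f x = g x := fun x => rfl
  have h1 : f ≠ 1 := fun h => by
    obtain ⟨x, hx⟩ := hg.nontriv
    exact hx (by rw [← hf, h]; rfl)
  have hu : (Finset.univ : Finset (K ≃ₐ[k] K)) = {1, f} := by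
    symm
    apply Finset.eq_univ_of_card
    rw [Finset.card_pair h1.symm, ← hc, Nat.card_eq_fintype_card]
  rw [Algebra.norm_eq_prod_automorphisms, hu, Finset.prod_pair h1.symm]
  rfl

/-- action on units of the field -/
noncomputable abbrev gX (g : K →+* K) : Kˣ →* Kˣ := Units.map (g : K →* K)
/-- action on units of the integers -/
noncomputable abbrev gE (g : K →+* K) : (𝓞 K)ˣ →* (𝓞 K)ˣ := Units.map (oi g : 𝓞 K →* 𝓞 K)

theorem Quad.comp_self (hg : Quad k K g) : g.comp g = RingHom.id K := RingHom.ext hg.invol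

theorem Quad.comp_alg (hg : Quad k K g) : g.comp (algebraMap k K) = algebraMap k K :=
  RingHom.ext hg.comm

theorem Quad.h90X (hg : Quad k K g) (x : Kˣ) (hx : x * gX g x = 1) : ∃ y, x = y / gX g y := by
  have hx' : (x : K) * g x = 1 := by simpa using congrArg Units.val hx
  by_cases h : (x : K) = -1
  · obtain ⟨z, hz⟩ := hg.nontriv
    have hz' : z - g z ≠ 0 := fun h => hz (sub_eq_zero.1 h).symm
    refine ⟨Units.mk0 _ hz', ?_⟩
    rw [eq_div_iff_mul_eq']
    ext1
    simp [h, hg.invol]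
  · have h' : 1 + (x : K) ≠ 0 := fun h2 => h (by linear_combination h2)
    refine ⟨Units.mk0 _ h', ?_⟩
    rw [eq_div_iff_mul_eq']
    ext1
    simp only [Units.val_mul, Units.coe_map, Units.val_mk0, map_add, map_one, MonoidHom.coe_coe]
    linear_combination hx'

theorem Quad.h90I (hg : Quad k K g) (x : FId K) (hx : x * extI g x = 1) : ∃ y, x = y / extI g y := by
  have hx' : (x : FractionalIdeal (𝓞 K)⁰ K) * FractionalIdeal.extended K (oi_le g) x.1 = 1 := by
    simpa [coe_extI] using congrArg Units.val hx
  have h' : 1 + (x : FractionalIdeal (𝓞 K)⁰ K) ≠ 0 := by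
    intro h
    have : (1 : FractionalIdeal (𝓞 K)⁰ K) ≤ 0 := by
      rw [← h]; exact le_self_add
    exact one_ne_zero (le_antisymm this (FractionalIdeal.zero_le _))
  refine ⟨Units.mk0 _ h', ?_⟩
  rw [eq_div_iff_mul_eq']
  ext1
  rw [Units.val_mul, coe_extI, Units.val_mk0, FractionalIdeal.extended_add,
    FractionalIdeal.extended_one, mul_add, mul_one, hx', add_comm]

theorem Quad.extI_invol (hg : Quad k K g) (I : FId K) : extI g (extI g I) = I := by
  rw [extI_comp, hg.comp_self, extI_id]

theorem Quad.extC_invol (hg : Quad k K g) (c : ClassGroup (𝓞 K)) : extC g (extC g c) = c := by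
  rw [extC_comp, hg.comp_self, extC_id]

theorem Quad.extC_alg (hg : Quad k K g) (c : ClassGroup (𝓞 k)) :
    extC g (extC (algebraMap k K) c) = extC (algebraMap k K) c := by
  rw [extC_comp, hg.comp_alg]

theorem extI_inj (f : k →+* K) : Function.Injective (extI f) := by
  intro I J h
  have := congrArg Units.val h
  ext1
  let _ : Algebra k K := f.toAlgebra
  have h2 := FractionalIdeal.extendedHom_injective (A := 𝓞 k) (K := k) (L := K) (B := 𝓞 K)
  exact h2 this

/-- number of ambiguous ideals modulo extended ones -/
noncomputable def tI (k K : Type) [Field k] [NumberField k] [Field K] [NumberField K] [Algebra k K]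
    (g : K →+* K) : ℕ := (extI (algebraMap k K)).range.relIndex (fixS (extI g))

/-- unit index: units fixed by `g` modulo those which are norms of elements -/
noncomputable def uI (g : K →+* K) : ℕ :=
  ((nmS (gX g)).range ⊓ (pr (K := K)).ker).relIndex (fixS (gX g) ⊓ (pr (K := K)).ker)

/-- ambiguous classes -/
noncomputable def aC (g : K →+* K) : ℕ := Nat.card (fixS (extC g))

theorem card_amb : (pr (K := K)).range.relIndex (ambS (extI g) pr) = aC g := by
  have h1 : ambS (extI g) (pr (K := K)) = (fixS (extC g)).comap (ClassGroup.mk K) := by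
    ext I
    rw [ambS, Subgroup.mem_comap, ← ker_mk, Subgroup.mem_comap, mem_fixS, extC_mk,
      MonoidHom.mem_ker, dfS_apply, map_div, div_eq_one, eq_comm]
  rw [h1, ← ker_mk, Subgroup.relIndex_ker, Subgroup.map_comap_eq_self_of_surjective mk_surj, aC]

theorem Quad.fixX (hg : Quad k K g) :
    (fixS (gX g)).map (pr (K := K)) = (pr (K := k)).range.map (extI (algebraMap k K)) := by
  ext I
  constructor
  · rintro ⟨x, hx, rfl⟩
    have hx : gX g x = x := hx
    obtain ⟨y, hy⟩ := hg.fix x (by simpa using congrArg Units.val hx)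
    have hy0 : y ≠ 0 := by rintro rfl; exact x.ne_zero (by rw [← hy, map_zero])
    refine ⟨pr (Units.mk0 y hy0), ⟨_, rfl⟩, ?_⟩
    rw [extI_pr]; congr 1; ext1; simpa using hy
  · rintro ⟨_, ⟨x, rfl⟩, rfl⟩
    rw [extI_pr]
    refine ⟨_, ?_, rfl⟩
    show gX g _ = _
    ext1; simp [hg.comm]

theorem ker_pr (x : Kˣ) : pr x = 1 ↔ ∃ u : (𝓞 K)ˣ, Units.map (algebraMap (𝓞 K) K : 𝓞 K →* K) u = x := by
  have : (x : K) ≠ 0 := x.ne_zero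
  constructor
  · intro h
    have h1 : FractionalIdeal.spanSingleton (𝓞 K)⁰ (x : K) = 1 := by
      rw [← coe_toPrincipalIdeal]; exact congrArg Units.val h
    have h2 : FractionalIdeal.spanSingleton (𝓞 K)⁰ (↑x⁻¹ : K) = 1 := by
      rw [← coe_toPrincipalIdeal]; rw [map_inv]; simp [h]
    have m1 : (x : K) ∈ (1 : FractionalIdeal (𝓞 K)⁰ K) := by
      rw [← h1]; exact FractionalIdeal.mem_spanSingleton_self _ _
    have m2 : (↑x⁻¹ : K) ∈ (1 : FractionalIdeal (𝓞 K)⁰ K) := by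
      rw [← h2]; exact FractionalIdeal.mem_spanSingleton_self _ _
    obtain ⟨a, ha⟩ := (FractionalIdeal.mem_one_iff _).1 m1
    obtain ⟨b, hb⟩ := (FractionalIdeal.mem_one_iff _).1 m2
    have hab : a * b = 1 := by
      apply RingOfIntegers.coe_injective
      rw [map_mul, ha, hb]; simp
    refine ⟨⟨a, b, hab, by rw [mul_comm, hab]⟩, ?_⟩
    ext1; simpa using ha
  · rintro ⟨u, rfl⟩
    ext1
    rw [coe_toPrincipalIdeal, Units.val_one]
    apply le_antisymm
    · rw [FractionalIdeal.spanSingleton_le_iff_mem, FractionalIdeal.mem_one_iff]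
      exact ⟨u, rfl⟩
    · rw [FractionalIdeal.one_le, FractionalIdeal.mem_spanSingleton]
      refine ⟨((u⁻¹ : (𝓞 K)ˣ) : 𝓞 K), ?_⟩
      rw [Algebra.smul_def]
      show algebraMap (𝓞 K) K _ * algebraMap (𝓞 K) K _ = 1
      rw [← map_mul]; simp

theorem Quad.chev (hg : Quad k K g) :
    aC g * uI g * h1 (gE g) = tI k K g * Nat.card (ClassGroup (𝓞 k)) * h0 (gE g) ∧
    h1 (gE g) ∣ tI k K g * Nat.card (ClassGroup (𝓞 k)) ∧
    h1 (gE g) = ((pr (K := k)).range.map (extI (algebraMap k K))).relIndex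
      (fixS (extI g) ⊓ (pr (K := K)).range) := by
  have key := chevalley (gX g) (extI g) (pr (K := K)) (gE g)
    (Units.map (algebraMap (𝓞 K) K : 𝓞 K →* K)) ?_ ?_ ?_ (extI (algebraMap k K)).range ?_ ?_ ?_ ?_ ?_
    hg.h90X hg.h90I
  · rw [card_amb, hg.fixX] at key
    have e : ((pr (K := k)).range.map (extI (algebraMap k K))).relIndex (extI (algebraMap k K)).range
        = Nat.card (ClassGroup (𝓞 k)) := by
      rw [MonoidHom.range_eq_map (extI (algebraMap k K)), Subgroup.relIndex_map_map_of_injective _ _ (extI_inj _),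
        ← ker_mk, Subgroup.relIndex_top_right, Subgroup.index_ker, MonoidHom.range_eq_top.2 mk_surj]
      exact Nat.card_congr Subgroup.topEquiv.toEquiv
    rw [e] at key
    exact key
  · exact Units.map_injective RingOfIntegers.coe_injective
  · ext x
    rw [MonoidHom.mem_ker, ker_pr]; rfl
  · intro e; ext1; rfl
  · rintro _ ⟨I, rfl⟩
    rw [mem_fixS, extI_comp, hg.comp_alg]
  · rw [hg.fixX]; rintro _ ⟨x, -, rfl⟩; exact ⟨x, rfl⟩
  · intro x; ext1; simp [hg.invol]
  · exact hg.extI_invol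
  · intro x; rw [extI_pr]

end Quad
end TC

namespace TC
set_option linter.unusedSectionVars false

section QuadNorm
open scoped nonZeroDivisors
variable {k K : Type} [Field k] [NumberField k] [Field K] [NumberField K] [Algebra k K]
  {g : K →+* K}

theorem Quad.oi_invol (hg : Quad k K g) (x : 𝓞 K) : oi g (oi g x) = x := by
  apply RingOfIntegers.coe_injective
  exact hg.invol _

/-- the automorphism on integers -/
noncomputable def Quad.oe (hg : Quad k K g) : 𝓞 K ≃+* 𝓞 K :=
  RingEquiv.ofRingHom (oi g) (oi g) (RingHom.ext hg.oi_invol) (RingHom.ext hg.oi_invol)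

theorem Quad.absNorm_map (hg : Quad k K g) (I : Ideal (𝓞 K)) :
    Ideal.absNorm (I.map (oi g)) = Ideal.absNorm I := by
  rw [Ideal.absNorm_apply, Ideal.absNorm_apply, Submodule.cardQuot_apply, Submodule.cardQuot_apply]
  exact Nat.card_congr (Ideal.quotientEquiv I (I.map (oi g)) hg.oe rfl).symm.toEquiv

theorem Quad.intNorm (hg : Quad k K g) (x : 𝓞 K) :
    algebraMap (𝓞 k) (𝓞 K) (Algebra.intNorm (𝓞 k) (𝓞 K) x) = x * oi g x := by
  apply RingOfIntegers.coe_injective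
  have h := Algebra.algebraMap_intNorm (A := 𝓞 k) (B := 𝓞 K) (K := k) (L := K) x
  rw [map_mul]
  show _ = (x : K) * g x
  rw [← hg.norm, ← h]
  rfl

theorem Quad.mul_conj (hg : Quad k K g) (I : Ideal (𝓞 K)) :
    I * I.map (oi g) = (Ideal.relNorm (𝓞 k) I).map (algebraMap (𝓞 k) (𝓞 K)) := by
  by_cases hI : I = ⊥
  · subst hI; simp
  have hle : (Ideal.relNorm (𝓞 k) I).map (algebraMap (𝓞 k) (𝓞 K)) ≤ I * I.map (oi g) := by
    rw [Ideal.relNorm_apply, Ideal.map_le_iff_le_comap, Ideal.span_le]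
    rintro _ ⟨x, hx, rfl⟩
    show algebraMap (𝓞 k) (𝓞 K) (Algebra.intNorm (𝓞 k) (𝓞 K) x) ∈ I * I.map (oi g)
    rw [hg.intNorm]
    exact Ideal.mul_mem_mul hx (Ideal.mem_map_of_mem _ hx)
  symm
  have hdvd := Ideal.dvd_iff_le.2 hle
  obtain ⟨J, hJ⟩ := hdvd
  have h1 := congrArg Ideal.absNorm hJ
  rw [map_mul, map_mul, hg.absNorm_map] at h1
  have h2 : Ideal.absNorm ((Ideal.relNorm (𝓞 k) I).map (algebraMap (𝓞 k) (𝓞 K))) =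
      Ideal.absNorm I * Ideal.absNorm I := by
    rw [Ideal.absNorm_algebraMap, Ideal.absNorm_relNorm]
    rw [← IsFractionRing.finrank_eq (𝓞 k) k (𝓞 K) K, hg.rank2, sq]
  rw [h2] at h1
  have h3 : Ideal.absNorm I ≠ 0 := Ideal.absNorm_ne_zero_iff_mem_nonZeroDivisors.2 (mem_nonZeroDivisors_iff_ne_zero.2 hI)
  have h4 : Ideal.absNorm J = 1 := by
    have : 0 < Ideal.absNorm I * Ideal.absNorm I := by positivity
    nlinarith
  rw [hJ, Ideal.absNorm_eq_one_iff.1 h4, Ideal.mul_top]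

theorem Quad.class_norm0 (hg : Quad k K g) (I : (Ideal (𝓞 K))⁰) (J : (Ideal (𝓞 k))⁰)
    (h : (J : Ideal (𝓞 k)) = Ideal.relNorm (𝓞 k) I.1) :
    ClassGroup.mk0 I * extC g (ClassGroup.mk0 I) = extC (algebraMap k K) (ClassGroup.mk0 J) := by
  rw [extC_mk0, extC_mk0, ← map_mul]
  congr 1
  ext1
  show I.1 * I.1.map (oi g) = J.1.map _
  rw [hg.mul_conj, h]; rfl

theorem Quad.class_norm (hg : Quad k K g) (c : ClassGroup (𝓞 K)) :
    ∃ b, c * extC g c = extC (algebraMap k K) b := by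
  obtain ⟨I, rfl⟩ := ClassGroup.mk0_surjective c
  have : Ideal.relNorm (𝓞 k) I.1 ≠ ⊥ := by
    rw [Ne, Ideal.relNorm_eq_bot_iff]; exact mem_nonZeroDivisors_iff_ne_zero.1 I.2
  exact ⟨_, hg.class_norm0 I ⟨_, mem_nonZeroDivisors_iff_ne_zero.2 this⟩ rfl⟩

/-- nonzero ideal as an element of the ideal group -/
noncomputable def fI (I : Ideal (𝓞 K)) : FId K :=
  open scoped Classical in
  if h : I = ⊥ then 1 else idI ⟨I, mem_nonZeroDivisors_iff_ne_zero.2 h⟩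

theorem fI_of_ne {I : Ideal (𝓞 K)} (h : I ≠ ⊥) :
    fI I = idI ⟨I, mem_nonZeroDivisors_iff_ne_zero.2 h⟩ := dif_neg h

theorem coe_fI {I : Ideal (𝓞 K)} (h : I ≠ ⊥) : ((fI I : FId K) : FractionalIdeal (𝓞 K)⁰ K) = I := by
  rw [fI_of_ne h]; rfl

theorem fI_mul {I J : Ideal (𝓞 K)} (hI : I ≠ ⊥) (hJ : J ≠ ⊥) : fI (I * J) = fI I * fI J := by
  ext1
  rw [coe_fI (mul_ne_zero hI hJ), Units.val_mul, coe_fI hI, coe_fI hJ, FractionalIdeal.coeIdeal_mul]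

theorem extI_fI (f : k →+* K) {I : Ideal (𝓞 k)} (hI : I ≠ ⊥) : extI f (fI I) = fI (I.map (oi f)) := by
  rw [fI_of_ne hI, fI_of_ne (map_ne_bot f hI), extI_idI]; rfl

theorem fI_inj {I J : Ideal (𝓞 K)} (hI : I ≠ ⊥) (hJ : J ≠ ⊥) (h : fI I = fI J) : I = J := by
  have := congrArg Units.val h
  rw [coe_fI hI, coe_fI hJ] at this
  exact FractionalIdeal.coeIdeal_injective this

theorem fI_top : fI (⊤ : Ideal (𝓞 K)) = 1 := by
  ext1
  rw [coe_fI top_ne_bot, FractionalIdeal.coeIdeal_top, Units.val_one]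

theorem fI_span {x : 𝓞 K} (hx : x ≠ 0) :
    fI (Ideal.span {x}) = pr (Units.mk0 (x : K) (by simpa using hx)) := by
  ext1
  rw [coe_fI (by simpa using hx), coe_toPrincipalIdeal, FractionalIdeal.coeIdeal_span_singleton]
  rfl

theorem Quad.fI_norm (hg : Quad k K g) {I : Ideal (𝓞 K)} (hI : I ≠ ⊥) :
    fI I * extI g (fI I) ∈ (extI (algebraMap k K)).range := by
  refine ⟨fI (Ideal.relNorm (𝓞 k) I), ?_⟩
  have h : Ideal.relNorm (𝓞 k) I ≠ ⊥ := by
    rwa [Ne, Ideal.relNorm_eq_bot_iff]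
  rw [extI_fI _ h, extI_fI _ hI, ← fI_mul hI (map_ne_bot _ hI), hg.mul_conj]; rfl

/-- every ideal is a quotient of an integral one by an extended one -/
theorem Quad.exists_int (hg : Quad k K g) (x : FId K) :
    ∃ I : Ideal (𝓞 K), I ≠ ⊥ ∧ ∃ y ∈ (extI (algebraMap k K)).range, x = fI I * y := by
  obtain ⟨a, I, ha, h⟩ := FractionalIdeal.exists_eq_spanSingleton_mul (x : FractionalIdeal (𝓞 K)⁰ K)
  have hI : I ≠ ⊥ := by
    rintro rfl; exact x.ne_zero (by rw [h]; simp)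
  have hsa : Ideal.span {a} ≠ ⊥ := by simpa using ha
  have h1 : x * fI (Ideal.span {a}) = fI I := by
    ext1
    rw [Units.val_mul, coe_fI hI, coe_fI hsa, h, FractionalIdeal.coeIdeal_span_singleton,
      mul_right_comm, FractionalIdeal.spanSingleton_mul_spanSingleton, inv_mul_cancel₀ (by simpa using ha)]
    simp
  have hm : (Ideal.span {a}).map (oi g) ≠ ⊥ := map_ne_bot g hsa
  refine ⟨I * (Ideal.span {a}).map (oi g), mul_ne_zero hI hm,
    _, inv_mem (hg.fI_norm hsa), ?_⟩
  rw [fI_mul hI hm, ← h1, extI_fI _ hsa]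
  group

theorem Quad.norm_ext (hg : Quad k K g) (x : FId K) :
    x * extI g x ∈ (extI (algebraMap k K)).range := by
  obtain ⟨I, hI, y, ⟨z, rfl⟩, rfl⟩ := hg.exists_int x
  rw [map_mul, extI_comp, hg.comp_alg, mul_mul_mul_comm]
  exact mul_mem (hg.fI_norm hI) (mul_mem ⟨z, rfl⟩ ⟨z, rfl⟩)

theorem Quad.prime_cases (hg : Quad k K g) {P : Ideal (𝓞 K)} (hP : P.IsPrime) (h0 : P ≠ ⊥)
    (hgP : P.map (oi g) = P) :
    (∀ x, x - oi g x ∈ P) ∨ fI P ∈ (extI (algebraMap k K)).range := by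
  have hm : P.IsMaximal := hP.isMaximal h0
  set p := P.under (𝓞 k) with hp
  have hpm : p.IsMaximal := Ideal.IsMaximal.under (𝓞 k) P
  have hp0 : p ≠ ⊥ := Ideal.under_ne_bot _ h0
  obtain ⟨s, hr⟩ := Ideal.exists_relNorm_eq_pow_of_isPrime (P := P) (p := p)
  have h2 := hg.mul_conj P
  rw [hgP, hr, Ideal.map_pow] at h2
  have hn : Ideal.absNorm p ^ s = Ideal.absNorm P := by
    have h := Ideal.absNorm_relNorm (R := 𝓞 k) (I := P)
    rw [← h, hr, map_pow]
  have hdvd : P ∣ p.map (algebraMap (𝓞 k) (𝓞 K)) := Ideal.dvd_iff_le.2 Ideal.map_comap_le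
  obtain ⟨Q, hQ⟩ := hdvd
  match s with
  | 0 =>
    exfalso
    rw [pow_zero, Ideal.one_eq_top] at h2
    apply hP.ne_top
    rw [eq_top_iff, ← h2]
    exact Ideal.mul_le_left
  | 1 =>
    left
    rw [pow_one] at hn
    let φ : (𝓞 k ⧸ p) →+* (𝓞 K ⧸ P) := Ideal.quotientMap P (algebraMap (𝓞 k) (𝓞 K)) le_rfl
    have hφ : Function.Injective φ := Ideal.quotientMap_injective
    have hfin : Finite (𝓞 K ⧸ P) := Ideal.finiteQuotientOfFreeOfNeBot P h0
    have hfin' : Finite (𝓞 k ⧸ p) := Ideal.finiteQuotientOfFreeOfNeBot p hp0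
    have hbij : Function.Bijective φ := by
      refine (Nat.bijective_iff_injective_and_card φ).2 ⟨hφ, ?_⟩
      rw [Ideal.absNorm_apply, Ideal.absNorm_apply, Submodule.cardQuot_apply,
        Submodule.cardQuot_apply] at hn
      exact hn
    intro x
    obtain ⟨y, hy⟩ := hbij.2 (Ideal.Quotient.mk P x)
    obtain ⟨y, rfl⟩ := Ideal.Quotient.mk_surjective y
    have h3 : algebraMap (𝓞 k) (𝓞 K) y - x ∈ P := by
      rw [← Ideal.Quotient.eq]; exact hy
    have h4 : oi g (algebraMap (𝓞 k) (𝓞 K) y - x) ∈ P := by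
      rw [← hgP]; exact Ideal.mem_map_of_mem _ h3
    have h5 : oi g (algebraMap (𝓞 k) (𝓞 K) y) = algebraMap (𝓞 k) (𝓞 K) y := by
      apply RingOfIntegers.coe_injective
      exact hg.comm _
    rw [map_sub, h5] at h4
    have := P.sub_mem h4 h3
    convert this using 1
    ring
  | s + 2 =>
    right
    rw [hQ] at h2
    have h3 : P * P * 1 = P * P * (P ^ s * Q ^ (s + 2)) := by
      rw [mul_one]; nth_rewrite 1 [h2]; ring
    have h4 := mul_left_cancel₀ (mul_ne_zero h0 h0) h3
    have h5 : Q = 1 := by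
      have : Q ∣ 1 := by rw [h4]; exact Dvd.intro_left (P ^ s * Q ^ (s + 1)) (by ring)
      rw [Ideal.one_eq_top]; exact Ideal.isUnit_iff.1 (isUnit_of_dvd_one this)
    refine ⟨fI p, ?_⟩
    rw [extI_fI _ hp0]
    congr 1
    rw [h5, mul_one] at hQ
    exact hQ

theorem Quad.tI_dvd (hg : Quad k K g) (S : Finset (Ideal (𝓞 K)))
    (hS : ∀ P : Ideal (𝓞 K), P.IsPrime → P ≠ ⊥ → (∀ x, x - oi g x ∈ P) → P ∈ S) :
    tI k K g ∣ 2 ^ S.card := by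
  classical
  set H := (extI (algebraMap k K)).range with hH
  let S' : Finset (FId K) := (S.filter (fun P => P.map (oi g) = P ∧ P ≠ ⊥)).image fI
  have hS'card : S'.card ≤ S.card := Finset.card_image_le.trans (Finset.card_filter_le _ _)
  refine (relIndex_dvd_of_gen H (fixS (extI g)) S' ?_ ?_).trans (pow_dvd_pow 2 hS'card)
  · intro x hx
    have hx : extI g x = x := hx
    have := hg.norm_ext x
    rwa [hx, ← sq] at this
  · have sqm : ∀ z ∈ S', z * z ∈ H := by
      intro z hz
      obtain ⟨P, hP, rfl⟩ := Finset.mem_image.1 hz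
      obtain ⟨-, hP, h0⟩ := Finset.mem_filter.1 hP
      have := hg.norm_ext (fI P)
      rwa [extI_fI _ h0, hP] at this
    have key : ∀ N : ℕ, ∀ I : Ideal (𝓞 K), I ≠ ⊥ → Ideal.absNorm I ≤ N → I.map (oi g) = I →
        ∃ y ∈ H, ∃ U ⊆ S', fI I = y * ∏ z ∈ U, z := by
      intro N
      induction N with
      | zero =>
        intro I hI hN
        exact absurd (Nat.le_zero.1 hN) (Ideal.absNorm_ne_zero_iff_mem_nonZeroDivisors.2
          (mem_nonZeroDivisors_iff_ne_zero.2 hI))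
      | succ N ih =>
        intro I hI hN hgI
        by_cases htop : I = ⊤
        · refine ⟨1, one_mem _, ∅, by simp, ?_⟩
          rw [htop, fI_top]; simp
        obtain ⟨P, hPm, hPI⟩ := Ideal.exists_le_maximal I htop
        have hP0 : P ≠ ⊥ := fun h => hI (le_bot_iff.1 (h ▸ hPI))
        have hPp := hPm.isPrime
        obtain ⟨I', hI'⟩ := Ideal.dvd_iff_le.2 hPI
        -- generic step
        have step : ∀ Q R : Ideal (𝓞 K), I = Q * R → Q.map (oi g) = Q → Q ≤ P →
            ∃ y ∈ H, ∃ U ⊆ S', fI R = y * ∏ z ∈ U, z := by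
          intro Q R hQR hgQ hQP
          have hQ0 : Q ≠ ⊥ := by rintro rfl; exact hI (by rw [hQR]; simp)
          have hR0 : R ≠ ⊥ := by rintro rfl; exact hI (by rw [hQR]; simp)
          apply ih R hR0
          · have h1 : Ideal.absNorm Q ≠ 1 := fun h =>
              hPp.ne_top (eq_top_iff.2 ((Ideal.absNorm_eq_one_iff.1 h) ▸ hQP))
            have h2 : Ideal.absNorm Q ≠ 0 := Ideal.absNorm_ne_zero_iff_mem_nonZeroDivisors.2
              (mem_nonZeroDivisors_iff_ne_zero.2 hQ0)
            have h3 : Ideal.absNorm R ≠ 0 := Ideal.absNorm_ne_zero_iff_mem_nonZeroDivisors.2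
              (mem_nonZeroDivisors_iff_ne_zero.2 hR0)
            have h4 := congrArg Ideal.absNorm hQR
            rw [map_mul] at h4
            have : 2 ≤ Ideal.absNorm Q := by omega
            have : 1 ≤ Ideal.absNorm R := by omega
            nlinarith
          · have h5 : Q * R.map (oi g) = Q * R := by
              rw [← hQR]; nth_rewrite 1 [← hgQ]; rw [← Ideal.map_mul, ← hQR, hgI]
            exact mul_left_cancel₀ hQ0 h5
        by_cases hgP : P.map (oi g) = P
        · obtain ⟨y, hy, U, hU, hyU⟩ := step P I' hI' hgP le_rfl
          have hI'0 : I' ≠ ⊥ := by rintro rfl; exact hI (by rw [hI']; simp)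
          rw [hI', fI_mul hP0 hI'0, hyU]
          rcases hg.prime_cases hPp hP0 hgP with hc | hc
          · have hm : fI P ∈ S' := Finset.mem_image.2 ⟨P, Finset.mem_filter.2
              ⟨hS P hPp hP0 hc, hgP, hP0⟩, rfl⟩
            by_cases hPU : fI P ∈ U
            · refine ⟨fI P * fI P * y, mul_mem (sqm _ hm) hy, U.erase (fI P),
                (Finset.erase_subset _ _).trans hU, ?_⟩
              rw [← Finset.mul_prod_erase U _ hPU, ← mul_assoc, ← mul_assoc, mul_right_comm (fI P) y]
            · refine ⟨y, hy, insert (fI P) U, Finset.insert_subset hm hU, ?_⟩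
              rw [Finset.prod_insert hPU, mul_left_comm]
          · exact ⟨fI P * y, mul_mem hc hy, U, hU, by rw [mul_assoc]⟩
        · have hgPm : (P.map (oi g)).IsMaximal := by
            have : P.map (oi g) = P.map hg.oe := rfl
            rw [this]
            exact Ideal.map_isMaximal_of_equiv hg.oe
          have hle : I ≤ P.map (oi g) := by rw [← hgI]; exact Ideal.map_mono hPI
          have hcop : IsCoprime P (P.map (oi g)) := by
            rw [Ideal.isCoprime_iff_sup_eq]
            exact hPm.coprime_of_ne hgPm (fun h => hgP h.symm)
          obtain ⟨R, hR⟩ := hcop.mul_dvd (Ideal.dvd_iff_le.2 hPI) (Ideal.dvd_iff_le.2 hle)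
          have hgg : (P.map (oi g)).map (oi g) = P := by
            rw [Ideal.map_map]
            have : (oi g).comp (oi g) = RingHom.id _ := RingHom.ext hg.oi_invol
            rw [this, Ideal.map_id]
          obtain ⟨y, hy, U, hU, hyU⟩ := step _ R hR (by
            rw [Ideal.map_mul, hgg, mul_comm]) Ideal.mul_le_left
          have hR0 : R ≠ ⊥ := by rintro rfl; exact hI (by rw [hR]; simp)
          have hgP0 := map_ne_bot g hP0
          refine ⟨fI P * fI (P.map (oi g)) * y, mul_mem ?_ hy, U, hU, ?_⟩
          · have := hg.norm_ext (fI P)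
            rwa [extI_fI _ hP0] at this
          · rw [hR, fI_mul (mul_ne_zero hP0 hgP0) hR0, fI_mul hP0 hgP0, hyU, mul_assoc, mul_assoc, mul_assoc]
    intro x hx
    have hx : extI g x = x := hx
    obtain ⟨I, hI, y, ⟨w, rfl⟩, rfl⟩ := hg.exists_int x
    rw [map_mul, extI_comp, hg.comp_alg, extI_fI _ hI] at hx
    have h1 := fI_inj (map_ne_bot g hI) hI (mul_right_cancel hx)
    obtain ⟨y, hy, U, hU, h2⟩ := key _ I hI le_rfl h1
    refine ⟨y * extI (algebraMap k K) w, mul_mem hy ⟨w, rfl⟩, U, hU, ?_⟩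
    rw [h2, mul_right_comm]

end QuadNorm
end TC

namespace TC
set_option linter.unusedSectionVars false

section QuadUnits
open scoped nonZeroDivisors
variable {k K : Type} [Field k] [NumberField k] [Field K] [NumberField K] [Algebra k K]
  {g : K →+* K}

theorem index_sq_units (K : Type) [Field K] [NumberField K] :
    (sqS (⊤ : Subgroup (𝓞 K)ˣ)).index = 2 ^ (Units.rank K + 1) := by
  set T := Units.torsion K with hT
  set H := sqS (⊤ : Subgroup (𝓞 K)ˣ) with hH
  have h1 : H.relIndex (H ⊔ T) * (H ⊔ T).index = H.index :=
    Subgroup.relIndex_mul_index le_sup_left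
  have h2 : H.relIndex (H ⊔ T) = 2 := by
    rw [Subgroup.relIndex_sup_left]
    have : H.subgroupOf T = (powMonoidHom 2 : T →* T).range := by
      ext x
      rw [Subgroup.mem_subgroupOf, hH, mem_sqS, MonoidHom.mem_range]
      constructor
      · rintro ⟨y, -, hy⟩
        have hyT : y ∈ T := by
          have h3 : y ^ 2 ∈ T := by rw [hy]; exact x.2
          rw [hT, Units.torsion, CommGroup.mem_torsion] at h3 ⊢
          exact h3.of_pow (by norm_num)
        exact ⟨⟨y, hyT⟩, Subtype.ext hy⟩
      · rintro ⟨y, rfl⟩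
        exact ⟨y, trivial, rfl⟩
    rw [Subgroup.relIndex, this, IsCyclic.index_powMonoidHom_range]
    exact Nat.gcd_eq_right (Units.even_torsionOrder K).two_dvd
  have h3 : (H ⊔ T).index = 2 ^ Units.rank K := by
    have e : H ⊔ T = (powMonoidHom (α := (𝓞 K)ˣ ⧸ T) 2).range.comap (QuotientGroup.mk' T) := by
      ext x
      rw [Subgroup.mem_comap, MonoidHom.mem_range, Subgroup.mem_sup]
      constructor
      · rintro ⟨_, ⟨y, -, rfl⟩, z, hz, rfl⟩
        refine ⟨QuotientGroup.mk' T y, ?_⟩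
        refine QuotientGroup.eq.2 ?_
        show (y ^ 2)⁻¹ * (y ^ 2 * z) ∈ T
        rwa [inv_mul_cancel_left]
      · rintro ⟨y, hy⟩
        obtain ⟨y, rfl⟩ := QuotientGroup.mk'_surjective T y
        refine ⟨y ^ 2, ⟨y, trivial, rfl⟩, (y ^ 2)⁻¹ * x, ?_, by group⟩
        rw [← QuotientGroup.eq, ]
        exact hy
    rw [e, Subgroup.index_comap_of_surjective _ (QuotientGroup.mk'_surjective T)]
    have := AddSubgroup.index_range_nsmul (Additive ((𝓞 K)ˣ ⧸ T)) 2
    rw [Units.finrank_modTorsion] at this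
    exact this
  rw [← h1, h2, h3, pow_succ, mul_comm]

theorem Quad.fixE (hg : Quad k K g) : fixS (gE g) =
    (Units.map (algebraMap (𝓞 k) (𝓞 K) : 𝓞 k →* 𝓞 K)).range := by
  ext x
  rw [mem_fixS, MonoidHom.mem_range]
  constructor
  · intro h
    have h1 : ∀ z : (𝓞 K)ˣ, gE g z = z → ∃ y : 𝓞 k, algebraMap (𝓞 k) (𝓞 K) y = z := by
      intro z hz
      have hz' : g ((z : 𝓞 K) : K) = ((z : 𝓞 K) : K) := congrArg (fun u : (𝓞 K)ˣ => ((u : 𝓞 K) : K)) hz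
      obtain ⟨y, hy⟩ := hg.fix _ hz'
      have hi : IsIntegral ℤ y := by
        have : IsIntegral ℤ (algebraMap k K y) := by rw [hy]; exact RingOfIntegers.isIntegral_coe _
        exact (isIntegral_algebraMap_iff (algebraMap k K).injective).1 this
      refine ⟨⟨y, hi⟩, ?_⟩
      apply RingOfIntegers.coe_injective
      exact hy
    obtain ⟨a, ha⟩ := h1 x h
    obtain ⟨b, hb⟩ := h1 x⁻¹ (by rw [map_inv, h])
    have hab : a * b = 1 := by
      apply oi_inj (algebraMap k K)
      show algebraMap (𝓞 k) (𝓞 K) _ = _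
      rw [map_mul, ha, hb, map_one, Units.mul_inv]
    exact ⟨⟨a, b, hab, by rw [mul_comm, hab]⟩, Units.ext ha⟩
  · rintro ⟨y, rfl⟩
    ext
    exact hg.comm _

theorem Quad.herb (hg : Quad k K g) :
    h0 (gE g) * 2 ^ Units.rank K = h1 (gE g) * 2 ^ (2 * Units.rank k) ∧ h0 (gE g) ≠ 0 := by
  refine herbrand (gE g) ?_ (-1) (by simp) ?_ ?_ ?_ (index_sq_units K) ?_
  · intro x; ext; exact hg.invol _
  · ext; simp
  · intro h
    have := congrArg (fun u : (𝓞 K)ˣ => ((u : 𝓞 K) : K)) h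
    norm_num at this
  · intro x hx
    have : (x : 𝓞 K) ^ 2 = 1 := by simpa using congrArg Units.val hx
    rw [sq] at this
    rcases mul_self_eq_one_iff.1 this with h | h
    · left; ext1; exact h
    · right; ext1; simpa using h
  · rw [hg.fixE, ← index_sq_units k, ← Subgroup.relIndex_top_right, MonoidHom.range_eq_map]
    have hinj : Function.Injective (Units.map (algebraMap (𝓞 k) (𝓞 K) : 𝓞 k →* 𝓞 K)) :=
      Units.map_injective (oi_inj (algebraMap k K))
    rw [← Subgroup.relIndex_map_map_of_injective _ _ hinj]
    congr 1
    ext x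
    constructor
    · rintro ⟨_, ⟨y, -, rfl⟩, rfl⟩
      exact ⟨y ^ 2, ⟨y, trivial, rfl⟩, by simp⟩
    · rintro ⟨_, ⟨y, -, rfl⟩, rfl⟩
      exact ⟨_, ⟨y, trivial, rfl⟩, by simp⟩

theorem rank_TR (K : Type) [Field K] [NumberField K] [IsTotallyReal K] :
    Units.rank K + 1 = Module.finrank ℚ K := by
  have h := InfinitePlace.card_add_two_mul_card_eq_rank K
  have h0 := IsTotallyReal.nrComplexPlaces_eq_zero K
  have h1 := InfinitePlace.card_eq_nrRealPlaces_add_nrComplexPlaces K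
  have h2 : 0 < Module.finrank ℚ K := Module.finrank_pos
  rw [Units.rank]; omega

theorem rank_TC (K : Type) [Field K] [NumberField K] [IsTotallyComplex K] :
    2 * (Units.rank K + 1) = Module.finrank ℚ K := by
  have h := InfinitePlace.card_add_two_mul_card_eq_rank K
  have h0 := IsTotallyComplex.nrRealPlaces_eq_zero K
  have h1 := InfinitePlace.card_eq_nrRealPlaces_add_nrComplexPlaces K
  have h2 : 0 < Module.finrank ℚ K := Module.finrank_pos
  rw [Units.rank]; omega

theorem Quad.finrankQ (hg : Quad k K g) : Module.finrank ℚ K = 2 * Module.finrank ℚ k := by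
  rw [← hg.rank2, mul_comm, Module.finrank_mul_finrank]

theorem Quad.h1_of_rank (hg : Quad k K g) (h : Units.rank K = 2 * Units.rank k + 1) :
    h1 (gE g) = 2 * h0 (gE g) := by
  have := hg.herb.1
  rw [h, pow_succ] at this
  have h2 : (2 : ℕ) ^ (2 * Units.rank k) ≠ 0 := by positivity
  apply mul_right_cancel₀ h2
  linarith

theorem Quad.h1_TR (hg : Quad k K g) [IsTotallyReal k] [IsTotallyReal K] :
    h1 (gE g) = 2 * h0 (gE g) := by
  apply hg.h1_of_rank
  have := rank_TR k; have := rank_TR K; have := hg.finrankQ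
  omega

theorem Quad.h1_TC (hg : Quad k K g) [IsTotallyComplex k] [IsTotallyComplex K] :
    h1 (gE g) = 2 * h0 (gE g) := by
  apply hg.h1_of_rank
  have := rank_TC k; have := rank_TC K; have := hg.finrankQ
  omega

theorem Quad.h1_imq (hg : Quad k K g) (hk : Units.rank k = 0) (hK : Units.rank K = 0) :
    h1 (gE g) = h0 (gE g) := by
  have := hg.herb.1
  rw [hk, hK] at this
  simpa using this.symm

end QuadUnits
end TC

namespace TC
set_option linter.unusedSectionVars false

section QuadCons
open scoped nonZeroDivisors
variable {k K : Type} [Field k] [NumberField k] [Field K] [NumberField K] [Algebra k K]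
  {g : K →+* K}

/-- odd class number -/
def OddCl (K : Type) [Field K] [NumberField K] : Prop := Odd (Nat.card (ClassGroup (𝓞 K)))

theorem Quad.odd_of_aC (hg : Quad k K g) (h : Odd (aC g)) : OddCl K := by
  classical
  let f : Function.End (ClassGroup (𝓞 K)) := fun c => extC g c
  have hf : f ^ 2 ^ 1 = 1 := by
    funext c; simp only [pow_one, sq]; exact hg.extC_invol c
  have := Equiv.Perm.card_fixedPoints_modEq (p := 2) (n := 1) hf
  have e : Fintype.card (Function.fixedPoints f) = aC g := by
    rw [← Nat.card_eq_fintype_card, aC]; rfl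
  simp only [e] at this
  rw [OddCl, Nat.odd_iff, Nat.card_eq_fintype_card]
  rw [Nat.odd_iff] at h
  rw [← h]; exact this

theorem Quad.aC_ne (hg : Quad k K g) : aC g ≠ 0 := by
  rw [aC]; exact Nat.card_pos.ne'

theorem Quad.h1_ne (hg : Quad k K g) : h1 (gE g) ≠ 0 := by
  intro h
  have := hg.herb
  rw [h, zero_mul] at this
  rcases Nat.mul_eq_zero.1 this.1 with h | h
  · exact this.2 h
  · exact absurd h (by positivity)

theorem card_cl_ne (K : Type) [Field K] [NumberField K] : Nat.card (ClassGroup (𝓞 K)) ≠ 0 :=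
  Nat.card_pos.ne'

theorem Quad.uI_ne (hg : Quad k K g) (hT : tI k K g ≠ 0) : uI g ≠ 0 := by
  intro h
  have := hg.chev.1
  rw [h, mul_zero, zero_mul] at this
  exact mul_ne_zero (mul_ne_zero hT (card_cl_ne k)) hg.herb.2 this.symm

theorem Quad.uI_pow (hg : Quad k K g) (hT : tI k K g ≠ 0) : ∃ t, uI g = 2 ^ t := by
  refine relIndex_two_pow _ _ ?_ (hg.uI_ne hT)
  rintro x ⟨hx, hx2⟩
  have hx : gX g x = x := hx
  exact ⟨⟨x, by rw [nmS_apply, hx, sq]⟩, pow_mem hx2 2⟩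

/-- a non-norm unit makes the unit index even -/
theorem Quad.two_dvd_uI (hg : Quad k K g) (hT : tI k K g ≠ 0) (u : (𝓞 k)ˣ)
    (hu : ∀ x : K, x * g x ≠ algebraMap k K (u : k)) : 2 ∣ uI g := by
  obtain ⟨t, ht⟩ := hg.uI_pow hT
  rcases t with _ | t
  · exfalso
    rw [uI, pow_zero, Subgroup.relIndex_eq_one] at ht
    let v : Kˣ := Units.map (algebraMap k K : k →* K) (Units.map (algebraMap (𝓞 k) k : 𝓞 k →* k) u)
    have hv : v ∈ fixS (gX g) ⊓ (pr (K := K)).ker := by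
      refine ⟨?_, ?_⟩
      · show gX g v = v
        ext1; exact hg.comm _
      · show pr v = 1
        rw [ker_pr]
        refine ⟨Units.map (algebraMap (𝓞 k) (𝓞 K) : 𝓞 k →* 𝓞 K) u, ?_⟩
        ext1; rfl
    obtain ⟨⟨x, hx⟩, -⟩ := ht hv
    exact hu x (congrArg Units.val hx)
  · rw [ht]; exact Dvd.intro_left _ (pow_succ 2 t).symm

theorem Quad.count (hg : Quad k K g) {e : ℕ} (he : h1 (gE g) = 2 ^ e * h0 (gE g)) :
    aC g * uI g * 2 ^ e = tI k K g * Nat.card (ClassGroup (𝓞 k)) := by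
  have := hg.chev.1
  rw [he] at this
  apply mul_right_cancel₀ hg.herb.2
  rw [← this]; ring

theorem tI_ne {t : ℕ} (h : tI k K g ∣ 2 ^ t) : tI k K g ≠ 0 := by
  intro h0; rw [h0] at h; exact absurd (zero_dvd_iff.1 h) (by positivity)

/-- 2-part bound of number of ambiguous classes -/
theorem Quad.aC_bound (hg : Quad k K g) (hk : OddCl k) {e t j s : ℕ}
    (he : h1 (gE g) = 2 ^ e * h0 (gE g)) (hT : tI k K g ∣ 2 ^ t) (hj : 2 ^ j ∣ uI g)
    (hs : 2 ^ s ∣ aC g) : s + j + e ≤ t := by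
  have h := hg.count he
  have h1 : 2 ^ (s + j + e) ∣ tI k K g * Nat.card (ClassGroup (𝓞 k)) := by
    rw [← h, pow_add, pow_add]
    exact mul_dvd_mul (mul_dvd_mul hs hj) dvd_rfl
  have h2 : Nat.Coprime (2 ^ (s + j + e)) (Nat.card (ClassGroup (𝓞 k))) :=
    (Nat.coprime_two_left.2 hk).pow_left _
  have h3 := (h2.dvd_of_dvd_mul_right h1).trans hT
  exact (Nat.pow_dvd_pow_iff_le_right (by norm_num)).1 h3

theorem Quad.odd_of (hg : Quad k K g) (hk : OddCl k) {e t j : ℕ}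
    (he : h1 (gE g) = 2 ^ e * h0 (gE g)) (hT : tI k K g ∣ 2 ^ t) (hj : 2 ^ j ∣ uI g)
    (hle : t ≤ e + j) : OddCl K := by
  apply hg.odd_of_aC
  by_contra hodd
  have h2 : 2 ^ 1 ∣ aC g := by rw [pow_one]; exact (Nat.not_odd_iff_even.1 hodd).two_dvd
  have := hg.aC_bound hk he hT hj h2
  omega

theorem Quad.h1_dvd (hg : Quad k K g) (hk : OddCl k) : h1 (gE g) ∣ tI k K g := by
  obtain ⟨t, ht⟩ := h1_pow_two (gE g) hg.h1_ne
  have h2 : Nat.Coprime (h1 (gE g)) (Nat.card (ClassGroup (𝓞 k))) := by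
    rw [ht]; exact (Nat.coprime_two_left.2 hk).pow_left _
  exact h2.dvd_of_dvd_mul_right hg.chev.2.1

/-- if the bottom has odd class number then `g` inverts classes of 2-power order -/
theorem Quad.inv_of_odd (hg : Quad k K g) (hk : OddCl k) (c : ClassGroup (𝓞 K)) {n : ℕ}
    (hc : c ^ 2 ^ n = 1) : extC g c = c⁻¹ := by
  obtain ⟨b, hb⟩ := hg.class_norm c
  have h1 : (c * extC g c) ^ 2 ^ n = 1 := by
    rw [mul_pow, ← map_pow, hc, map_one, one_mul]
  have h2 : (c * extC g c) ^ Nat.card (ClassGroup (𝓞 k)) = 1 := by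
    rw [hb, ← map_pow, pow_card_eq_one', map_one]
  have h3 : c * extC g c = 1 := by
    have := Nat.dvd_gcd (orderOf_dvd_of_pow_eq_one h1) (orderOf_dvd_of_pow_eq_one h2)
    rw [((Nat.coprime_two_left.2 hk).pow_left n : Nat.gcd _ _ = 1)] at this
    exact orderOf_eq_one_iff.1 (Nat.dvd_one.1 this)
  exact eq_inv_of_mul_eq_one_right h3

theorem Quad.two_torsion_dvd (hg : Quad k K g) (hk : OddCl k) :
    Nat.card (powMonoidHom 2 : ClassGroup (𝓞 K) →* ClassGroup (𝓞 K)).ker ∣ aC g := by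
  apply Subgroup.card_dvd_of_le
  intro c hc
  have hc : c ^ 2 = 1 := hc
  rw [mem_fixS, hg.inv_of_odd hk c (n := 1) hc]
  exact inv_eq_of_mul_eq_one_right (by rw [← sq, hc])

/-- capitulation kernel divides `h1` -/
theorem Quad.ker_dvd (hg : Quad k K g) : Nat.card (extC (algebraMap k K)).ker *
    ((extI (algebraMap k K)).range ⊓ (pr (K := K)).range).relIndex
      (fixS (extI g) ⊓ (pr (K := K)).range) = h1 (gE g) := by
  set ε := extI (algebraMap k K) with hε
  have hle1 : (pr (K := k)).range.map ε ≤ ε.range ⊓ (pr (K := K)).range := by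
    rintro _ ⟨_, ⟨x, rfl⟩, rfl⟩
    exact ⟨⟨_, rfl⟩, ⟨_, (extI_pr _ x).symm⟩⟩
  have hle2 : ε.range ⊓ (pr (K := K)).range ≤ fixS (extI g) ⊓ (pr (K := K)).range := by
    refine inf_le_inf_right _ ?_
    rintro _ ⟨I, rfl⟩
    rw [mem_fixS, extI_comp, hg.comp_alg]
  rw [hg.chev.2.2, ← Subgroup.relIndex_mul_relIndex _ _ _ hle1 hle2]
  congr 1
  have e1 : ε.range ⊓ (pr (K := K)).range = ((extC (algebraMap k K)).ker.comap (ClassGroup.mk k)).map ε := by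
    ext J
    constructor
    · rintro ⟨⟨I, rfl⟩, h⟩
      refine ⟨I, ?_, rfl⟩
      rw [← ker_mk, ] at h
      show extC _ (ClassGroup.mk k I) = 1
      rw [extC_mk]; exact h
    · rintro ⟨I, hI, rfl⟩
      refine ⟨⟨I, rfl⟩, ?_⟩
      rw [← ker_mk]
      have hI : extC _ (ClassGroup.mk k I) = 1 := hI
      rw [extC_mk] at hI; exact hI
  rw [e1, Subgroup.relIndex_map_map_of_injective _ _ (extI_inj _), ← ker_mk, Subgroup.relIndex_ker,
    Subgroup.map_comap_eq_self_of_surjective mk_surj]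

theorem Quad.ker_dvd' (hg : Quad k K g) : Nat.card (extC (algebraMap k K)).ker ∣ h1 (gE g) :=
  Dvd.intro _ hg.ker_dvd

/-- improved bound if there is an ambiguous principal ideal which is not extended -/
theorem Quad.ker_dvd_two (hg : Quad k K g) (x : Kˣ) (hx : extI g (pr x) = pr x)
    (hx2 : pr x ∉ (extI (algebraMap k K)).range) :
    2 * Nat.card (extC (algebraMap k K)).ker ∣ h1 (gE g) := by
  obtain ⟨t, ht⟩ := h1_pow_two (gE g) hg.h1_ne
  have hk := hg.ker_dvd
  set D := ((extI (algebraMap k K)).range ⊓ (pr (K := K)).range).relIndex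
      (fixS (extI g) ⊓ (pr (K := K)).range) with hD
  have h1 : D ≠ 1 := by
    intro h
    rw [hD, Subgroup.relIndex_eq_one] at h
    exact hx2 (h ⟨hx, ⟨x, rfl⟩⟩).1
  have h2 : D ∣ 2 ^ t := by rw [← ht, ← hk]; exact Dvd.intro_left _ rfl
  obtain ⟨m, -, hm⟩ := (Nat.dvd_prime_pow Nat.prime_two).1 h2
  rw [← hk, mul_comm]
  refine mul_dvd_mul dvd_rfl ?_
  rcases m with _ | m
  · exact absurd hm h1
  · rw [hm]; exact Dvd.intro_left _ (pow_succ 2 m).symm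

end QuadCons

theorem relIndex_dvd_two {G : Type*} [CommGroup G] (H K : Subgroup G)
    (h : ∀ a ∈ K, ∀ b ∈ K, a ∈ H ∨ b ∈ H ∨ a * b ∈ H) : H.relIndex K ∣ 2 := by
  by_cases hle : K ≤ H
  · rw [Subgroup.relIndex_eq_one.2 hle]; norm_num
  · obtain ⟨a, ha, haH⟩ := Set.not_subset.1 hle
    have : H.relIndex K = 2 := by
      rw [Subgroup.relIndex_eq_two_iff]
      refine ⟨a, ha, fun b hb => ?_⟩
      by_cases hbH : b ∈ H
      · refine Or.inr ⟨hbH, fun h2 => haH ?_⟩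
        have := H.mul_mem (H.inv_mem hbH) h2
        rwa [inv_mul_cancel_left] at this
      · refine Or.inl ⟨?_, hbH⟩
        rcases h b hb a ha with h | h | h
        · exact absurd h hbH
        · exact absurd h haH
        · exact h
    rw [this]

theorem relIndex_dvd_two' {G : Type*} [CommGroup G] (H K : Subgroup G)
    (h : H.relIndex K ∣ 2) {a b : G} (ha : a ∈ K) (hb : b ∈ K) : a ∈ H ∨ b ∈ H ∨ a * b ∈ H := by
  rcases (Nat.dvd_prime Nat.prime_two).1 h with h | h
  · rw [Subgroup.relIndex_eq_one] at h; exact Or.inl (h ha)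
  · have := Subgroup.mul_mem_iff_of_index_two h (a := ⟨a, ha⟩) (b := ⟨b, hb⟩)
    simp only [Subgroup.mem_subgroupOf, Subgroup.coe_mul] at this
    tauto

end TC

namespace TC
set_option linter.unusedSectionVars false

section Local
variable {p : ℕ} [hp : Fact p.Prime]

theorem toZ0 (x : ℤ_[p]) : PadicInt.toZMod x = 0 ↔ ‖x‖ < 1 := by
  rw [← RingHom.mem_ker, PadicInt.ker_toZMod, IsLocalRing.mem_maximalIdeal, PadicInt.mem_nonunits]

theorem val_sq (x : ℚ_[p]) : (x ^ 2).valuation = 2 * x.valuation := by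
  rw [Padic.valuation_pow]; norm_num

/-- the key local lemma -/
theorem loc (u : ℤ_[p]) (hu : ‖u‖ = 1) (d X Y Z : ℚ_[p]) (hd : Odd d.valuation) (hZ : Z ≠ 0)
    (h : (u : ℚ_[p]) * Z ^ 2 = X ^ 2 - d * Y ^ 2) : IsSquare (PadicInt.toZMod u) := by
  obtain ⟨x, hx⟩ : ∃ x, x = X / Z := ⟨_, rfl⟩
  obtain ⟨y, hy⟩ : ∃ y, y = Y / Z := ⟨_, rfl⟩
  have hd0 : d ≠ 0 := by rintro rfl; simp at hd
  have h1 : (u : ℚ_[p]) = x ^ 2 - d * y ^ 2 := by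
    rw [hx, hy]; field_simp; linear_combination h
  have hp1 : (1 : ℝ) < p := by exact_mod_cast hp.out.one_lt
  have hu' : ‖(u : ℚ_[p])‖ = 1 := by simpa using hu
  have key : ∀ z : ℚ_[p], d * z ^ 2 ≠ 0 → Odd (d * z ^ 2).valuation := by
    intro z hz
    have hz2 : z ^ 2 ≠ 0 := right_ne_zero_of_mul hz
    rw [Padic.valuation_mul hd0 hz2, val_sq]
    exact hd.add_even (even_two_mul _)
  have hne1 : ‖d * y ^ 2‖ ≠ 1 := by
    intro h2
    have h0 : d * y ^ 2 ≠ 0 := by intro h; rw [h] at h2; simp at h2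
    rw [Padic.norm_eq_zpow_neg_valuation h0] at h2
    have := (zpow_eq_one_iff_right₀ (by positivity) hp1.ne').1 h2
    have h3 := key y h0
    rw [neg_eq_zero.1 this] at h3
    simp at h3
  have hne : ‖x ^ 2‖ ≠ ‖d * y ^ 2‖ := by
    intro h2
    by_cases h0 : d * y ^ 2 = 0
    · rw [h0, norm_zero, norm_eq_zero] at h2
      rw [h1, h0, h2] at hu'; simp at hu'
    · have hx0 : x ^ 2 ≠ 0 := by
        intro h; rw [h, norm_zero] at h2; exact h0 (norm_eq_zero.1 h2.symm)
      rw [Padic.norm_eq_zpow_neg_valuation h0, Padic.norm_eq_zpow_neg_valuation hx0] at h2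
      have := zpow_right_injective₀ (by positivity) hp1.ne' h2
      have h3 := key y h0
      rw [← neg_inj.1 this, val_sq] at h3
      exact (Int.not_odd_iff_even.2 (even_two_mul _)) h3
  have hmax : max ‖x ^ 2‖ ‖d * y ^ 2‖ = 1 := by
    rw [← hu', h1, sub_eq_add_neg, Padic.add_eq_max_of_ne (by rwa [norm_neg]), norm_neg]
  have hx2 : ‖x ^ 2‖ ≤ 1 := hmax ▸ le_max_left _ _
  have hy2 : ‖d * y ^ 2‖ < 1 := lt_of_le_of_ne (hmax ▸ le_max_right _ _) hne1
  have hx1 : ‖x‖ ≤ 1 := by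
    rw [norm_pow] at hx2
    exact (pow_le_one_iff_of_nonneg (norm_nonneg _) (by norm_num)).1 hx2
  let a : ℤ_[p] := ⟨x, hx1⟩
  have h4 : PadicInt.toZMod (u - a ^ 2) = 0 := by
    rw [toZ0]
    have : ((u - a ^ 2 : ℤ_[p]) : ℚ_[p]) = - (d * y ^ 2) := by
      push_cast; rw [h1]; ring
    rw [PadicInt.norm_def, this, norm_neg]; exact hy2
  refine ⟨PadicInt.toZMod a, ?_⟩
  rw [map_sub, map_pow, sub_eq_zero] at h4
  rw [h4, sq]

theorem norm_one_of {x : ℤ_[p]} (h : PadicInt.toZMod x ≠ 0) : ‖x‖ = 1 := by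
  rw [Ne, toZ0] at h
  exact le_antisymm (PadicInt.norm_le_one _) (not_lt.1 h)

theorem zsq_neg {a : ZMod p} (hp4 : p % 4 = 3) (ha : a ≠ 0) : ¬ (IsSquare a ∧ IsSquare (-a)) := by
  rintro ⟨⟨x, hx⟩, ⟨y, hy⟩⟩
  have hx0 : x ≠ 0 := by rintro rfl; exact ha (by rw [hx]; ring)
  have : IsSquare (-1 : ZMod p) := ⟨y / x, by
    field_simp; rw [sq, sq, ← hx, ← hy]⟩
  exact ZMod.exists_sq_eq_neg_one_iff.1 this hp4

theorem zsq_or {a : ZMod p} (hp4 : p % 4 = 3) : IsSquare a ∨ IsSquare (-a) := by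
  by_cases ha : a = 0
  · left; rw [ha]; exact ⟨0, by ring⟩
  · by_contra! h
    have h1 : quadraticChar (ZMod p) a = -1 := quadraticChar_neg_one_iff_not_isSquare.2 h.1
    have h2 : quadraticChar (ZMod p) (-a) = -1 := quadraticChar_neg_one_iff_not_isSquare.2 h.2
    have h3 : quadraticChar (ZMod p) (-1) = -1 := by
      rw [quadraticChar_neg_one_iff_not_isSquare, ZMod.exists_sq_eq_neg_one_iff]; tauto
    rw [← neg_one_mul, map_mul, h1, h3] at h2
    norm_num at h2

theorem exists_t (hp8 : p % 8 = 3) : ∃ t : ℤ_[p], t ^ 2 = -2 ∧ IsSquare (PadicInt.toZMod t) := by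
  have hp2 : p ≠ 2 := by rintro rfl; norm_num at hp8
  suffices h : ∃ t : ℤ_[p], t ^ 2 = -2 by
    obtain ⟨t, ht⟩ := h
    rcases zsq_or (a := PadicInt.toZMod t) (by omega) with h | h
    · exact ⟨t, ht, h⟩
    · exact ⟨-t, by rw [neg_sq, ht], by rwa [map_neg]⟩
  obtain ⟨b, hb⟩ := (ZMod.exists_sq_eq_neg_two_iff hp2).2 (Or.inr hp8)
  obtain ⟨a, rfl⟩ := ZMod.ringHom_surjective (PadicInt.toZMod (p := p)) b
  have h2 : (2 : ZMod p) ≠ 0 := by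
    intro h
    have h : ((2 : ℕ) : ZMod p) = 0 := by exact_mod_cast h
    rw [ZMod.natCast_eq_zero_iff] at h
    exact hp2 ((Nat.prime_dvd_prime_iff_eq hp.out Nat.prime_two).1 h)
  have ha : PadicInt.toZMod a ≠ 0 := by
    intro h; rw [h] at hb; apply h2; linear_combination -hb
  have n1 : ‖2 * a‖ = 1 := norm_one_of (by
    rw [map_mul, map_ofNat]; exact mul_ne_zero h2 ha)
  have n2 : ‖a ^ 2 + 2‖ < 1 := by
    rw [← toZ0, map_add, map_pow, map_ofNat, sq, ← hb]; ring
  obtain ⟨z, hz, -⟩ := hensels_lemma (F := (Polynomial.X ^ 2 + 2 : Polynomial ℤ_[p])) (a := a) (by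
    have e1 : (Polynomial.aeval a) (Polynomial.X ^ 2 + 2 : Polynomial ℤ_[p]) = a ^ 2 + 2 := by simp
    have e2 : (Polynomial.aeval a) (Polynomial.derivative (Polynomial.X ^ 2 + 2 : Polynomial ℤ_[p])) = 2 * a := by
      simp; left; norm_num
    rw [e1, e2, n1]; simpa using n2)
  refine ⟨z, ?_⟩
  simp at hz
  linear_combination hz

theorem val_pm {m : ℕ} (hm : ¬ p ∣ m) : Odd ((p : ℚ_[p]) * m).valuation := by
  have hm0 : m ≠ 0 := by rintro rfl; simp at hm
  rw [Padic.valuation_mul (by exact_mod_cast hp.out.ne_zero) (by exact_mod_cast hm0)]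
  have : ((m : ℚ_[p])).valuation = 0 := by
    rw [Padic.valuation_natCast, padicValNat.eq_zero_of_not_dvd hm]; rfl
  rw [this]; simp

/-- rational version -/
theorem locQ {m : ℕ} (hm : ¬ p ∣ m) (c : ℤ) (hc : ¬ (p : ℤ) ∣ c) (X Y Z : ℚ) (hZ : Z ≠ 0)
    (h : c * Z ^ 2 = X ^ 2 - p * m * Y ^ 2) : IsSquare (c : ZMod p) := by
  have hu : ‖(c : ℤ_[p])‖ = 1 := by
    apply norm_one_of
    rw [map_intCast, Ne, ZMod.intCast_zmod_eq_zero_iff_dvd]; exact hc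
  have := loc (c : ℤ_[p]) hu (p * m) X Y Z (val_pm hm) (by exact_mod_cast hZ) (by
    have := congrArg (fun x : ℚ => (x : ℚ_[p])) h
    push_cast at this ⊢; exact this)
  rwa [map_intCast] at this

theorem emb_of {k E : Type*} [Field k] [CharZero k] [Field E] [CharZero E] (t : k)
    (ht : t ^ 2 = -2) (htop : ℚ⟮t⟯ = ⊤) (τ : E) (hτ : τ ^ 2 = -2) :
    ∃ f : k →+* E, f t = τ := by
  have h2 : ∀ x : ℚ, x ^ 2 ≠ -2 := by intro x hx; nlinarith [sq_nonneg x]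
  have hirr : Irreducible (Polynomial.X ^ 2 - Polynomial.C (-2 : ℚ)) :=
    X_pow_sub_C_irreducible_of_prime Nat.prime_two h2
  have hm : (Polynomial.X ^ 2 - Polynomial.C (-2 : ℚ)).Monic :=
    Polynomial.monic_X_pow_sub_C _ (by norm_num)
  have hr : Polynomial.aeval t (Polynomial.X ^ 2 - Polynomial.C (-2 : ℚ)) = 0 := by simp [ht]
  have hIntg : IsIntegral ℚ t := ⟨_, hm, by rw [Polynomial.aeval_def] at hr; exact hr⟩
  have hmin := minpoly.eq_of_irreducible_of_monic hirr hr hm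
  have hx : Polynomial.aeval τ (minpoly ℚ t) = 0 := by rw [← hmin]; simp [hτ]
  have hx' : τ ∈ (minpoly ℚ t).aroots E := by
    rw [Polynomial.mem_aroots]; exact ⟨minpoly.ne_zero hIntg, hx⟩
  have h1 := algHomAdjoinIntegralEquiv_symm_apply_gen ℚ hIntg ⟨τ, hx'⟩
  obtain ⟨f1, hf1⟩ : ∃ f1 : ℚ⟮t⟯ →ₐ[ℚ] E, f1 (AdjoinSimple.gen ℚ t) = τ := ⟨_, h1⟩
  have hmem : ∀ x : k, x ∈ ℚ⟮t⟯ := fun x => by rw [htop]; trivial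
  let i : k →+* ℚ⟮t⟯ :=
    { toFun := fun x => ⟨x, hmem x⟩, map_one' := rfl, map_mul' := fun _ _ => rfl,
      map_zero' := rfl, map_add' := fun _ _ => rfl }
  exact ⟨(f1 : ℚ⟮t⟯ →+* E).comp i, hf1⟩

/-- version over `ℚ(√-2)` -/
theorem locT (hp8 : p % 8 = 3) {m : ℕ} (hm : ¬ p ∣ m) {k : Type*} [Field k] [CharZero k] (t : k)
    (ht : t ^ 2 = -2) (htop : ℚ⟮t⟯ = ⊤) (c : ℤ) (hc : ¬ (p : ℤ) ∣ c) (a : ℕ) (X Y Z : k)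
    (hZ : Z ≠ 0) (h : c * t ^ a * Z ^ 2 = X ^ 2 - p * m * Y ^ 2) : IsSquare (c : ZMod p) := by
  obtain ⟨τ, hτ, hτ2⟩ := exists_t hp8
  have hτ' : (τ : ℚ_[p]) ^ 2 = -2 := by
    have := congrArg (fun x : ℤ_[p] => (x : ℚ_[p])) hτ
    push_cast at this; exact_mod_cast this
  obtain ⟨f, hf⟩ := emb_of t ht htop (τ : ℚ_[p]) hτ'
  have h2 : (-2 : ZMod p) ≠ 0 := by
    intro h
    have h : ((-2 : ℤ) : ZMod p) = 0 := by exact_mod_cast h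
    rw [ZMod.intCast_zmod_eq_zero_iff_dvd, Int.dvd_neg] at h
    have := (Nat.prime_dvd_prime_iff_eq hp.out Nat.prime_two).1 (by exact_mod_cast h)
    rw [this] at hp8; norm_num at hp8
  have hτ0 : PadicInt.toZMod τ ≠ 0 := by
    intro h
    have := congrArg PadicInt.toZMod hτ
    rw [map_pow, h, map_neg, map_ofNat] at this
    apply h2; rw [← this]; ring
  have hc0 : (c : ZMod p) ≠ 0 := by rwa [Ne, ZMod.intCast_zmod_eq_zero_iff_dvd]
  have hu : ‖(c : ℤ_[p]) * τ ^ a‖ = 1 := by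
    apply norm_one_of
    rw [map_mul, map_pow, map_intCast]
    exact mul_ne_zero hc0 (pow_ne_zero _ hτ0)
  have := loc ((c : ℤ_[p]) * τ ^ a) hu (p * m) (f X) (f Y) (f Z) (val_pm hm)
    (by simpa using hZ) (by
    have := congrArg f h
    simp only [map_mul, map_pow, map_sub, map_intCast, map_natCast, hf] at this
    push_cast; exact this)
  rw [map_mul, map_pow, map_intCast] at this
  obtain ⟨w, hw⟩ := hτ2.pow a
  obtain ⟨v, hv⟩ := this
  have hw0 : w ≠ 0 := by
    rintro rfl; exact pow_ne_zero a hτ0 (by rw [hw]; ring)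
  refine ⟨v / w, ?_⟩
  rw [hw] at hv
  field_simp
  linear_combination hv

theorem nsq_two (hp8 : p % 8 = 3) : ¬ IsSquare ((2 : ℤ) : ZMod p) := by
  have hp2 : p ≠ 2 := by rintro rfl; norm_num at hp8
  push_cast
  rw [ZMod.exists_sq_eq_two_iff hp2]; omega

theorem nsq_neg_one (hp8 : p % 8 = 3) : ¬ IsSquare ((-1 : ℤ) : ZMod p) := by
  push_cast
  rw [ZMod.exists_sq_eq_neg_one_iff]; omega

end Local
end TC

namespace TC
set_option linter.unusedSectionVars false
set_option linter.style.haveILetI false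

section Poly
open Polynomial

/-- iterated `X^2-2` -/
noncomputable def PP : ℕ → ℤ[X]
  | 0 => X
  | n + 1 => PP n ^ 2 - C 2

theorem PP_monic_deg (n : ℕ) : (PP n).Monic ∧ (PP n).natDegree = 2 ^ n := by
  induction n with
  | zero => exact ⟨monic_X, natDegree_X⟩
  | succ n ih =>
    have h1 : (PP n ^ 2).Monic := ih.1.pow 2
    have h2 : (PP n ^ 2).natDegree = 2 ^ (n + 1) := by
      rw [ih.1.natDegree_pow, ih.2]; ring
    have h3 : (C (2 : ℤ)).degree < (PP n ^ 2).degree := by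
      rw [degree_eq_natDegree h1.ne_zero, h2, degree_C (by norm_num)]
      exact_mod_cast Nat.pos_of_ne_zero (by positivity)
    refine ⟨h1.sub_of_left h3, ?_⟩
    rw [PP, natDegree_sub_C, h2]

theorem PP_map (n : ℕ) : (PP n).map (Int.castRingHom (ZMod 2)) = X ^ 2 ^ n := by
  induction n with
  | zero => simp [PP]
  | succ n ih =>
    have : (Int.castRingHom (ZMod 2)) 2 = 0 := by decide
    rw [PP, Polynomial.map_sub, Polynomial.map_pow, ih, map_C, this]
    simp; ring

theorem PP_zero (n : ℕ) : (PP (n+1)).eval 0 = 2 ∨ (PP (n+1)).eval 0 = -2 := by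
  induction n with
  | zero => simp [PP]
  | succ n ih => rw [PP]; rcases ih with h | h <;> simp [h]

theorem PP_irr (n : ℕ) : Irreducible ((PP n).map (Int.castRingHom ℚ)) := by
  have hm := PP_monic_deg n
  rw [← IsPrimitive.Int.irreducible_iff_irreducible_map_cast hm.1.isPrimitive]
  rcases n with _ | n
  · exact irreducible_X
  have hpr : (Ideal.span {(2 : ℤ)}).IsPrime :=
    (Ideal.span_singleton_prime (by norm_num)).2 Int.prime_two
  refine IsEisensteinAt.irreducible (𝓟 := Ideal.span {(2 : ℤ)}) ⟨?_, ?_, ?_⟩ hpr hm.1.isPrimitive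
    (by rw [hm.2]; positivity)
  · rw [hm.1.leadingCoeff]
    exact fun h => hpr.ne_top ((Ideal.eq_top_iff_one _).2 h)
  · intro i hi
    rw [hm.2] at hi
    rw [Ideal.mem_span_singleton]
    have := congrArg (fun P => P.coeff i) (PP_map (n+1))
    simp only [coeff_map, coeff_X_pow, hi.ne, if_false] at this
    exact (ZMod.intCast_zmod_eq_zero_iff_dvd _ 2).1 this
  · rw [Ideal.span_singleton_pow, Ideal.mem_span_singleton, coeff_zero_eq_eval_zero]
    rcases PP_zero n with h | h <;> rw [h] <;> norm_num

theorem PP_eval {K : Type*} [CommRing K] (n : ℕ) (x : K) :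
    aeval x (PP n) = (fun y : K => y ^ 2 - 2)^[n] x := by
  induction n with
  | zero => simp [PP]
  | succ n ih => rw [PP, Function.iterate_succ_apply', ← ih]; simp [map_ofNat]

end Poly

theorem finrank_eta {K : Type*} [Field K] [CharZero K] {n : ℕ} {η : K}
    (h : (fun y : K => y ^ 2 - 2)^[n] η = 0) : Module.finrank ℚ ℚ⟮η⟯ = 2 ^ n := by
  have hm := PP_monic_deg n
  have hm' : ((PP n).map (Int.castRingHom ℚ)).Monic := hm.1.map _
  have hr : Polynomial.aeval η ((PP n).map (Int.castRingHom ℚ)) = 0 := by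
    have := PP_eval n η
    rw [h] at this
    rw [← this]
    exact Polynomial.aeval_map_algebraMap ℚ η (PP n)
  have hIntg : IsIntegral ℚ η := ⟨_, hm', by rw [Polynomial.aeval_def] at hr; exact hr⟩
  rw [IntermediateField.adjoin.finrank hIntg,
    ← minpoly.eq_of_irreducible_of_monic (PP_irr n) hr hm', hm.1.natDegree_map, hm.2]

theorem finrank_zeta {K : Type*} [Field K] [CharZero K] {n : ℕ} {ζ : K}
    (h : IsPrimitiveRoot ζ (2 ^ (n+2))) : Module.finrank ℚ ℚ⟮ζ⟯ = 2 ^ (n+1) := by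
  have hIntg : IsIntegral ℚ ζ := (h.isIntegral (by positivity)).tower_top
  rw [IntermediateField.adjoin.finrank hIntg, ← Polynomial.cyclotomic_eq_minpoly_rat h (by positivity),
    Polynomial.natDegree_cyclotomic, Nat.totient_prime_pow_succ Nat.prime_two]
  simp

theorem q_dvd_of {K : Type*} [Field K] [NumberField K] {p q : ℕ} (h : (p : 𝓞 K) ∣ q) : p ∣ q := by
  have h1 := Ideal.absNorm_dvd_absNorm_of_le ((Ideal.span_singleton_le_span_singleton).2 h)
  have h2 : ∀ m : ℕ, Ideal.absNorm (Ideal.span {(m : 𝓞 K)}) = m ^ Module.finrank ℚ K := by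
    intro m
    rw [Ideal.absNorm_span_natCast, RingOfIntegers.rank]
  rw [h2, h2] at h1
  exact (Nat.pow_dvd_pow_iff Module.finrank_pos.ne').1 h1

/-- `√(pq)` is not in a 2-power cyclotomic field -/
theorem s_notMem_aux {K : Type*} [Field K] [NumberField K] {p q n : ℕ} (hp : p.Prime) (hp2 : p ≠ 2)
    (hpq : ¬ p ∣ q)
    [IsCyclotomicExtension {2 ^ (n+2)} ℚ K] (s : K) (hs : s ^ 2 = p * q) : False := by
  haveI : Fact p.Prime := ⟨hp⟩
  haveI : NeZero (2 ^ (n+2)) := ⟨by positivity⟩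
  have hζ := IsCyclotomicExtension.zeta_spec (2 ^ (n+2)) ℚ K
  obtain ⟨f, hf0, hf⟩ : ∃ f : ℕ, 0 < f ∧ p ^ f ≡ 1 [MOD 2 ^ (n+2)] :=
    ⟨_, Nat.totient_pos.2 (by positivity), Nat.ModEq.pow_totient
      (((Nat.coprime_primes hp Nat.prime_two).2 hp2).pow_right _)⟩
  have hsint : IsIntegral ℤ s := by
    refine ⟨Polynomial.X ^ 2 - Polynomial.C ((p * q : ℕ) : ℤ), Polynomial.monic_X_pow_sub_C _ (by norm_num), ?_⟩
    simp [hs]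
  let S : 𝓞 K := ⟨s, hsint⟩
  have hS : S ^ 2 = p * q := by
    apply RingOfIntegers.coe_injective; simp only [map_pow, map_mul, map_natCast]; exact hs
  let I : Ideal (𝓞 K) := Ideal.span {(p : 𝓞 K)}
  haveI : CharP (𝓞 K ⧸ I) p := by
    apply CharP.quotient
    intro h
    have := q_dvd_of (K := K) (p := p) (q := 1) (by simpa using isUnit_iff_dvd_one.1 h)
    exact hp.one_lt.ne' (Nat.dvd_one.1 this)
  let φ : 𝓞 K →ₐ[ℤ] 𝓞 K ⧸ I := (Ideal.Quotient.mk I).toIntAlgHom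
  let ψ : 𝓞 K →ₐ[ℤ] 𝓞 K ⧸ I := ((iterateFrobenius (𝓞 K ⧸ I) p f).comp (Ideal.Quotient.mk I)).toIntAlgHom
  have hφ : φ = ψ := by
    apply AlgHom.ext_of_adjoin_eq_top (IsCyclotomicExtension.Rat.adjoin_singleton_eq_top hζ)
    rintro _ rfl
    have e : hζ.toInteger ^ p ^ f = hζ.toInteger := by
      apply RingOfIntegers.coe_injective
      rw [map_pow]
      show IsCyclotomicExtension.zeta (2 ^ (n+2)) ℚ K ^ p ^ f = IsCyclotomicExtension.zeta (2 ^ (n+2)) ℚ K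
      conv_rhs => rw [← pow_one (IsCyclotomicExtension.zeta (2 ^ (n+2)) ℚ K)]
      exact pow_eq_pow_of_modEq hf hζ.pow_eq_one
    show Ideal.Quotient.mk I hζ.toInteger = iterateFrobenius (𝓞 K ⧸ I) p f (Ideal.Quotient.mk I hζ.toInteger)
    rw [iterateFrobenius_def, ← map_pow, e]
  have h1 : Ideal.Quotient.mk I S = (Ideal.Quotient.mk I S) ^ p ^ f := by
    have := DFunLike.congr_fun hφ S
    exact this
  have h2 : (Ideal.Quotient.mk I S) ^ p ^ f = 0 := by
    rw [← map_pow, Ideal.Quotient.eq_zero_iff_mem]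
    have h3 : 2 ≤ p ^ f := hp.two_le.trans (Nat.le_self_pow hf0.ne' p)
    obtain ⟨c, hc⟩ := Nat.exists_eq_add_of_le h3
    rw [hc, pow_add, hS]
    exact Ideal.mul_mem_right _ _ (Ideal.mul_mem_right _ _ (Ideal.mem_span_singleton_self _))
  rw [h2, Ideal.Quotient.eq_zero_iff_mem, Ideal.mem_span_singleton] at h1
  obtain ⟨c, hc⟩ := h1
  apply hpq
  apply q_dvd_of (K := K)
  refine ⟨c ^ 2, ?_⟩
  have hp0 : (p : 𝓞 K) ≠ 0 := by exact_mod_cast hp.ne_zero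
  apply mul_left_cancel₀ hp0
  rw [← hS, hc]; ring

theorem s_notMem {K : Type*} [Field K] [CharZero K] [Algebra.IsAlgebraic ℚ K] {p q n : ℕ} (hp : p.Prime) (hp2 : p ≠ 2)
    (hpq : ¬ p ∣ q) {ζ : K} (hζ : IsPrimitiveRoot ζ (2 ^ (n+2))) {s : K} (hs : s ^ 2 = p * q) :
    s ∉ ℚ⟮ζ⟯ := by
  intro hmem
  haveI : NeZero (2 ^ (n+2)) := ⟨by positivity⟩
  haveI : IsCyclotomicExtension {2 ^ (n+2)} ℚ ℚ⟮ζ⟯ := hζ.intermediateField_adjoin_isCyclotomicExtension ℚ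
  haveI : NumberField ℚ⟮ζ⟯ := IsCyclotomicExtension.numberField {2 ^ (n+2)} ℚ _
  exact s_notMem_aux (n := n) hp hp2 hpq (⟨s, hmem⟩ : ℚ⟮ζ⟯) (by ext1; simpa using hs)

theorem finrank_sqrt {F K : Type*} [Field F] [Field K] [Algebra F K] {s : K} (a : F)
    (hs : s ^ 2 = algebraMap F K a) (hn : ∀ b : F, algebraMap F K b ≠ s) :
    Module.finrank F F⟮s⟯ = 2 := by
  have h2 : ∀ x : F, x ^ 2 ≠ a := by
    intro x hx
    rw [← hx, map_pow, sq_eq_sq_iff_eq_or_eq_neg] at hs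
    rcases hs with h | h
    · exact hn _ h.symm
    · exact hn (-x) (by rw [map_neg, h])
  have hirr : Irreducible (Polynomial.X ^ 2 - Polynomial.C a) :=
    X_pow_sub_C_irreducible_of_prime Nat.prime_two h2
  have hm : (Polynomial.X ^ 2 - Polynomial.C a).Monic :=
    Polynomial.monic_X_pow_sub_C _ (by norm_num)
  have hr : Polynomial.aeval s (Polynomial.X ^ 2 - Polynomial.C a) = 0 := by simp [hs]
  have hIntg : IsIntegral F s := ⟨_, hm, by rw [Polynomial.aeval_def] at hr; exact hr⟩
  rw [IntermediateField.adjoin.finrank hIntg, ← minpoly.eq_of_irreducible_of_monic hirr hr hm,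
    Polynomial.natDegree_X_pow_sub_C]

theorem finrank_pair {K : Type*} [Field K] [CharZero K] {x s : K} (m : ℚ)
    (hs : s ^ 2 = m) (hn : s ∉ ℚ⟮x⟯) :
    Module.finrank ℚ (IntermediateField.adjoin ℚ {x, s}) = 2 * Module.finrank ℚ ℚ⟮x⟯ := by
  have h1 : Module.finrank ℚ⟮x⟯ ℚ⟮x⟯⟮s⟯ = 2 := finrank_sqrt (m : ℚ⟮x⟯) (by rw [hs]; simp)
    (fun b hb => hn (hb ▸ b.2))
  have h2 : IntermediateField.adjoin ℚ {x, s} = (ℚ⟮x⟯⟮s⟯).restrictScalars ℚ := by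
    exact (IntermediateField.adjoin_simple_adjoin_simple ℚ x s).symm
  rw [h2]
  have := Module.finrank_mul_finrank ℚ ℚ⟮x⟯ ℚ⟮x⟯⟮s⟯
  rw [h1] at this
  rw [mul_comm, this]; rfl

theorem top_of_finrank {K : Type*} [Field K] [NumberField K] {E : IntermediateField ℚ K}
    (h : Module.finrank ℚ E = Module.finrank ℚ K) : E = ⊤ := by
  exact IntermediateField.eq_of_le_of_finrank_eq le_top (by rw [h, IntermediateField.finrank_top'])

theorem finrank_top_two {K : Type*} [Field K] [NumberField K] {E : IntermediateField ℚ K} {a : ℕ}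
    (h1 : Module.finrank ℚ E = a) (h : Module.finrank ℚ K = a * 2) : Module.finrank E K = 2 := by
  have := Module.finrank_mul_finrank ℚ E K
  have h0 : 0 < Module.finrank ℚ E := Module.finrank_pos
  rw [h1] at this h0
  rw [h] at this
  exact Nat.eq_of_mul_eq_mul_left h0 this

/-- a ring hom fixing generators is the identity -/
theorem fix_top {K : Type*} [Field K] [CharZero K] {S : Set K}
    (h : IntermediateField.adjoin ℚ S = ⊤) (g : K →+* K) (hg : ∀ x ∈ S, g x = x) (y : K) : g y = y := by
  have hy : y ∈ IntermediateField.adjoin ℚ S := by rw [h]; trivial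
  induction hy using IntermediateField.adjoin_induction with
  | mem x hx => exact hg x hx
  | algebraMap x => simp
  | add x y _ _ hx hy => rw [map_add, hx, hy]
  | inv x _ hx => rw [map_inv₀, hx]
  | mul x y _ _ hx hy => rw [map_mul, hx, hy]

theorem hom_eq_of_top {K L : Type*} [Field K] [CharZero K] [Field L] {S : Set K}
    (h : IntermediateField.adjoin ℚ S = ⊤) (f g : K →+* L) (hg : ∀ x ∈ S, f x = g x) : f = g := by
  ext y
  have hy : y ∈ IntermediateField.adjoin ℚ S := by rw [h]; trivial
  induction hy using IntermediateField.adjoin_induction with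
  | mem x hx => exact hg x hx
  | algebraMap x => simp
  | add x y _ _ hx hy => rw [map_add, map_add, hx, hy]
  | inv x _ hx => rw [map_inv₀, map_inv₀, hx]
  | mul x y _ _ hx hy => rw [map_mul, map_mul, hx, hy]

end TC

namespace TC
set_option linter.unusedSectionVars false
set_option linter.style.haveILetI false

/-! ### Residue degrees and counting ramified primes -/

theorem iter_add_inv {F : Type*} [Field F] {z : F} (hz : z ≠ 0) (n : ℕ) :
    (fun y : F => y ^ 2 - 2)^[n] (z + z⁻¹) = z ^ 2 ^ n + (z ^ 2 ^ n)⁻¹ := by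
  induction n with
  | zero => simp
  | succ n ih =>
    rw [Function.iterate_succ_apply', ih, pow_succ 2 n, pow_mul]
    field_simp
    ring

theorem iter_map {F F' : Type*} [CommRing F] [CommRing F'] (φ : F →+* F') (n : ℕ) (x : F) :
    φ ((fun y : F => y ^ 2 - 2)^[n] x) = (fun y : F' => y ^ 2 - 2)^[n] (φ x) := by
  induction n generalizing x with
  | zero => rfl
  | succ n ih =>
    rw [Function.iterate_succ_apply, Function.iterate_succ_apply, ih]
    simp only [map_sub, map_pow, map_ofNat]

theorem prim_of_iter {F : Type*} [Field F] (h2 : (2 : F) ≠ 0) {z : F} (hz : z ≠ 0) (n : ℕ)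
    (h : (fun y : F => y ^ 2 - 2)^[n] (z + z⁻¹) = 0) : IsPrimitiveRoot z (2 ^ (n + 2)) := by
  rw [iter_add_inv hz] at h
  have hw : z ^ 2 ^ n ≠ 0 := pow_ne_zero _ hz
  have h1 : z ^ 2 ^ (n + 1) = -1 := by
    rw [pow_succ 2 n, pow_mul]
    field_simp at h
    linear_combination h
  have := orderOf_eq_prime_pow (p := 2) (x := z) (n := n + 1) (by
    rw [h1]; intro h3; apply h2; linear_combination -h3) (by
    rw [pow_succ 2 (n+1), pow_mul, h1]; norm_num)
  rw [← this]; exact IsPrimitiveRoot.orderOf z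

theorem even_exp {p f : ℕ} (hp8 : p % 8 = 3) : (p ^ f % 8 = 1 ∧ Even f) ∨ (p ^ f % 8 = 3 ∧ ¬ Even f) := by
  induction f with
  | zero => left; simp
  | succ f ih =>
    rw [pow_succ, Nat.mul_mod, hp8, Nat.even_add_one]
    rcases ih with ⟨h, h'⟩ | ⟨h, h'⟩
    · right; rw [h]; exact ⟨rfl, not_not.2 h'⟩
    · left; rw [h]; exact ⟨rfl, h'⟩

theorem exp_dvd {p f n : ℕ} (hp8 : p % 8 = 3) (hf : Even f) (h : 2 ^ (n + 2) ∣ p ^ f - 1) :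
    2 ^ n ∣ f := by
  rcases Nat.eq_zero_or_pos f with rfl | hf0
  · simp
  rcases Nat.eq_zero_or_pos n with rfl | hn
  · simp
  have h1 : 1 < p := by omega
  have hlt := padicValNat.pow_two_sub_pow (x := p) (y := 1) (by omega) (by omega) (by omega) hf0.ne' hf
  rw [one_pow] at hlt
  have e1 : padicValNat 2 (p + 1) = 2 := by
    obtain ⟨m, hm⟩ : ∃ m, p + 1 = 2 ^ 2 * (2 * m + 1) := ⟨p / 8, by omega⟩
    rw [hm, padicValNat.mul (by norm_num) (by omega), padicValNat.prime_pow,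
      padicValNat.eq_zero_of_not_dvd (by omega)]
  have e2 : padicValNat 2 (p - 1) = 1 := by
    obtain ⟨m, hm⟩ : ∃ m, p - 1 = 2 ^ 1 * (2 * m + 1) := ⟨p / 8 * 2, by omega⟩
    rw [hm, padicValNat.mul (by norm_num) (by omega), padicValNat.prime_pow,
      padicValNat.eq_zero_of_not_dvd (by omega)]
  have hne : p ^ f - 1 ≠ 0 := by
    have := Nat.one_lt_pow hf0.ne' h1
    omega
  rw [padicValNat_dvd_iff_le hne] at h
  rw [padicValNat_dvd_iff_le hf0.ne']
  omega

theorem resF {p n : ℕ} [hp : Fact p.Prime] (hp8 : p % 8 = 3) (F : Type) [Field F] [Finite F]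
    [CharP F p] (η : F) (h : (fun y : F => y ^ 2 - 2)^[n] η = 0) : p ^ 2 ^ n ∣ Nat.card F := by
  classical
  have := Fintype.ofFinite F
  obtain ⟨f, -, hf⟩ := FiniteField.card F p
  rw [Nat.card_eq_fintype_card, hf]
  apply pow_dvd_pow
  rcases Nat.eq_zero_or_pos n with rfl | hn
  · exact f.2
  refine Nat.le_of_dvd f.2 ?_
  let A := AlgebraicClosure F
  let φ : F →+* A := algebraMap F A
  have : CharP A p := charP_of_injective_algebraMap φ.injective p
  have h2 : (2 : A) ≠ 0 := by
    intro h
    have := (CharP.cast_eq_zero_iff A p 2).1 (by exact_mod_cast h)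
    have := Nat.le_of_dvd (by norm_num) this
    omega
  obtain ⟨z, hz⟩ : ∃ z : A, z ^ 2 - φ η * z + 1 = 0 := by
    have := IsAlgClosed.exists_root (Polynomial.X ^ 2 - Polynomial.C (φ η) * Polynomial.X + 1 : Polynomial A) (by
      have : (Polynomial.X ^ 2 - Polynomial.C (φ η) * Polynomial.X + 1 : Polynomial A).degree = 2 := by
        compute_degree!
      rw [this]; norm_num)
    obtain ⟨z, hz⟩ := this
    exact ⟨z, by simpa using hz⟩
  have hz0 : z ≠ 0 := by rintro rfl; simp at hz
  have hη : z + z⁻¹ = φ η := by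
    linear_combination z⁻¹ * hz - (z - φ η) * (mul_inv_cancel₀ hz0)
  have hprim : IsPrimitiveRoot z (2 ^ (n + 2)) := prim_of_iter h2 hz0 n (by
    rw [hη, ← iter_map, h, map_zero])
  set Q := p ^ (f : ℕ) with hQ
  have hfr : φ η ^ Q = φ η := by rw [← map_pow, ← hf, FiniteField.pow_card]
  have hQ1 : 1 ≤ Q := Nat.pos_of_ne_zero (pow_ne_zero _ hp.out.ne_zero)
  have hz3 : (z ^ (Q - 1) - 1) * (z ^ (Q + 1) - 1) = 0 := by
    have : (z + z⁻¹) ^ Q = z ^ Q + (z ^ Q)⁻¹ := by rw [hQ, add_pow_char_pow, inv_pow]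
    rw [hη, hfr, ← hη] at this
    have hq : z ^ Q = z ^ (Q - 1) * z := by rw [← pow_succ]; congr 1; omega
    rw [pow_succ, hq]
    rw [hq] at this
    have h4 : z ^ (Q - 1) ≠ 0 := pow_ne_zero _ hz0
    linear_combination -(z ^ (Q - 1) * z) * this + (z ^ (Q - 1)) * (mul_inv_cancel₀ hz0) -
      mul_inv_cancel₀ (mul_ne_zero h4 hz0)
  have h8 : 8 ∣ 2 ^ (n + 2) := ⟨2 ^ (n - 1), by
    rw [show (8 : ℕ) = 2 ^ 3 by norm_num, ← pow_add]; congr 1; omega⟩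
  have key : 2 ^ (n + 2) ∣ Q - 1 ∨ 2 ^ (n + 2) ∣ Q + 1 := by
    rcases mul_eq_zero.1 hz3 with h | h
    · left; exact hprim.dvd_of_pow_eq_one _ (sub_eq_zero.1 h)
    · right; exact hprim.dvd_of_pow_eq_one _ (sub_eq_zero.1 h)
  rcases even_exp (f := f) hp8 with ⟨h5, h6⟩ | ⟨h5, h6⟩ <;> rw [← hQ] at h5
  · rcases key with h | h
    · exact exp_dvd hp8 h6 h
    · have := h8.trans h; omega
  · rcases key with h | h <;> have := h8.trans h <;> omega

section
variable {K : Type} [Field K] [NumberField K]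

theorem quot_facts {p : ℕ} [hp : Fact p.Prime] {P : Ideal (𝓞 K)} (hP : P.IsPrime) (h0 : P ≠ ⊥)
    (hpP : (p : 𝓞 K) ∈ P) : ∃ (F : Type) (_ : Field F) (_ : Finite F) (_ : CharP F p) (φ : 𝓞 K →+* F),
      Nat.card F = Ideal.absNorm P := by
  have hm : P.IsMaximal := hP.isMaximal h0
  refine ⟨𝓞 K ⧸ P, Ideal.Quotient.field P, Ideal.finiteQuotientOfFreeOfNeBot P h0, ?_, Ideal.Quotient.mk P, ?_⟩
  · letI := Ideal.Quotient.field P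
    have : ((p : ℕ) : 𝓞 K ⧸ P) = 0 := by
      have := Ideal.Quotient.eq_zero_iff_mem.2 hpP
      simpa using this
    exact ringChar.of_eq (CharP.ringChar_of_prime_eq_zero hp.out this)
  · rw [Ideal.absNorm_apply, Submodule.cardQuot_apply]

theorem resdeg {p n : ℕ} [hp : Fact p.Prime] (hp8 : p % 8 = 3) {P : Ideal (𝓞 K)} (hP : P.IsPrime) (h0 : P ≠ ⊥)
    (hpP : (p : 𝓞 K) ∈ P) (η : 𝓞 K) (h : (fun y : 𝓞 K => y ^ 2 - 2)^[n] η = 0) :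
    p ^ 2 ^ n ∣ Ideal.absNorm P := by
  obtain ⟨F, _, _, _, φ, hF⟩ := quot_facts hP h0 hpP
  rw [← hF]
  exact resF hp8 F (φ η) (by rw [← iter_map, h, map_zero])

theorem resdeg0 {p : ℕ} [hp : Fact p.Prime] (hp8 : p % 8 = 3) {P : Ideal (𝓞 K)} (hP : P.IsPrime) (h0 : P ≠ ⊥)
    (hpP : (p : 𝓞 K) ∈ P) (i : 𝓞 K) (h : i ^ 2 = -1) :
    p ^ 2 ∣ Ideal.absNorm P := by
  obtain ⟨F, _, _, _, φ, hF⟩ := quot_facts hP h0 hpP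
  rw [← hF]
  have := Fintype.ofFinite F
  obtain ⟨f, -, hf⟩ := FiniteField.card F p
  have h1 : IsSquare (-1 : F) := ⟨φ i, by rw [← sq, ← map_pow, h]; simp⟩
  rw [FiniteField.isSquare_neg_one_iff, hf] at h1
  rw [Nat.card_eq_fintype_card, hf]
  apply pow_dvd_pow
  have h3 : 0 < (f : ℕ) := f.2
  by_contra hlt
  have h4 : (f : ℕ) = 1 := by omega
  rw [h4, pow_one] at h1; omega

/-- the primes containing a given nonzero element with norm divisible by `m` -/
theorem count_primes {a : 𝓞 K} (ha : a ≠ 0) {m : ℕ} (p : Ideal (𝓞 K) → Prop)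
    (hm : ∀ P : Ideal (𝓞 K), P.IsPrime → P ≠ ⊥ → p P → a ∈ P ∧ m ∣ Ideal.absNorm P) :
    ∃ S : Finset (Ideal (𝓞 K)), (∀ P, P.IsPrime → P ≠ ⊥ → p P → P ∈ S) ∧
      m ^ S.card ∣ Ideal.absNorm (Ideal.span {a}) := by
  classical
  have hne : Ideal.span {a} ≠ (⊥ : Ideal (𝓞 K)) := by simpa using ha
  let S := (UniqueFactorizationMonoid.normalizedFactors (Ideal.span {a})).toFinset.filter p
  have hS : ∀ P ∈ S, P.IsPrime ∧ P ≠ ⊥ ∧ p P ∧ P ∣ Ideal.span {a} := by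
    intro P hP
    rw [Finset.mem_filter, Multiset.mem_toFinset] at hP
    have hpr := UniqueFactorizationMonoid.prime_of_normalized_factor P hP.1
    exact ⟨Ideal.isPrime_of_prime hpr, hpr.ne_zero, hP.2,
      UniqueFactorizationMonoid.dvd_of_mem_normalizedFactors hP.1⟩
  refine ⟨S, ?_, ?_⟩
  · intro P h1 h2 h3
    rw [Finset.mem_filter, Multiset.mem_toFinset]
    refine ⟨?_, h3⟩
    rw [Ideal.mem_normalizedFactors_iff hne]
    exact ⟨h1, by rw [Ideal.span_singleton_le_iff_mem]; exact (hm P h1 h2 h3).1⟩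
  · have h1 : ∏ P ∈ S, P ∣ Ideal.span {a} := by
      apply Finset.prod_primes_dvd
      · intro P hP; exact Ideal.prime_of_isPrime (hS P hP).2.1 (hS P hP).1
      · intro P hP; exact (hS P hP).2.2.2
    have h2 := map_dvd Ideal.absNorm h1
    rw [map_prod] at h2
    refine dvd_trans ?_ h2
    rw [← Finset.prod_const]
    apply Finset.prod_dvd_prod_of_dvd
    intro P hP
    exact (hm P (hS P hP).1 (hS P hP).2.1 (hS P hP).2.2.1).2

end

end TC

namespace TC
set_option linter.unusedSectionVars false
set_option linter.style.haveILetI false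

/-! ### Norm computations -/

section
variable {k K : Type} [Field k] [NumberField k] [Field K] [NumberField K] [Algebra k K]
  {g : K →+* K}

theorem absNorm_span (x : 𝓞 K) : ((Ideal.absNorm (Ideal.span {x}) : ℕ) : ℚ) = |Algebra.norm ℚ (x : K)| := by
  rw [Ideal.absNorm_span_singleton, Nat.cast_natAbs, ← Algebra.coe_norm_int]
  simp

theorem norm_of_mem (E : IntermediateField ℚ K) (y : E) :
    Algebra.norm ℚ (y : K) = (Algebra.norm ℚ y) ^ Module.finrank E K := by
  have : (y : K) = algebraMap E K y := rfl
  rw [this, ← Algebra.norm_norm (R := ℚ) (S := E), Algebra.norm_algebraMap, map_pow]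

theorem norm_zeta {n c : ℕ} {ζ : K} (hζ : IsPrimitiveRoot ζ (2 ^ (n + 2)))
    (hc : Module.finrank ℚ K = 2 ^ (n + 1) * c) : Algebra.norm ℚ (ζ - 1) = 2 ^ c := by
  have h1 := finrank_zeta hζ
  have h2 := Module.finrank_mul_finrank ℚ ℚ⟮ζ⟯ K
  rw [h1, hc] at h2
  have h3 : Module.finrank ℚ⟮ζ⟯ K = c := Nat.eq_of_mul_eq_mul_left (by positivity) h2
  have : IsCyclotomicExtension {2 ^ (n+2)} ℚ ℚ⟮ζ⟯ :=
    hζ.intermediateField_adjoin_isCyclotomicExtension ℚ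
  have hz : IsPrimitiveRoot (AdjoinSimple.gen ℚ ζ) (2 ^ (n + 2)) := by
    refine IsPrimitiveRoot.of_map_of_injective (f := algebraMap ℚ⟮ζ⟯ K) ?_ (algebraMap ℚ⟮ζ⟯ K).injective
    simpa using hζ
  have h4 := hz.norm_sub_one_two (K := ℚ) (by omega) (Polynomial.cyclotomic.irreducible_rat (by positivity))
  have h5 := norm_of_mem ℚ⟮ζ⟯ (AdjoinSimple.gen ℚ ζ - 1)
  rw [h4, h3] at h5
  simpa using h5

theorem norm_eta {n c : ℕ} {η : K} (h : (fun y : K => y ^ 2 - 2)^[n + 1] η = 0)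
    (hc : Module.finrank ℚ K = 2 ^ (n + 1) * c) : |Algebra.norm ℚ η| = 2 ^ c := by
  have h1 := finrank_eta h
  have h2 := Module.finrank_mul_finrank ℚ ℚ⟮η⟯ K
  rw [h1, hc] at h2
  have h3 : Module.finrank ℚ⟮η⟯ K = c := Nat.eq_of_mul_eq_mul_left (by positivity) h2
  have h5 := norm_of_mem ℚ⟮η⟯ (AdjoinSimple.gen ℚ η)
  rw [h3] at h5
  rw [AdjoinSimple.coe_gen] at h5
  rw [h5, abs_pow]
  congr 1
  have hIntg : IsIntegral ℚ η := Algebra.IsIntegral.isIntegral η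
  have h6 := Algebra.PowerBasis.norm_gen_eq_coeff_zero_minpoly (IntermediateField.adjoin.powerBasis hIntg)
  rw [IntermediateField.adjoin.powerBasis_gen, IntermediateField.minpoly_gen] at h6
  have h8 : Algebra.norm ℚ (AdjoinSimple.gen ℚ η) =
      (-1) ^ (adjoin.powerBasis hIntg).dim * (minpoly ℚ η).coeff 0 := by
    convert h6 <;> first | rfl | exact Subsingleton.elim _ _
  rw [h8, abs_mul, abs_pow, abs_neg, abs_one, one_pow, one_mul]
  have hm := PP_monic_deg (n + 1)
  have h7 : minpoly ℚ η = (PP (n+1)).map (Int.castRingHom ℚ) := by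
    symm
    apply minpoly.eq_of_irreducible_of_monic (PP_irr _) _ (hm.1.map _)
    have := PP_eval (n+1) η
    rw [h] at this
    rw [← this]
    exact Polynomial.aeval_map_algebraMap ℚ η (PP (n+1))
  rw [h7, Polynomial.coeff_map, Polynomial.coeff_zero_eq_eval_zero]
  rcases PP_zero n with h | h <;> rw [h] <;> simp

theorem norm_sq {c : ℕ} {x : K} {b : ℚ} (h : x ^ 2 = b) (hc : Module.finrank ℚ K = 2 * c) :
    |Algebra.norm ℚ x| = |b| ^ c := by
  have h1 := congrArg (Algebra.norm ℚ) h
  have h2 : (b : K) = algebraMap ℚ K b := by simp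
  rw [h2, Algebra.norm_algebraMap, hc, map_pow, mul_comm, pow_mul] at h1
  have := congrArg abs h1
  rw [abs_pow, abs_pow] at this
  rw [← abs_pow]
  exact (pow_left_inj₀ (abs_nonneg _) (abs_nonneg _) two_ne_zero).1 (by rw [this, ← abs_pow])

theorem ram_zeta {n : ℕ} {ζ : 𝓞 K} (hζ : ζ ^ 2 ^ n = 1) {P : Ideal (𝓞 K)}
    (hP : P.IsPrime) (h2 : (2 : 𝓞 K) ∈ P) : ζ - 1 ∈ P := by
  have : CharP (𝓞 K ⧸ P) 2 := by
    have : ((2 : ℕ) : 𝓞 K ⧸ P) = 0 := by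
      exact_mod_cast Ideal.Quotient.eq_zero_iff_mem.2 h2
    exact ringChar.of_eq (CharP.ringChar_of_prime_eq_zero Nat.prime_two this)
  rw [← Ideal.Quotient.eq_zero_iff_mem]
  have h : (Ideal.Quotient.mk P (ζ - 1)) ^ 2 ^ n = 0 := by
    rw [map_sub, map_one, sub_pow_char_pow, ← map_pow, hζ]; simp
  exact pow_eq_zero_iff (by positivity) |>.1 h

theorem ram_eta {n : ℕ} {η : 𝓞 K} (h : (fun y : 𝓞 K => y ^ 2 - 2)^[n] η = 0) {P : Ideal (𝓞 K)}
    (hP : P.IsPrime) (h2 : (2 : 𝓞 K) ∈ P) : η ∈ P := by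
  have h2' : (2 : 𝓞 K ⧸ P) = 0 := by
    exact_mod_cast Ideal.Quotient.eq_zero_iff_mem.2 h2
  have h3 := iter_map (Ideal.Quotient.mk P) n η
  rw [h, map_zero, h2'] at h3
  have h4 : ∀ m x, (fun y : 𝓞 K ⧸ P => y ^ 2 - 0)^[m] x = x ^ 2 ^ m := by
    intro m
    induction m with
    | zero => simp
    | succ m ih => intro x; rw [Function.iterate_succ_apply', ih, pow_succ 2 m, pow_mul]; ring
  rw [h4] at h3
  rw [← Ideal.Quotient.eq_zero_iff_mem]
  exact pow_eq_zero_iff (by positivity) |>.1 h3.symm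

theorem Quad.tI_el (hg : Quad k K g) {a : 𝓞 K} {c : ℕ} (hc : Ideal.absNorm (Ideal.span {a}) = 2 ^ c)
    (ha : ∀ P : Ideal (𝓞 K), P.IsPrime → P ≠ ⊥ → (∀ x, x - oi g x ∈ P) → a ∈ P) : tI k K g ∣ 2 ^ c := by
  have ha0 : a ≠ 0 := by
    rintro rfl
    rw [Ideal.span_singleton_zero, Ideal.absNorm_bot] at hc
    exact absurd hc.symm (by positivity)
  obtain ⟨S, hS, hS2⟩ := count_primes ha0 (m := 2) (fun P => ∀ x, x - oi g x ∈ P) (by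
    intro P h1 h2 h3
    have h4 := ha P h1 h2 h3
    refine ⟨h4, ?_⟩
    have h5 : Ideal.absNorm P ∣ 2 ^ c := by
      rw [← hc]; exact Ideal.absNorm_dvd_absNorm_of_le (by rwa [Ideal.span_singleton_le_iff_mem])
    obtain ⟨j, hj, h6⟩ := (Nat.dvd_prime_pow Nat.prime_two).1 h5
    rw [h6]
    refine dvd_pow_self 2 ?_
    rintro rfl
    rw [pow_zero, Ideal.absNorm_eq_one_iff] at h6
    exact h1.ne_top h6)
  rw [hc] at hS2
  have := (Nat.pow_dvd_pow_iff_le_right (by norm_num)).1 hS2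
  exact (hg.tI_dvd S hS).trans (pow_dvd_pow _ this)

theorem exists_omega {m : ℕ} (hm : m % 4 = 1) {s : 𝓞 K} (hs : s ^ 2 = m) : ∃ ω : 𝓞 K, 2 * ω = 1 + s := by
  have hIntg : IsIntegral ℤ ((1 + (s : K)) / 2) := by
    refine ⟨Polynomial.X ^ 2 - Polynomial.X - Polynomial.C ((m / 4 : ℕ) : ℤ), ?_, ?_⟩
    · monicity!
    · have h1 : (s : K) ^ 2 = m := by
        have := congrArg (algebraMap (𝓞 K) K) hs
        simpa using this
      have h2 : (m : K) = 4 * ((m / 4 : ℕ) : K) + 1 := by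
        have : m = 4 * (m / 4) + 1 := by omega
        exact_mod_cast this
      simp only [Polynomial.eval₂_sub, Polynomial.eval₂_pow, Polynomial.eval₂_X, Polynomial.eval₂_C]
      have h3 : (algebraMap ℤ K) ((m / 4 : ℕ) : ℤ) = ((m / 4 : ℕ) : K) := map_natCast _ _
      rw [h3]
      linear_combination h1 / 4 + h2 / 4
  obtain ⟨ω, hω⟩ : ∃ ω : 𝓞 K, (ω : K) = (1 + (s : K)) / 2 := ⟨⟨_, hIntg⟩, rfl⟩
  refine ⟨ω, ?_⟩
  apply RingOfIntegers.ext
  change algebraMap (𝓞 K) K (2 * ω) = algebraMap (𝓞 K) K (1 + s)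
  have hω' : algebraMap (𝓞 K) K ω = (1 + algebraMap (𝓞 K) K s) / 2 := hω
  rw [map_mul, hω', map_add, map_one, map_ofNat]; ring

theorem ram_s {m : ℕ} (hm : m % 4 = 1) {s : 𝓞 K} (hs : s ^ 2 = m)
    (hgs : oi g s = -s) {P : Ideal (𝓞 K)} (h : ∀ x, x - oi g x ∈ P) : s ∈ P := by
  obtain ⟨ω, hω⟩ := exists_omega hm hs
  have h1 := h ω
  have h2 : 2 * oi g ω = 1 - s := by
    have := congrArg (oi g) hω
    rw [map_mul, map_add, map_one, map_ofNat, hgs] at this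
    rw [this]; ring
  have : ω - oi g ω = s := by
    have h3 : (2 : 𝓞 K) * (ω - oi g ω) = 2 * s := by linear_combination hω - h2
    exact mul_left_cancel₀ two_ne_zero h3
  rwa [this] at h1

theorem Quad.tI_s (hg : Quad k K g) {p q : ℕ} [hp : Fact p.Prime] [hq : Fact q.Prime] (hpq : p ≠ q)
    (hm : (p * q) % 4 = 1) {s : 𝓞 K} (hs : s ^ 2 = ((p * q : ℕ) : 𝓞 K)) (hgs : oi g s = -s) {e E c : ℕ}
    (h1 : ∀ P : Ideal (𝓞 K), P.IsPrime → P ≠ ⊥ → (p : 𝓞 K) ∈ P → p ^ e ∣ Ideal.absNorm P)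
    (h2 : ∀ P : Ideal (𝓞 K), P.IsPrime → P ≠ ⊥ → (q : 𝓞 K) ∈ P → q ^ e ∣ Ideal.absNorm P)
    (hE : Ideal.absNorm (Ideal.span {s}) = (p * q) ^ E) (hlt : E < e * (c + 1)) : tI k K g ∣ 2 ^ (2 * c) := by
  classical
  have hs0 : s ≠ 0 := by
    rintro rfl
    have : ((p * q : ℕ) : 𝓞 K) = 0 := by rw [← hs]; simp
    have := Nat.cast_eq_zero.1 this
    exact mul_ne_zero hp.out.ne_zero hq.out.ne_zero this
  have aux : ∀ p q : ℕ, p.Prime → q.Prime → p ≠ q → (∀ P : Ideal (𝓞 K), P.IsPrime → P ≠ ⊥ → (p : 𝓞 K) ∈ P → p ^ e ∣ Ideal.absNorm P) →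
      Ideal.absNorm (Ideal.span {s}) = (p * q) ^ E → ∃ S : Finset (Ideal (𝓞 K)), S.card ≤ c ∧
      ∀ P : Ideal (𝓞 K), P.IsPrime → P ≠ ⊥ → s ∈ P → (p : 𝓞 K) ∈ P → P ∈ S := by
    intro p q hp hq hpq h hE
    obtain ⟨S, hS, hS2⟩ := count_primes hs0 (m := p ^ e) (fun P => s ∈ P ∧ (p : 𝓞 K) ∈ P) (by
      rintro P h1 h2 ⟨h3, h4⟩
      exact ⟨h3, h P h1 h2 h4⟩)
    refine ⟨S, ?_, fun P h1 h2 h3 h4 => hS P h1 h2 ⟨h3, h4⟩⟩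
    rw [hE, ← pow_mul, mul_pow] at hS2
    have hco : Nat.Coprime (p ^ (e * S.card)) (q ^ E) :=
      Nat.Coprime.pow _ _ ((Nat.coprime_primes hp hq).2 hpq)
    have := (Nat.pow_dvd_pow_iff_le_right hp.one_lt).1 (hco.dvd_of_dvd_mul_right hS2)
    by_contra hcon
    have h5 : e * (c + 1) ≤ e * S.card := Nat.mul_le_mul_left _ (by omega)
    omega
  obtain ⟨S1, c1, hS1⟩ := aux p q hp.out hq.out hpq h1 hE
  obtain ⟨S2, c2, hS2⟩ := aux q p hq.out hp.out hpq.symm h2 (by rw [hE, mul_comm])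
  refine (hg.tI_dvd (S1 ∪ S2) ?_).trans (pow_dvd_pow _ ((Finset.card_union_le _ _).trans (by omega)))
  intro P h3 h4 h5
  have h6 := ram_s hm hs hgs h5
  have h7 : (p : 𝓞 K) * q ∈ P := by
    have : (p : 𝓞 K) * q = s * s := by rw [← sq, hs]; simp
    rw [this]; exact P.mul_mem_left _ h6
  rw [Finset.mem_union]
  rcases h3.mem_or_mem h7 with h | h
  · exact Or.inl (hS1 P h3 h4 h6 h)
  · exact Or.inr (hS2 P h3 h4 h6 h)

end

end TC

namespace TC
set_option linter.unusedSectionVars false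
set_option linter.style.haveILetI false

/-! ### Norm forms, real and complex fields -/

section
variable {k K : Type} [Field k] [NumberField k] [Field K] [NumberField K] [Algebra k K]
  {g : K →+* K}

theorem norm_form {s : K} {a : k} (ha : a ≠ 0) (hs : s ^ 2 = algebraMap k K a)
    (hn : ∀ b, algebraMap k K b ≠ s) (x : K) :
    ∃ X Y : k, Algebra.norm k x = X ^ 2 - a * Y ^ 2 := by
  let E := k⟮s⟯
  have h2 : Module.finrank k E = 2 := finrank_sqrt a hs hn
  have : NumberField E := NumberField.of_module_finite k E
  obtain ⟨g, hg⟩ := Quad.of_rank h2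
  rw [← Algebra.norm_norm (R := k) (S := E) (A := K)]
  set y : E := Algebra.norm E x
  have hE : ∀ z : k, algebraMap k E z = algebraMap k E z := fun _ => rfl
  let s' : E := AdjoinSimple.gen k s
  have hs' : s' ^ 2 = algebraMap k E a := by
    apply (algebraMap E K).injective
    rw [map_pow, AdjoinSimple.algebraMap_gen, hs]; rfl
  have hgs : g s' = -s' := by
    apply hg.neg_of_sq hs'
    intro h
    obtain ⟨b, hb⟩ := hg.fix _ h
    apply hn b
    have := congrArg (algebraMap E K) hb
    rw [AdjoinSimple.algebraMap_gen] at this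
    rw [← this]; rfl
  obtain ⟨U, hU⟩ := hg.fix (y + g y) (by rw [map_add, hg.invol, add_comm])
  obtain ⟨V, hV⟩ := hg.fix ((y - g y) * s') (by rw [map_mul, map_sub, hg.invol, hgs]; ring)
  refine ⟨U / 2, V / (2 * a), ?_⟩
  apply (algebraMap k E).injective
  rw [hg.norm]
  have ha' : algebraMap k E a ≠ 0 := by simpa using ha
  simp only [map_sub, map_mul, map_pow, map_div₀, map_ofNat, hU, hV]
  field_simp
  linear_combination (y - g y) ^ 2 * hs'

theorem ringInt_inj : Function.Injective (algebraMap (𝓞 K) K) := FaithfulSMul.algebraMap_injective (𝓞 K) K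

theorem coe_oi (g : k →+* K) (x : 𝓞 k) : algebraMap (𝓞 K) K (oi g x) = g (algebraMap (𝓞 k) k x) := rfl

theorem lift_int {x : K} (h : IsIntegral ℤ x) : ∃ y : 𝓞 K, algebraMap (𝓞 K) K y = x := ⟨⟨x, h⟩, rfl⟩

theorem lift_eta {n : ℕ} {η : K} (h : (fun y : K => y ^ 2 - 2)^[n] η = 0) :
    ∃ y : 𝓞 K, algebraMap (𝓞 K) K y = η ∧ (fun y : 𝓞 K => y ^ 2 - 2)^[n] y = 0 := by
  obtain ⟨y, hy⟩ := lift_int (x := η) ⟨PP n, (PP_monic_deg n).1, by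
    have := PP_eval n η
    rwa [h, Polynomial.aeval_def] at this⟩
  refine ⟨y, hy, ringInt_inj ?_⟩
  rw [iter_map, hy, h, map_zero]

theorem lift_sq {s : K} {m : ℤ} (h : s ^ 2 = m) :
    ∃ y : 𝓞 K, algebraMap (𝓞 K) K y = s ∧ y ^ 2 = m := by
  obtain ⟨y, hy⟩ := lift_int (x := s) (IsIntegral.of_pow (n := 2) (by norm_num) (by
    rw [h]; exact isIntegral_algebraMap (R := ℤ) (x := m)))
  refine ⟨y, hy, ringInt_inj ?_⟩
  rw [map_pow, hy, h]; simp

theorem lift_root {m : ℕ} (hm : 0 < m) {ζ : K} (h : IsPrimitiveRoot ζ m) :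
    ∃ y : 𝓞 K, algebraMap (𝓞 K) K y = ζ ∧ IsPrimitiveRoot y m := by
  obtain ⟨y, hy⟩ := lift_int (x := ζ) (h.isIntegral hm)
  refine ⟨y, hy, ?_⟩
  rw [← hy] at h
  exact h.of_map_of_injective ringInt_inj

theorem TR_of {S : Set K} (h : IntermediateField.adjoin ℚ S = ⊤)
    (hS : ∀ φ : K →+* ℂ, ∀ x ∈ S, (starRingEnd ℂ) (φ x) = φ x) : IsTotallyReal K := by
  constructor
  intro v
  rw [InfinitePlace.isReal_iff, ComplexEmbedding.isReal_iff]
  exact hom_eq_of_top h _ _ (fun x hx => by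
    rw [ComplexEmbedding.conjugate_coe_eq]; exact hS _ x hx)

theorem TC_of {x : K} {a : ℚ} (ha : a < 0) (hx : x ^ 2 = a) : IsTotallyComplex K := by
  constructor
  intro v
  by_contra hv
  rw [InfinitePlace.not_isComplex_iff_isReal] at hv
  have h1 := congrArg (InfinitePlace.embedding_of_isReal hv) hx
  rw [map_pow, map_ratCast] at h1
  have h2 : ((a : ℚ) : ℝ) < 0 := by exact_mod_cast ha
  nlinarith [sq_nonneg (InfinitePlace.embedding_of_isReal hv x)]

theorem conj_eta {n : ℕ} {η : ℂ} (h : (fun y : ℂ => y ^ 2 - 2)^[n] η = 0) : (starRingEnd ℂ) η = η := by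
  obtain ⟨z, hz⟩ : ∃ z : ℂ, z ^ 2 - η * z + 1 = 0 := by
    have := IsAlgClosed.exists_root (Polynomial.X ^ 2 - Polynomial.C η * Polynomial.X + 1 : Polynomial ℂ) (by
      have : (Polynomial.X ^ 2 - Polynomial.C η * Polynomial.X + 1 : Polynomial ℂ).degree = 2 := by
        compute_degree!
      rw [this]; norm_num)
    obtain ⟨z, hz⟩ := this
    exact ⟨z, by simpa using hz⟩
  have hz0 : z ≠ 0 := by rintro rfl; simp at hz
  have hη : z + z⁻¹ = η := by
    linear_combination z⁻¹ * hz - (z - η) * (mul_inv_cancel₀ hz0)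
  have hprim : IsPrimitiveRoot z (2 ^ (n + 2)) := prim_of_iter two_ne_zero hz0 n (by rw [hη, h])
  have hnorm : ‖z‖ = 1 := hprim.norm'_eq_one (by positivity)
  have : z⁻¹ = (starRingEnd ℂ) z := by
    rw [Complex.inv_def, Complex.normSq_eq_norm_sq, hnorm]; simp
  rw [← hη, this, map_add, Complex.conj_conj, add_comm]

theorem conj_sqrt {s : ℂ} {m : ℕ} (h : s ^ 2 = m) : (starRingEnd ℂ) s = s := by
  have h1 : (((m : ℝ).sqrt : ℝ) : ℂ) ^ 2 = m := by
    rw [← Complex.ofReal_pow, Real.sq_sqrt (by positivity)]; simp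
  rw [← h1, sq_eq_sq_iff_eq_or_eq_neg] at h
  rcases h with rfl | rfl <;> simp

theorem odd_of_rank_one (h : Module.finrank ℚ K = 1) : OddCl K := by
  have hb : Function.Bijective (algebraMap ℚ K) :=
    Module.Free.bijective_algebraMap_of_finrank_eq_one h
  let e : ℚ ≃+* K := RingEquiv.ofBijective _ hb
  have h1 : Nat.card (ClassGroup (𝓞 ℚ)) = 1 := by
    have := Rat.classNumber_eq
    rwa [NumberField.classNumber, ← Nat.card_eq_fintype_card] at this
  have : Subsingleton (ClassGroup (𝓞 ℚ)) := (Nat.card_eq_one_iff_unique.1 h1).1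
  have h2 : Subsingleton (ClassGroup (𝓞 K)) := by
    constructor
    intro a b
    have : ∀ c : ClassGroup (𝓞 K), c = 1 := by
      intro c
      have h3 := extC_comp (e.symm : K →+* ℚ) (e : ℚ →+* K) c
      rw [Subsingleton.elim (extC (e.symm : K →+* ℚ) c) 1, map_one] at h3
      have h4 : (e : ℚ →+* K).comp (e.symm : K →+* ℚ) = RingHom.id K := by ext; simp
      rw [h4, extC_id] at h3
      exact h3.symm
    rw [this a, this b]
  have : Nat.card (ClassGroup (𝓞 K)) = 1 := Nat.card_unique
  rw [OddCl, this]; exact odd_one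

theorem odd_rat : OddCl ℚ := odd_of_rank_one (by simp)

theorem map_mem_adjoin {A : Type*} [Field A] [CharZero A] (φ : K →+* A) {S : Set K} {E : IntermediateField ℚ A}
    (hS : ∀ x ∈ S, φ x ∈ E) {x : K} (hx : x ∈ IntermediateField.adjoin ℚ S) : φ x ∈ E := by
  induction hx using IntermediateField.adjoin_induction with
  | mem x hx => exact hS x hx
  | algebraMap x => rw [show φ (algebraMap ℚ K x) = algebraMap ℚ A x by simp]; exact E.algebraMap_mem _
  | add x y _ _ hx hy => rw [map_add]; exact E.add_mem hx hy
  | inv x _ hx => rw [map_inv₀]; exact E.inv_mem hx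
  | mul x y _ _ hx hy => rw [map_mul]; exact E.mul_mem hx hy

theorem exists_root_z (n : ℕ) {η : K} (h : (fun y : K => y ^ 2 - 2)^[n] η = 0) :
    ∃ z : AlgebraicClosure K, IsPrimitiveRoot z (2 ^ (n + 2)) ∧ algebraMap K (AlgebraicClosure K) η ∈ ℚ⟮z⟯ := by
  set φ := algebraMap K (AlgebraicClosure K)
  obtain ⟨z, hz⟩ : ∃ z : AlgebraicClosure K, z ^ 2 - φ η * z + 1 = 0 := by
    have := IsAlgClosed.exists_root (Polynomial.X ^ 2 - Polynomial.C (φ η) * Polynomial.X + 1 : Polynomial (AlgebraicClosure K)) (by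
      have : (Polynomial.X ^ 2 - Polynomial.C (φ η) * Polynomial.X + 1 : Polynomial (AlgebraicClosure K)).degree = 2 := by
        compute_degree!
      rw [this]; norm_num)
    obtain ⟨z, hz⟩ := this
    exact ⟨z, by simpa using hz⟩
  have hz0 : z ≠ 0 := by rintro rfl; simp at hz
  have hη : z + z⁻¹ = φ η := by
    linear_combination z⁻¹ * hz - (z - φ η) * (mul_inv_cancel₀ hz0)
  refine ⟨z, prim_of_iter two_ne_zero hz0 n (by rw [hη, ← iter_map, h, map_zero]), ?_⟩
  rw [← hη]
  exact add_mem (mem_adjoin_simple_self ℚ z) (inv_mem (mem_adjoin_simple_self ℚ z))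

theorem exists_root_t {t : K} (h : t ^ 2 = -2) :
    ∃ z : AlgebraicClosure K, IsPrimitiveRoot z (2 ^ (1 + 2)) ∧ algebraMap K (AlgebraicClosure K) t ∈ ℚ⟮z⟯ := by
  set φ := algebraMap K (AlgebraicClosure K)
  obtain ⟨z, hz⟩ : ∃ z : AlgebraicClosure K, z ^ 2 - φ t * z - 1 = 0 := by
    have := IsAlgClosed.exists_root (Polynomial.X ^ 2 - Polynomial.C (φ t) * Polynomial.X - 1 : Polynomial (AlgebraicClosure K)) (by
      have : (Polynomial.X ^ 2 - Polynomial.C (φ t) * Polynomial.X - 1 : Polynomial (AlgebraicClosure K)).degree = 2 := by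
        compute_degree!
      rw [this]; norm_num)
    obtain ⟨z, hz⟩ := this
    exact ⟨z, by simpa using hz⟩
  have hz0 : z ≠ 0 := by rintro rfl; simp at hz
  have hη : z - z⁻¹ = φ t := by
    linear_combination z⁻¹ * hz - (z - φ t) * (mul_inv_cancel₀ hz0)
  have ht : φ t ^ 2 = -2 := by rw [← map_pow, h, map_neg, map_ofNat]
  have h4 : z ^ 4 = -1 := by
    have : (z ^ 2 - 1) ^ 2 = -2 * z ^ 2 := by
      rw [← ht, show z ^ 2 - 1 = φ t * z by linear_combination hz]; ring
    linear_combination this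
  refine ⟨z, ?_, ?_⟩
  · have := orderOf_eq_prime_pow (p := 2) (x := z) (n := 2) (by
      norm_num; rw [h4]; intro h; have : (2 : AlgebraicClosure K) = 0 := by linear_combination -h
      exact two_ne_zero this) (by
      norm_num; rw [show z ^ 8 = (z ^ 4) ^ 2 by ring, h4]; norm_num)
    rw [show 1 + 2 = 2 + 1 by norm_num, ← this]; exact IsPrimitiveRoot.orderOf z
  · rw [← hη]
    exact sub_mem (mem_adjoin_simple_self ℚ z) (inv_mem (mem_adjoin_simple_self ℚ z))

theorem s_notMem_of_z {p q n : ℕ} (hp : p.Prime) (hp2 : p ≠ 2) (hpq : ¬ p ∣ q) {s x : K} (hs : s ^ 2 = p * q)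
    {z : AlgebraicClosure K} (hz : IsPrimitiveRoot z (2 ^ (n + 2)))
    (hx : algebraMap K (AlgebraicClosure K) x ∈ ℚ⟮z⟯) : s ∉ ℚ⟮x⟯ := by
  intro h
  have : Algebra.IsAlgebraic ℚ (AlgebraicClosure K) := Algebra.IsAlgebraic.trans ℚ K _
  refine s_notMem (K := AlgebraicClosure K) hp hp2 hpq hz (s := algebraMap K _ s) (by rw [← map_pow, hs]; simp) ?_
  refine map_mem_adjoin (algebraMap K (AlgebraicClosure K)) ?_ h
  rintro y rfl
  exact hx

end

end TC

namespace TC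
set_option linter.unusedSectionVars false
set_option linter.style.haveILetI false

/-! ### The fields with odd class number -/

/-- the standing hypotheses on `p`, `q` -/
structure PQ (p q : ℕ) : Prop where
  hp : p.Prime
  hq : q.Prime
  p8 : p % 8 = 3
  q8 : q % 8 = 3
  ne : p ≠ q

theorem PQ.symm {p q : ℕ} (h : PQ p q) : PQ q p := ⟨h.hq, h.hp, h.q8, h.p8, h.ne.symm⟩
theorem PQ.not_dvd {p q : ℕ} (h : PQ p q) : ¬ p ∣ q := fun hd =>
  h.ne ((Nat.prime_dvd_prime_iff_eq h.hp h.hq).1 hd)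
theorem PQ.mod8 {p q : ℕ} (h : PQ p q) : (p * q) % 8 = 1 := by
  rw [Nat.mul_mod, h.p8, h.q8]
theorem PQ.mod4 {p q : ℕ} (h : PQ p q) : (p * q) % 4 = 1 := by have := h.mod8; omega
theorem PQ.ne_two {p q : ℕ} (h : PQ p q) : p ≠ 2 := by have := h.p8; omega
theorem PQ.pos {p q : ℕ} (h : PQ p q) : 0 < p * q := Nat.mul_pos h.hp.pos h.hq.pos

/-- `ℚ(ζ_{2^{n+2}})` -/
structure HF (n : ℕ) (K : Type) [Field K] [NumberField K] (ζ : K) : Prop where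
  prim : IsPrimitiveRoot ζ (2 ^ (n + 2))
  rank : Module.finrank ℚ K = 2 ^ (n + 1)

/-- the maximal real subfield of `ℚ(ζ_{2^{n+2}})` -/
structure HB (n : ℕ) (K : Type) [Field K] [NumberField K] (η : K) : Prop where
  iter : (fun y : K => y ^ 2 - 2)^[n] η = 0
  rank : Module.finrank ℚ K = 2 ^ n

/-- the maximal real subfield of `L_n` -/
structure LP (p q n : ℕ) (K : Type) [Field K] [NumberField K] (η s : K) : Prop where
  iter : (fun y : K => y ^ 2 - 2)^[n] η = 0
  sq : s ^ 2 = ((p * q : ℕ) : K)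
  rank : Module.finrank ℚ K = 2 ^ (n + 1)

/-- `ℚ(√-2)` -/
structure QT (K : Type) [Field K] [NumberField K] (t : K) : Prop where
  sq : t ^ 2 = -2
  rank : Module.finrank ℚ K = 2

section
variable {k K : Type} [Field k] [NumberField k] [Field K] [NumberField K] [Algebra k K]
  {g : K →+* K} {p q n : ℕ} {ζ η s t : K}

theorem absNorm_of {x : 𝓞 K} {m : ℕ} (h : |Algebra.norm ℚ (algebraMap (𝓞 K) K x)| = m) :
    Ideal.absNorm (Ideal.span {x}) = m := by
  have := absNorm_span x
  rw [h] at this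
  exact_mod_cast this

theorem sub_quad (E : IntermediateField ℚ K) {a : ℕ} (h1 : Module.finrank ℚ E = a)
    (h : Module.finrank ℚ K = a * 2) {S : Set K} {x : K} (hS : IntermediateField.adjoin ℚ S = ⊤)
    (hSE : ∀ y ∈ S, y = x ∨ y ∈ E) (hx2 : x ^ 2 ∈ E) :
    ∃ g, Quad E K g ∧ g x = -x ∧ ∀ y ∈ E, g y = y := by
  obtain ⟨g, hg⟩ := Quad.of_rank (finrank_top_two h1 h)
  refine ⟨g, hg, ?_, fun y hy => hg.comm ⟨y, hy⟩⟩
  apply hg.neg_of_sq (y := ⟨x ^ 2, hx2⟩) rfl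
  intro hgx
  obtain ⟨y, hy⟩ := hg.nontriv
  apply hy
  apply fix_top hS
  intro z hz
  rcases hSE z hz with rfl | h
  · exact hgx
  · exact hg.comm ⟨z, h⟩

theorem quad_rat (h : Module.finrank ℚ K = 2) {x : K} {a : ℚ} (hx : x ^ 2 = a)
    (hn : ∀ b : ℚ, algebraMap ℚ K b ≠ x) : ∃ g, Quad ℚ K g ∧ g x = -x := by
  obtain ⟨g, hg⟩ := Quad.of_rank h
  refine ⟨g, hg, hg.neg_of_sq (y := a) (by simpa using hx) fun h => ?_⟩
  obtain ⟨b, hb⟩ := hg.fix _ h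
  exact hn b hb

theorem odd_imq (hg : Quad ℚ K g) (hT : tI ℚ K g ∣ 2 ^ 1) {x : K} {a : ℚ} (ha : a < 0)
    (hx : x ^ 2 = a) (hn : ∀ b : ℚ, algebraMap ℚ K b ≠ x) : OddCl K := by
  have := TC_of ha hx
  have h1 := rank_TC K
  have h2 := rank_TR ℚ
  have h3 := hg.rank2
  rw [Module.finrank_self] at h2
  have h4 := hg.h1_imq (by omega) (by omega)
  refine hg.odd_of odd_rat (e := 0) (t := 1) (j := 1) (by simpa using h4) hT ?_ (by norm_num)
  rw [pow_one]
  refine hg.two_dvd_uI (tI_ne hT) (-1) ?_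
  intro y hy
  rw [← hg.norm] at hy
  have hy := (algebraMap ℚ K).injective hy
  obtain ⟨X, Y, hXY⟩ := norm_form ha.ne (by simpa using hx) hn y
  rw [hy] at hXY
  simp at hXY
  nlinarith [sq_nonneg X, sq_nonneg Y]

theorem not_rat {x : K} {a : ℚ} (ha : a < 0) (hx : x ^ 2 = a) (b : ℚ) : algebraMap ℚ K b ≠ x := by
  rintro rfl
  have : b ^ 2 = a := by
    apply (algebraMap ℚ K).injective
    rw [map_pow, hx]; simp
  nlinarith [sq_nonneg b]

theorem two_mem_of {x : 𝓞 K} {P : Ideal (𝓞 K)} (hP : P.IsPrime) (hgx : oi g x = -x)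
    (h : ∀ y, y - oi g y ∈ P) : (2 : 𝓞 K) ∈ P ∨ x ∈ P := by
  have := h x
  rw [hgx, sub_neg_eq_add, ← two_mul] at this
  exact hP.mem_or_mem this

theorem unit_notMem {x : 𝓞 K} {P : Ideal (𝓞 K)} (hP : P.IsPrime) {m : ℕ} (h0 : 0 < m) (hm : x ^ m = 1) :
    x ∉ P := by
  intro h
  exact hP.ne_top (P.eq_top_of_unit_mem (x ^ m) 1 (P.pow_mem_of_mem h _ h0) (by rw [hm, one_mul]))

/-! #### cyclotomic fields -/

theorem HF.top (h : HF n K ζ) : ℚ⟮ζ⟯ = ⊤ := top_of_finrank (by rw [finrank_zeta h.prim, h.rank])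

theorem sq_root {ζ : K} (h : IsPrimitiveRoot ζ (2 ^ (n + 2))) : (ζ ^ 2 ^ n) ^ 2 = ((-1 : ℚ) : K) := by
  have h1 := (h.pow (by positivity) (show 2 ^ (n + 2) = 2 ^ (n + 1) * 2 by rw [← pow_succ])).eq_neg_one_of_two_right
  rw [← pow_mul, ← pow_succ, h1]; simp

theorem HF.tc (h : HF n K ζ) : IsTotallyComplex K := TC_of (by norm_num) (sq_root h.prim)

theorem HF.sub (h : HF (n + 1) K ζ) : ∃ (E : IntermediateField ℚ K) (z : E) (g : K →+* K),
    HF n E z ∧ (z : K) = ζ ^ 2 ∧ Quad E K g ∧ g ζ = -ζ := by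
  have hp : IsPrimitiveRoot (ζ ^ 2) (2 ^ (n + 2)) := h.prim.pow (by positivity) (by
    rw [mul_comm, ← pow_succ])
  have hf := finrank_zeta hp
  obtain ⟨g, hg, h1, -⟩ := sub_quad ℚ⟮ζ ^ 2⟯ hf (by rw [h.rank, ← pow_succ]) h.top
    (x := ζ) (by rintro y rfl; exact Or.inl rfl) (mem_adjoin_simple_self ℚ _)
  refine ⟨ℚ⟮ζ ^ 2⟯, AdjoinSimple.gen ℚ (ζ ^ 2), g, ⟨?_, hf⟩, AdjoinSimple.coe_gen _ _, hg, h1⟩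
  refine IsPrimitiveRoot.of_map_of_injective (f := algebraMap ℚ⟮ζ ^ 2⟯ K) ?_ (algebraMap ℚ⟮ζ ^ 2⟯ K).injective
  rwa [AdjoinSimple.algebraMap_gen]

theorem HF.tI (h : HF n K ζ) (hg : Quad k K g) (hgz : g ζ = -ζ) : tI k K g ∣ 2 ^ 1 := by
  obtain ⟨z, hz, hz2⟩ := lift_root (by positivity) h.prim
  refine hg.tI_el (a := z - 1) (absNorm_of ?_) ?_
  · rw [map_sub, hz, map_one, norm_zeta h.prim (c := 1) (by rw [h.rank, mul_one])]; simp
  · intro P h1 h2 h3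
    rcases two_mem_of (x := z) h1 (ringInt_inj (by rw [coe_oi, hz, hgz, map_neg, hz])) h3 with h4 | h4
    · exact ram_zeta hz2.pow_eq_one h1 h4
    · exact absurd h4 (unit_notMem h1 (by positivity) hz2.pow_eq_one)

theorem HF.odd (h : HF n K ζ) : OddCl K := by
  induction n generalizing K with
  | zero =>
    have hx : ζ ^ 2 = ((-1 : ℚ) : K) := by simpa using sq_root h.prim
    have hn := not_rat (by norm_num) hx
    obtain ⟨g, hg, h1⟩ := quad_rat (by simpa using h.rank) hx hn
    exact odd_imq hg (h.tI hg h1) (by norm_num) hx hn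
  | succ n ih =>
    obtain ⟨E, z, g, hE, -, hg, h1⟩ := h.sub
    have := h.tc
    have := hE.tc
    exact hg.odd_of (ih hE) (e := 1) (t := 1) (j := 0) (by simpa using hg.h1_TC) (h.tI hg h1)
      (one_dvd _) (by norm_num)

theorem QT.odd (h : QT K t) : OddCl K := by
  have hx : t ^ 2 = ((-2 : ℚ) : K) := by rw [h.sq]; simp
  have hn := not_rat (by norm_num) hx
  obtain ⟨g, hg, h1⟩ := quad_rat h.rank hx hn
  obtain ⟨z, hz, hz2⟩ := lift_sq (s := t) (m := -2) (by rw [h.sq]; simp)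
  refine odd_imq hg (hg.tI_el (a := z) (absNorm_of ?_) ?_) (by norm_num) hx hn
  · rw [hz, norm_sq (c := 1) hx (by rw [h.rank])]; norm_num
  · intro P h1 h2 h3
    rcases two_mem_of (x := z) h1 (ringInt_inj (by rw [coe_oi, hz, ‹g t = -t›, map_neg, hz])) h3 with h4 | h4
    · apply h1.mem_of_pow_mem 2
      rw [hz2]; simpa using h4
    · exact h4

/-! #### real fields -/

theorem HB.top (h : HB n K η) : ℚ⟮η⟯ = ⊤ := top_of_finrank (by rw [finrank_eta h.iter, h.rank])

theorem HB.TR (h : HB n K η) : IsTotallyReal K := TR_of h.top (by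
  rintro φ x rfl
  exact conj_eta (n := n) (by rw [← iter_map, h.iter, map_zero]))

theorem HB.sub (h : HB (n + 1) K η) : ∃ (E : IntermediateField ℚ K) (e : E) (g : K →+* K),
    HB n E e ∧ (e : K) = η ^ 2 - 2 ∧ Quad E K g ∧ g η = -η := by
  have hi := h.iter
  rw [Function.iterate_succ_apply] at hi
  have hf := finrank_eta hi
  obtain ⟨g, hg, h1, -⟩ := sub_quad ℚ⟮η ^ 2 - 2⟯ hf (by rw [h.rank, ← pow_succ]) h.top
    (x := η) (by rintro y rfl; exact Or.inl rfl) (by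
      have := add_mem (mem_adjoin_simple_self ℚ (η ^ 2 - 2)) (ofNat_mem ℚ⟮η ^ 2 - 2⟯ 2)
      simpa using this)
  refine ⟨ℚ⟮η ^ 2 - 2⟯, AdjoinSimple.gen ℚ (η ^ 2 - 2), g, ⟨?_, hf⟩, AdjoinSimple.coe_gen _ _, hg, h1⟩
  apply (algebraMap ℚ⟮η ^ 2 - 2⟯ K).injective
  rw [iter_map, AdjoinSimple.algebraMap_gen, map_zero]
  exact hi

theorem tI_eta {c : ℕ} (h : (fun y : K => y ^ 2 - 2)^[n + 1] η = 0) (hr : Module.finrank ℚ K = 2 ^ (n + 1) * c)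
    (hg : Quad k K g) (hgz : g η = -η) : TC.tI k K g ∣ 2 ^ c := by
  obtain ⟨z, hz, hz2⟩ := lift_eta h
  refine hg.tI_el (a := z) (absNorm_of ?_) ?_
  · rw [hz, norm_eta h hr]; simp
  · intro P h1 h2 h3
    rcases two_mem_of (x := z) h1 (ringInt_inj (by rw [coe_oi, hz, hgz, map_neg, hz])) h3 with h4 | h4
    · exact ram_eta hz2 h1 h4
    · exact h4

theorem Quad.h0_of (hg : Quad k K g) (hk : OddCl k) {c : ℕ} (hT : TC.tI k K g ∣ 2 ^ (c + 1))
    (hh : h1 (gE g) = 2 * h0 (gE g)) : h0 (gE g) ∣ 2 ^ c := by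
  have h1 := (hg.h1_dvd hk).trans hT
  rw [hh, pow_succ, mul_comm] at h1
  exact Nat.dvd_of_mul_dvd_mul_right (by norm_num) h1

/-- if `h0 = 1` every unit is a norm -/
theorem Quad.norm_of_h0 (hg : Quad k K g) (h : h0 (gE g) = 1) (u : (𝓞 k)ˣ) :
    ∃ v : (𝓞 K)ˣ, (algebraMap (𝓞 K) K v) * g (algebraMap (𝓞 K) K v) = algebraMap k K (algebraMap (𝓞 k) k u) := by
  rw [h0, Subgroup.relIndex_eq_one] at h
  have h1 : Units.map (algebraMap (𝓞 k) (𝓞 K) : 𝓞 k →* 𝓞 K) u ∈ fixS (gE g) := by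
    rw [hg.fixE]; exact ⟨u, rfl⟩
  obtain ⟨v, hv⟩ := h h1
  refine ⟨v, ?_⟩
  have := congrArg (fun x : (𝓞 K)ˣ => algebraMap (𝓞 K) K x) hv
  exact this

theorem HB.main (h : HB n K η) : OddCl K ∧ ∃ u : (𝓞 K)ˣ, Algebra.norm ℚ (algebraMap (𝓞 K) K u) = -1 := by
  induction n generalizing K with
  | zero =>
    have hr : Module.finrank ℚ K = 1 := by simpa using h.rank
    refine ⟨odd_of_rank_one hr, -1, ?_⟩
    have : algebraMap (𝓞 K) K ((-1 : (𝓞 K)ˣ) : 𝓞 K) = algebraMap ℚ K (-1) := by simp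
    rw [this, Algebra.norm_algebraMap, hr, pow_one]
  | succ n ih =>
    obtain ⟨E, z, g, hE, -, hg, h1⟩ := h.sub
    have := h.TR
    have := hE.TR
    obtain ⟨i1, u, i2⟩ := ih hE
    have hT := tI_eta (c := 1) h.iter (by rw [h.rank, mul_one]) hg h1
    refine ⟨hg.odd_of i1 (e := 1) (t := 1) (j := 0) (by simpa using hg.h1_TR) hT
      (one_dvd _) (by norm_num), ?_⟩
    obtain ⟨v, hv⟩ := hg.norm_of_h0 (Nat.dvd_one.1 (hg.h0_of i1 (c := 0) hT hg.h1_TR)) u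
    refine ⟨v, ?_⟩
    rw [← hg.norm] at hv
    have hv := (algebraMap E K).injective hv
    rw [← Algebra.norm_norm (R := ℚ) (S := E), hv, i2]

theorem LP.notMem (h : LP p q n K η s) (hpq : PQ p q) : s ∉ ℚ⟮η⟯ := by
  obtain ⟨z, hz, hz2⟩ := exists_root_z n h.iter
  exact s_notMem_of_z hpq.hp hpq.ne_two hpq.not_dvd (by rw [h.sq]; simp) hz hz2

theorem LP.top (h : LP p q n K η s) (hpq : PQ p q) : IntermediateField.adjoin ℚ {η, s} = ⊤ :=
  top_of_finrank (by
    rw [finrank_pair ((p * q : ℕ) : ℚ) (by rw [h.sq]; simp) (h.notMem hpq), finrank_eta h.iter, h.rank,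
      pow_succ, mul_comm])

theorem LP.TR (h : LP p q n K η s) (hpq : PQ p q) : IsTotallyReal K := TR_of (h.top hpq) (by
  rintro φ x (rfl | rfl)
  · exact conj_eta (n := n) (by rw [← iter_map, h.iter, map_zero])
  · exact conj_sqrt (m := p * q) (by rw [← map_pow, h.sq, map_natCast]))

theorem LP.subB (h : LP p q n K η s) (hpq : PQ p q) : ∃ (E : IntermediateField ℚ K) (e : E) (g : K →+* K),
    HB n E e ∧ Quad E K g ∧ g s = -s := by
  have hf := finrank_eta h.iter
  obtain ⟨g, hg, h1, -⟩ := sub_quad ℚ⟮η⟯ hf (by rw [h.rank, ← pow_succ]) (h.top hpq)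
    (x := s) (by
      rintro y (rfl | rfl)
      · exact Or.inr (mem_adjoin_simple_self ℚ y)
      · exact Or.inl rfl) (by rw [h.sq]; exact _root_.natCast_mem _ _)
  refine ⟨ℚ⟮η⟯, AdjoinSimple.gen ℚ η, g, ⟨?_, hf⟩, hg, h1⟩
  apply (algebraMap ℚ⟮η⟯ K).injective
  rw [iter_map, AdjoinSimple.algebraMap_gen, map_zero]
  exact h.iter

theorem mem_pair {x y : K} : x ∈ IntermediateField.adjoin ℚ {x, y} ∧ y ∈ IntermediateField.adjoin ℚ {x, y} :=
  ⟨IntermediateField.subset_adjoin _ _ (by simp), IntermediateField.subset_adjoin _ _ (by simp)⟩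

theorem LP.sub (h : LP p q (n + 1) K η s) (hpq : PQ p q) :
    ∃ (E : IntermediateField ℚ K) (e s' : E) (g : K →+* K),
    LP p q n E e s' ∧ (e : K) = η ^ 2 - 2 ∧ (s' : K) = s ∧ Quad E K g ∧ g η = -η := by
  have hi := h.iter
  rw [Function.iterate_succ_apply] at hi
  have hs : s ∉ ℚ⟮η ^ 2 - 2⟯ := by
    obtain ⟨z, hz, hz2⟩ := exists_root_z n hi
    exact s_notMem_of_z hpq.hp hpq.ne_two hpq.not_dvd (by rw [h.sq]; simp) hz hz2
  have hf := finrank_pair ((p * q : ℕ) : ℚ) (by rw [h.sq]; simp) hs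
  rw [finrank_eta hi, mul_comm, ← pow_succ] at hf
  set E := IntermediateField.adjoin ℚ {η ^ 2 - 2, s}
  have m1 : η ^ 2 - 2 ∈ E := mem_pair.1
  have m2 : s ∈ E := mem_pair.2
  obtain ⟨g, hg, h1, -⟩ := sub_quad E hf (by rw [h.rank, ← pow_succ]) (h.top hpq)
    (x := η) (by
      rintro y (rfl | rfl)
      · exact Or.inl rfl
      · exact Or.inr m2) (by simpa using add_mem m1 (ofNat_mem E 2))
  refine ⟨E, ⟨_, m1⟩, ⟨_, m2⟩, g, ⟨?_, ?_, hf⟩, rfl, rfl, hg, h1⟩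
  · apply (algebraMap E K).injective
    rw [iter_map, map_zero]
    exact hi
  · apply (algebraMap E K).injective
    rw [map_pow, map_natCast]; exact h.sq

/-- `-1` is not a norm-form value -/
theorem PQ.no_neg_one (hpq : PQ p q) (X Y : ℚ) : (-1 : ℚ) ≠ X ^ 2 - ((p * q : ℕ) : ℚ) * Y ^ 2 := by
  intro h
  have := Fact.mk hpq.hp
  refine nsq_neg_one hpq.p8 (locQ hpq.not_dvd (-1) ?_ X Y 1 one_ne_zero ?_)
  · intro h
    have := Int.eq_one_of_dvd_one (by positivity) ((Int.dvd_neg).1 h)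
    have := hpq.p8; omega
  · push_cast at h ⊢
    linear_combination h

theorem LP.s_rat (h : LP p q n K η s) (hpq : PQ p q) (b : ℚ) : algebraMap ℚ K b ≠ s := fun hb =>
  h.notMem hpq (hb ▸ ℚ⟮η⟯.algebraMap_mem b)

theorem LP.odd (h : LP p q n K η s) (hpq : PQ p q) : OddCl K := by
  obtain ⟨E, e, g, hE, hg, hgs⟩ := h.subB hpq
  have := h.TR hpq
  have := hE.TR
  have := Fact.mk hpq.hp
  have := Fact.mk hpq.hq
  obtain ⟨i1, u, i2⟩ := hE.main
  obtain ⟨s', hs, hs2⟩ := lift_sq (s := s) (m := (p * q : ℕ)) (by rw [h.sq]; simp)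
  obtain ⟨η', hη, hη2⟩ := lift_eta h.iter
  have hT : TC.tI E K g ∣ 2 ^ (2 * 1) := by
    refine hg.tI_s hpq.ne hpq.mod4 (s := s') (by simpa using hs2)
      (ringInt_inj (by rw [coe_oi, hs, hgs, map_neg, hs])) (e := 2 ^ n) (E := 2 ^ n)
      (fun P h1 h2 h3 => resdeg hpq.p8 h1 h2 h3 η' hη2) (fun P h1 h2 h3 => resdeg hpq.q8 h1 h2 h3 η' hη2)
      (absNorm_of ?_) (by have : 0 < 2 ^ n := by positivity
                          omega)
    rw [hs, norm_sq (c := 2 ^ n) (b := ((p * q : ℕ) : ℚ)) (by rw [h.sq]; simp) (by rw [h.rank, pow_succ, mul_comm])]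
    rw [Nat.abs_cast]; push_cast; rfl
  refine hg.odd_of i1 (e := 1) (t := 2 * 1) (j := 1) (by simpa using hg.h1_TR) hT ?_ (by norm_num)
  rw [pow_one]
  refine hg.two_dvd_uI (tI_ne hT) u ?_
  intro x hx
  rw [← hg.norm] at hx
  have hx := (algebraMap E K).injective hx
  have h5 : Algebra.norm ℚ x = -1 := by
    rw [← Algebra.norm_norm (R := ℚ) (S := E), hx, ← i2]
  obtain ⟨X, Y, hXY⟩ := norm_form (a := ((p * q : ℕ) : ℚ)) (by exact_mod_cast hpq.pos.ne')
    (by rw [h.sq]; simp) (h.s_rat hpq) x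
  rw [h5] at hXY
  exact hpq.no_neg_one X Y hXY

theorem LP.h0 (h : LP p q (n + 1) K η s) {e s' : k} (hk : LP p q n k e s') (hpq : PQ p q) (hg : Quad k K g)
    (hgη : g η = -η) : h0 (gE g) ∣ 2 := by
  have := h.TR hpq
  have := hk.TR hpq
  have hT := tI_eta (c := 1 + 1) h.iter (by rw [h.rank, pow_succ 2 (n + 1)]) hg hgη
  simpa using hg.h0_of (hk.odd hpq) hT hg.h1_TR

end

end TC

namespace TC
set_option linter.unusedSectionVars false
set_option linter.style.haveILetI false

/-! ### Finite abelian groups and their 2-parts -/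

/-- the 2-part of an abelian group -/
abbrev tw (G : Type*) [CommGroup G] : Subgroup G := CommGroup.primaryComponent G 2

theorem mem_tw {G : Type*} [CommGroup G] {g : G} : g ∈ tw G ↔ ∃ k : ℕ, g ^ 2 ^ k = 1 :=
  CommGroup.mem_primaryComponent

theorem exists_N (M : ℕ) (hM : M ≠ 0) : ∃ N k : ℕ, Odd N ∧ M ∣ N * 2 ^ k ∧ ∃ l, N = 2 ^ k * l + 1 := by
  obtain ⟨k, m, hm, rfl⟩ := Nat.exists_eq_two_pow_mul_odd hM
  have hc : Nat.Coprime m (2 ^ k) := (Nat.coprime_two_right.2 hm).pow_right k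
  refine ⟨m ^ Nat.totient (2 ^ k), k, hm.pow, ?_, ?_⟩
  · rw [mul_comm]
    exact Nat.mul_dvd_mul (dvd_pow_self m (Nat.totient_pos.2 (by positivity)).ne') dvd_rfl
  · have h := Nat.ModEq.pow_totient hc
    have h1 : 1 ≤ m ^ Nat.totient (2 ^ k) := Nat.one_le_pow _ _ hm.pos
    obtain ⟨l, hl⟩ := (Nat.modEq_iff_dvd' h1).1 h.symm
    exact ⟨l, by omega⟩

section
variable {G H : Type*} [CommGroup G] [CommGroup H] [Finite G] [Finite H]

theorem pow_N_mem {N k : ℕ} (h : Nat.card G ∣ N * 2 ^ k) (g : G) : g ^ N ∈ tw G :=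
  mem_tw.2 ⟨k, by
    obtain ⟨l, hl⟩ := h
    rw [← pow_mul, hl, pow_mul, pow_card_eq_one', one_pow]⟩

theorem pow_odd_eq_one {a : G} (ha : a ∈ tw G) {m : ℕ} (hm : Odd m) (h : a ^ m = 1) : a = 1 := by
  obtain ⟨k, hk⟩ := mem_tw.1 ha
  have : Nat.Coprime m (2 ^ k) := (Nat.coprime_two_right.2 hm).pow_right k
  have h1 := orderOf_dvd_of_pow_eq_one h
  have h2 := orderOf_dvd_of_pow_eq_one hk
  exact orderOf_eq_one_iff.1 (Nat.dvd_one.1 (this ▸ Nat.dvd_gcd h1 h2))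

theorem tw_pow_N {N k l : ℕ} (h : Nat.card G ∣ N * 2 ^ k) (hN : Odd N) (hl : N = 2 ^ k * l + 1) {a : G}
    (ha : a ∈ tw G) : a ^ N = a := by
  have : a ^ 2 ^ k = 1 := by
    apply pow_odd_eq_one (Subgroup.pow_mem _ ha _) hN
    obtain ⟨l, hl⟩ := h
    rw [← pow_mul, mul_comm, hl, pow_mul, pow_card_eq_one', one_pow]
  rw [hl, pow_succ, pow_mul, this, one_pow, one_mul]

theorem map_tw (j : G →* H) {a : G} (ha : a ∈ tw G) : j a ∈ tw H := by
  obtain ⟨k, hk⟩ := mem_tw.1 ha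
  exact mem_tw.2 ⟨k, by rw [← map_pow, hk, map_one]⟩

theorem card_map_mul (j : G →* H) (A : Subgroup G) :
    Nat.card A = Nat.card (A ⊓ j.ker : Subgroup G) * Nat.card (A.map j) := by
  have h := Subgroup.card_mul_index (j.comp A.subtype).ker
  rw [Subgroup.index_ker] at h
  rw [← h]
  congr 1
  · have e : (j.comp A.subtype).ker = (A ⊓ j.ker).subgroupOf A := by
      ext x
      simp [Subgroup.mem_subgroupOf, MonoidHom.mem_ker]
    rw [e]
    exact Nat.card_congr (Subgroup.subgroupOfEquivOfLe inf_le_left).toEquiv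
  · rw [MonoidHom.range_comp, Subgroup.range_subtype]

theorem card_sup_zpowers {S : Subgroup G} {c : G} (hc : c ∉ S) (h2 : c ^ 2 = 1) :
    Nat.card (S ⊔ Subgroup.zpowers c : Subgroup G) = 2 * Nat.card S := by
  rw [← Subgroup.relIndex_bot_left, ← Subgroup.relIndex_mul_relIndex ⊥ S _ bot_le le_sup_left,
    Subgroup.relIndex_sup_left, relIndex_zpowers_of_notMem hc h2, Subgroup.relIndex_bot_left, mul_comm]

theorem mem_sup_zp {S : Subgroup G} {c x : G} (h2 : c ^ 2 = 1) :
    x ∈ S ⊔ Subgroup.zpowers c ↔ ∃ a ∈ S, x = a ∨ x = a * c := by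
  rw [Subgroup.mem_sup]
  constructor
  · rintro ⟨a, ha, b, hb, rfl⟩
    obtain ⟨k, rfl⟩ := Subgroup.mem_zpowers_iff.1 hb
    refine ⟨a, ha, ?_⟩
    have h2' : c ^ (2 : ℤ) = 1 := by exact_mod_cast h2
    rcases Int.even_or_odd' k with ⟨m, rfl | rfl⟩
    · left; rw [zpow_mul, h2', one_zpow, mul_one]
    · right; rw [zpow_add, zpow_mul, h2', one_zpow, one_mul, zpow_one]
  · rintro ⟨a, ha, rfl | rfl⟩
    · exact ⟨_, ha, 1, one_mem _, mul_one _⟩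
    · exact ⟨_, ha, c, Subgroup.mem_zpowers c, rfl⟩

/-- squares and `c` have index at most two in the 2-part -/
theorem sq_index (hT : Nat.card (powMonoidHom 2 : G →* G).ker ∣ 4) {c : G}
    (h2 : c ^ 2 = 1) (hc : ∀ a, c ≠ a ^ 2) :
    Nat.card (tw G) ≤ 2 * Nat.card ((tw G).map (powMonoidHom 2 : G →* G) ⊔ Subgroup.zpowers c : Subgroup G) := by
  rw [card_sup_zpowers _ h2, card_map_mul (powMonoidHom 2 : G →* G) (tw G), ← mul_assoc]
  · apply Nat.mul_le_mul_right
    refine le_trans ?_ (Nat.le_of_dvd (by norm_num) hT)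
    exact Nat.le_of_dvd Nat.card_pos (Subgroup.card_dvd_of_le inf_le_right)
  · rintro ⟨a, -, ha⟩
    exact hc a ha.symm

theorem D_le {c : G} (hct : c ∈ tw G) :
    (tw G).map (powMonoidHom 2 : G →* G) ⊔ Subgroup.zpowers c ≤ tw G := by
  refine sup_le ?_ (by simpa using hct)
  rintro _ ⟨a, ha, rfl⟩
  exact Subgroup.pow_mem _ ha 2

theorem mem_tw_of_sq {c : G} (h2 : c ^ 2 = 1) : c ∈ tw G := mem_tw.2 ⟨1, by simpa using h2⟩

theorem le_of_not_sup {A D B : Subgroup G} (hD : D ≤ A) (hB : B ≤ A) (h : Nat.card A ≤ 2 * Nat.card D)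
    (hne : D ⊔ B ≠ A) : B ≤ D ∧ Nat.card A = 2 * Nat.card D := by
  have h1 : Nat.card (D ⊔ B : Subgroup G) * (D ⊔ B).relIndex A = Nat.card A := by
    rw [← Subgroup.relIndex_bot_left, ← Subgroup.relIndex_bot_left]
    exact Subgroup.relIndex_mul_relIndex _ _ _ bot_le (sup_le hD hB)
  have h2 : Nat.card D * D.relIndex (D ⊔ B) = Nat.card (D ⊔ B : Subgroup G) := by
    rw [← Subgroup.relIndex_bot_left, ← Subgroup.relIndex_bot_left]
    exact Subgroup.relIndex_mul_relIndex _ _ _ bot_le le_sup_left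
  have hp : 0 < Nat.card A := Nat.card_pos
  have hpD : 0 < Nat.card D := Nat.card_pos
  have h3 : (D ⊔ B).relIndex A ≠ 1 := fun h => hne (le_antisymm (sup_le hD hB) (Subgroup.relIndex_eq_one.1 h))
  have h4 : (D ⊔ B).relIndex A ≠ 0 := by rintro h; rw [h] at h1; omega
  have h6 : D.relIndex (D ⊔ B) ≠ 0 := by rintro h; rw [h] at h2; rw [← h2] at h1; omega
  rw [← h2, mul_assoc] at h1
  have h7 : D.relIndex (D ⊔ B) * (D ⊔ B).relIndex A ≤ 2 := by
    by_contra! h8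
    nlinarith
  have h8 : 2 ≤ (D ⊔ B).relIndex A := by omega
  have h9 : D.relIndex (D ⊔ B) = 1 := by
    by_contra h9
    have h10 : 2 ≤ D.relIndex (D ⊔ B) := by omega
    nlinarith
  refine ⟨le_trans le_sup_right (Subgroup.relIndex_eq_one.1 h9), ?_⟩
  rw [h9, one_mul] at h1 h7
  rw [← h1, le_antisymm h7 h8, mul_comm]

/-- the doubling lemma -/
theorem doubling (j : H →* G) (γ : G →* G)
    (hT : Nat.card (powMonoidHom 2 : G →* G).ker ∣ 4) {c : G} (h2 : c ^ 2 = 1)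
    (hc : ∀ a b, c ≠ a ^ 2 * j b) (hK1 : ∃ b ∈ tw H, b ≠ 1 ∧ j b = 1) (hK2 : Nat.card j.ker ∣ 2)
    (hN1 : ∀ a, ∃ b, a * γ a = j b) (hN : ∀ a ∈ tw G, a * γ a = 1 → a ^ 2 = 1)
    (hX : ∃ x, ∀ a b (e : ℕ), x ≠ a ^ 2 * c ^ e * j b) :
    Nat.card (tw G) = 2 * Nat.card (tw H) := by
  obtain ⟨N, k, hNo, hNd, l, hl⟩ := exists_N (Nat.card G * Nat.card H)
    (Nat.mul_ne_zero Nat.card_pos.ne' Nat.card_pos.ne')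
  have hG := (Nat.dvd_mul_right (Nat.card G) (Nat.card H)).trans hNd
  have hH := (Nat.dvd_mul_left (Nat.card H) (Nat.card G)).trans hNd
  have hct : c ∈ tw G := mem_tw_of_sq h2
  have hcs : ∀ a, c ≠ a ^ 2 := fun a => by simpa using hc a 1
  have hB := card_map_mul j (tw H)
  have hk2 : Nat.card (tw H ⊓ j.ker : Subgroup H) = 2 := by
    have h1 : Nat.card (tw H ⊓ j.ker : Subgroup H) ∣ 2 := (Subgroup.card_dvd_of_le inf_le_right).trans hK2
    rcases (Nat.dvd_prime Nat.prime_two).1 h1 with h | h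
    · exfalso
      obtain ⟨b, hb, hb1, hj⟩ := hK1
      rw [Subgroup.card_eq_one] at h
      exact hb1 ((Subgroup.mem_bot).1 (h ▸ ⟨hb, hj⟩))
    · exact h
  rw [hk2] at hB
  apply le_antisymm
  · let φ : G →* G := MonoidHom.id G * γ
    have h1 := card_map_mul φ (tw G)
    have h3 : Nat.card (tw G ⊓ φ.ker : Subgroup G) ≤ 4 := by
      refine le_trans (Nat.le_of_dvd Nat.card_pos (Subgroup.card_dvd_of_le ?_)) (Nat.le_of_dvd (by norm_num) hT)
      rintro a ⟨ha, hφ⟩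
      exact hN a ha hφ
    have h4 : Nat.card ((tw G).map φ) ≤ Nat.card ((tw H).map j) := by
      refine Nat.le_of_dvd Nat.card_pos (Subgroup.card_dvd_of_le ?_)
      rintro _ ⟨a, ha, rfl⟩
      obtain ⟨b, hb⟩ := hN1 a
      refine ⟨b ^ N, pow_N_mem hH b, ?_⟩
      rw [map_pow, ← hb]
      exact tw_pow_N hG hNo hl (mul_mem ha (map_tw γ ha))
    calc _ = _ := h1
      _ ≤ 4 * Nat.card ((tw H).map j) := Nat.mul_le_mul h3 h4
      _ = _ := by omega
  · obtain ⟨x, hx⟩ := hX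
    set D := (tw G).map (powMonoidHom 2 : G →* G) ⊔ Subgroup.zpowers c with hD
    have h0 : (tw H).map j ≤ tw G := by
      rintro _ ⟨b, hb, rfl⟩
      exact map_tw j hb
    obtain ⟨h1, h3⟩ := le_of_not_sup (D_le hct) h0 (sq_index hT h2 hcs) (by
      intro he
      have hxN : x ^ N ∈ D ⊔ (tw H).map j := he ▸ pow_N_mem hG x
      obtain ⟨d, hd, _, ⟨b, hb, rfl⟩, h⟩ := Subgroup.mem_sup.1 hxN
      obtain ⟨_, ⟨a, ha, rfl⟩, hd⟩ := (mem_sup_zp h2).1 hd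
      obtain ⟨M, hM⟩ := hNo
      have hx' : x = (x⁻¹ ^ M) ^ 2 * x ^ N := by rw [hM, ← pow_mul, pow_succ, ← mul_assoc]; simp [mul_comm]
      rcases hd with rfl | rfl
      · apply hx (x⁻¹ ^ M * a) b 0
        rw [pow_zero, mul_one, mul_pow, mul_assoc]
        conv_lhs => rw [hx', ← h]
        rfl
      · apply hx (x⁻¹ ^ M * a) b 1
        rw [pow_one, mul_pow, mul_assoc, mul_assoc]
        conv_lhs => rw [hx', ← h]
        rw [mul_assoc ((powMonoidHom 2) a)]
        rfl)
    rw [← hD] at h3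
    rw [h3]
    have h4 : Nat.card ((tw H).map j ⊔ Subgroup.zpowers c : Subgroup G) ≤ Nat.card D :=
      Nat.le_of_dvd Nat.card_pos (Subgroup.card_dvd_of_le (sup_le h1 le_sup_right))
    rw [card_sup_zpowers _ h2] at h4
    · omega
    · rintro ⟨b, -, hb⟩
      exact hc 1 b (by simp [hb])

theorem gen_two (hT : Nat.card (powMonoidHom 2 : G →* G).ker ∣ 4) {c : G} (h2 : c ^ 2 = 1)
    (hc : ∀ a, c ≠ a ^ 2) : ∃ g ∈ tw G, c ∉ Subgroup.zpowers g ∧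
      ∀ a ∈ tw G, a ∈ Subgroup.zpowers g ⊔ Subgroup.zpowers c := by
  have hct : c ∈ tw G := mem_tw_of_sq h2
  have key : ∃ g ∈ tw G, ∀ a ∈ tw G, a ∈ Subgroup.zpowers g ⊔ Subgroup.zpowers c := by
    set D := (tw G).map (powMonoidHom 2 : G →* G) ⊔ Subgroup.zpowers c with hD
    have hstep : ∃ g ∈ tw G, ∀ a ∈ tw G, a ∈ Subgroup.zpowers g ⊔ D := by
      by_cases h : ∃ g ∈ tw G, g ∉ D
      · obtain ⟨g, hg, hgD⟩ := h
        refine ⟨g, hg, ?_⟩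
        by_contra! hne
        obtain ⟨a, ha, haD⟩ := hne
        exact hgD ((le_of_not_sup (D_le hct) (Subgroup.zpowers_le.2 hg) (sq_index hT h2 hc)
          (fun h => haD (by rw [sup_comm, h]; exact ha))).1 (Subgroup.mem_zpowers g))
      · push Not at h
        exact ⟨1, one_mem _, fun a ha => Subgroup.mem_sup_right (h a ha)⟩
    obtain ⟨g, hg, hgen⟩ := hstep
    refine ⟨g, hg, ?_⟩
    set S := Subgroup.zpowers g ⊔ Subgroup.zpowers c with hS
    have hs : ∀ a ∈ tw G, ∃ b ∈ tw G, ∃ d ∈ S, a = d * b ^ 2 := by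
      intro a ha
      obtain ⟨u, hu, v, hv, rfl⟩ := Subgroup.mem_sup.1 (hgen a ha)
      obtain ⟨_, ⟨b, hb, rfl⟩, w, hw, rfl⟩ := Subgroup.mem_sup.1 hv
      refine ⟨b, hb, u * w, mul_mem (Subgroup.mem_sup_left hu) (Subgroup.mem_sup_right hw), ?_⟩
      rw [mul_comm ((powMonoidHom 2) b), mul_assoc]; rfl
    have hind : ∀ k : ℕ, ∀ a ∈ tw G, ∃ b ∈ tw G, ∃ d ∈ S, a = d * b ^ 2 ^ k := by
      intro k
      induction k with
      | zero => exact fun a ha => ⟨a, ha, 1, one_mem _, by simp⟩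
      | succ k ih =>
        intro a ha
        obtain ⟨b, hb, d, hd, rfl⟩ := ih a ha
        obtain ⟨b', hb', d', hd', rfl⟩ := hs b hb
        refine ⟨b', hb', d * d' ^ 2 ^ k, mul_mem hd (Subgroup.pow_mem _ hd' _), ?_⟩
        rw [mul_pow, ← pow_mul, pow_succ, mul_comm 2, mul_assoc]
    obtain ⟨N, k, hNo, hNd, l, hl⟩ := exists_N (Nat.card G) Nat.card_pos.ne'
    intro a ha
    obtain ⟨b, hb, d, hd, rfl⟩ := hind k a ha
    have : b ^ 2 ^ k = 1 := by
      apply pow_odd_eq_one (Subgroup.pow_mem _ hb _) hNo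
      obtain ⟨l, hl⟩ := hNd
      rw [← pow_mul, mul_comm, hl, pow_mul, pow_card_eq_one', one_pow]
    rwa [this, mul_one]
  obtain ⟨g, hg, hgen⟩ := key
  by_cases hcg : c ∈ Subgroup.zpowers g
  · refine ⟨1, one_mem _, ?_, ?_⟩
    · rw [Subgroup.zpowers_one_eq_bot, Subgroup.mem_bot]
      exact fun h => hc 1 (by simpa using h)
    · have hgc : g ∈ Subgroup.zpowers c := by
        obtain ⟨k, hk⟩ := Subgroup.mem_zpowers_iff.1 hcg
        rcases Int.even_or_odd' k with ⟨m, rfl | rfl⟩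
        · exact absurd hk.symm (by rw [mul_comm, zpow_mul]; exact_mod_cast hc (g ^ m))
        · obtain ⟨e, he⟩ := mem_tw.1 hg
          have hcop : IsCoprime (2 * m + 1) ((2 : ℤ) ^ e) :=
            IsCoprime.pow_right ⟨1, -m, by ring⟩
          obtain ⟨a, b, hab⟩ := hcop
          refine Subgroup.mem_zpowers_iff.2 ⟨a, ?_⟩
          rw [← hk, ← zpow_mul]
          have he' : g ^ ((2 : ℤ) ^ e) = 1 := by exact_mod_cast he
          calc g ^ ((2 * m + 1) * a) = g ^ (a * (2 * m + 1) + b * 2 ^ e) := by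
                rw [zpow_add, mul_comm b, zpow_mul g (2 ^ e), he', one_zpow, mul_one, mul_comm]
            _ = g := by rw [hab, zpow_one]
      intro a ha
      refine Subgroup.mem_sup_right ?_
      have := hgen a ha
      rwa [sup_eq_right.2 (Subgroup.zpowers_le.2 hgc)] at this
  · exact ⟨g, hg, hcg, hgen⟩

theorem struct_two (hT : Nat.card (powMonoidHom 2 : G →* G).ker ∣ 4) {c : G} (h2 : c ^ 2 = 1)
    (hc : ∀ a, c ≠ a ^ 2) {m : ℕ} (hm : Nat.card (tw G) = 2 ^ (m + 1)) :
    Nonempty (tw G ≃* Multiplicative (ZMod (2 ^ m) × ZMod 2)) := by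
  obtain ⟨g, hg, hcg, hgen⟩ := gen_two hT h2 hc
  have hct : c ∈ tw G := mem_tw_of_sq h2
  have he : tw G = Subgroup.zpowers g ⊔ Subgroup.zpowers c :=
    le_antisymm hgen (sup_le (Subgroup.zpowers_le.2 hg) (Subgroup.zpowers_le.2 hct))
  have hcard : Nat.card (Subgroup.zpowers g) = 2 ^ m := by
    rw [he, card_sup_zpowers hcg h2, pow_succ] at hm
    omega
  have hc1 : c ≠ 1 := fun h => hc 1 (by simpa using h)
  have hcc : Nat.card (Subgroup.zpowers c) = 2 := by
    rw [Nat.card_zpowers]; exact orderOf_eq_prime h2 hc1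
  let φ : Subgroup.zpowers g × Subgroup.zpowers c →* G :=
    (Subgroup.zpowers g).subtype.coprod (Subgroup.zpowers c).subtype
  have hφ : φ.range = tw G := by
    rw [he]
    ext x
    rw [Subgroup.mem_sup]
    constructor
    · rintro ⟨⟨a, b⟩, rfl⟩
      exact ⟨a, a.2, b, b.2, rfl⟩
    · rintro ⟨a, ha, b, hb, rfl⟩
      exact ⟨(⟨a, ha⟩, ⟨b, hb⟩), rfl⟩
  have hfin : Nat.card (Subgroup.zpowers g × Subgroup.zpowers c) = Nat.card φ.range := by
    rw [hφ, hm, Nat.card_prod, hcard, hcc, pow_succ]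
  have hinj : Function.Injective φ := by
    have hb : Function.Bijective φ.rangeRestrict :=
      (Nat.bijective_iff_surjective_and_card _).2 ⟨φ.rangeRestrict_surjective, hfin⟩
    intro x y hxy
    exact hb.1 (Subtype.ext hxy)
  let e1 : Subgroup.zpowers g × Subgroup.zpowers c ≃* tw G :=
    (MonoidHom.ofInjective hinj).trans (MulEquiv.subgroupCongr hφ)
  have e2 : Multiplicative (ZMod (2 ^ m)) ≃* Subgroup.zpowers g := mulEquivOfCyclicCardEq (by simp [hcard])
  have e3 : Multiplicative (ZMod 2) ≃* Subgroup.zpowers c := mulEquivOfCyclicCardEq (by simp [hcc])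
  exact ⟨(((MulEquiv.prodMultiplicative _ _).trans (e2.prodCongr e3)).trans e1).symm⟩

theorem gamma_two (hT : Nat.card (powMonoidHom 2 : G →* G).ker ∣ 4) {c : G} (h2 : c ^ 2 = 1)
    (hc : ∀ a, c ≠ a ^ 2) (g' : G →* G) (hg' : g' c = c) (a : G) (ha : a ∈ tw G)
    (h : a * g' (g' a) = 1) : a ^ 2 = 1 := by
  obtain ⟨g, hg, hcg, hgen⟩ := gen_two hT h2 hc
  obtain ⟨_, ⟨u, rfl⟩, hu⟩ := (mem_sup_zp h2).1 (hgen _ (map_tw g' hg))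
  obtain ⟨_, ⟨i, rfl⟩, hi⟩ := (mem_sup_zp h2).1 (hgen a ha)
  simp only at hu hi
  have h2' : c * c = 1 := by rw [← pow_two, h2]
  have e1 : g' (g' g) = g ^ (u * u) ∨ g' (g' g) = g ^ (u * u) * c := by
    rcases hu with hu | hu
    · left; rw [hu, map_zpow, hu, ← zpow_mul]
    · rcases Int.even_or_odd' u with ⟨v, hv⟩
      have hcu : c ^ u = 1 ∨ c ^ u = c := by
        have h2'' : c ^ (2 : ℤ) = 1 := by exact_mod_cast h2
        rcases hv with hv | hv
        · left; rw [hv, zpow_mul, h2'', one_zpow]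
        · right; rw [hv, zpow_add, zpow_mul, h2'', one_zpow, one_mul, zpow_one]
      have : g' (g' g) = g ^ (u * u) * c ^ u * c := by
        rw [hu, map_mul, hg', map_zpow, hu, mul_zpow, ← zpow_mul]
      rcases hcu with h | h
      · right; rw [this, h, mul_one]
      · left; rw [this, h, mul_assoc, h2', mul_one]
  have e2 : ∃ d, (d = 1 ∨ d = c) ∧ g ^ (i * (1 + u * u)) = d := by
    refine ⟨_, ?_, rfl⟩
    have hcz := Subgroup.mem_zpowers c
    obtain ⟨d1, hd1, hd1c, hi'⟩ : ∃ d1 ∈ Subgroup.zpowers c, g' (g' d1) = d1 ∧ a = g ^ i * d1 := by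
      rcases hi with h | h
      · exact ⟨1, one_mem _, by simp, by simpa using h⟩
      · exact ⟨c, hcz, by rw [hg', hg'], h⟩
    obtain ⟨d2, hd2, hu'⟩ : ∃ d2 ∈ Subgroup.zpowers c, g' (g' g) = g ^ (u * u) * d2 := by
      rcases e1 with h | h
      · exact ⟨1, one_mem _, by simpa using h⟩
      · exact ⟨c, hcz, h⟩
    have : g ^ (i * (1 + u * u)) ∈ Subgroup.zpowers c := by
      have e : g ^ (i * (1 + u * u)) = (d1 * d2 ^ i * d1)⁻¹ := by
        rw [eq_inv_iff_mul_eq_one, ← h, hi', map_mul, map_mul, hd1c, map_zpow, map_zpow, hu', mul_zpow,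
          ← zpow_mul, mul_add, mul_one, zpow_add, mul_comm i (u * u)]
        simp only [mul_comm, mul_left_comm, mul_assoc]
      rw [e]
      exact inv_mem (mul_mem (mul_mem hd1 (Subgroup.zpow_mem _ hd2 _)) hd1)
    obtain ⟨b, hb, h⟩ := (mem_sup_zp (S := ⊥) h2).1 (Subgroup.mem_sup_right this)
    rw [Subgroup.mem_bot.1 hb, one_mul] at h
    exact h
  have e3 : g ^ (i * (1 + u * u)) = 1 := by
    obtain ⟨d, rfl | rfl, hd⟩ := e2
    · exact hd
    · exact absurd (Subgroup.mem_zpowers_iff.2 ⟨_, hd⟩) hcg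
  have e4 : g ^ (2 * i) = 1 := by
    obtain ⟨w, v, hw, hv⟩ : ∃ w v : ℤ, Odd w ∧ 2 * w = v * (1 + u * u) := by
      rcases Int.even_or_odd' u with ⟨v, rfl | rfl⟩
      · exact ⟨1 + 2 * v * (2 * v), 2, ⟨2 * v * v, by ring⟩, rfl⟩
      · exact ⟨1 + 2 * v + 2 * v * v, 1, ⟨v + v * v, by ring⟩, by ring⟩
    have h5 : (g ^ (2 * i)) ^ w = 1 := by
      rw [← zpow_mul]
      have : 2 * i * w = (i * (1 + u * u)) * v := by linear_combination i * hv
      rw [this, zpow_mul, e3, one_zpow]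
    have h6 : (g ^ (2 * i)) ^ w.natAbs = 1 := by
      rcases Int.natAbs_eq w with h | h
      · rw [h] at h5; exact_mod_cast h5
      · rw [h, zpow_neg, inv_eq_one] at h5; exact_mod_cast h5
    exact pow_odd_eq_one (Subgroup.zpow_mem _ hg _) (Int.natAbs_odd.2 hw) h6
  have e5 : (g ^ i) ^ 2 = 1 := by
    rw [← e4, mul_comm, zpow_mul]; exact_mod_cast rfl
  rcases hi with rfl | rfl
  · exact e5
  · rw [mul_pow, e5, h2, one_mul]

theorem card_eq_tw {S : Subgroup G} (hS : tw G ≤ S) : ∃ m, Odd m ∧ Nat.card S = Nat.card (tw G) * m := by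
  refine ⟨(tw G).relIndex S, ?_, ?_⟩
  · rw [← Nat.not_even_iff_odd, even_iff_two_dvd]
    intro h
    have : Fact (Nat.Prime 2) := ⟨Nat.prime_two⟩
    obtain ⟨x, hx⟩ := exists_prime_orderOf_dvd_card' (G := S ⧸ (tw G).subgroupOf S) 2 h
    induction x using QuotientGroup.induction_on with
    | H x =>
      have h2 : ((x : S ⧸ (tw G).subgroupOf S)) ^ 2 = 1 := by rw [← hx, pow_orderOf_eq_one]
      have h1 : (x : S ⧸ (tw G).subgroupOf S) ≠ 1 := fun h => by rw [h, orderOf_one] at hx; omega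
      apply h1
      rw [QuotientGroup.eq_one_iff, Subgroup.mem_subgroupOf]
      rw [← QuotientGroup.mk_pow, QuotientGroup.eq_one_iff, Subgroup.mem_subgroupOf] at h2
      obtain ⟨k, hk⟩ := mem_tw.1 h2
      exact mem_tw.2 ⟨k + 1, by rw [← hk, pow_succ', pow_mul]; rfl⟩
  · rw [← Subgroup.relIndex_bot_left, ← Subgroup.relIndex_bot_left,
      Subgroup.relIndex_mul_relIndex _ _ _ bot_le hS]

theorem card_tw_pow (G : Type*) [CommGroup G] [Finite G] : ∃ k, Nat.card (tw G) = 2 ^ k := by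
  have : Fact (Nat.Prime 2) := ⟨Nat.prime_two⟩
  exact (CommGroup.primaryComponent.isPGroup (G := G) (p := 2)).exists_card_eq

end
end TC

namespace TC
set_option linter.unusedSectionVars false
set_option linter.style.haveILetI false

/-! ### The fields `L_n` and `ℚ(√-2, √pq)` and their subfields of index two -/

/-- `L_n` -/
structure LF (p q n : ℕ) (K : Type) [Field K] [NumberField K] (ζ s : K) : Prop where
  prim : IsPrimitiveRoot ζ (2 ^ (n + 2))
  sq : s ^ 2 = ((p * q : ℕ) : K)
  rank : Module.finrank ℚ K = 2 ^ (n + 2)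

/-- `ℚ(√-2, √pq)` -/
structure MF (p q : ℕ) (K : Type) [Field K] [NumberField K] (t s : K) : Prop where
  tsq : t ^ 2 = -2
  sq : s ^ 2 = ((p * q : ℕ) : K)
  rank : Module.finrank ℚ K = 4

section
variable {k K : Type} [Field k] [NumberField k] [Field K] [NumberField K] [Algebra k K]
  {g : K →+* K} {p q n : ℕ} {ζ η s t : K}

theorem sub_gen (E : IntermediateField ℚ K) {m : ℕ} (h1 : Module.finrank ℚ E = m)
    (h : Module.finrank ℚ K = m * 2) {S : Set K} {x : K} (hS : IntermediateField.adjoin ℚ S = ⊤)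
    (hSE : ∀ y ∈ S, y = x ∨ y ∈ E) {a b : K} (ha : a ∈ E) (hb : b ∈ E) (hx : x ^ 2 = a * x + b) :
    ∃ g, Quad E K g ∧ g x = a - x ∧ ∀ y ∈ E, g y = y := by
  obtain ⟨g, hg⟩ := Quad.of_rank (finrank_top_two h1 h)
  have hfix : ∀ y ∈ E, g y = y := fun y hy => hg.comm ⟨y, hy⟩
  refine ⟨g, hg, ?_, hfix⟩
  have h2 : (g x - x) * (g x - (a - x)) = 0 := by
    have h3 := congrArg g hx
    rw [map_pow, map_add, map_mul, hfix a ha, hfix b hb] at h3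
    linear_combination h3 - hx
  rcases mul_eq_zero.1 h2 with h3 | h3
  · exfalso
    obtain ⟨y, hy⟩ := hg.nontriv
    apply hy
    apply fix_top hS
    intro z hz
    rcases hSE z hz with rfl | h
    · exact sub_eq_zero.1 h3
    · exact hfix z h
  · exact sub_eq_zero.1 h3

theorem LF.notMem (h : LF p q n K ζ s) (hpq : PQ p q) : s ∉ ℚ⟮ζ⟯ :=
  s_notMem hpq.hp hpq.ne_two hpq.not_dvd h.prim (by rw [h.sq]; simp)

theorem LF.notMem_of (h : LF p q n K ζ s) (hpq : PQ p q) {x : K} (hx : x ∈ ℚ⟮ζ⟯) : s ∉ ℚ⟮x⟯ := fun hs =>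
  h.notMem hpq ((IntermediateField.adjoin_simple_le_iff.2 hx) hs)

theorem LF.top (h : LF p q n K ζ s) (hpq : PQ p q) : IntermediateField.adjoin ℚ {ζ, s} = ⊤ :=
  top_of_finrank (by
    rw [finrank_pair ((p * q : ℕ) : ℚ) (by rw [h.sq]; simp) (h.notMem hpq), finrank_zeta h.prim, h.rank,
      pow_succ' 2 (n + 1)])

theorem LF.tc (h : LF p q n K ζ s) : IsTotallyComplex K := TC_of (by norm_num) (sq_root h.prim)

theorem LF.ne0 (h : LF p q n K ζ s) : ζ ≠ 0 := h.prim.ne_zero (by positivity)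

theorem LF.subF (h : LF p q n K ζ s) (hpq : PQ p q) : ∃ (E : IntermediateField ℚ K) (z : E) (g : K →+* K),
    HF n E z ∧ (z : K) = ζ ∧ Quad E K g ∧ g ζ = ζ ∧ g s = -s := by
  have hf := finrank_zeta h.prim
  obtain ⟨g, hg, h1, h2⟩ := sub_gen ℚ⟮ζ⟯ hf (by rw [h.rank, ← pow_succ]) (h.top hpq)
    (x := s) (by
      rintro y (rfl | rfl)
      · exact Or.inr (mem_adjoin_simple_self ℚ y)
      · exact Or.inl rfl) (zero_mem _) (b := ((p * q : ℕ) : K)) (_root_.natCast_mem _ _) (by rw [h.sq]; ring)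
  refine ⟨ℚ⟮ζ⟯, AdjoinSimple.gen ℚ ζ, g, ⟨?_, hf⟩, AdjoinSimple.coe_gen _ _, hg, h2 _ (mem_adjoin_simple_self ℚ _), by simpa using h1⟩
  refine IsPrimitiveRoot.of_map_of_injective (f := algebraMap ℚ⟮ζ⟯ K) ?_ (algebraMap ℚ⟮ζ⟯ K).injective
  rw [AdjoinSimple.algebraMap_gen]; exact h.prim

theorem LF.eta (h : LF p q n K ζ s) : (fun y : K => y ^ 2 - 2)^[n] (ζ + ζ⁻¹) = 0 := by
  rw [iter_add_inv h.ne0]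
  have h1 := sq_root h.prim
  have h2 : ζ ^ 2 ^ n ≠ 0 := pow_ne_zero _ h.ne0
  field_simp
  rw [h1]; simp

theorem LF.subP (h : LF p q n K ζ s) (hpq : PQ p q) : ∃ (E : IntermediateField ℚ K) (e s' : E) (g : K →+* K),
    LP p q n E e s' ∧ (e : K) = ζ + ζ⁻¹ ∧ (s' : K) = s ∧ Quad E K g ∧ g ζ = ζ⁻¹ ∧ g s = s := by
  have hz : ζ ∈ ℚ⟮ζ⟯ := mem_adjoin_simple_self ℚ _
  have hf := finrank_pair ((p * q : ℕ) : ℚ) (by rw [h.sq]; simp)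
    (h.notMem_of hpq (add_mem hz (inv_mem hz)))
  rw [finrank_eta h.eta, mul_comm, ← pow_succ] at hf
  set E := IntermediateField.adjoin ℚ {ζ + ζ⁻¹, s}
  have m1 : ζ + ζ⁻¹ ∈ E := mem_pair.1
  have m2 : s ∈ E := mem_pair.2
  obtain ⟨g, hg, h1, h2⟩ := sub_gen E hf (by rw [h.rank, ← pow_succ]) (h.top hpq)
    (x := ζ) (by
      rintro y (rfl | rfl)
      · exact Or.inl rfl
      · exact Or.inr m2) m1 (b := -1) (neg_mem (one_mem _)) (by have := h.ne0; field_simp; ring)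
  refine ⟨E, ⟨_, m1⟩, ⟨_, m2⟩, g, ⟨?_, ?_, hf⟩, rfl, rfl, hg, by simpa using h1, h2 _ m2⟩
  · apply (algebraMap E K).injective
    rw [iter_map, map_zero]
    exact h.eta
  · apply (algebraMap E K).injective
    rw [map_pow, map_natCast]; exact h.sq

theorem LF.subL (h : LF p q (n + 1) K ζ s) (hpq : PQ p q) :
    ∃ (E : IntermediateField ℚ K) (z s' : E) (g : K →+* K),
    LF p q n E z s' ∧ (z : K) = ζ ^ 2 ∧ (s' : K) = s ∧ Quad E K g ∧ g ζ = -ζ ∧ g s = s := by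
  have hp : IsPrimitiveRoot (ζ ^ 2) (2 ^ (n + 2)) := h.prim.pow (by positivity) (by
    rw [mul_comm, ← pow_succ])
  have hz : ζ ∈ ℚ⟮ζ⟯ := mem_adjoin_simple_self ℚ _
  have hf := finrank_pair ((p * q : ℕ) : ℚ) (by rw [h.sq]; simp) (h.notMem_of hpq (pow_mem hz 2))
  rw [finrank_zeta hp, mul_comm, ← pow_succ] at hf
  set E := IntermediateField.adjoin ℚ {ζ ^ 2, s}
  have m1 : ζ ^ 2 ∈ E := mem_pair.1
  have m2 : s ∈ E := mem_pair.2
  obtain ⟨g, hg, h1, h2⟩ := sub_gen E hf (by rw [h.rank, ← pow_succ]) (h.top hpq)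
    (x := ζ) (by
      rintro y (rfl | rfl)
      · exact Or.inl rfl
      · exact Or.inr m2) (zero_mem _) m1 (by ring)
  refine ⟨E, ⟨_, m1⟩, ⟨_, m2⟩, g, ⟨?_, ?_, hf⟩, rfl, rfl, hg, by simpa using h1, h2 _ m2⟩
  · exact IsPrimitiveRoot.of_map_of_injective (f := algebraMap E K) hp (algebraMap E K).injective
  · apply (algebraMap E K).injective
    rw [map_pow, map_natCast]; exact h.sq

theorem LF.subM (h : LF p q 1 K ζ s) (hpq : PQ p q) :
    ∃ (E : IntermediateField ℚ K) (t s' : E) (g : K →+* K),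
    MF p q E t s' ∧ (t : K) = ζ + ζ ^ 3 ∧ (s' : K) = s ∧ Quad E K g ∧ g ζ = ζ ^ 3 ∧ g s = s := by
  have h4 : ζ ^ 4 = -1 := by
    have := sq_root h.prim
    rw [← pow_mul] at this; simpa using this
  have ht : (ζ + ζ ^ 3) ^ 2 = -2 := by linear_combination (2 + ζ ^ 2) * h4
  have hz : ζ ∈ ℚ⟮ζ⟯ := mem_adjoin_simple_self ℚ _
  have hf := finrank_pair ((p * q : ℕ) : ℚ) (by rw [h.sq]; simp)
    (h.notMem_of hpq (add_mem hz (pow_mem hz 3)))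
  rw [finrank_sqrt (-2 : ℚ) (by rw [ht]; simp) (not_rat (a := -2) (by norm_num) (by rw [ht]; simp))] at hf
  set E := IntermediateField.adjoin ℚ {ζ + ζ ^ 3, s}
  have m1 : ζ + ζ ^ 3 ∈ E := mem_pair.1
  have m2 : s ∈ E := mem_pair.2
  obtain ⟨g, hg, h1, h2⟩ := sub_gen E hf (by rw [h.rank]; norm_num) (h.top hpq)
    (x := ζ) (by
      rintro y (rfl | rfl)
      · exact Or.inl rfl
      · exact Or.inr m2) m1 (b := 1) (one_mem _) (by linear_combination -h4)
  refine ⟨E, ⟨_, m1⟩, ⟨_, m2⟩, g, ⟨?_, ?_, hf⟩, rfl, rfl, hg, by simpa using h1, h2 _ m2⟩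
  · apply (algebraMap E K).injective
    rw [map_pow, map_neg, map_ofNat]; exact ht
  · apply (algebraMap E K).injective
    rw [map_pow, map_natCast]; exact h.sq

/-! subfields of `MF` -/

theorem MF.top (h : MF p q K t s) (hpq : PQ p q) : IntermediateField.adjoin ℚ {t, s} = ⊤ :=
  top_of_finrank (by
    obtain ⟨z, hz, hz2⟩ := exists_root_t h.tsq
    rw [finrank_pair ((p * q : ℕ) : ℚ) (by rw [h.sq]; simp)
      (s_notMem_of_z hpq.hp hpq.ne_two hpq.not_dvd (by rw [h.sq]; simp) hz hz2),
      finrank_sqrt (-2 : ℚ) (by rw [h.tsq]; simp) (not_rat (a := -2) (by norm_num) (by rw [h.tsq]; simp)), h.rank])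

theorem MF.tc (h : MF p q K t s) : IsTotallyComplex K := TC_of (a := -2) (by norm_num) (by rw [h.tsq]; simp)

theorem MF.subT (h : MF p q K t s) (hpq : PQ p q) : ∃ (E : IntermediateField ℚ K) (t' : E) (g : K →+* K),
    QT E t' ∧ (t' : K) = t ∧ Quad E K g ∧ g t = t ∧ g s = -s := by
  have hf := finrank_sqrt (-2 : ℚ) (by rw [h.tsq]; simp) (not_rat (a := -2) (by norm_num) (by rw [h.tsq]; simp))
  obtain ⟨g, hg, h1, h2⟩ := sub_gen ℚ⟮t⟯ hf (by rw [h.rank]) (h.top hpq)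
    (x := s) (by
      rintro y (rfl | rfl)
      · exact Or.inr (mem_adjoin_simple_self ℚ y)
      · exact Or.inl rfl) (zero_mem _) (b := ((p * q : ℕ) : K)) (_root_.natCast_mem _ _) (by rw [h.sq]; ring)
  refine ⟨ℚ⟮t⟯, AdjoinSimple.gen ℚ t, g, ⟨?_, hf⟩, AdjoinSimple.coe_gen _ _, hg, h2 _ (mem_adjoin_simple_self ℚ _), by simpa using h1⟩
  apply (algebraMap ℚ⟮t⟯ K).injective
  rw [map_pow, AdjoinSimple.algebraMap_gen, h.tsq, map_neg, map_ofNat]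

theorem MF.s_rat (h : MF p q K t s) (hpq : PQ p q) (b : ℚ) : algebraMap ℚ K b ≠ s := fun hb => by
  obtain ⟨z, hz, hz2⟩ := exists_root_t h.tsq
  exact (s_notMem_of_z hpq.hp hpq.ne_two hpq.not_dvd (by rw [h.sq]; simp) hz hz2)
    (hb ▸ IntermediateField.algebraMap_mem _ b)

theorem MF.subS (h : MF p q K t s) (hpq : PQ p q) : ∃ (E : IntermediateField ℚ K) (s' : E) (g : K →+* K),
    LP p q 0 E 0 s' ∧ (s' : K) = s ∧ Quad E K g ∧ g t = -t ∧ g s = s := by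
  have hf := finrank_sqrt ((p * q : ℕ) : ℚ) (by rw [h.sq]; simp) (h.s_rat hpq)
  obtain ⟨g, hg, h1, h2⟩ := sub_gen ℚ⟮s⟯ hf (by rw [h.rank]) (h.top hpq)
    (x := t) (by
      rintro y (rfl | rfl)
      · exact Or.inl rfl
      · exact Or.inr (mem_adjoin_simple_self ℚ y)) (zero_mem _) (b := -2) (neg_mem (ofNat_mem _ 2)) (by rw [h.tsq]; ring)
  refine ⟨ℚ⟮s⟯, AdjoinSimple.gen ℚ s, g, ⟨rfl, ?_, hf⟩, AdjoinSimple.coe_gen _ _, hg, by simpa using h1, h2 _ (mem_adjoin_simple_self ℚ _)⟩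
  apply (algebraMap ℚ⟮s⟯ K).injective
  rw [map_pow, AdjoinSimple.algebraMap_gen, h.sq]; simp

theorem MF.subW (h : MF p q K t s) (hpq : PQ p q) : ∃ (E : IntermediateField ℚ K) (w : E) (g : K →+* K),
    E = ℚ⟮t * s⟯ ∧ Module.finrank ℚ E = 2 ∧ (w : K) = t * s ∧ Quad E K g ∧ g t = -t ∧ g s = -s := by
  have hw : (t * s) ^ 2 = ((-2 * (p * q : ℕ) : ℚ) : K) := by rw [mul_pow, h.tsq, h.sq]; simp
  have hf := finrank_sqrt (-2 * (p * q : ℕ) : ℚ) (by rw [hw]; simp) (not_rat (a := -2 * (p * q : ℕ)) (by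
    have := hpq.pos
    have : (0 : ℚ) < ((p * q : ℕ) : ℚ) := by exact_mod_cast this
    linarith) hw)
  have ht0 : t ≠ 0 := fun h0 => by
    have := h.tsq
    rw [h0] at this; norm_num at this
  have hs0 : s ≠ 0 := fun h0 => by
    have := h.sq
    rw [h0] at this
    have h2 := hpq.pos.ne
    apply h2
    exact_mod_cast (show ((0 : ℕ) : K) = ((p * q : ℕ) : K) by rw [← this]; simp)
  have hm : t * s ∈ ℚ⟮t * s⟯ := mem_adjoin_simple_self ℚ _
  obtain ⟨g, hg, h1, h2⟩ := sub_gen ℚ⟮t * s⟯ hf (by rw [h.rank]) (S := {t, t * s}) (by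
      rw [eq_top_iff, ← h.top hpq, IntermediateField.adjoin_le_iff]
      rintro x (rfl | rfl)
      · exact mem_pair.1
      · have := mul_mem (inv_mem (mem_pair (x := t) (y := t * x)).1) (mem_pair (x := t) (y := t * x)).2
        rwa [inv_mul_cancel_left₀ ht0] at this)
    (x := t) (by
      rintro y (rfl | rfl)
      · exact Or.inl rfl
      · exact Or.inr hm) (zero_mem _) (b := -2) (neg_mem (ofNat_mem _ 2)) (by rw [h.tsq]; ring)
  rw [zero_sub] at h1
  refine ⟨ℚ⟮t * s⟯, AdjoinSimple.gen ℚ (t * s), g, rfl, hf, AdjoinSimple.coe_gen _ _, hg, h1, ?_⟩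
  have h3 := h2 _ hm
  rw [map_mul, h1] at h3
  have h4 : t * (g s + s) = 0 := by linear_combination -h3
  rcases mul_eq_zero.1 h4 with h5 | h5
  · exact absurd h5 ht0
  · linear_combination h5

/-- the element `√-2` of `L_n` -/
theorem LF.t_sq (h : LF p q (n + 1) K ζ s) : (ζ ^ 2 ^ n + ζ ^ (3 * 2 ^ n)) ^ 2 = -2 := by
  have h4 : ζ ^ (4 * 2 ^ n) = -1 := by
    have := sq_root h.prim
    rw [← pow_mul] at this
    rw [show 4 * 2 ^ n = 2 ^ (n + 1) * 2 by rw [pow_succ]; ring, this]; simp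
  have e : ζ ^ (6 * 2 ^ n) = ζ ^ (4 * 2 ^ n) * ζ ^ (2 * 2 ^ n) := by rw [← pow_add]; ring_nf
  have e1 : (ζ ^ 2 ^ n + ζ ^ (3 * 2 ^ n)) ^ 2 = ζ ^ (2 * 2 ^ n) + 2 * ζ ^ (4 * 2 ^ n) + ζ ^ (6 * 2 ^ n) := by ring
  rw [e1, e, h4]; ring

end
end TC

namespace TC
set_option linter.unusedSectionVars false
set_option linter.style.haveILetI false

/-! ### The 2-rank of the class group of `L_n` -/

section
variable {k K : Type} [Field k] [NumberField k] [Field K] [NumberField K] [Algebra k K]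
  {g : K →+* K} {p q n : ℕ} {ζ η s t : K}

theorem HF.pow4 (h : HF (n + 1) K ζ) : ζ ^ (4 * 2 ^ n) = -1 := by
  have := sq_root h.prim
  rw [← pow_mul] at this
  rw [show 4 * 2 ^ n = 2 ^ (n + 1) * 2 by rw [pow_succ]; ring, this]; simp

theorem HF.norm_t (h : HF (n + 1) K ζ) (hk : Module.finrank ℚ k = 2) {τ : k}
    (hτ : algebraMap k K τ = ζ ^ 2 ^ n + ζ ^ (3 * 2 ^ n)) : Algebra.norm k ζ = -1 := by
  have hr : Module.finrank k K = 2 ^ (n + 1) := by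
    have h1 := Module.finrank_mul_finrank ℚ k K
    rw [hk, h.rank, pow_succ] at h1
    omega
  have htop : k⟮ζ⟯ = ⊤ := by
    rw [eq_top_iff]
    intro x _
    have hx : x ∈ ℚ⟮ζ⟯ := by rw [h.top]; trivial
    induction hx using IntermediateField.adjoin_induction with
    | mem x hx => rw [Set.mem_singleton_iff.1 hx]; exact mem_adjoin_simple_self k ζ
    | algebraMap x => rw [IsScalarTower.algebraMap_apply ℚ k K]; exact IntermediateField.algebraMap_mem _ _
    | add x y _ _ hx hy => exact add_mem (hx trivial) (hy trivial)
    | inv x _ hx => exact inv_mem (hx trivial)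
    | mul x y _ _ hx hy => exact mul_mem (hx trivial) (hy trivial)
  have hIntg : IsIntegral k ζ := Algebra.IsIntegral.isIntegral ζ
  let P : Polynomial k := Polynomial.X ^ 2 ^ (n + 1) - Polynomial.C τ * Polynomial.X ^ 2 ^ n - 1
  have hlt : 2 ^ n < 2 ^ (n + 1) := by rw [pow_succ]; have : 0 < 2 ^ n := by positivity
                                       omega
  have hpos : 0 < 2 ^ n := by positivity
  have hQ : (Polynomial.C τ * Polynomial.X ^ 2 ^ n + 1 : Polynomial k).degree < ((2 ^ (n + 1) : ℕ) : WithBot ℕ) := by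
    refine lt_of_le_of_lt (Polynomial.degree_add_le _ _) (max_lt ?_ ?_)
    · refine lt_of_le_of_lt (Polynomial.degree_C_mul_X_pow_le _ _) ?_
      exact_mod_cast hlt
    · rw [Polynomial.degree_one]
      exact_mod_cast (by positivity : 0 < 2 ^ (n + 1))
  have hP : P = Polynomial.X ^ 2 ^ (n + 1) - (Polynomial.C τ * Polynomial.X ^ 2 ^ n + 1) := by
    simp only [P]; ring
  have hmon : P.Monic := by
    rw [hP]; exact Polynomial.monic_X_pow_sub hQ
  have hdeg : P.degree = ((2 ^ (n + 1) : ℕ) : WithBot ℕ) := by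
    rw [hP, Polynomial.degree_sub_eq_left_of_degree_lt] <;> rw [Polynomial.degree_X_pow]
    exact hQ
  have hev : Polynomial.aeval ζ P = 0 := by
    simp only [P, map_sub, map_mul, map_pow, Polynomial.aeval_X, Polynomial.aeval_C, map_one, hτ]
    have h1 : ζ ^ 2 ^ (n + 1) = ζ ^ 2 ^ n * ζ ^ 2 ^ n := by rw [← pow_add]; congr 1; ring
    have h2 : ζ ^ (3 * 2 ^ n) * ζ ^ 2 ^ n = -1 := by rw [← h.pow4, ← pow_add]; congr 1; ring
    rw [h1]
    linear_combination -h2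
  have hn1 : (minpoly k ζ).natDegree = 2 ^ (n + 1) := by
    rw [← IntermediateField.adjoin.finrank hIntg, htop, IntermediateField.finrank_top', hr]
  have hmin : P = minpoly k ζ := by
    apply minpoly.unique_of_degree_le_degree_minpoly k ζ hmon hev
    rw [hdeg, Polynomial.degree_eq_natDegree (minpoly.ne_zero hIntg), hn1]
  have h1 : Module.finrank k⟮ζ⟯ K = 1 := by rw [htop]; exact IntermediateField.finrank_top
  rw [Algebra.norm_eq_norm_adjoin k ζ, h1, pow_one,
    ← IntermediateField.adjoin.powerBasis_gen hIntg, Algebra.PowerBasis.norm_gen_eq_coeff_zero_minpoly,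
    IntermediateField.adjoin.powerBasis_gen hIntg, IntermediateField.minpoly_gen, ← hmin,
    IntermediateField.adjoin.powerBasis_dim hIntg, hn1]
  simp only [P, Polynomial.coeff_sub, Polynomial.coeff_C_mul, Polynomial.coeff_X_pow]
  rw [if_neg (by positivity), if_neg (by positivity), Polynomial.coeff_one, if_pos rfl, pow_succ 2 n, pow_mul',
    neg_one_sq, one_pow]
  simp

theorem QT.top (h : QT K t) : ℚ⟮t⟯ = ⊤ :=
  top_of_finrank (by
    rw [h.rank]
    exact finrank_sqrt (-2 : ℚ) (by rw [h.sq]; simp) (not_rat (a := -2) (by norm_num) (by rw [h.sq]; simp)))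

theorem LF.zeta_norm {F : Type} [Field F] [NumberField F] [Algebra F K] {z : F} (hF : HF (n + 1) F z)
    (h : LF p q (n + 1) K ζ s) (hpq : PQ p q) (hz : algebraMap F K z = ζ) (x : K) : Algebra.norm F x ≠ z := by
  intro hx
  have ht : (z ^ 2 ^ n + z ^ (3 * 2 ^ n)) ^ 2 = -2 := by
    have h2 : z ^ (3 * 2 ^ n) * z ^ 2 ^ n = -1 := by rw [← hF.pow4, ← pow_add]; congr 1; ring
    have h3 : z ^ 2 ^ n * z ^ 2 ^ n * (z ^ 2 ^ n * z ^ 2 ^ n) = -1 := by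
      rw [← hF.pow4, ← pow_add, ← pow_add]; congr 1; ring
    have h4 : z ^ (3 * 2 ^ n) = (z ^ 2 ^ n) ^ 3 := by rw [← pow_mul, mul_comm]
    rw [h4]
    linear_combination (2 + (z ^ 2 ^ n) ^ 2) * h3
  set t := z ^ 2 ^ n + z ^ (3 * 2 ^ n) with ht'
  have hr : Module.finrank ℚ ℚ⟮t⟯ = 2 :=
    finrank_sqrt (-2 : ℚ) (by rw [ht]; simp) (not_rat (a := -2) (by norm_num) (by rw [ht]; simp))
  have hn := hF.norm_t (k := ℚ⟮t⟯) hr (τ := AdjoinSimple.gen ℚ t) (AdjoinSimple.algebraMap_gen ℚ t)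
  have h5 : Algebra.norm ℚ⟮t⟯ x = -1 := by
    rw [← Algebra.norm_norm (R := ℚ⟮t⟯) (S := F), hx, hn]
  have hns : ∀ b : ℚ⟮t⟯, algebraMap ℚ⟮t⟯ K b ≠ s := by
    intro b hb
    apply h.notMem hpq
    rw [← hb, IsScalarTower.algebraMap_apply ℚ⟮t⟯ F K]
    refine map_mem_adjoin (algebraMap F K) (S := {z}) ?_ (?_ : algebraMap ℚ⟮t⟯ F b ∈ ℚ⟮z⟯)
    · intro x hx
      rw [Set.mem_singleton_iff.1 hx, hz]; exact mem_adjoin_simple_self ℚ _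
    · rw [hF.top]; trivial
  obtain ⟨X, Y, hXY⟩ := norm_form (a := ((p * q : ℕ) : ℚ⟮t⟯)) (by exact_mod_cast hpq.pos.ne')
    (by rw [h.sq]; simp) hns x
  have := Fact.mk hpq.hp
  have hQT : QT ℚ⟮t⟯ (AdjoinSimple.gen ℚ t) := ⟨by
    apply (algebraMap ℚ⟮t⟯ F).injective
    rw [map_pow, AdjoinSimple.algebraMap_gen, map_neg, map_ofNat]; exact ht, hr⟩
  refine nsq_neg_one hpq.p8 (locT hpq.p8 (m := q) hpq.not_dvd (AdjoinSimple.gen ℚ t) ?_ ?_ (-1) ?_ 0 X Y 1 one_ne_zero ?_)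
  · exact hQT.sq
  · exact hQT.top
  · rw [Int.dvd_neg]; intro h6; have := Int.le_of_dvd one_pos h6; have := hpq.hp.two_le; omega
  · rw [h5] at hXY; push_cast at hXY ⊢; linear_combination hXY

theorem card_ker_pow (G : Type) [CommGroup G] [Finite G] :
    ∃ m, Nat.card (powMonoidHom 2 : G →* G).ker = 2 ^ m := by
  have : IsPGroup 2 (powMonoidHom 2 : G →* G).ker := by
    intro x
    refine ⟨1, ?_⟩
    apply Subtype.ext
    have := x.2
    rw [MonoidHom.mem_ker] at this
    simpa using this
  exact (IsPGroup.iff_card).1 this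

theorem LF.Tc (h : LF p q n K ζ s) (c : ℕ) {E : IntermediateField ℚ K} {z : E} (hE : HF n E z)
    (hg : Quad E K g) (hT : TC.tI E K g ∣ 2 ^ c) (j : ℕ) (hj : 2 ^ j ∣ uI g) :
    Nat.card (powMonoidHom 2 : ClassGroup (𝓞 K) →* ClassGroup (𝓞 K)).ker ∣ 2 ^ (c - j - 1) := by
  have := h.tc
  have := hE.tc
  obtain ⟨m, hm⟩ := card_ker_pow (ClassGroup (𝓞 K))
  have h2 := hg.two_torsion_dvd hE.odd
  rw [hm] at h2 ⊢
  have := hg.aC_bound hE.odd (e := 1) (by simpa using hg.h1_TC) hT hj h2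
  exact pow_dvd_pow 2 (by omega)

theorem LF.T1 (h : LF p q (n + 1) K ζ s) (hpq : PQ p q) :
    Nat.card (powMonoidHom 2 : ClassGroup (𝓞 K) →* ClassGroup (𝓞 K)).ker ∣ 4 := by
  obtain ⟨E, z, g, hE, hz, hg, -, hgs⟩ := h.subF hpq
  have := Fact.mk hpq.hp
  have := Fact.mk hpq.hq
  obtain ⟨s', hs, hs2⟩ := lift_sq (s := s) (m := (p * q : ℕ)) (by rw [h.sq]; simp)
  obtain ⟨η', hη, hη2⟩ := lift_eta h.eta
  have hT : TC.tI E K g ∣ 2 ^ (2 * 2) := by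
    refine hg.tI_s hpq.ne hpq.mod4 (s := s') (by simpa using hs2)
      (ringInt_inj (by rw [coe_oi, hs, hgs, map_neg, hs])) (e := 2 ^ (n + 1)) (E := 2 ^ (n + 2))
      (fun P h1 h2 h3 => resdeg hpq.p8 h1 h2 h3 η' hη2) (fun P h1 h2 h3 => resdeg hpq.q8 h1 h2 h3 η' hη2)
      (absNorm_of ?_) (by have : 0 < 2 ^ n := by positivity
                          rw [pow_succ, pow_succ]; omega)
    rw [hs, norm_sq (c := 2 ^ (n + 2)) (b := ((p * q : ℕ) : ℚ)) (by rw [h.sq]; simp) (by rw [h.rank, pow_succ, mul_comm])]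
    rw [Nat.abs_cast]; push_cast; rfl
  refine h.Tc (2 * 2) hE hg hT 1 ?_
  rw [pow_one]
  obtain ⟨z', hz', hz2⟩ := lift_root (by positivity) hE.prim
  obtain ⟨u, hu⟩ := hz2.isUnit (by positivity)
  refine hg.two_dvd_uI (tI_ne hT) u fun x hx => ?_
  rw [← hg.norm] at hx
  have hx := (algebraMap E K).injective hx
  refine h.zeta_norm hE hpq hz x ?_
  rw [hx, hu, hz']

theorem LF.T0 (h : LF p q 0 K ζ s) (hpq : PQ p q) :
    Nat.card (powMonoidHom 2 : ClassGroup (𝓞 K) →* ClassGroup (𝓞 K)).ker ∣ 2 := by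
  obtain ⟨E, z, g, hE, hz, hg, -, hgs⟩ := h.subF hpq
  have := Fact.mk hpq.hp
  have := Fact.mk hpq.hq
  obtain ⟨s', hs, hs2⟩ := lift_sq (s := s) (m := (p * q : ℕ)) (by rw [h.sq]; simp)
  obtain ⟨i, hi, hi2⟩ := lift_sq (s := ζ) (m := -1) (by have := sq_root h.prim; simpa using this)
  have hi3 : i ^ 2 = -1 := by rw [hi2]; simp
  have hT : TC.tI E K g ∣ 2 ^ (2 * 1) := by
    refine hg.tI_s hpq.ne hpq.mod4 (s := s') (by simpa using hs2)
      (ringInt_inj (by rw [coe_oi, hs, hgs, map_neg, hs])) (e := 2) (E := 2)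
      (fun P h1 h2 h3 => resdeg0 hpq.p8 h1 h2 h3 i hi3) (fun P h1 h2 h3 => resdeg0 hpq.q8 h1 h2 h3 i hi3)
      (absNorm_of ?_) (by norm_num)
    rw [hs, norm_sq (c := 2) (b := ((p * q : ℕ) : ℚ)) (by rw [h.sq]; simp) (by rw [h.rank]; norm_num)]
    rw [Nat.abs_cast]; push_cast; rfl
  exact h.Tc (2 * 1) hE hg hT 0 (one_dvd _)

end
end TC

namespace TC
set_option linter.unusedSectionVars false
set_option linter.style.haveILetI false

/-! ### Ideals of norm two -/

section
open scoped nonZeroDivisors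
variable {k K : Type} [Field k] [NumberField k] [Field K] [NumberField K] [Algebra k K]
  {g : K →+* K} {p q n : ℕ} {ζ η s t : K}

theorem oi_bij (φ : K →+* K) : Function.Bijective (oi φ) := by
  refine ⟨oi_inj φ, fun y => ?_⟩
  have hb : Function.Bijective (φ.toRatAlgHom : K →ₐ[ℚ] K) := AlgHom.bijective _
  obtain ⟨x, hx⟩ := hb.2 (algebraMap (𝓞 K) K y)
  have hx : φ x = algebraMap (𝓞 K) K y := hx
  have hi : IsIntegral ℤ x := by
    have : IsIntegral ℤ (φ.toIntAlgHom x) := by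
      rw [show φ.toIntAlgHom x = φ x from rfl, hx]; exact RingOfIntegers.isIntegral_coe y
    exact (isIntegral_algHom_iff φ.toIntAlgHom φ.injective).1 this
  obtain ⟨z, hz⟩ := lift_int hi
  refine ⟨z, ringInt_inj ?_⟩
  rw [coe_oi, hz, hx]

theorem absNorm_map (φ : K →+* K) (I : Ideal (𝓞 K)) :
    Ideal.absNorm (I.map (oi φ)) = Ideal.absNorm I := by
  rw [Ideal.absNorm_apply, Ideal.absNorm_apply, Submodule.cardQuot_apply, Submodule.cardQuot_apply]
  exact Nat.card_congr (Ideal.quotientEquiv I (I.map (oi φ)) (RingEquiv.ofBijective _ (oi_bij φ)) rfl).symm.toEquiv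

theorem two_mem {P : Ideal (𝓞 K)} (hP : Ideal.absNorm P = 2) : (2 : 𝓞 K) ∈ P := by
  have := Ideal.absNorm_mem P
  rw [hP] at this
  exact_mod_cast this

theorem prime_of {P : Ideal (𝓞 K)} (hP : Ideal.absNorm P = 2) : P.IsPrime :=
  Ideal.isPrime_of_irreducible_absNorm (by rw [hP]; exact Nat.prime_two)

theorem ne_bot_of {P : Ideal (𝓞 K)} (hP : Ideal.absNorm P = 2) : P ≠ ⊥ := by
  rintro rfl
  simp at hP

theorem omega_sq {m : ℕ} (hm : m % 8 = 1) {s ω : 𝓞 K} (hs : s ^ 2 = m) (hω : 2 * ω = 1 + s) :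
    ω * (1 - ω) = 2 * (-(m / 8 : ℕ)) := by
  have h2 : (4 : 𝓞 K) ≠ 0 := by norm_num
  apply mul_left_cancel₀ h2
  have h3 : (m : 𝓞 K) = 8 * (m / 8 : ℕ) + 1 := by
    conv_lhs => rw [← Nat.div_add_mod m 8, hm]
    push_cast; rfl
  have h4 : 4 * (ω * (1 - ω)) = 2 * ω * (2 - 2 * ω) := by ring
  rw [h4, hω]
  linear_combination -hs - h3

/-- an automorphism moving `√pq` moves all ideals of norm two -/
theorem swap_ne {m : ℕ} (hm : m % 8 = 1) {s : K} (hs : s ^ 2 = (m : K)) {φ : K →+* K} (hφ : φ s = -s)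
    {P : Ideal (𝓞 K)} (hP : Ideal.absNorm P = 2) : P.map (oi φ) ≠ P := by
  intro h
  obtain ⟨s', hs', hs2⟩ := lift_sq (s := s) (m := (m : ℕ)) (by rw [hs]; simp)
  have hs2 : s' ^ 2 = (m : 𝓞 K) := by simpa using hs2
  obtain ⟨ω, hω⟩ := exists_omega (by omega) hs2
  have h1 := omega_sq hm hs2 hω
  have h2 : oi φ ω = 1 - ω := by
    have h3 := congrArg (oi φ) hω
    rw [map_mul, map_add, map_one, map_ofNat] at h3
    have h4 : oi φ s' = -s' := ringInt_inj (by rw [coe_oi, hs', hφ, map_neg, hs'])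
    apply mul_left_cancel₀ (two_ne_zero (α := 𝓞 K))
    rw [h3, h4]; linear_combination hω
  have hp := prime_of hP
  have h5 : ω * (1 - ω) ∈ P := by rw [h1]; exact P.mul_mem_right _ (two_mem hP)
  have hmap : ∀ x ∈ P, oi φ x ∈ P := fun x hx => by rw [← h]; exact Ideal.mem_map_of_mem _ hx
  have h6 : ω ∈ P ∧ 1 - ω ∈ P := by
    rcases hp.mem_or_mem h5 with h6 | h6
    · exact ⟨h6, h2 ▸ hmap _ h6⟩
    · refine ⟨?_, h6⟩
      have := hmap _ h6
      rw [map_sub, map_one, h2] at this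
      simpa using this
  exact hp.ne_top ((Ideal.eq_top_iff_one _).2 (by simpa using P.add_mem h6.1 h6.2))

theorem sqrt_rat (hpq : PQ p q) (hs : s ^ 2 = ((p * q : ℕ) : K)) (b : ℚ) : algebraMap ℚ K b ≠ s := by
  rintro rfl
  have hb : b ^ 2 = ((p * q : ℕ) : ℚ) := by
    apply (algebraMap ℚ K).injective
    rw [map_pow, hs]; simp
  have := Fact.mk hpq.hp
  have hb0 : b ≠ 0 := by
    rintro rfl
    have := hpq.pos
    have h : ((p * q : ℕ) : ℚ) ≠ 0 := by exact_mod_cast this.ne'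
    exact h (by rw [← hb]; simp)
  refine nsq_two hpq.p8 (locQ (m := q) hpq.not_dvd 2 ?_ (3 / 2) (1 / (2 * b)) 1 one_ne_zero ?_)
  · intro h
    have := Int.le_of_dvd two_pos h
    have := hpq.p8; omega
  · push_cast at hb
    rw [← hb]; field_simp; norm_num

theorem norm_pos {a : ℚ} (ha : a < 0) {y : K} (hy : y ^ 2 = (a : K)) {x : K} (hx : x ≠ 0) : 0 < Algebra.norm ℚ x := by
  obtain ⟨X, Y, h⟩ := norm_form (k := ℚ) ha.ne (by rw [hy]; rfl) (not_rat ha hy) x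
  have h1 : Algebra.norm ℚ x ≠ 0 := by rwa [Ne, Algebra.norm_eq_zero_iff]
  refine lt_of_le_of_ne ?_ h1.symm
  rw [h]
  nlinarith [sq_nonneg X, sq_nonneg Y]

/-- ideals of norm two are not equivalent to ideals with square norm -/
theorem mk_ne (hpq : PQ p q) (hs : s ^ 2 = ((p * q : ℕ) : K)) {a : ℚ} (ha : a < 0) {y : K} (hy : y ^ 2 = (a : K))
    (I J : (Ideal (𝓞 K))⁰) (hI : Ideal.absNorm I.1 = 2) {Z : ℕ} (hJ : Ideal.absNorm J.1 = Z ^ 2) :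
    ClassGroup.mk0 I ≠ ClassGroup.mk0 J := by
  intro h
  obtain ⟨u, v, hu, hv, h1⟩ := ClassGroup.mk0_eq_mk0_iff.1 h
  have h2 := congrArg Ideal.absNorm h1
  rw [map_mul, map_mul, hI, hJ] at h2
  have h2' : (((Ideal.absNorm (Ideal.span {u}) * 2 : ℕ)) : ℚ) = ((Ideal.absNorm (Ideal.span {v}) * Z ^ 2 : ℕ) : ℚ) := by
    exact_mod_cast h2
  push_cast at h2'
  have hu' : algebraMap (𝓞 K) K u ≠ 0 := by simpa using hu
  have hv' : algebraMap (𝓞 K) K v ≠ 0 := by simpa using hv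
  have pu := norm_pos ha hy hu'
  have pv := norm_pos ha hy hv'
  rw [absNorm_span, absNorm_span, abs_of_pos pu, abs_of_pos pv] at h2'
  obtain ⟨X, Y, h3⟩ := norm_form (k := ℚ) (a := ((p * q : ℕ) : ℚ)) (by exact_mod_cast hpq.pos.ne')
    (by rw [hs]; simp) (sqrt_rat hpq hs) (algebraMap (𝓞 K) K u * algebraMap (𝓞 K) K v)
  rw [map_mul] at h3
  have := Fact.mk hpq.hp
  have hZ : (Z : ℚ) ≠ 0 := by
    intro h0
    rw [h0] at h2'
    have : Algebra.norm ℚ (algebraMap (𝓞 K) K u) = 0 := by linarith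
    exact pu.ne' this
  refine nsq_two hpq.p8 (locQ (m := q) hpq.not_dvd 2 ?_ X Y (Algebra.norm ℚ (algebraMap (𝓞 K) K v) * Z / 2) ?_ ?_)
  · intro h
    have := Int.le_of_dvd two_pos h
    have := hpq.p8; omega
  · exact div_ne_zero (mul_ne_zero pv.ne' hZ) two_ne_zero
  · push_cast at h3 ⊢
    rw [← h3]
    linear_combination -(Algebra.norm ℚ (algebraMap (𝓞 K) K v)) / 2 * h2'

/-- splitting of a principal ideal of norm four -/
theorem split_two {m : ℕ} (hm : m % 8 = 1) {s ω π : 𝓞 K} (hs : s ^ 2 = m) (hω : 2 * ω = 1 + s)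
    {φ : K →+* K} (hφs : oi φ s = -s) (hφ : oi φ π = π) (h4 : Ideal.absNorm (Ideal.span {π}) = 4)
    (h2 : π ∣ 2) : Ideal.absNorm (Ideal.span {π, ω}) = 2 := by
  have hφω : oi φ ω = 1 - ω := by
    have h3 := congrArg (oi φ) hω
    rw [map_mul, map_add, map_one, map_ofNat, hφs] at h3
    apply mul_left_cancel₀ (two_ne_zero (α := 𝓞 K))
    rw [h3]; linear_combination hω
  have h5 : (Ideal.span {π, ω}).map (oi φ) = Ideal.span {π, 1 - ω} := by
    rw [Ideal.map_span, Set.image_pair, hφ, hφω]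
  have h6 : Ideal.span {π, ω} * Ideal.span {π, 1 - ω} = Ideal.span {π} := by
    rw [Ideal.span_pair_mul_span_pair]
    apply le_antisymm
    · rw [Ideal.span_le]
      rintro x (rfl | rfl | rfl | rfl)
      · exact Ideal.mem_span_singleton.2 (dvd_mul_right _ _)
      · exact Ideal.mem_span_singleton.2 (dvd_mul_right _ _)
      · exact Ideal.mem_span_singleton.2 (dvd_mul_left _ _)
      · rw [omega_sq hm hs hω]
        exact Ideal.mem_span_singleton.2 (h2.mul_right _)
    · rw [Ideal.span_singleton_le_iff_mem]
      have : π = π * (1 - ω) + ω * π := by ring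
      have h8 := Ideal.add_mem (Ideal.span {π * π, π * (1 - ω), ω * π, ω * (1 - ω)})
        (Ideal.subset_span (Or.inr (Or.inl rfl))) (Ideal.subset_span (Or.inr (Or.inr (Or.inl rfl))))
      rwa [← this] at h8
  have h7 := congrArg Ideal.absNorm h6
  rw [map_mul, ← h5, absNorm_map, h4] at h7
  nlinarith

/-- an ideal of norm two which is fixed by all automorphisms fixing `√pq` -/
theorem exists_two {m : ℕ} (hm : m % 8 = 1) {s π : K} (hs : s ^ 2 = (m : K)) {φ : K →+* K}
    (hφs : φ s = -s) (hφ : φ π = π) (hi : IsIntegral ℤ π) (h4 : |Algebra.norm ℚ π| = 4)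
    (h2 : ∃ y : 𝓞 K, π * algebraMap (𝓞 K) K y = 2)
    (hr : ∀ P : Ideal (𝓞 K), P.IsPrime → (2 : 𝓞 K) ∈ P → ∀ x : 𝓞 K, algebraMap (𝓞 K) K x = π → x ∈ P) :
    ∃ P : Ideal (𝓞 K), Ideal.absNorm P = 2 ∧ ∀ φ : K →+* K, φ s = s → P.map (oi φ) = P := by
  obtain ⟨s', hs', hs2⟩ := lift_sq (s := s) (m := (m : ℕ)) (by rw [hs]; simp)
  have hs2 : s' ^ 2 = (m : 𝓞 K) := by simpa using hs2
  obtain ⟨ω, hω⟩ := exists_omega (by omega) hs2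
  obtain ⟨x, hx⟩ := lift_int hi
  obtain ⟨y, hy⟩ := h2
  have h5 := split_two hm hs2 hω (φ := φ) (π := x) (ringInt_inj (by rw [coe_oi, hs', hφs, map_neg, hs']))
    (ringInt_inj (by rw [coe_oi, hx, hφ])) (absNorm_of (by rw [hx, h4]; norm_num))
    ⟨y, ringInt_inj (by rw [map_mul, hx, hy, map_ofNat])⟩
  refine ⟨_, h5, ?_⟩
  intro ψ hψ
  have h6 : oi ψ ω = ω := by
    have h3 := congrArg (oi ψ) hω
    have h4 : oi ψ s' = s' := ringInt_inj (by rw [coe_oi, hs', hψ])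
    rw [map_mul, map_add, map_one, map_ofNat, h4, ← hω] at h3
    exact mul_left_cancel₀ (two_ne_zero (α := 𝓞 K)) h3
  set P := Ideal.span {x, ω} with hP
  have h7 : Ideal.absNorm (P.map (oi ψ)) = 2 := by rw [absNorm_map, h5]
  have h8 : P ≤ P.map (oi ψ) := by
    conv_lhs => rw [hP]
    rw [Ideal.span_le]
    rintro z (rfl | rfl)
    · exact hr _ (prime_of h7) (two_mem h7) z hx
    · rw [← h6]
      exact Ideal.mem_map_of_mem _ (Ideal.subset_span (by simp))
  have := (prime_of h5).isMaximal (ne_bot_of h5)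
  exact (this.eq_of_le (prime_of h7).ne_top h8).symm

theorem LF.two (h : LF p q n K ζ s) (hpq : PQ p q) : ∃ P : Ideal (𝓞 K), Ideal.absNorm P = 2 ∧
    ∀ φ : K →+* K, φ s = s → P.map (oi φ) = P := by
  obtain ⟨E, z, g, hE, hz, hg, h1, h2⟩ := h.subF hpq
  obtain ⟨z', hz', hz2⟩ := lift_root (by positivity) h.prim
  refine exists_two (π := ζ - 1) hpq.mod8 h.sq h2 (by rw [map_sub, h1, map_one]) ?_ ?_ ?_ ?_
  · exact (h.prim.isIntegral (by positivity)).sub isIntegral_one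
  · rw [norm_zeta (c := 2) h.prim (by rw [h.rank]; ring)]; norm_num
  · have h3 : z' ^ 2 ^ (n + 1) = -1 := by
      have := sq_root h.prim
      rw [← pow_mul, ← pow_succ] at this
      apply ringInt_inj
      rw [map_pow, hz', this, map_neg, map_one]; simp
    have h4 := sub_dvd_pow_sub_pow z' 1 (2 ^ (n + 1))
    rw [h3, one_pow, show (-1 - 1 : 𝓞 K) = -2 by norm_num, dvd_neg] at h4
    obtain ⟨y, hy⟩ := h4
    refine ⟨y, ?_⟩
    have := congrArg (algebraMap (𝓞 K) K) hy
    rw [map_mul, map_sub, map_one, hz', map_ofNat] at this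
    exact this.symm
  · intro P h3 h4 x hx
    have : x = z' - 1 := ringInt_inj (by rw [hx, map_sub, map_one, hz'])
    rw [this]
    exact ram_zeta hz2.pow_eq_one h3 h4

theorem MF.two (h : MF p q K t s) (hpq : PQ p q) : ∃ P : Ideal (𝓞 K), Ideal.absNorm P = 2 ∧
    ∀ φ : K →+* K, φ s = s → P.map (oi φ) = P := by
  obtain ⟨E, z, g, hE, hz, hg, h1, h2⟩ := h.subT hpq
  obtain ⟨t', ht', ht2⟩ := lift_sq (s := t) (m := -2) (by rw [h.tsq]; simp)
  refine exists_two (π := t) hpq.mod8 h.sq h2 h1 ?_ ?_ ⟨-t', ?_⟩ ?_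
  · rw [← ht']; exact RingOfIntegers.isIntegral_coe t'
  · rw [norm_sq (c := 2) (b := -2) (by rw [h.tsq]; simp) (by rw [h.rank])]; norm_num
  · rw [map_neg, ht']; linear_combination -h.tsq
  · intro P h3 h4 x hx
    have : x = t' := ringInt_inj (by rw [hx, ht'])
    rw [this]
    apply h3.mem_of_pow_mem 2
    rw [ht2]; simpa using h4

end
end TC

namespace TC
set_option linter.unusedSectionVars false
set_option linter.style.haveILetI false

/-! ### The class of an ideal of norm two -/

theorem tw_cyc {G : Type*} [CommGroup G] [Finite G] (hT : Nat.card (powMonoidHom 2 : G →* G).ker ∣ 2) {b : G}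
    (hb : b ∈ tw G) (hb2 : ∀ a, b ≠ a ^ 2) {a : G} (ha : a ∈ tw G) : a ∈ Subgroup.zpowers b := by
  have h1 := card_map_mul (powMonoidHom 2 : G →* G) (tw G)
  set S := (tw G).map (powMonoidHom 2 : G →* G) with hS
  have hle : S ≤ tw G := by
    rintro _ ⟨a, ha, rfl⟩
    exact Subgroup.pow_mem _ ha 2
  have h2 : S.relIndex (tw G) ∣ 2 := by
    have h3 : Nat.card S * S.relIndex (tw G) = Nat.card (tw G) := by
      have := Subgroup.relIndex_mul_relIndex ⊥ S (tw G) bot_le hle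
      simpa [Subgroup.relIndex_bot_left] using this
    rw [h1, mul_comm] at h3
    have h4 := Nat.eq_of_mul_eq_mul_right Nat.card_pos h3
    rw [h4]
    exact (Subgroup.card_dvd_of_le inf_le_right).trans hT
  have h3 : ∀ a ∈ tw G, ∃ c ∈ tw G, a * (c ^ 2)⁻¹ ∈ Subgroup.zpowers b := by
    intro a ha
    rcases relIndex_dvd_two' S (tw G) h2 ha hb with h4 | h4 | h4
    · obtain ⟨c, hc, rfl⟩ := h4
      exact ⟨c, hc, by simp⟩
    · obtain ⟨c, hc, h5⟩ := h4
      exact absurd h5.symm (hb2 c)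
    · obtain ⟨c, hc, h5⟩ := h4
      refine ⟨c, hc, ?_⟩
      rw [show c ^ 2 = a * b from h5]
      simp
  have h4 : ∀ m : ℕ, ∀ a ∈ tw G, ∃ c ∈ tw G, a * (c ^ 2 ^ m)⁻¹ ∈ Subgroup.zpowers b := by
    intro m
    induction m with
    | zero => exact fun a ha => ⟨a, ha, by simp⟩
    | succ m ih =>
      intro a ha
      obtain ⟨c, hc, h5⟩ := ih a ha
      obtain ⟨d, hd, h6⟩ := h3 c hc
      refine ⟨d, hd, ?_⟩
      have := mul_mem h5 (pow_mem h6 (2 ^ m))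
      convert this using 1
      rw [mul_pow, inv_pow, ← pow_mul, pow_succ', mul_assoc]
      congr 1
      simp
  obtain ⟨m, hm⟩ := card_tw_pow G
  obtain ⟨c, hc, h5⟩ := h4 m a ha
  have : c ^ 2 ^ m = 1 := by
    have := pow_card_eq_one' (x := (⟨c, hc⟩ : tw G))
    rw [hm] at this
    exact congrArg Subtype.val this
  simpa [this] using h5

section
open scoped nonZeroDivisors
variable {k K : Type} [Field k] [NumberField k] [Field K] [NumberField K] [Algebra k K]
  {g : K →+* K} {p q n : ℕ} {ζ η s t : K}

/-- a nonzero ideal of norm two as a member of the nonzero divisors -/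
def nz (P : Ideal (𝓞 K)) (hP : Ideal.absNorm P = 2) : (Ideal (𝓞 K))⁰ :=
  ⟨P, mem_nonZeroDivisors_iff_ne_zero.2 (ne_bot_of hP)⟩

theorem pow_odd_split {G : Type*} [CommGroup G] {N : ℕ} (hN : Odd N) (x : G) : ∃ y, x ^ N = x * y ^ 2 := by
  obtain ⟨m, rfl⟩ := hN
  exact ⟨x ^ m, by rw [← pow_mul, ← pow_succ', mul_comm]⟩

theorem two_not_sq (hpq : PQ p q) (hs : s ^ 2 = ((p * q : ℕ) : K)) {a : ℚ} (ha : a < 0) {y : K} (hy : y ^ 2 = (a : K))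
    {P : Ideal (𝓞 K)} (hP : Ideal.absNorm P = 2) {N : ℕ} (hN : Odd N) (c : ClassGroup (𝓞 K)) :
    ClassGroup.mk0 (nz P hP) ^ N ≠ c ^ 2 := by
  intro h
  obtain ⟨d, hd⟩ := pow_odd_split hN (ClassGroup.mk0 (nz P hP))
  rw [hd] at h
  obtain ⟨I, hI⟩ := ClassGroup.mk0_surjective (c / d)
  refine mk_ne hpq hs ha hy (nz P hP) (I ^ 2) hP (Z := Ideal.absNorm I.1) ?_ ?_
  · simp
  · rw [map_pow, hI, div_pow, eq_div_iff_mul_eq', h]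

theorem two_not_sq' (hpq : PQ p q) (hs : s ^ 2 = ((p * q : ℕ) : K)) {a : ℚ} (ha : a < 0) {y : K} (hy : y ^ 2 = (a : K))
    {P : Ideal (𝓞 K)} (hP : Ideal.absNorm P = 2) {N : ℕ} (hN : Odd N) (hg : Quad k K g) (c : ClassGroup (𝓞 K))
    (b : ClassGroup (𝓞 k)) :
    ClassGroup.mk0 (nz P hP) ^ N ≠ c ^ 2 * extC (algebraMap k K) b := by
  intro h
  obtain ⟨d, hd⟩ := pow_odd_split hN (ClassGroup.mk0 (nz P hP))
  rw [hd] at h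
  obtain ⟨I, hI⟩ := ClassGroup.mk0_surjective (c / d)
  obtain ⟨B, hB⟩ := ClassGroup.mk0_surjective b
  refine mk_ne hpq hs ha hy (nz P hP) (I ^ 2 * exI (algebraMap k K) B) hP
    (Z := Ideal.absNorm I.1 * Ideal.absNorm B.1) ?_ ?_
  · have h1 : Ideal.absNorm (exI (algebraMap k K) B).1 = Ideal.absNorm B.1 ^ 2 := by
      have := Ideal.absNorm_algebraMap (R := 𝓞 k) (S := 𝓞 K) B.1
      rw [← IsFractionRing.finrank_eq (𝓞 k) k (𝓞 K) K, hg.rank2] at this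
      exact this
    rw [Submonoid.coe_mul, map_mul, h1]; simp [mul_pow]
  · rw [map_mul, map_pow, hI, ← extC_mk0, hB, div_pow, div_mul_eq_mul_div, eq_div_iff_mul_eq', h]

theorem class_fix {P : Ideal (𝓞 K)} (hP : Ideal.absNorm P = 2) {φ : K →+* K} (h : P.map (oi φ) = P) :
    extC φ (ClassGroup.mk0 (nz P hP)) = ClassGroup.mk0 (nz P hP) := by
  rw [extC_mk0]
  congr 1
  exact Subtype.ext h

theorem two_sq {E : Type} [Field E] [NumberField E] [Algebra E K] {J : K →+* K} (hJ : Quad E K J) (hE : OddCl E)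
    {P : Ideal (𝓞 K)} (hP : Ideal.absNorm P = 2) (hPJ : P.map (oi J) = P) {N m : ℕ}
    (hN : Nat.card (ClassGroup (𝓞 K)) ∣ N * 2 ^ m) : (ClassGroup.mk0 (nz P hP) ^ N) ^ 2 = 1 := by
  obtain ⟨i, hi⟩ := mem_tw.1 (pow_N_mem hN (ClassGroup.mk0 (nz P hP)))
  have h1 := hJ.inv_of_odd hE _ hi
  rw [map_pow, class_fix hP hPJ] at h1
  rw [sq]
  nth_rewrite 2 [h1]
  exact mul_inv_cancel _

theorem Quad.norm_two (hg : Quad k K g) {P : Ideal (𝓞 K)} (hP : Ideal.absNorm P = 2) :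
    ∃ (Q : Ideal (𝓞 k)) (hQ : Ideal.absNorm Q = 2), ClassGroup.mk0 (nz P hP) * extC g (ClassGroup.mk0 (nz P hP)) =
      extC (algebraMap k K) (ClassGroup.mk0 (nz Q hQ)) := by
  have hQ : Ideal.absNorm (Ideal.relNorm (𝓞 k) P) = 2 := by rw [Ideal.absNorm_relNorm, hP]
  exact ⟨_, hQ, hg.class_norm0 (nz P hP) (nz _ hQ) rfl⟩

/-- kernel element -/
theorem two_ker (hpq : PQ p q) {s' : k} (hs : s' ^ 2 = ((p * q : ℕ) : k)) {a : ℚ} (ha : a < 0) {y : k}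
    (hy : y ^ 2 = (a : k)) {P : Ideal (𝓞 K)} (hP : Ideal.absNorm P = 2) {N m : ℕ} (hN : Odd N)
    (hNK : Nat.card (ClassGroup (𝓞 k)) ∣ N * 2 ^ m)
    (h2 : (ClassGroup.mk0 (nz P hP) ^ N) ^ 2 = 1) (hg : Quad k K g) (hPg : P.map (oi g) = P) :
    ∃ b ∈ tw (ClassGroup (𝓞 k)), b ≠ 1 ∧ (∀ a, b ≠ a ^ 2) ∧ extC (algebraMap k K) b = 1 := by
  obtain ⟨Q, hQ, h3⟩ := hg.norm_two hP
  have h4 : ∀ a, ClassGroup.mk0 (nz Q hQ) ^ N ≠ a ^ 2 := fun c => two_not_sq hpq hs ha hy hQ hN c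
  refine ⟨ClassGroup.mk0 (nz Q hQ) ^ N, pow_N_mem hNK _, ?_, h4, ?_⟩
  · intro h; exact h4 1 (by rw [h, one_pow])
  · rw [map_pow, ← h3, class_fix hP hPg, ← sq, ← pow_mul, mul_comm, pow_mul, h2]

end
end TC

namespace TC
set_option linter.unusedSectionVars false
set_option linter.style.haveILetI false

/-! ### Ramification at two -/

section
open scoped nonZeroDivisors
variable {k K : Type} [Field k] [NumberField k] [Field K] [NumberField K] [Algebra k K]
  {g : K →+* K} {p q n : ℕ} {ζ η s t : K}

theorem int_of_extI (I : FId k) (x : 𝓞 K) (hx : x ≠ 0) (h : extI (algebraMap k K) I = fI (Ideal.span {x})) :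
    ∃ A : Ideal (𝓞 k), A ≠ ⊥ ∧ I = fI A := by
  have hx' : Ideal.span {x} ≠ ⊥ := by simpa using hx
  have h1 : FractionalIdeal.extended K (oi_le (algebraMap k K)) I.1 ≤ 1 := by
    rw [← coe_extI, h, coe_fI hx']
    exact FractionalIdeal.coeIdeal_le_one
  have h2 : I.1 ≤ 1 := FractionalIdeal.le_one_of_extendedHom_le_one K (𝓞 K) h1
  obtain ⟨A, hA⟩ := FractionalIdeal.le_one_iff_exists_coeIdeal.1 h2
  have hA0 : A ≠ ⊥ := by
    rintro rfl
    exact I.ne_zero (by rw [← hA]; simp)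
  exact ⟨A, hA0, Units.ext (by rw [coe_fI hA0, hA])⟩

theorem ram_gen (hg : Quad k K g) (hpq : PQ p q) {s' : k} (hs : s' ^ 2 = ((p * q : ℕ) : k)) (x : 𝓞 K)
    (hx : Ideal.absNorm (Ideal.span {x}) = 4) {σ : K →+* K} {σ' : k →+* k}
    (hσ : σ.comp (algebraMap k K) = (algebraMap k K).comp σ') (hσx : oi σ x = x) (hσs : σ' s' = -s') (I : FId k) :
    extI (algebraMap k K) I ≠ fI (Ideal.span {x}) := by
  intro h
  have hx0 : x ≠ 0 := by rintro rfl; simp at hx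
  have hx' : Ideal.span {x} ≠ ⊥ := by simpa using hx0
  obtain ⟨A, hA, rfl⟩ := int_of_extI I x hx0 h
  have h1 : A.map (oi (algebraMap k K)) = Ideal.span {x} := by
    rw [extI_fI _ hA] at h
    exact fI_inj (map_ne_bot _ hA) hx' h
  have h2 : Ideal.absNorm A = 2 := by
    have := Ideal.absNorm_algebraMap (R := 𝓞 k) (S := 𝓞 K) A
    rw [← IsFractionRing.finrank_eq (𝓞 k) k (𝓞 K) K, hg.rank2,
      show A.map (algebraMap (𝓞 k) (𝓞 K)) = Ideal.span {x} from h1, hx] at this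
    nlinarith
  refine swap_ne hpq.mod8 hs hσs h2 ?_
  have hA' : A.map (oi σ') ≠ ⊥ := map_ne_bot _ hA
  refine fI_inj hA' hA (extI_inj (algebraMap k K) ?_)
  rw [← extI_fI _ hA, extI_comp, ← hσ, ← extI_comp, h, extI_fI _ hx', Ideal.map_span, Set.image_singleton, hσx]

theorem uext {u v : (𝓞 K)ˣ} (h : algebraMap (𝓞 K) K u = algebraMap (𝓞 K) K v) : u = v :=
  Units.ext (ringInt_inj h)

theorem LF.Z (h : LF p q n K ζ s) : ∃ Z : (𝓞 K)ˣ, algebraMap (𝓞 K) K Z = ζ := by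
  obtain ⟨y, hy, hp⟩ := lift_root (by positivity) h.prim
  exact ⟨(hp.isUnit (by positivity)).unit, hy⟩

theorem LF.root2 (h : LF p q n K ζ s) (hpq : PQ p q) {w : K} {a : ℕ} (hw : w ^ 2 ^ a = 1) : ∃ i : ℕ, w = ζ ^ i := by
  by_cases h1 : w ^ 2 ^ (n + 2) = 1
  · obtain ⟨i, -, hi⟩ := h.prim.eq_pow_of_pow_eq_one h1
    exact ⟨i, hi.symm⟩
  · exfalso
    obtain ⟨b, hb, ho⟩ := (Nat.dvd_prime_pow Nat.prime_two).1 (orderOf_dvd_of_pow_eq_one hw)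
    have h2 : n + 3 ≤ b := by
      by_contra! h3
      apply h1
      rw [← orderOf_dvd_iff_pow_eq_one, ho]
      exact pow_dvd_pow 2 (by omega)
    have h3 : IsPrimitiveRoot w (2 ^ b) := ho ▸ IsPrimitiveRoot.orderOf w
    have h4 : IsPrimitiveRoot (w ^ 2 ^ (b - (n + 3))) (2 ^ (n + 1 + 2)) := h3.pow (by positivity) (by
      rw [← pow_add]; congr 1; omega)
    refine s_notMem hpq.hp hpq.ne_two hpq.not_dvd h4 (s := s) (by rw [h.sq]; simp) ?_
    have ht : ℚ⟮w ^ 2 ^ (b - (n + 3))⟯ = ⊤ := top_of_finrank (by rw [finrank_zeta h4, h.rank])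
    rw [ht]
    trivial

theorem LP.swap (h : LP p q n K η s) (hpq : PQ p q) : ∃ σ : K →+* K, σ η = η ∧ σ s = -s := by
  obtain ⟨g, -, h1, h2⟩ := sub_gen ℚ⟮η⟯ (finrank_eta h.iter) (by rw [h.rank, ← pow_succ]) (h.top hpq)
    (x := s) (by
      rintro y (rfl | rfl)
      · exact Or.inr (mem_adjoin_simple_self ℚ y)
      · exact Or.inl rfl) (zero_mem _) (b := ((p * q : ℕ) : K)) (_root_.natCast_mem _ _) (by rw [h.sq]; ring)
  exact ⟨g, h2 _ (mem_adjoin_simple_self ℚ _), by simpa using h1⟩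

theorem LF.norm_x (h : LF p q n K ζ s) {x : 𝓞 K} (hx : algebraMap (𝓞 K) K x = ζ - 1) :
    Ideal.absNorm (Ideal.span {x}) = 4 :=
  absNorm_of (by rw [hx, norm_zeta (c := 2) h.prim (by rw [h.rank, ← pow_succ])]; norm_num)

theorem LF.conj (h : LF p q n K ζ s) (hpq : PQ p q) {J : K →+* K} (hJ : J ζ = ζ⁻¹) (hJs : J s = s) (φ : K →+* ℂ) (x : K) :
    φ (J x) = (starRingEnd ℂ) (φ x) := by
  have : φ.comp J = (starRingEnd ℂ).comp φ := by
    apply hom_eq_of_top (h.top hpq)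
    rintro y (rfl | rfl)
    · rw [RingHom.comp_apply, RingHom.comp_apply, hJ, map_inv₀]
      refine (Complex.inv_eq_conj ?_)
      exact Complex.norm_eq_one_of_pow_eq_one (n := 2 ^ (n + 2)) (by rw [← map_pow, h.prim.pow_eq_one, map_one]) (by positivity)
    · rw [RingHom.comp_apply, RingHom.comp_apply, hJs]
      exact (conj_sqrt (m := p * q) (by rw [← map_pow, h.sq, map_natCast])).symm
  exact DFunLike.congr_fun this x

theorem LF.unit_form (h : LF p q n K ζ s) (hpq : PQ p q) {J : K →+* K} (hJζ : J ζ = ζ⁻¹) (hJs : J s = s)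
    {e s' : k} (hJ : Quad k K J) (hE : LP p q n k e s') (he : algebraMap k K e = ζ + ζ⁻¹) (hs' : algebraMap k K s' = s)
    {Z : (𝓞 K)ˣ} (hZ : algebraMap (𝓞 K) K Z = ζ) (v : (𝓞 K)ˣ) :
    ∃ (o : ℕ) (i : ℤ) (r : (𝓞 K)ˣ), Odd o ∧ gE J r = r ∧ v ^ o = Z ^ i * r := by
  have hc : ∀ u : (𝓞 K)ˣ, algebraMap (𝓞 K) K (gE J u) = J (algebraMap (𝓞 K) K u) := fun u => rfl
  have hZJ : gE J Z = Z⁻¹ := by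
    rw [eq_inv_iff_mul_eq_one]
    apply uext
    rw [Units.val_mul, map_mul, hc, hZ, hJζ, inv_mul_cancel₀ h.ne0]; simp
  have hne : ∀ u : (𝓞 K)ˣ, algebraMap (𝓞 K) K u ≠ 0 := fun u => by
    simpa using u.ne_zero
  obtain ⟨N, hN, h1⟩ := NumberField.Embeddings.pow_eq_one_of_norm_eq_one K ℂ
    (x := algebraMap (𝓞 K) K (v / gE J v : (𝓞 K)ˣ)) (RingOfIntegers.isIntegral_coe _) (by
      intro φ
      have h2 : algebraMap (𝓞 K) K (v / gE J v : (𝓞 K)ˣ) * J (algebraMap (𝓞 K) K v) = algebraMap (𝓞 K) K v := by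
        rw [← hc, ← map_mul, ← Units.val_mul, div_mul_cancel]
      have h3 := congrArg (fun x => ‖φ x‖) h2
      simp only [map_mul, norm_mul, h.conj hpq hJζ hJs] at h3
      rw [RCLike.norm_conj] at h3
      refine mul_right_cancel₀ (b := ‖φ (algebraMap (𝓞 K) K v)‖) ?_ (by rw [h3, one_mul])
      rw [norm_ne_zero_iff]
      exact (map_ne_zero φ).2 (hne v))
  obtain ⟨a, o, ho, rfl⟩ := Nat.exists_eq_two_pow_mul_odd hN.ne'
  obtain ⟨j, hj⟩ := h.root2 hpq (w := algebraMap (𝓞 K) K (v / gE J v : (𝓞 K)ˣ) ^ o) (a := a) (by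
    rw [← pow_mul, mul_comm, h1])
  have hV : v ^ o = Z ^ j * gE J (v ^ o) := by
    have : (v / gE J v) ^ o = Z ^ j := uext (by simp only [Units.val_pow_eq_pow_val, map_pow, hj, hZ])
    rw [← this, div_pow, ← map_pow, div_mul_cancel]
  set V := v ^ o with hVd
  rcases Nat.even_or_odd' j with ⟨i, rfl | rfl⟩
  · refine ⟨o, i, Z ^ (-(i : ℤ)) * V, ho, ?_, by rw [← mul_assoc, ← zpow_add]; simp [hVd]⟩
    rw [map_mul, map_zpow, hZJ]
    nth_rewrite 2 [hV]
    rw [← mul_assoc, inv_zpow', neg_neg, ← zpow_natCast, ← zpow_add]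
    congr 2; push_cast; ring
  · exfalso
    have hx : algebraMap (𝓞 K) K ((Z : 𝓞 K) - 1) = ζ - 1 := by rw [map_sub, hZ, map_one]
    have hm1 : Z ^ 2 ^ (n + 1) = -1 := uext (by
      have := sq_root h.prim
      rw [← pow_mul, ← pow_succ] at this
      simp only [Units.val_pow_eq_pow_val, map_pow, hZ, this]; simp)
    set y := ζ ^ ((2 : ℤ) ^ n - i - 1) * algebraMap (𝓞 K) K V * (ζ - 1) with hy
    have hζ0 := h.ne0
    have hz1 : ζ - 1 ≠ 0 := by
      intro h0
      have := h.prim.ne_one (Nat.one_lt_two_pow (by omega))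
      exact this (by linear_combination h0)
    have hy0 : y ≠ 0 := mul_ne_zero (mul_ne_zero (zpow_ne_zero _ hζ0) (hne V)) hz1
    have hJy : J y = y := by
      have h5 : algebraMap (𝓞 K) K V = ζ ^ (2 * i + 1) * J (algebraMap (𝓞 K) K V) := by
        have := congrArg (fun u : (𝓞 K)ˣ => algebraMap (𝓞 K) K u) hV
        simpa [hc, hZ] using this
      have h6 : ζ ^ ((2 : ℤ) ^ n * 2) = -1 := by
        have := congrArg (fun u : (𝓞 K)ˣ => algebraMap (𝓞 K) K u) hm1
        simp only [Units.val_pow_eq_pow_val, map_pow, hZ] at this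
        rw [show (2 : ℤ) ^ n * 2 = ((2 ^ (n + 1) : ℕ) : ℤ) by push_cast; ring, zpow_natCast, this]; simp
      rw [hy, map_mul, map_mul, map_zpow₀, hJζ, map_sub, map_one, hJζ]
      nth_rewrite 2 [h5]
      set W := J (algebraMap (𝓞 K) K V)
      have h7 : ζ⁻¹ - 1 = - ζ⁻¹ * (ζ - 1) := by field_simp; ring
      have h8 : (ζ⁻¹ : K) ^ ((2 : ℤ) ^ n - i - 1) * (- ζ⁻¹) = ζ ^ ((2 : ℤ) ^ n - i - 1) * ζ ^ (2 * i + 1) := by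
        rw [neg_eq_neg_one_mul, ← h6, inv_zpow', ← zpow_natCast ζ (2 * i + 1), ← zpow_neg_one ζ, ← zpow_add₀ hζ0, ← zpow_add₀ hζ0, ← zpow_add₀ hζ0]
        congr 1; push_cast; ring
      rw [h7]
      linear_combination (W * (ζ - 1)) * h8
    obtain ⟨y', hy'⟩ := hJ.fix _ hJy
    have hy'0 : y' ≠ 0 := by rintro rfl; exact hy0 (by rw [← hy', map_zero])
    obtain ⟨E1, z1, σ, -, -, -, hσ1, hσ2⟩ := h.subF hpq
    obtain ⟨σ', hs1, hs2⟩ := hE.swap hpq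
    have hx0 : (Z : 𝓞 K) - 1 ≠ 0 := by intro h0; rw [h0, map_zero] at hx; exact hz1 hx.symm
    refine ram_gen hJ hpq hE.sq ((Z : 𝓞 K) - 1) (h.norm_x hx) (σ := σ) (σ' := σ') ?_ ?_ hs2 (pr (Units.mk0 y' hy'0)) ?_
    · apply hom_eq_of_top (hE.top hpq)
      rintro y (rfl | rfl)
      · rw [RingHom.comp_apply, RingHom.comp_apply, hs1, he, map_add, map_inv₀, hσ1]
      · rw [RingHom.comp_apply, RingHom.comp_apply, hs2, map_neg, hs', hσ2]
    · apply ringInt_inj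
      rw [coe_oi, hx, map_sub, hσ1, map_one]
    · rw [extI_pr, fI_span hx0, ← div_eq_one, ← map_div, ker_pr]
      refine ⟨Z ^ ((2 : ℤ) ^ n - i - 1) * V, ?_⟩
      rw [eq_div_iff_mul_eq']
      have hZz : ∀ m : ℤ, algebraMap (𝓞 K) K ((Z ^ m : (𝓞 K)ˣ) : 𝓞 K) = ζ ^ m := by
        intro m
        have := map_zpow (Units.map (algebraMap (𝓞 K) K : 𝓞 K →* K)) Z m
        have := congrArg Units.val this
        rw [Units.val_zpow_eq_zpow_val] at this
        rw [← hZ]; exact this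
      ext
      simp only [Units.val_mul, Units.coe_map, Units.val_mk0, map_mul, MonoidHom.coe_coe, hy', hy, hZz, hx]

theorem LF.h0 (h : LF p q (n + 1) K ζ s) (hpq : PQ p q) {z s' : k} (hk : LF p q n k z s')
    (hz : algebraMap k K z = ζ ^ 2) (hs' : algebraMap k K s' = s) (hg : Quad k K g) (hgζ : g ζ = -ζ) (hgs : g s = s) :
    TC.h0 (gE g) ∣ 2 := by
  obtain ⟨Z, hZ⟩ := h.Z
  obtain ⟨Y, hY⟩ := hk.Z
  obtain ⟨F, f, sf, Jk, hF, hf, hsf, hJk, hJkz, hJks⟩ := hk.subP hpq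
  obtain ⟨E, e, se, J, hE, he, hse, hJ, hJζ, hJs⟩ := h.subP hpq
  obtain ⟨B, b, sb, g', hB, hb, hsb, hg', hge⟩ := hE.sub hpq
  have hgs' : g' se = se := by
    have : algebraMap B E sb = se := hsb
    rw [← this]; exact hg'.comm _
  have hm1 : Z ^ 2 ^ (n + 2) = -1 := uext (by
    have := sq_root h.prim
    rw [← pow_mul, ← pow_succ] at this
    simp only [Units.val_pow_eq_pow_val, map_pow, hZ, this]; simp)
  have hgZ : gE g Z = -Z := uext (by
    change g (algebraMap (𝓞 K) K Z) = _
    rw [hZ, hgζ, Units.val_neg, map_neg, hZ])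
  set H := (nmS (gE g)).range with hH
  have hZH : Z ^ 2 ∈ H := by
    refine ⟨Z ^ (2 ^ (n + 1) + 1), ?_⟩
    rw [nmS_apply, map_pow, hgZ]
    have h1 : Odd (2 ^ (n + 1) + 1) := Even.add_one (by simp [Nat.even_pow])
    rw [h1.neg_pow, ← neg_one_mul, ← hm1]
    rw [← pow_add, ← pow_add]
    have h2 : Z ^ 2 ^ (n + 3) = 1 := by rw [pow_succ, pow_mul, hm1]; simp
    have : 2 ^ (n + 1) + 1 + (2 ^ (n + 2) + (2 ^ (n + 1) + 1)) = 2 ^ (n + 3) + 2 := by ring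
    rw [this, pow_add, h2, one_mul]
  have hodd : ∀ (o : ℕ) (a : (𝓞 K)ˣ), Odd o → a ∈ fixS (gE g) → (a ^ o ∈ H ↔ a ∈ H) := by
    intro o a ho ha
    obtain ⟨m, rfl⟩ := ho
    have h1 : a ^ (2 * m) ∈ H := by
      rw [pow_mul']
      exact sq_fix_le _ (mem_sqS.2 ⟨a ^ m, Subgroup.pow_mem _ ha _, rfl⟩)
    rw [pow_succ]
    exact Subgroup.mul_mem_cancel_left _ h1
  have hcJ : J.comp (algebraMap k K) = (algebraMap k K).comp Jk := by
    apply hom_eq_of_top (hk.top hpq)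
    rintro y (rfl | rfl)
    · rw [RingHom.comp_apply, RingHom.comp_apply, hJkz, hz, map_inv₀, hz, map_pow, hJζ, inv_pow]
    · rw [RingHom.comp_apply, RingHom.comp_apply, hJks, hs', hJs]
  have hcg : g.comp (algebraMap E K) = (algebraMap E K).comp g' := by
    apply hom_eq_of_top (hE.top hpq)
    have he : algebraMap E K e = ζ + ζ⁻¹ := he
    have hse : algebraMap E K se = s := hse
    rintro y (rfl | rfl)
    · rw [RingHom.comp_apply, RingHom.comp_apply, hge, map_neg, he, map_add, map_inv₀, hgζ, inv_neg]; ring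
    · rw [RingHom.comp_apply, RingHom.comp_apply, hgs', hse, hgs]
  set jE : (𝓞 E)ˣ →* (𝓞 K)ˣ := Units.map (algebraMap (𝓞 E) (𝓞 K) : 𝓞 E →* 𝓞 K) with hjE
  have hjg : ∀ r, gE g (jE r) = jE (gE g' r) := by
    intro r
    apply uext
    exact DFunLike.congr_fun hcg (algebraMap (𝓞 E) E r)
  have hjinj : Function.Injective jE := by
    intro r r' hr
    apply uext
    apply (algebraMap E K).injective
    exact congrArg (fun u : (𝓞 K)ˣ => algebraMap (𝓞 K) K u) hr
  have hjH : ∀ r ∈ (nmS (gE g')).range, jE r ∈ H := by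
    rintro _ ⟨y, rfl⟩
    exact ⟨jE y, by rw [nmS_apply, nmS_apply, map_mul, hjg]⟩
  have key : ∀ a ∈ fixS (gE g), ∃ (o : ℕ) (r : (𝓞 E)ˣ) (w : (𝓞 K)ˣ), Odd o ∧ w ∈ H ∧ r ∈ fixS (gE g') ∧ a ^ o = w * jE r := by
    intro a ha
    rw [hg.fixE] at ha
    obtain ⟨a0, rfl⟩ := ha
    obtain ⟨o, i, r, ho, hr, ha0⟩ := hk.unit_form hpq hJkz hJks hJk hF hf hsf hY a0
    set jk : (𝓞 k)ˣ →* (𝓞 K)ˣ := Units.map (algebraMap (𝓞 k) (𝓞 K) : 𝓞 k →* 𝓞 K) with hjk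
    have h1 : jk r ∈ fixS (gE J) := by
      apply uext
      have h2 := DFunLike.congr_fun hcJ (algebraMap (𝓞 k) k r)
      refine Eq.trans h2 ?_
      have h3 := congrArg (fun u : (𝓞 k)ˣ => algebraMap k K (algebraMap (𝓞 k) k u)) hr
      exact h3
    have h1g : gE g (jk r) = jk r := by
      have : jk r ∈ fixS (gE g) := by rw [hg.fixE]; exact ⟨r, rfl⟩
      exact this
    rw [hJ.fixE] at h1
    obtain ⟨r', hr'⟩ := h1
    have hr' : jE r' = jk r := hr'
    have hYZ : jk Y = Z ^ 2 := by
      apply uext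
      rw [Units.val_pow_eq_pow_val, map_pow, hZ, ← hz, ← hY]; rfl
    refine ⟨o, r', (Z ^ 2) ^ i, ho, Subgroup.zpow_mem _ hZH i, ?_, ?_⟩
    · apply hjinj
      rw [← hjg, hr', h1g]
    · rw [hr', ← map_pow, ha0, map_mul, map_zpow, hYZ]
  apply relIndex_dvd_two
  intro a ha b hb
  obtain ⟨o, r, w, ho, hw, hr, h1⟩ := key a ha
  obtain ⟨o', r', w', ho', hw', hr', h1'⟩ := key b hb
  rcases relIndex_dvd_two' _ _ (hE.h0 hB hpq hg' hge) hr hr' with h2 | h2 | h2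
  · left
    rw [← hodd o a ho ha, h1]
    exact mul_mem hw (hjH _ h2)
  · right; left
    rw [← hodd o' b ho' hb, h1']
    exact mul_mem hw' (hjH _ h2)
  · right; right
    have h3 : a ^ o * b ^ o' ∈ H := by
      rw [h1, h1', mul_mul_mul_comm, ← map_mul]
      exact mul_mem (mul_mem hw hw') (hjH _ h2)
    obtain ⟨m, rfl⟩ := ho
    obtain ⟨m', rfl⟩ := ho'
    have h4 : (a ^ m * b ^ m') ^ 2 ∈ H :=
      sq_fix_le _ (mem_sqS.2 ⟨_, mul_mem (Subgroup.pow_mem _ ha _) (Subgroup.pow_mem _ hb _), rfl⟩)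
    have h5 : a ^ (2 * m + 1) * b ^ (2 * m' + 1) = (a ^ m * b ^ m') ^ 2 * (a * b) := by
      rw [mul_pow, ← pow_mul, ← pow_mul, pow_succ, pow_succ, mul_comm 2, mul_comm 2, mul_mul_mul_comm]
    rw [h5] at h3
    exact (Subgroup.mul_mem_cancel_left _ h4).1 h3

end
end TC

namespace TC
set_option linter.unusedSectionVars false
set_option linter.style.haveILetI false

/-! ### The capitulation kernels -/

section
open scoped nonZeroDivisors
variable {k K : Type} [Field k] [NumberField k] [Field K] [NumberField K] [Algebra k K]
  {g : K →+* K} {p q n : ℕ} {ζ η s t : K}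

theorem prim_eight {y : K} (h : y ^ 4 = -1) : IsPrimitiveRoot y (2 ^ (1 + 2)) := by
  have : orderOf y = 2 ^ (2 + 1) := by
    apply orderOf_eq_prime_pow
    · norm_num [h]
    · norm_num
      rw [show y ^ 8 = (y ^ 4) ^ 2 by ring, h]; norm_num
  have h2 := IsPrimitiveRoot.orderOf y
  rw [this] at h2
  exact h2

theorem MF.no_i (h : MF p q K t s) (hpq : PQ p q) (u : K) : u ^ 2 ≠ -1 := by
  intro hu
  have ht : t ≠ 0 := by
    rintro rfl
    have := h.tsq
    norm_num at this
  have h1 : ((1 + u) / t) ^ 4 = -1 := by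
    have : t ^ 4 = 4 := by rw [show t ^ 4 = (t ^ 2) ^ 2 by ring, h.tsq]; norm_num
    rw [div_pow, this]
    linear_combination (u ^ 2 + 4 * u + 5) / 4 * hu
  have h2 := prim_eight h1
  refine s_notMem hpq.hp hpq.ne_two hpq.not_dvd h2 (s := s) (by rw [h.sq]; simp) ?_
  have ht : ℚ⟮(1 + u) / t⟯ = ⊤ := top_of_finrank (by rw [finrank_zeta h2, h.rank]; norm_num)
  rw [ht]
  trivial

theorem LF.four (h : LF p q 1 K ζ s) : ζ ^ 4 = -1 := by
  have := sq_root h.prim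
  rw [← pow_mul] at this; simpa using this

theorem LF.h0M (h : LF p q 1 K ζ s) (hpq : PQ p q) {t s' : k} (hk : MF p q k t s')
    (hg : Quad k K g) (hgζ : g ζ = ζ ^ 3) : TC.h0 (gE g) ∣ 2 := by
  have := hk.tc
  obtain ⟨Z, hZ⟩ := h.Z
  set jk : (𝓞 k)ˣ →* (𝓞 K)ˣ := Units.map (algebraMap (𝓞 k) (𝓞 K) : 𝓞 k →* 𝓞 K) with hjk
  set H := (nmS (gE g)).range with hH
  set S := sqS (⊤ : Subgroup (𝓞 k)ˣ) with hS
  have h1 : S.index = 4 := by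
    rw [hS, index_sq_units]
    have := rank_TC k
    rw [hk.rank] at this
    rw [show Units.rank k + 1 = 2 by omega]; norm_num
  have h2 : (-1 : (𝓞 k)ˣ) ∉ S := by
    intro h3
    obtain ⟨u, -, hu⟩ := mem_sqS.1 h3
    apply hk.no_i hpq (algebraMap (𝓞 k) k u)
    rw [← map_pow, ← Units.val_pow_eq_pow_val, hu]; simp
  have h3 : S ≤ H.comap jk := by
    intro x hx
    obtain ⟨u, -, rfl⟩ := mem_sqS.1 hx
    rw [Subgroup.mem_comap, map_pow]
    refine sq_fix_le _ (mem_sqS.2 ⟨jk u, ?_, rfl⟩)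
    rw [hg.fixE]; exact ⟨u, rfl⟩
  have h4 : (-1 : (𝓞 k)ˣ) ∈ H.comap jk := by
    rw [Subgroup.mem_comap]
    refine ⟨Z, uext ?_⟩
    have : algebraMap (𝓞 K) K (gE g Z) = ζ ^ 3 := by rw [← hgζ, ← hZ]; rfl
    rw [nmS_apply, Units.val_mul, map_mul, this, hZ]
    have h5 := h.four
    have : algebraMap (𝓞 K) K (jk (-1)) = -1 := by
      simp [hjk]
    rw [this, ← h5]; ring
  have h5 := Subgroup.relIndex_mul_index h3
  rw [h1] at h5
  have h6 : (TC.h0 (gE g)) = (H.comap jk).index := by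
    rw [Subgroup.index_comap, TC.h0, hg.fixE]
  rw [h6]
  have h7 : S.relIndex (H.comap jk) ≠ 1 := by
    rw [Ne, Subgroup.relIndex_eq_one]
    exact fun h => h2 (h h4)
  have h8 : (H.comap jk).index ∣ 2 ^ 2 := ⟨_, by rw [mul_comm]; exact h5.symm⟩
  obtain ⟨i, hi, h9⟩ := (Nat.dvd_prime_pow Nat.prime_two).1 h8
  rw [h9] at h5 ⊢
  interval_cases i
  · norm_num
  · norm_num
  · exfalso; omega

theorem LF.ker_two (h : LF p q n K ζ s) (hpq : PQ p q) (hg : Quad k K g) (hh : TC.h0 (gE g) ∣ 2) (hk : IsTotallyComplex k)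
    {s' : k} (hs : s' ^ 2 = ((p * q : ℕ) : k)) {σ : K →+* K} {σ' : k →+* k} (hσζ : σ ζ = ζ)
    (hσ : σ.comp (algebraMap k K) = (algebraMap k K).comp σ') (hσs : σ' s' = -s') {j : ℕ} (hj : g ζ = ζ ^ j) :
    Nat.card (extC (algebraMap k K)).ker ∣ 2 := by
  have := h.tc
  obtain ⟨Z, hZ⟩ := h.Z
  have hx : algebraMap (𝓞 K) K ((Z : 𝓞 K) - 1) = ζ - 1 := by rw [map_sub, hZ, map_one]
  have hN := h.norm_x hx
  set x := (Z : 𝓞 K) - 1 with hxd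
  have hx0 : x ≠ 0 := by intro h0; rw [h0] at hN; simp at hN
  have h1 := hg.ker_dvd_two (Units.mk0 (algebraMap (𝓞 K) K x) (by simpa using hx0)) ?_ ?_
  · rw [hg.h1_TC] at h1
    exact (Nat.dvd_of_mul_dvd_mul_left (by norm_num) h1).trans hh
  · have hxd' : x ∣ oi g x := by
      have : oi g x = (Z : 𝓞 K) ^ j - 1 := by
        apply ringInt_inj
        rw [coe_oi, hx, map_sub, map_one, hj, map_sub, map_pow, hZ, map_one]
      rw [this]
      simpa using sub_dvd_pow_sub_pow (Z : 𝓞 K) 1 j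
    have hxd2 : oi g x ∣ x := by
      have := map_dvd (oi g) hxd'
      rwa [hg.oi_invol] at this
    rw [← fI_span hx0, extI_fI _ (by simpa using hx0), Ideal.map_span, Set.image_singleton,
      Ideal.span_singleton_eq_span_singleton.2 (associated_of_dvd_dvd hxd2 hxd')]
  · rintro ⟨I, hI⟩
    refine ram_gen hg hpq hs x hN hσ ?_ hσs I ?_
    · apply ringInt_inj
      rw [coe_oi, hx, map_sub, hσζ, map_one]
    · rw [hI, fI_span hx0]

theorem LF.kerL (h : LF p q (n + 1) K ζ s) (hpq : PQ p q) {z s' : k} (hk : LF p q n k z s')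
    (hz : algebraMap k K z = ζ ^ 2) (hs' : algebraMap k K s' = s) (hg : Quad k K g) (hgζ : g ζ = -ζ) (hgs : g s = s) :
    Nat.card (extC (algebraMap k K)).ker ∣ 2 := by
  obtain ⟨E1, z1, σ, -, -, -, hσ1, hσ2⟩ := h.subF hpq
  obtain ⟨E2, z2, σ', -, -, -, hσ3, hσ4⟩ := hk.subF hpq
  refine h.ker_two hpq hg (h.h0 hpq hk hz hs' hg hgζ hgs) hk.tc hk.sq hσ1 (σ' := σ') ?_ hσ4 (j := 2 ^ (n + 2) + 1) ?_
  · apply hom_eq_of_top (hk.top hpq)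
    rintro y (rfl | rfl)
    · rw [RingHom.comp_apply, RingHom.comp_apply, hσ3, hz, map_pow, hσ1]
    · rw [RingHom.comp_apply, RingHom.comp_apply, hσ4, map_neg, hs', hσ2]
  · have := sq_root h.prim
    rw [← pow_mul, ← pow_succ] at this
    rw [hgζ, pow_succ, this]; simp

theorem LF.kerM (h : LF p q 1 K ζ s) (hpq : PQ p q) {t s' : k} (hk : MF p q k t s')
    (ht : algebraMap k K t = ζ + ζ ^ 3) (hs' : algebraMap k K s' = s) (hg : Quad k K g) (hgζ : g ζ = ζ ^ 3) :
    Nat.card (extC (algebraMap k K)).ker ∣ 2 := by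
  obtain ⟨E1, z1, σ, -, -, -, hσ1, hσ2⟩ := h.subF hpq
  obtain ⟨E2, z2, σ', -, -, -, hσ3, hσ4⟩ := hk.subT hpq
  refine h.ker_two hpq hg (h.h0M hpq hk hg hgζ) hk.tc hk.sq hσ1 (σ' := σ') ?_ hσ4 hgζ
  apply hom_eq_of_top (hk.top hpq)
  rintro y (rfl | rfl)
  · rw [RingHom.comp_apply, RingHom.comp_apply, hσ3, ht, map_add, map_pow, hσ1]
  · rw [RingHom.comp_apply, RingHom.comp_apply, hσ4, map_neg, hs', hσ2]

end
end TC

namespace TC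
set_option linter.unusedSectionVars false
set_option linter.style.haveILetI false

/-! ### The doubling step -/

section
open scoped nonZeroDivisors
variable {k K : Type} [Field k] [NumberField k] [Field K] [NumberField K] [Algebra k K]
  {g : K →+* K} {p q n : ℕ} {ζ η s t : K}

theorem lift_hom {Ω : Type} [Field Ω] [IsAlgClosed Ω] [CharZero Ω] (f : k →+* Ω) :
    ∃ ψ : K →+* Ω, ψ.comp (algebraMap k K) = f := by
  letI : Algebra k Ω := f.toAlgebra
  haveI : Algebra.IsAlgebraic k K := Algebra.IsAlgebraic.tower_top (K := ℚ) k
  exact ⟨(IsAlgClosed.lift (R := k) (S := K) (M := Ω)).toRingHom, RingHom.ext fun x =>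
    AlgHom.commutes (IsAlgClosed.lift (R := k) (S := K) (M := Ω)) x⟩

theorem pull_hom {Ω : Type} [Field Ω] [CharZero Ω] [Algebra K Ω] (ψ : K →+* Ω) {S : Set K}
    (hS : IntermediateField.adjoin ℚ S = ⊤) (h : ∀ x ∈ S, ∃ y, ψ x = algebraMap K Ω y) :
    ∃ φ : K →+* K, ∀ x, algebraMap K Ω (φ x) = ψ x := by
  have h1 : ∀ x, ∃ y, algebraMap K Ω y = ψ x := by
    intro x
    have hx : x ∈ IntermediateField.adjoin ℚ S := by rw [hS]; trivial
    have := map_mem_adjoin ψ (E := (IsScalarTower.toAlgHom ℚ K Ω).fieldRange) (fun x hx => by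
      obtain ⟨y, hy⟩ := h x hx
      exact ⟨y, hy.symm⟩) hx
    exact this
  choose φ hφ using h1
  have hinj := (algebraMap K Ω).injective
  exact ⟨{ toFun := φ
           map_one' := hinj (by rw [hφ]; simp)
           map_zero' := hinj (by rw [hφ]; simp)
           map_add' := fun x y => hinj (by rw [hφ, map_add, map_add, hφ, hφ])
           map_mul' := fun x y => hinj (by rw [hφ, map_mul, map_mul, hφ, hφ]) }, hφ⟩

theorem LF.quarter (h : LF p q (n + 2) K ζ s) (hpq : PQ p q) : ∃ φ : K →+* K, φ (φ ζ) = -ζ ∧ φ s = s := by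
  obtain ⟨E, z, s', g, hE, hz, hs', hg, hgζ, hgs⟩ := h.subL hpq
  obtain ⟨F, y, s2, τ, hF, hy, hs2, hτ, hτz, hτs⟩ := hE.subL hpq
  have hz : algebraMap E K z = ζ ^ 2 := hz
  have hs' : algebraMap E K s' = s := hs'
  have : Algebra.IsAlgebraic ℚ (AlgebraicClosure K) := Algebra.IsAlgebraic.trans ℚ K _
  set A := algebraMap K (AlgebraicClosure K) with hA
  obtain ⟨ψ, hψ⟩ := lift_hom (K := K) (A.comp ((algebraMap E K).comp τ))
  have hψ' : ∀ x, ψ (algebraMap E K x) = A (algebraMap E K (τ x)) := fun x => DFunLike.congr_fun hψ x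
  have hψs : ψ s = A s := by rw [← hs', hψ', hτs]
  set i := ζ ^ 2 ^ (n + 2) with hi
  have hi2 : i ^ 2 = -1 := by
    have := sq_root h.prim
    simpa using this
  have hψζ : ψ ζ ^ 2 = A (i * ζ) ^ 2 := by
    rw [← map_pow, ← map_pow, ← hz, hψ', hτz, map_neg, hz, mul_pow, hi2, neg_one_mul]
  have h1 : ∃ w, w ^ 2 = -1 ∧ ψ ζ = A (w * ζ) ∧ (w = i ∨ w = -i) := by
    rcases sq_eq_sq_iff_eq_or_eq_neg.1 hψζ with h1 | h1
    · exact ⟨i, hi2, h1, Or.inl rfl⟩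
    · exact ⟨-i, by rw [neg_sq, hi2], by rw [h1, ← map_neg, neg_mul], Or.inr rfl⟩
  obtain ⟨w, hw, h2, h3⟩ := h1
  obtain ⟨φ, hφ⟩ := pull_hom ψ (h.top hpq) (by
    rintro x (rfl | rfl)
    · exact ⟨_, h2⟩
    · exact ⟨_, hψs⟩)
  have hφζ : φ ζ = w * ζ := A.injective (by rw [hφ, h2])
  have hφs : φ s = s := A.injective (by rw [hφ, hψs])
  have hφi : φ i = i := by
    rw [hi, map_pow, hφζ, mul_pow]
    have : w ^ 2 ^ (n + 2) = 1 := by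
      rw [pow_succ', pow_succ', pow_mul, hw, pow_mul]; simp
    rw [this, one_mul]
  have hφw : φ w = w := by
    rcases h3 with rfl | rfl
    · exact hφi
    · rw [map_neg, hφi]
  refine ⟨φ, ?_, hφs⟩
  rw [hφζ, map_mul, hφw, hφζ, ← mul_assoc, ← pow_two, hw, neg_one_mul]

/-- properties of the distinguished class of order two -/
theorem LF.cls (h : LF p q n K ζ s) (hpq : PQ p q) {P : Ideal (𝓞 K)} (hP : Ideal.absNorm P = 2)
    (hPφ : ∀ φ : K →+* K, φ s = s → P.map (oi φ) = P) {N m : ℕ}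
    (hN : Nat.card (ClassGroup (𝓞 K)) ∣ N * 2 ^ m) : (ClassGroup.mk0 (nz P hP) ^ N) ^ 2 = 1 := by
  obtain ⟨E, e, se, J, hE, he, hse, hJ, hJζ, hJs⟩ := h.subP hpq
  exact two_sq hJ (hE.odd hpq) hP (hPφ J hJs) hN

theorem LF.dbl (h : LF p q (n + 1) K ζ s) (hpq : PQ p q) (hg : Quad k K g) {s' y : k}
    (hs : s' ^ 2 = ((p * q : ℕ) : k)) {a : ℚ} (ha : a < 0) (hy : y ^ 2 = (a : k)) (hgs : g s = s)
    (hker : Nat.card (extC (algebraMap k K)).ker ∣ 2)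
    (hN : ∀ c : ClassGroup (𝓞 K), c ^ 2 = 1 → (∀ a, c ≠ a ^ 2) → (∀ φ : K →+* K, φ s = s → extC φ c = c) →
      ∀ a ∈ tw (ClassGroup (𝓞 K)), a * extC g a = 1 → a ^ 2 = 1)
    (hX : ∀ (P : Ideal (𝓞 K)) (hP : Ideal.absNorm P = 2), ∃ x : ClassGroup (𝓞 K), ∀ a b (e : ℕ),
      x ≠ a ^ 2 * ClassGroup.mk0 (nz P hP) ^ e * extC (algebraMap k K) b) :
    Nat.card (tw (ClassGroup (𝓞 K))) = 2 * Nat.card (tw (ClassGroup (𝓞 k))) := by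
  obtain ⟨N, m, hNo, hNd, -⟩ := exists_N (Nat.card (ClassGroup (𝓞 K)) * Nat.card (ClassGroup (𝓞 k)))
    (Nat.mul_ne_zero Nat.card_pos.ne' Nat.card_pos.ne')
  have hG := (Nat.dvd_mul_right (Nat.card (ClassGroup (𝓞 K))) (Nat.card (ClassGroup (𝓞 k)))).trans hNd
  have hH := (Nat.dvd_mul_left (Nat.card (ClassGroup (𝓞 k))) (Nat.card (ClassGroup (𝓞 K)))).trans hNd
  obtain ⟨P, hP, hPφ⟩ := h.two hpq
  have h2 := h.cls hpq hP hPφ hG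
  have hroot := sq_root h.prim
  have hn1 : (-1 : ℚ) < 0 := by norm_num
  obtain ⟨b, hb1, hb2, -, hb3⟩ := two_ker hpq hs ha hy hP hNo hH h2 hg (hPφ g hgs)
  obtain ⟨x, hx⟩ := hX P hP
  refine doubling (extC (algebraMap k K)) (extC g) (h.T1 hpq) h2
    (fun a b => two_not_sq' hpq h.sq hn1 hroot hP hNo hg a b) ⟨b, hb1, hb2, hb3⟩ hker hg.class_norm
    (hN _ h2 (fun a => two_not_sq hpq h.sq hn1 hroot hP hNo a) ?_) ⟨x, fun a b e => ?_⟩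
  · intro φ hφ
    rw [map_pow, class_fix hP (hPφ φ hφ)]
  · rw [← pow_mul]; exact hx a b _

theorem LF.dblL (h : LF p q (n + 2) K ζ s) (hpq : PQ p q) {z s' : k} (hk : LF p q (n + 1) k z s')
    (hz : algebraMap k K z = ζ ^ 2) (hs' : algebraMap k K s' = s) (hg : Quad k K g) (hgζ : g ζ = -ζ) (hgs : g s = s)
    (hX : ∀ (P : Ideal (𝓞 K)) (hP : Ideal.absNorm P = 2), ∃ x : ClassGroup (𝓞 K), ∀ a b (e : ℕ),
      x ≠ a ^ 2 * ClassGroup.mk0 (nz P hP) ^ e * extC (algebraMap k K) b) :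
    Nat.card (tw (ClassGroup (𝓞 K))) = 2 * Nat.card (tw (ClassGroup (𝓞 k))) := by
  refine h.dbl hpq hg hk.sq (a := -1) (by norm_num) (sq_root hk.prim) hgs (h.kerL hpq hk hz hs' hg hgζ hgs) ?_ hX
  intro c h2 hc hφ a ha h1
  obtain ⟨φ, hφ1, hφ2⟩ := h.quarter hpq
  refine gamma_two (h.T1 hpq) h2 hc (extC φ) (hφ φ hφ2) a ha ?_
  have : φ.comp φ = g := by
    apply hom_eq_of_top (h.top hpq)
    rintro y (rfl | rfl)
    · rw [RingHom.comp_apply, hφ1, hgζ]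
    · rw [RingHom.comp_apply, hφ2, hφ2, hgs]
  rw [extC_comp, this, h1]

theorem LF.dblM (h : LF p q 1 K ζ s) (hpq : PQ p q) {t s' : k} (hk : MF p q k t s')
    (ht : algebraMap k K t = ζ + ζ ^ 3) (hs' : algebraMap k K s' = s) (hg : Quad k K g) (hgζ : g ζ = ζ ^ 3) (hgs : g s = s)
    (hX : ∀ (P : Ideal (𝓞 K)) (hP : Ideal.absNorm P = 2), ∃ x : ClassGroup (𝓞 K), ∀ a b (e : ℕ),
      x ≠ a ^ 2 * ClassGroup.mk0 (nz P hP) ^ e * extC (algebraMap k K) b) :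
    Nat.card (tw (ClassGroup (𝓞 K))) = 2 * Nat.card (tw (ClassGroup (𝓞 k))) := by
  refine h.dbl hpq hg hk.sq (a := -2) (y := t) (by norm_num) (by rw [hk.tsq]; simp) hgs
    (h.kerM hpq hk ht hs' hg hgζ) ?_ hX
  intro c _ _ _ a ha h1
  obtain ⟨E, z, s2, τ, hE, hz, hs2, hτ, hτζ, hτs⟩ := h.subL hpq
  obtain ⟨F, e, se, J, hF, he, hse, hJ, hJζ, hJs⟩ := h.subP hpq
  have hg' : J.comp τ = g := by
    apply hom_eq_of_top (h.top hpq)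
    have h4 := h.four
    have h0 := h.ne0
    rintro y (rfl | rfl)
    · rw [RingHom.comp_apply, hτζ, hgζ, map_neg, hJζ]
      field_simp; rw [h4]
    · rw [RingHom.comp_apply, hτs, hJs, hgs]
  obtain ⟨i, hi⟩ := mem_tw.1 ha
  have hJa := hJ.inv_of_odd (hF.odd hpq) a hi
  obtain ⟨N, m, hNo, hNd, l, hl⟩ := exists_N (Nat.card (ClassGroup (𝓞 K)) * Nat.card (ClassGroup (𝓞 E)))
    (Nat.mul_ne_zero Nat.card_pos.ne' Nat.card_pos.ne')
  have hG := (Nat.dvd_mul_right (Nat.card (ClassGroup (𝓞 K))) (Nat.card (ClassGroup (𝓞 E)))).trans hNd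
  have hH := (Nat.dvd_mul_left (Nat.card (ClassGroup (𝓞 E))) (Nat.card (ClassGroup (𝓞 K)))).trans hNd
  obtain ⟨P, hP, hPφ⟩ := h.two hpq
  obtain ⟨b, hb1, hb2, hb4, hb3⟩ := two_ker hpq hE.sq (a := -1) (by norm_num) (sq_root hE.prim) hP hNo hH
    (h.cls hpq hP hPφ hG) hτ (hPφ τ hτs)
  have hτa : extC τ a = a⁻¹ := by
    obtain ⟨b', hb'⟩ := hτ.class_norm a
    have h2 : a * extC τ a ∈ tw (ClassGroup (𝓞 K)) := mul_mem ha (map_tw _ ha)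
    have h3 := tw_pow_N hG hNo hl h2
    rw [hb', ← map_pow] at h3
    obtain ⟨j, hj⟩ := tw_cyc (hE.T0 hpq) hb1 hb4 (pow_N_mem hH b')
    have hj : b ^ j = b' ^ N := hj
    rw [← hj, map_zpow, hb3, one_zpow] at h3
    rw [← h3] at hb'
    exact eq_inv_of_mul_eq_one_right hb'
  have : extC g a = a := by
    rw [← hg', ← extC_comp, hτa, map_inv, hJa, inv_inv]
  rw [this] at h1
  rw [pow_two, h1]

end
end TC

namespace TC
set_option linter.unusedSectionVars false
set_option linter.style.haveILetI false

/-! ### An auxiliary prime -/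

section
open scoped nonZeroDivisors
variable {k K : Type} [Field k] [NumberField k] [Field K] [NumberField K] [Algebra k K]
  {g : K →+* K} {p q n : ℕ} {ζ η s t : K}

theorem exists_den {z y : 𝓞 K} (h : IntermediateField.adjoin ℚ {algebraMap (𝓞 K) K z, algebraMap (𝓞 K) K y} = ⊤) :
    ∃ m : ℕ, m ≠ 0 ∧ ∀ x : 𝓞 K, (m : 𝓞 K) * x ∈ Algebra.adjoin ℤ {z, y} := by
  have h1 : ∀ x : K, ∃ m : ℕ, m ≠ 0 ∧ ∃ a ∈ Algebra.adjoin ℤ {z, y}, (m : K) * x = algebraMap (𝓞 K) K a := by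
    intro x
    have hx : x ∈ Algebra.adjoin ℚ {algebraMap (𝓞 K) K z, algebraMap (𝓞 K) K y} := by
      rw [← IntermediateField.adjoin_toSubalgebra_of_isAlgebraic (fun x _ => Algebra.IsAlgebraic.isAlgebraic x), h]
      trivial
    induction hx using Algebra.adjoin_induction with
    | mem x hx =>
      rcases hx with rfl | rfl
      · exact ⟨1, one_ne_zero, z, Algebra.subset_adjoin (by simp), by simp⟩
      · exact ⟨1, one_ne_zero, y, Algebra.subset_adjoin (by simp), by simp⟩
    | algebraMap r =>
      refine ⟨r.den, r.den_nz, (r.num : ℤ), intCast_mem _ _, ?_⟩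
      have := r.den_mul_eq_num
      rw [eq_ratCast, map_intCast]
      exact_mod_cast congrArg (Rat.cast (K := K)) this
    | add x y _ _ hx hy =>
      obtain ⟨m, hm, a, ha, h2⟩ := hx
      obtain ⟨l, hl, b, hb, h3⟩ := hy
      refine ⟨m * l, mul_ne_zero hm hl, l * a + m * b, add_mem (mul_mem (natCast_mem _ _) ha) (mul_mem (natCast_mem _ _) hb), ?_⟩
      rw [map_add, map_mul, map_mul, ← h2, ← h3, map_natCast, map_natCast]; push_cast; ring
    | mul x y _ _ hx hy =>
      obtain ⟨m, hm, a, ha, h2⟩ := hx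
      obtain ⟨l, hl, b, hb, h3⟩ := hy
      refine ⟨m * l, mul_ne_zero hm hl, a * b, mul_mem ha hb, ?_⟩
      rw [map_mul, ← h2, ← h3]; push_cast; ring
  have h2 : ∀ x : 𝓞 K, ∃ m : ℕ, m ≠ 0 ∧ (m : 𝓞 K) * x ∈ Algebra.adjoin ℤ {z, y} := by
    intro x
    obtain ⟨m, hm, a, ha, h3⟩ := h1 (algebraMap (𝓞 K) K x)
    refine ⟨m, hm, ?_⟩
    have : (m : 𝓞 K) * x = a := by
      apply ringInt_inj
      rw [← h3, map_mul, map_natCast]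
    rwa [this]
  choose f hf hf' using h2
  obtain ⟨S, hS⟩ := Module.Finite.fg_top (R := ℤ) (M := 𝓞 K)
  obtain ⟨M, hM⟩ : ∃ M, M = ∏ i ∈ S, f i := ⟨_, rfl⟩
  have hM1 : ∀ x ∈ S, ∃ c, M = c * f x := fun x hx => by
    obtain ⟨c, hc⟩ := Finset.dvd_prod_of_mem f hx
    exact ⟨c, by rw [hM, hc, mul_comm]⟩
  refine ⟨M, by rw [hM]; exact Finset.prod_ne_zero_iff.2 fun i _ => hf i, fun x => ?_⟩
  clear hM
  have hx : x ∈ Submodule.span ℤ (S : Set (𝓞 K)) := by rw [hS]; trivial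
  induction hx using Submodule.span_induction with
  | mem x hx =>
    obtain ⟨c, hc⟩ := hM1 x hx
    have e : (M : 𝓞 K) * x = (c : 𝓞 K) * ((f x : 𝓞 K) * x) := by
      rw [hc, Nat.cast_mul, mul_assoc]
    rw [e]
    exact Subalgebra.mul_mem _ (Subalgebra.natCast_mem _ c) (hf' x)
  | zero => rw [mul_zero]; exact zero_mem _
  | add x y _ _ hx hy => rw [mul_add]; exact add_mem hx hy
  | smul a x _ hx => rw [mul_smul_comm]; exact Subalgebra.smul_mem _ hx a

theorem res_le {l m : ℕ} (hl : l.Prime) (hlm : m < l) (hm0 : m ≠ 0) {z y : 𝓞 K}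
    (hm : ∀ x : 𝓞 K, (m : 𝓞 K) * x ∈ Algebra.adjoin ℤ {z, y}) {P : Ideal (𝓞 K)} (hP : P.IsPrime)
    (hlP : (l : 𝓞 K) ∈ P) (hz : z ^ l ^ 2 - z ∈ P) (hy : y ^ l ^ 2 - y ∈ P) :
    Ideal.absNorm P = l ∨ Ideal.absNorm P = l ^ 2 := by
  have hl0 : (l : 𝓞 K) ≠ 0 := by exact_mod_cast hl.ne_zero
  have h0 : P ≠ ⊥ := by rintro rfl; exact hl0 (by simpa using hlP)
  have hmax : P.IsMaximal := hP.isMaximal h0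
  letI := Ideal.Quotient.field P
  haveI : Finite (𝓞 K ⧸ P) := Ideal.finiteQuotientOfFreeOfNeBot P h0
  haveI : Fact l.Prime := ⟨hl⟩
  haveI : CharP (𝓞 K ⧸ P) l := by
    have : ((l : ℕ) : 𝓞 K ⧸ P) = 0 := by
      rw [← map_natCast (Ideal.Quotient.mk P)]; exact Ideal.Quotient.eq_zero_iff_mem.2 hlP
    exact ringChar.of_eq (CharP.ringChar_of_prime_eq_zero hl this)
  have key : ∀ x : 𝓞 K, x ∈ Algebra.adjoin ℤ {z, y} → Ideal.Quotient.mk P x ^ l ^ 2 = Ideal.Quotient.mk P x := by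
    intro x hx
    have e : ∀ x : 𝓞 K ⧸ P, x ^ l ^ 2 = iterateFrobenius (𝓞 K ⧸ P) l 2 x := fun x => (iterateFrobenius_def ..).symm
    induction hx using Algebra.adjoin_induction with
    | mem x hx =>
      rw [← map_pow, Ideal.Quotient.eq]
      rcases hx with rfl | rfl
      · exact hz
      · exact hy
    | algebraMap r => rw [e]; simp
    | add x y _ _ hx hy => rw [map_add, e, map_add, ← e, ← e, hx, hy]
    | mul x y _ _ hx hy => rw [map_mul, mul_pow, hx, hy]
  have hmP : Ideal.Quotient.mk P (m : 𝓞 K) ≠ 0 := by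
    rw [map_natCast, Ne, CharP.cast_eq_zero_iff _ l]
    exact fun h => absurd (Nat.le_of_dvd (Nat.pos_of_ne_zero hm0) h) (by omega)
  have hall : ∀ x : 𝓞 K ⧸ P, x ^ l ^ 2 = x := by
    intro x
    obtain ⟨x, rfl⟩ := Ideal.Quotient.mk_surjective x
    have h1 := key _ (hm x)
    have h2 := key _ (natCast_mem _ m)
    rw [map_mul, mul_pow, h2] at h1
    exact mul_left_cancel₀ hmP h1
  have hN : Nat.card (𝓞 K ⧸ P) = Ideal.absNorm P := by rw [Ideal.absNorm_apply, Submodule.cardQuot_apply]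
  have hl1 := hl.one_lt
  have hcard : Nat.card (𝓞 K ⧸ P)ˣ ∣ l ^ 2 - 1 := by
    rw [← IsCyclic.exponent_eq_card]
    apply Monoid.exponent_dvd_of_forall_pow_eq_one
    intro u
    apply Units.ext
    have h1 := hall (u : 𝓞 K ⧸ P)
    have h2 : l ^ 2 = (l ^ 2 - 1) + 1 := by have : 0 < l ^ 2 := by positivity
                                            omega
    rw [h2, pow_succ] at h1
    have := mul_right_cancel₀ u.ne_zero (h1.trans (one_mul _).symm)
    simpa using this
  have hle : Ideal.absNorm P ≤ l ^ 2 := by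
    rw [← hN]
    have h1 := Nat.card_units (𝓞 K ⧸ P)
    have h2 : 1 < l ^ 2 := by nlinarith
    have := Nat.le_of_dvd (by omega) hcard
    have h3 : 0 < Nat.card (𝓞 K ⧸ P) := Nat.card_pos
    omega
  have := Fintype.ofFinite (𝓞 K ⧸ P)
  obtain ⟨f, -, hf⟩ := FiniteField.card (𝓞 K ⧸ P) l
  rw [← hN, Nat.card_eq_fintype_card, hf] at hle ⊢
  have hf2 := (Nat.pow_le_pow_iff_right hl1).1 hle
  have := f.pos
  have h3 : (f : ℕ) = 1 ∨ (f : ℕ) = 2 := by omega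
  rcases h3 with h3 | h3 <;> rw [h3] <;> simp

/-- the auxiliary prime -/
theorem aux_prime (hpq : PQ p q) (n m : ℕ) : ∃ l : ℕ, m < l ∧ l.Prime ∧ 2 ^ (n + 2) ∣ l ^ 2 - 1 ∧ l % 8 = 7 ∧
    (l : ZMod p) = 1 ∧ (l : ZMod q) = -1 := by
  have hp2 := hpq.p8
  have hq2 := hpq.q8
  have hpo : Odd p := Nat.odd_iff.2 (by omega)
  have hqo : Odd q := Nat.odd_iff.2 (by omega)
  have hc : Nat.Coprime p q := (Nat.coprime_primes hpq.hp hpq.hq).2 hpq.ne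
  have hc1 : Nat.Coprime p (2 ^ (n + 3) * q) := by
    apply Nat.Coprime.mul_right _ hc
    exact (Nat.coprime_two_right.2 hpo).pow_right _
  obtain ⟨Q, hQ⟩ : ∃ Q, Q = 2 ^ (n + 3) * q := ⟨_, rfl⟩
  rw [← hQ] at hc1
  have hQ8 : 8 ∣ Q := by rw [hQ, pow_add]; exact Dvd.intro_left (2 ^ n * q) (by ring)
  have hQ0 : 0 < Q := by rw [hQ]; have := hpq.hq.pos; positivity
  obtain ⟨a, ha1, ha2⟩ := Nat.chineseRemainder hc1 1 (Q - 1)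
  have hap : a.Coprime p := by
    have : Nat.Coprime 1 p := Nat.coprime_one_left p
    rw [Nat.Coprime, ha1.gcd_eq]; exact this
  have haQ : a.Coprime Q := by
    rw [Nat.Coprime, ha2.gcd_eq]
    have : Nat.Coprime (Q - 1) (Q - 1 + 1) := by simp
    rwa [Nat.sub_add_cancel hQ0] at this
  obtain ⟨l, hl, hlp, hla⟩ := Nat.forall_exists_prime_gt_and_modEq m (q := p * Q) (a := a)
    (mul_ne_zero hpq.hp.ne_zero hQ0.ne') (hap.mul_right haQ)
  have h1 : l ≡ 1 [MOD p] := (hla.of_dvd (Dvd.intro _ rfl)).trans ha1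
  have h2 : l ≡ Q - 1 [MOD Q] := (hla.of_dvd (Dvd.intro_left _ rfl)).trans ha2
  have h3 : Q ∣ l + 1 := by
    have := h2.add_right 1
    rw [Nat.sub_add_cancel hQ0] at this
    exact (Nat.modEq_zero_iff_dvd).1 (this.trans (Nat.modEq_zero_iff_dvd.2 dvd_rfl))
  have h4 : l ^ 2 - 1 = (l + 1) * (l - 1) := by
    have := Nat.sq_sub_sq l 1; simpa using this
  refine ⟨l, hl, hlp, ?_, ?_, ?_, ?_⟩
  · rw [h4]
    exact (((pow_dvd_pow 2 (by omega)).trans (Dvd.intro _ hQ.symm)).trans h3).mul_right _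
  · have := hQ8.trans h3
    omega
  · have := (ZMod.natCast_eq_natCast_iff l 1 p).2 h1
    simpa using this
  · have : q ∣ l + 1 := (Dvd.intro_left _ hQ.symm).trans h3
    have := (ZMod.natCast_eq_zero_iff (l + 1) q).2 this
    push_cast at this
    exact eq_neg_of_add_eq_zero_left this

end
end TC

namespace TC
set_option linter.unusedSectionVars false
set_option linter.style.haveILetI false

/-! ### Norms down to `ℚ(√-2)` -/

section
open scoped nonZeroDivisors
variable {k K : Type} [Field k] [NumberField k] [Field K] [NumberField K] [Algebra k K]
  {g : K →+* K} {p q n : ℕ} {ζ η s t : K}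

theorem eq_of_norm {I J : Ideal (𝓞 K)} (h : I ≤ J) (hn : Ideal.absNorm I = Ideal.absNorm J)
    (h0 : Ideal.absNorm I ≠ 0) : I = J := by
  obtain ⟨C, hC⟩ := Ideal.dvd_iff_le.2 h
  have h1 := congrArg Ideal.absNorm hC
  rw [map_mul, ← hn] at h1
  have h2 : Ideal.absNorm C = 1 := by
    have := Nat.eq_of_mul_eq_mul_left (Nat.pos_of_ne_zero h0) ((mul_one _).trans h1)
    exact this.symm
  rw [hC, Ideal.absNorm_eq_one_iff.1 h2, Ideal.mul_top]

theorem QT.no_l (h : QT K t) {l : ℕ} (hl : l.Prime) (hl8 : l % 8 = 7) (J : Ideal (𝓞 K)) : Ideal.absNorm J ≠ l := by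
  intro hJ
  obtain ⟨T, hT, hT2⟩ := lift_sq (s := t) (m := -2) (by rw [h.sq]; simp)
  have hN : Nat.card (𝓞 K ⧸ J) = l := by rw [← hJ, Ideal.absNorm_apply, Submodule.cardQuot_apply]
  haveI : Finite (𝓞 K ⧸ J) := Nat.finite_of_card_ne_zero (by rw [hN]; exact hl.ne_zero)
  have := Fintype.ofFinite (𝓞 K ⧸ J)
  rw [Nat.card_eq_fintype_card] at hN
  have e := ZMod.ringEquivOfPrime (𝓞 K ⧸ J) hl hN
  haveI : Fact l.Prime := ⟨hl⟩
  have h1 : IsSquare (-2 : ZMod l) := ⟨e.symm (Ideal.Quotient.mk J T), by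
    rw [← map_mul, ← map_mul, ← pow_two, hT2, map_intCast, map_intCast]; norm_num⟩
  rw [ZMod.exists_sq_eq_neg_two_iff (by omega)] at h1
  omega

theorem QT.inert (h : QT K t) {l : ℕ} (hl : l.Prime) (hl8 : l % 8 = 7) {J : Ideal (𝓞 K)}
    (hJ : Ideal.absNorm J = l ^ 2) : J = Ideal.span {(l : 𝓞 K)} := by
  have hl0 : l ^ 2 ≠ 0 := pow_ne_zero _ hl.ne_zero
  have hJ1 : J ≠ ⊤ := by
    rintro rfl
    rw [Ideal.absNorm_top] at hJ
    have := hl.one_lt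
    nlinarith
  obtain ⟨Q, hQ, hJQ⟩ := Ideal.exists_le_maximal J hJ1
  have h1 : Ideal.absNorm Q ∣ l ^ 2 := by
    rw [← hJ]; exact Ideal.absNorm_dvd_absNorm_of_le hJQ
  have h2 : Ideal.absNorm Q = l ^ 2 := by
    obtain ⟨i, hi, h3⟩ := (Nat.dvd_prime_pow hl).1 h1
    interval_cases i
    · exact absurd (Ideal.absNorm_eq_one_iff.1 (by simpa using h3)) hQ.ne_top
    · exact absurd (by simpa using h3) (h.no_l hl hl8 Q)
    · exact h3
  have h3 : (l : 𝓞 K) ∈ Q := by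
    have := Ideal.absNorm_mem Q
    rw [h2] at this
    push_cast at this
    exact hQ.isPrime.mem_of_pow_mem _ this
  rw [eq_of_norm hJQ (hJ.trans h2.symm) (by rw [hJ]; exact hl0)]
  have h4 : Ideal.absNorm (Ideal.span {(l : 𝓞 K)}) = l ^ 2 := by
    rw [Ideal.absNorm_span_natCast, RingOfIntegers.rank, h.rank]
  exact (eq_of_norm ((Ideal.span_singleton_le_iff_mem _).2 h3) (h4.trans h2.symm) (by rw [h4]; exact hl0)).symm

theorem QT.two (h : QT K t) {T : 𝓞 K} (hT : algebraMap (𝓞 K) K T = t) {P : Ideal (𝓞 K)}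
    (hP : Ideal.absNorm P = 2) : P = Ideal.span {T} := by
  have h1 : Ideal.absNorm (Ideal.span {T}) = 2 := by
    apply absNorm_of
    rw [hT, norm_sq (b := -2) (c := 1) (by rw [h.sq]; simp) (by rw [h.rank])]
    norm_num
  have hT2 : T ^ 2 = -2 := by
    apply ringInt_inj
    rw [map_pow, hT, h.sq, map_neg, map_ofNat]
  have h2 : T ∈ P := by
    apply (prime_of hP).mem_of_pow_mem 2
    rw [hT2]
    exact P.neg_mem (two_mem hP)
  exact (eq_of_norm ((Ideal.span_singleton_le_iff_mem _).2 h2) (h1.trans hP.symm) (by rw [h1]; norm_num)).symm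

theorem QT.units (h : QT K t) (u : (𝓞 K)ˣ) : ∃ v : (𝓞 K)ˣ, u = v ^ 2 ∨ u = -v ^ 2 := by
  haveI : IsTotallyComplex K := TC_of (x := t) (a := -2) (by norm_num) (by rw [h.sq]; simp)
  have h1 := rank_TC K
  rw [h.rank] at h1
  have h2 := index_sq_units K
  rw [show Units.rank K + 1 = 1 by omega, pow_one, ← Subgroup.relIndex_top_right] at h2
  have h3 : (-1 : (𝓞 K)ˣ) ∉ sqS (⊤ : Subgroup (𝓞 K)ˣ) := by
    intro h3
    obtain ⟨i, -, hi⟩ := mem_sqS.1 h3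
    have hi1 : (algebraMap (𝓞 K) K i) ^ 2 = -1 := by
      have := congrArg (fun u : (𝓞 K)ˣ => algebraMap (𝓞 K) K u) hi
      simpa using this
    set j := algebraMap (𝓞 K) K i
    have ht0 : t ≠ 0 := by
      intro h0
      have := h.sq
      rw [h0] at this
      norm_num at this
    -- `(j t)² = 2`, `y = (jt + t)/2` satisfies `y² = -j·…`
    have hy : ((j * t + t) / 2) ^ 4 = -1 := by
      have e : (j * t + t) ^ 2 = -4 * j := by linear_combination (j + 1) ^ 2 * h.sq - 2 * hi1
      have e2 : (j * t + t) ^ 4 = -16 := by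
        linear_combination ((j * t + t) ^ 2 - 4 * j) * e + 16 * hi1
      rw [div_pow, e2]; norm_num
    have h4 := finrank_zeta (n := 1) (prim_eight hy)
    have h5 := Submodule.finrank_le (ℚ⟮(j * t + t) / 2⟯.toSubalgebra.toSubmodule)
    have h6 : Module.finrank ℚ (ℚ⟮(j * t + t) / 2⟯.toSubalgebra.toSubmodule) = 4 := h4
    rw [h6, h.rank] at h5
    omega
  rcases relIndex_dvd_two' (sqS (⊤ : Subgroup (𝓞 K)ˣ)) ⊤ (by rw [h2]) (Subgroup.mem_top u)
    (Subgroup.mem_top (-1)) with h4 | h4 | h4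
  · obtain ⟨v, -, hv⟩ := mem_sqS.1 h4
    exact ⟨v, Or.inl hv.symm⟩
  · exact absurd h4 h3
  · obtain ⟨v, -, hv⟩ := mem_sqS.1 h4
    exact ⟨v, Or.inr (by rw [hv]; simp)⟩

theorem intNorm_ne {x : 𝓞 K} (hx : x ≠ 0) : Algebra.intNorm (𝓞 k) (𝓞 K) x ≠ 0 := by
  rwa [Ne, Algebra.intNorm_eq_zero]

theorem l_ndvd {l r : ℕ} [Fact r.Prime] {e : ZMod r} (he : e ≠ 0) (h : (l : ZMod r) = e) (c : ℤ)
    (hc : c = l ∨ c = -l) : ¬ (r : ℤ) ∣ c := by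
  rw [← ZMod.intCast_zmod_eq_zero_iff_dvd]
  rcases hc with rfl | rfl
  · push_cast; rwa [h]
  · push_cast; rwa [h, neg_eq_zero]

theorem nu_main {F M : Type} [Field F] [NumberField F] [Field M] [NumberField M] [Algebra F M] [Algebra M k]
    {tF : F} (hF : QT F tF) (hFM : Module.finrank F M = 2)
    (hform : ∀ x : M, ∃ X Y : F, Algebra.norm F x = X ^ 2 - ((p * q : ℕ) : F) * Y ^ 2)
    (hkK : Module.finrank k K = 2) (hpq : PQ p q) {l : ℕ} (hl : l.Prime) (hl8 : l % 8 = 7)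
    (hlp : (l : ZMod p) = 1) (hlq : (l : ZMod q) = -1)
    {P : Ideal (𝓞 K)} (hP : Ideal.absNorm P = 2) (Lam : (Ideal (𝓞 K))⁰)
    (hL : Ideal.absNorm Lam.1 = l ∨ Ideal.absNorm Lam.1 = l ^ 2)
    (a : ClassGroup (𝓞 K)) (b : ClassGroup (𝓞 k)) (e : ℕ) :
    ClassGroup.mk0 Lam ≠ a ^ 2 * ClassGroup.mk0 (nz P hP) ^ e * extC (algebraMap k K) b := by
  intro h
  obtain ⟨A, rfl⟩ := ClassGroup.mk0_surjective a
  obtain ⟨B, rfl⟩ := ClassGroup.mk0_surjective b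
  rw [extC_mk0, ← map_pow, ← map_pow, ← map_mul, ← map_mul] at h
  obtain ⟨x, y, hx, hy, h1⟩ := ClassGroup.mk0_eq_mk0_iff.1 h
  obtain ⟨T, hT, -⟩ := lift_sq (s := tF) (m := -2) (by rw [hF.sq]; simp)
  set ν' : Ideal (𝓞 k) →* Ideal (𝓞 F) :=
    ((Ideal.relNorm (𝓞 F) : Ideal (𝓞 M) →*₀ Ideal (𝓞 F)) : Ideal (𝓞 M) →* Ideal (𝓞 F)).comp
    ((Ideal.relNorm (𝓞 M) : Ideal (𝓞 k) →*₀ Ideal (𝓞 M)) : Ideal (𝓞 k) →* Ideal (𝓞 M)) with hν'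
  set ν : Ideal (𝓞 K) →* Ideal (𝓞 F) :=
    ν'.comp ((Ideal.relNorm (𝓞 k) : Ideal (𝓞 K) →*₀ Ideal (𝓞 k)) : Ideal (𝓞 K) →* Ideal (𝓞 k)) with hν
  have hνN : ∀ I, Ideal.absNorm (ν I) = Ideal.absNorm I := by
    intro I
    change Ideal.absNorm (Ideal.relNorm (𝓞 F) (Ideal.relNorm (𝓞 M) (Ideal.relNorm (𝓞 k) I))) = _
    rw [Ideal.absNorm_relNorm, Ideal.absNorm_relNorm, Ideal.absNorm_relNorm]
  have hνL : ν Lam.1 = Ideal.span {(l : 𝓞 F)} := by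
    rcases hL with hL | hL
    · exact absurd ((hνN _).trans hL) (hF.no_l hl hl8 _)
    · exact hF.inert hl hl8 ((hνN _).trans hL)
  have hνP : ν P = Ideal.span {T} := hF.two hT ((hνN _).trans hP)
  have hνB : ν (exI (algebraMap k K) B).1 = ν' B.1 ^ 2 := by
    have h2 : Ideal.relNorm (𝓞 k) (exI (algebraMap k K) B).1 = B.1 ^ 2 := by
      have := Ideal.relNorm_algebraMap (R := 𝓞 k) (S := 𝓞 K) B.1
      rw [← IsFractionRing.finrank_eq (𝓞 k) k (𝓞 K) K, hkK] at this
      exact this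
    rw [← map_pow, ← h2]; rfl
  have hνs : ∀ x : 𝓞 K, ν (Ideal.span {x}) = Ideal.span {Algebra.intNorm (𝓞 F) (𝓞 M)
      (Algebra.intNorm (𝓞 M) (𝓞 k) (Algebra.intNorm (𝓞 k) (𝓞 K) x))} := by
    intro x
    change Ideal.relNorm (𝓞 F) (Ideal.relNorm (𝓞 M) (Ideal.relNorm (𝓞 k) _)) = _
    rw [Ideal.relNorm_singleton, Ideal.relNorm_singleton, Ideal.relNorm_singleton]
  obtain ⟨x', hx'⟩ : ∃ x', x' = Algebra.intNorm (𝓞 M) (𝓞 k) (Algebra.intNorm (𝓞 k) (𝓞 K) x) := ⟨_, rfl⟩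
  obtain ⟨y', hy'⟩ : ∃ y', y' = Algebra.intNorm (𝓞 M) (𝓞 k) (Algebra.intNorm (𝓞 k) (𝓞 K) y) := ⟨_, rfl⟩
  have hx0 : x' ≠ 0 := by rw [hx']; exact intNorm_ne (intNorm_ne hx)
  have hy0 : y' ≠ 0 := by rw [hy']; exact intNorm_ne (intNorm_ne hy)
  have h2 := congrArg ν h1
  simp only [Submonoid.coe_mul, SubmonoidClass.coe_pow] at h2
  rw [map_mul, map_mul, map_mul, map_mul, map_pow, map_pow, hνL, hνB, show ((nz P hP).1) = P from rfl, hνP,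
    hνs, hνs, ← hx', ← hy'] at h2
  obtain ⟨X1, hX1⟩ : ∃ X1, X1 = Algebra.intNorm (𝓞 F) (𝓞 M) x' := ⟨_, rfl⟩
  obtain ⟨Y1, hY1⟩ : ∃ Y1, Y1 = Algebra.intNorm (𝓞 F) (𝓞 M) y' := ⟨_, rfl⟩
  have hX0 : X1 ≠ 0 := by rw [hX1]; exact intNorm_ne hx0
  have hY0 : Y1 ≠ 0 := by rw [hY1]; exact intNorm_ne hy0
  rw [← hX1, ← hY1] at h2
  obtain ⟨D, hD⟩ : ∃ D, D = ν A.1 * ν' B.1 := ⟨_, rfl⟩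
  have hl0 : (l : 𝓞 F) ≠ 0 := by exact_mod_cast hl.ne_zero
  have h3 : Ideal.span {X1} * Ideal.span {(l : 𝓞 F)} = Ideal.span {Y1} * (Ideal.span {T} ^ e * D ^ 2) := by
    rw [h2, hD]; ring
  have hD0 : D ≠ ⊥ := by
    intro h0
    rw [h0, ← Ideal.zero_eq_bot, zero_pow two_ne_zero, mul_zero, mul_zero, Ideal.span_singleton_mul_span_singleton] at h3
    exact mul_ne_zero hX0 hl0 (Ideal.span_singleton_eq_bot.1 h3)
  obtain ⟨j, hj⟩ : Odd (Nat.card (ClassGroup (𝓞 F))) := hF.odd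
  obtain ⟨δ, hδ⟩ : ∃ δ, D ^ (2 * j + 1) = Ideal.span {δ} := by
    have h4 : ClassGroup.mk0 (⟨D, mem_nonZeroDivisors_iff_ne_zero.2 hD0⟩ : (Ideal (𝓞 F))⁰) ^ (2 * j + 1) = 1 := by
      rw [← hj]; exact pow_card_eq_one'
    rw [← map_pow, ClassGroup.mk0_eq_one_iff] at h4
    exact h4.principal
  have h4 := congrArg (fun I => I ^ (2 * j + 1)) h3
  simp only [mul_pow] at h4
  rw [← pow_mul D, mul_comm 2 (2 * j + 1), pow_mul D, hδ] at h4
  simp only [Ideal.span_singleton_pow, Ideal.span_singleton_mul_span_singleton] at h4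
  obtain ⟨u, hu⟩ := Ideal.span_singleton_eq_span_singleton.1 h4
  obtain ⟨v, hv⟩ := hF.units u
  obtain ⟨c, hc, hcv⟩ : ∃ c : ℤ, (c = l ∨ c = -l) ∧ (l : 𝓞 F) * u = c * (v : 𝓞 F) ^ 2 := by
    rcases hv with hv | hv
    · exact ⟨l, Or.inl rfl, by rw [hv]; simp⟩
    · exact ⟨-l, Or.inr rfl, by rw [hv]; simp⟩
  -- in `F`
  set E := algebraMap (𝓞 F) F with hE
  obtain ⟨w, hw⟩ : ∃ w, w = T ^ (e * (2 * j + 1)) * δ := ⟨_, rfl⟩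
  have h5 : (c : 𝓞 F) * T ^ (e * (2 * j + 1)) * ((l : 𝓞 F) ^ j * v * X1 ^ (2 * j + 1)) ^ 2 =
      (X1 * Y1) ^ (2 * j + 1) * w ^ 2 := by
    rw [hw]
    rw [← pow_mul T] at hu
    linear_combination X1 ^ (2 * j + 1) * T ^ (e * (2 * j + 1)) * hu
      - T ^ (e * (2 * j + 1)) * ((l : 𝓞 F) ^ j) ^ 2 * (X1 ^ (2 * j + 1)) ^ 2 * hcv
  have hN : Algebra.norm F (algebraMap (𝓞 M) M (x' * y') ^ (2 * j + 1) * algebraMap F M (E w)) =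
      E ((X1 * Y1) ^ (2 * j + 1) * w ^ 2) := by
    rw [map_mul, Algebra.norm_algebraMap, hFM, map_pow, map_mul, map_mul, map_mul, ← Algebra.algebraMap_intNorm (A := 𝓞 F),
      ← Algebra.algebraMap_intNorm (A := 𝓞 F), ← hX1, ← hY1, map_pow, map_pow, map_mul]
  obtain ⟨X, Y, hXY⟩ := hform (algebraMap (𝓞 M) M (x' * y') ^ (2 * j + 1) * algebraMap F M (E w))
  rw [hN, ← h5] at hXY
  rw [map_mul, map_mul, map_pow, map_pow, map_intCast, hT] at hXY
  have hZ0 : algebraMap (𝓞 F) F ((l : 𝓞 F) ^ j * v * X1 ^ (2 * j + 1)) ≠ 0 := by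
    rw [Ne, map_eq_zero_iff _ (ringInt_inj (K := F))]
    exact mul_ne_zero (mul_ne_zero (pow_ne_zero _ hl0) v.ne_zero) (pow_ne_zero _ hX0)
  haveI : Fact p.Prime := ⟨hpq.hp⟩
  haveI : Fact q.Prime := ⟨hpq.hq⟩
  have hsp := locT (p := p) hpq.p8 (m := q) hpq.not_dvd tF hF.sq hF.top c (l_ndvd one_ne_zero hlp c hc) _ X Y _ hZ0
    (by rw [hXY]; push_cast; ring)
  have hsq := locT (p := q) hpq.q8 (m := p) hpq.symm.not_dvd tF hF.sq hF.top c
    (l_ndvd (neg_ne_zero.2 one_ne_zero) hlq c hc) _ X Y _ hZ0 (by rw [hXY]; push_cast; ring)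
  rcases hc with rfl | rfl
  · refine nsq_neg_one (p := q) hpq.q8 ?_
    push_cast at hsq ⊢
    rwa [hlq] at hsq
  · refine nsq_neg_one (p := p) hpq.p8 ?_
    push_cast at hsp ⊢
    rwa [hlp] at hsp

end
end TC

namespace TC
set_option linter.unusedSectionVars false
set_option linter.style.haveILetI false

/-! ### A class which is not in the image -/

section
open scoped nonZeroDivisors
variable {k K : Type} [Field k] [NumberField k] [Field K] [NumberField K] [Algebra k K]
  {g : K →+* K} {p q n : ℕ} {ζ η s t : K}

theorem MF.form (h : MF p q K t s) (hpq : PQ p q) : ∃ (F : IntermediateField ℚ K) (tF : F), QT F tF ∧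
    Module.finrank F K = 2 ∧ ∀ x : K, ∃ X Y : F, Algebra.norm F x = X ^ 2 - ((p * q : ℕ) : F) * Y ^ 2 := by
  obtain ⟨E, t', τ, hE, ht', hτ, hτt, hτs⟩ := h.subT hpq
  have hpos := hpq.pos
  refine ⟨E, t', hE, hτ.rank2, norm_form (s := s) (a := ((p * q : ℕ) : E)) ?_ ?_ ?_⟩
  · exact_mod_cast hpos.ne'
  · rw [h.sq, map_natCast]
  · intro b hb
    have h1 := hτ.comm b
    rw [hb, hτs, neg_eq_self] at h1
    have h2 := h.sq
    rw [h1, zero_pow two_ne_zero] at h2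
    have h3 : p * q = 0 := by exact_mod_cast h2.symm
    omega

theorem LF.subMF (h : LF p q (n + 1) K ζ s) (hpq : PQ p q) :
    ∃ (E : IntermediateField ℚ K) (t s' : E), MF p q E t s' := by
  have ht := h.t_sq
  have hz : ζ ∈ ℚ⟮ζ⟯ := mem_adjoin_simple_self ℚ _
  set t := ζ ^ 2 ^ n + ζ ^ (3 * 2 ^ n) with htdef
  have hf := finrank_pair ((p * q : ℕ) : ℚ) (by rw [h.sq]; simp)
    (h.notMem_of hpq (add_mem (pow_mem hz (2 ^ n)) (pow_mem hz (3 * 2 ^ n))))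
  rw [← htdef, finrank_sqrt (-2 : ℚ) (by rw [ht]; simp) (not_rat (a := -2) (by norm_num) (by rw [ht]; simp))] at hf
  refine ⟨IntermediateField.adjoin ℚ {t, s}, ⟨t, mem_pair.1⟩, ⟨s, mem_pair.2⟩, ⟨?_, ?_, hf⟩⟩
  · apply (algebraMap (IntermediateField.adjoin ℚ {t, s}) K).injective
    rw [map_pow, map_neg, map_ofNat]; exact ht
  · apply (algebraMap (IntermediateField.adjoin ℚ {t, s}) K).injective
    rw [map_pow, map_natCast]; exact h.sq

theorem LF.prime (h : LF p q n K ζ s) (hpq : PQ p q) : ∃ (l : ℕ) (Lam : (Ideal (𝓞 K))⁰), l.Prime ∧ l % 8 = 7 ∧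
    (l : ZMod p) = 1 ∧ (l : ZMod q) = -1 ∧ (Ideal.absNorm Lam.1 = l ∨ Ideal.absNorm Lam.1 = l ^ 2) := by
  obtain ⟨Z, hZ⟩ := h.Z
  obtain ⟨S, hS, hS2⟩ := lift_sq (s := s) (m := (p * q : ℕ)) (by rw [h.sq]; simp)
  obtain ⟨m, hm0, hm⟩ := exists_den (z := (Z : 𝓞 K)) (y := S) (by rw [hZ, hS]; exact h.top hpq)
  obtain ⟨l, hlm, hl, hl2, hl8, hlp, hlq⟩ := aux_prime hpq n (m + p * q)
  have hl0 : (l : 𝓞 K) ≠ 0 := by exact_mod_cast hl.ne_zero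
  have hnu : Ideal.span {(l : 𝓞 K)} ≠ ⊤ := by
    intro h1
    have h2 := Ideal.absNorm_eq_one_iff.2 h1
    rw [Ideal.absNorm_span_natCast, RingOfIntegers.rank, h.rank] at h2
    have := Nat.one_lt_pow (n := 2 ^ (n + 2)) (by positivity) hl.one_lt
    omega
  obtain ⟨P, hP, hle⟩ := Ideal.exists_le_maximal _ hnu
  have hlP : (l : 𝓞 K) ∈ P := hle (Ideal.mem_span_singleton_self _)
  have hP0 : P ≠ ⊥ := by rintro rfl; exact hl0 (by simpa using hlP)
  have hpos : 0 < l ^ 2 := by have := hl.pos; positivity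
  refine ⟨l, ⟨P, mem_nonZeroDivisors_iff_ne_zero.2 hP0⟩, hl, hl8, hlp, hlq, res_le hl (by omega) hm0 hm hP.isPrime hlP ?_ ?_⟩
  · have hZ1 : (Z : 𝓞 K) ^ 2 ^ (n + 2) = 1 := by
      apply ringInt_inj
      rw [map_pow, hZ, h.prim.pow_eq_one, map_one]
    obtain ⟨c, hc⟩ := hl2
    have : (Z : 𝓞 K) ^ l ^ 2 = Z := by
      rw [show l ^ 2 = 2 ^ (n + 2) * c + 1 by omega, pow_succ, pow_mul, hZ1, one_pow, one_mul]
    rw [this, sub_self]; exact zero_mem _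
  · obtain ⟨a, ha⟩ : ∃ a, l + 1 = 2 * a := ⟨(l + 1) / 2, by omega⟩
    have e : l ^ 2 = 2 * ((l - 1) * a) + 1 := by
      obtain ⟨b, rfl⟩ : ∃ b, l = b + 1 := ⟨l - 1, by have := hl.pos; omega⟩
      simp only [Nat.add_sub_cancel]
      nlinarith
    have hpq0 := hpq.pos
    haveI : Fact l.Prime := ⟨hl⟩
    have h1 : (l : ℤ) ∣ ((p * q : ℕ) : ℤ) ^ ((l - 1) * a) - 1 := by
      rw [← ZMod.intCast_zmod_eq_zero_iff_dvd]
      have h2 : ((p * q : ℕ) : ZMod l) ≠ 0 := by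
        rw [Ne, ZMod.natCast_eq_zero_iff]
        exact fun h2 => absurd (Nat.le_of_dvd hpq0 h2) (by omega)
      have h3 := ZMod.pow_card_sub_one_eq_one h2
      rw [Int.cast_sub, Int.cast_pow, Int.cast_natCast, pow_mul, h3]
      simp
    obtain ⟨c, hc⟩ := h1
    have h4 : S ^ l ^ 2 - S = (l : 𝓞 K) * (c * S) := by
      rw [e, pow_succ, pow_mul, hS2]
      have h5 := congrArg (Int.cast (R := 𝓞 K)) hc
      rw [Int.cast_sub, Int.cast_pow, Int.cast_mul, Int.cast_natCast (l : ℕ)] at h5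
      linear_combination S * h5
    rw [h4]
    exact P.mul_mem_right _ hlP

theorem LF.hX (h : LF p q n K ζ s) (hpq : PQ p q) (hg : Quad k K g) {M : Type} [Field M] [NumberField M]
    [Algebra M k] {t s' : M} (hM : MF p q M t s') (P : Ideal (𝓞 K)) (hP : Ideal.absNorm P = 2) :
    ∃ x : ClassGroup (𝓞 K), ∀ a b (e : ℕ),
      x ≠ a ^ 2 * ClassGroup.mk0 (nz P hP) ^ e * extC (algebraMap k K) b := by
  obtain ⟨l, Lam, hl, hl8, hlp, hlq, hL⟩ := h.prime hpq
  obtain ⟨F, tF, hF, hr, hform⟩ := hM.form hpq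
  exact ⟨ClassGroup.mk0 Lam, fun a b e => nu_main hF hr hform hg.rank2 hpq hl hl8 hlp hlq hP Lam hL a b e⟩

/-- the doubling formula along the tower -/
theorem LF.tower (h : LF p q (n + 2) K ζ s) (hpq : PQ p q) : ∃ (E : IntermediateField ℚ K) (z s' : E),
    LF p q (n + 1) E z s' ∧ Nat.card (tw (ClassGroup (𝓞 K))) = 2 * Nat.card (tw (ClassGroup (𝓞 E))) := by
  obtain ⟨E, z, s', τ, hE, hz, hs', hτ, hτζ, hτs⟩ := h.subL hpq
  obtain ⟨M, t, s2, hM⟩ := hE.subMF hpq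
  exact ⟨E, z, s', hE, h.dblL hpq hE hz hs' hτ hτζ hτs (h.hX hpq hτ hM)⟩

theorem LF.towerM (h : LF p q 1 K ζ s) (hpq : PQ p q) : ∃ (E : IntermediateField ℚ K) (t s' : E),
    MF p q E t s' ∧ Nat.card (tw (ClassGroup (𝓞 K))) = 2 * Nat.card (tw (ClassGroup (𝓞 E))) := by
  obtain ⟨E, t, s', τ, hE, ht, hs', hτ, hτζ, hτs⟩ := h.subM hpq
  exact ⟨E, t, s', hE, h.dblM hpq hE ht hs' hτ hτζ hτs (h.hX hpq hτ hE)⟩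

end
end TC

namespace TC
set_option linter.unusedSectionVars false
set_option linter.style.haveILetI false

/-! ### The base case: `ℚ(√-2, √pq)` over `ℚ(√-2pq)` -/

theorem thue {p : ℕ} (hp : p.Prime) (h8 : p % 8 = 3) : ∃ x y : ℤ, (p : ℤ) = x ^ 2 + 2 * y ^ 2 := by
  haveI : Fact p.Prime := ⟨hp⟩
  obtain ⟨a, ha⟩ := (ZMod.exists_sq_eq_neg_two_iff (p := p) (by omega)).2 (Or.inr h8)
  set k := Nat.sqrt p with hk
  have hk1 : k * k ≤ p := Nat.sqrt_le p
  have hk2 : p < (k + 1) * (k + 1) := Nat.lt_succ_sqrt p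
  have hk3 : k * k ≠ p := fun h => by
    rcases Nat.prime_mul_iff.1 (h ▸ hp) with ⟨h1, h2⟩ | ⟨h1, h2⟩
    · exact h1.one_lt.ne' h2
    · exact h1.one_lt.ne' h2
  obtain ⟨⟨u, v⟩, h1, ⟨u', v'⟩, h2, hne, he⟩ := Finset.exists_ne_map_eq_of_card_lt_of_maps_to
    (s := Finset.range (k + 1) ×ˢ Finset.range (k + 1)) (t := (Finset.univ : Finset (ZMod p)))
    (f := fun w => (w.1 : ZMod p) - a * (w.2 : ZMod p)) (by
      rw [Finset.card_product, Finset.card_range, Finset.card_univ, ZMod.card]; exact hk2)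
    (fun _ _ => Finset.mem_coe.2 (Finset.mem_univ _))
  simp only [Finset.mem_product, Finset.mem_range] at h1 h2
  have hx : (u : ℤ) - u' ≤ k ∧ -(k : ℤ) ≤ (u : ℤ) - u' := by omega
  have hy : (v : ℤ) - v' ≤ k ∧ -(k : ℤ) ≤ (v : ℤ) - v' := by omega
  have hxy : ¬ ((u : ℤ) - u' = 0 ∧ (v : ℤ) - v' = 0) := by
    rintro ⟨h3, h4⟩
    apply hne
    rw [Prod.mk.injEq]; omega
  have hmod : (((((u : ℤ) - u') ^ 2 + 2 * ((v : ℤ) - v') ^ 2 : ℤ)) : ZMod p) = 0 := by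
    push_cast
    have e : (u : ZMod p) - u' = a * (v - v') := by linear_combination he
    rw [e]; linear_combination (-((v : ZMod p) - v') ^ 2) * ha
  obtain ⟨x, hx0⟩ : ∃ x : ℤ, x = (u : ℤ) - u' := ⟨_, rfl⟩
  obtain ⟨y, hy0⟩ : ∃ x : ℤ, x = (v : ℤ) - v' := ⟨_, rfl⟩
  rw [← hx0] at hx hxy hmod
  rw [← hy0] at hy hxy hmod
  obtain ⟨c, hc⟩ := (ZMod.intCast_zmod_eq_zero_iff_dvd _ _).1 hmod
  have hkp : (k : ℤ) * k < p := by exact_mod_cast lt_of_le_of_ne hk1 hk3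
  have hxk : x ^ 2 ≤ k * k := by nlinarith
  have hyk : y ^ 2 ≤ k * k := by nlinarith
  have hpos : 0 < x ^ 2 + 2 * y ^ 2 := by
    rcases eq_or_ne x 0 with h | h
    · have : y ≠ 0 := fun h' => hxy ⟨h, h'⟩
      have := pow_two_pos_of_ne_zero this
      nlinarith [sq_nonneg x]
    · have := pow_two_pos_of_ne_zero h
      nlinarith [sq_nonneg y]
  have hp0 : (0 : ℤ) < p := by exact_mod_cast hp.pos
  have hc0 : 0 < c := by nlinarith
  have hc3 : c < 3 := by nlinarith
  obtain rfl | rfl : c = 1 ∨ c = 2 := by omega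
  · exact ⟨x, y, by linarith⟩
  · obtain ⟨z, hz⟩ : Even x := by
      have : Even (x ^ 2) := ⟨p - y ^ 2, by linarith⟩
      rwa [Int.even_pow' (by norm_num)] at this
    exact ⟨y, z, by rw [hz] at hc; nlinarith⟩

theorem PQ.form {p q : ℕ} (h : PQ p q) : ∃ X Y : ℤ, ((p * q : ℕ) : ℤ) = X ^ 2 + 2 * Y ^ 2 := by
  obtain ⟨a, b, h1⟩ := thue h.hp h.p8
  obtain ⟨c, d, h2⟩ := thue h.hq h.q8
  exact ⟨a * c - 2 * b * d, a * d + b * c, by push_cast; rw [h1, h2]; ring⟩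

section
open scoped nonZeroDivisors
variable {k K : Type} [Field k] [NumberField k] [Field K] [NumberField K] [Algebra k K]
  {g : K →+* K} {p q n : ℕ} {ζ η s t : K}

theorem units_imq (hr : Module.finrank ℚ K = 2) (hc : IsTotallyComplex K)
    (hi : ∀ x : K, x ^ 2 ≠ -1) (u : (𝓞 K)ˣ) : ∃ v : (𝓞 K)ˣ, u = v ^ 2 ∨ u = -v ^ 2 := by
  have h1 := rank_TC K
  rw [hr] at h1
  have h2 := index_sq_units K
  rw [show Units.rank K + 1 = 1 by omega, pow_one, ← Subgroup.relIndex_top_right] at h2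
  have h3 : (-1 : (𝓞 K)ˣ) ∉ sqS (⊤ : Subgroup (𝓞 K)ˣ) := by
    intro h3
    obtain ⟨i, -, hi'⟩ := mem_sqS.1 h3
    apply hi (algebraMap (𝓞 K) K i)
    have := congrArg (fun u : (𝓞 K)ˣ => algebraMap (𝓞 K) K u) hi'
    simpa using this
  rcases relIndex_dvd_two' (sqS (⊤ : Subgroup (𝓞 K)ˣ)) ⊤ (by rw [h2]) (Subgroup.mem_top u)
    (Subgroup.mem_top (-1)) with h4 | h4 | h4
  · obtain ⟨v, -, hv⟩ := mem_sqS.1 h4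
    exact ⟨v, Or.inl hv.symm⟩
  · exact absurd h4 h3
  · obtain ⟨v, -, hv⟩ := mem_sqS.1 h4
    exact ⟨v, Or.inr (by rw [hv]; simp)⟩

theorem MF.norm_neg (h : MF p q K t s) (hpq : PQ p q) (h1 : g t = -t) (h2 : g s = -s) :
    ∃ w : K, w * g w = -1 := by
  obtain ⟨X, Y, hXY⟩ := hpq.form
  have hXY' : s ^ 2 = (X : K) ^ 2 + 2 * (Y : K) ^ 2 := by
    rw [h.sq]
    have := congrArg (fun z : ℤ => (z : K)) hXY
    push_cast at this ⊢
    exact this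
  have ht0 : t ≠ 0 := by
    intro h0
    have := h.tsq
    rw [h0] at this
    norm_num at this
  have hY : (Y : K) ≠ 0 := by
    intro h0
    have h3 : (s - X) * (s + X) = 0 := by rw [h0] at hXY'; linear_combination hXY'
    rcases mul_eq_zero.1 h3 with h4 | h4
    · exact h.s_rat hpq X (by rw [map_intCast]; linear_combination -h4)
    · exact h.s_rat hpq (-X) (by rw [map_neg, map_intCast]; linear_combination -h4)
  refine ⟨(s + X) / (t * Y), ?_⟩
  rw [map_div₀, map_add, map_mul, map_intCast, map_intCast, h1, h2]
  field_simp
  linear_combination hXY' + (Y : K) ^ 2 * h.tsq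

theorem MF.tI (h : MF p q K t s) (hpq : PQ p q) (hg : Quad k K g) (h1 : g t = -t) (h2 : g s = -s) :
    tI k K g = 1 := by
  have := hg.tI_dvd ∅ (fun P hP hP0 hi => by
    exfalso
    obtain ⟨T, hT, hT2⟩ := lift_sq (s := t) (m := -2) (by rw [h.tsq]; simp)
    obtain ⟨S, hS, hS2⟩ := lift_sq (s := s) (m := (p * q : ℕ)) (by rw [h.sq]; simp)
    obtain ⟨ω, hω⟩ := exists_omega (K := K) (m := p * q) (s := S) hpq.mod4 (by rw [hS2]; simp)
    have e2 : (2 : 𝓞 K) ∈ P := by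
      rcases two_mem_of (x := T) hP (by apply ringInt_inj; rw [coe_oi, hT, h1, map_neg, hT]) hi with h3 | h3
      · exact h3
      · have h4 := P.mul_mem_left (-T) h3
        have h5 : -T * T = 2 := by push_cast at hT2; linear_combination -hT2
        rwa [h5] at h4
    have e3 : S ∈ P := by
      have h3 := hi ω
      have h4 : ω - oi g ω = S := by
        apply ringInt_inj
        rw [map_sub, coe_oi, hS]
        have h5 : algebraMap (𝓞 K) K ω = (1 + s) / 2 := by
          have h5 := congrArg (algebraMap (𝓞 K) K) hω
          rw [map_mul, map_add, map_one, hS, map_ofNat] at h5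
          rw [eq_div_iff two_ne_zero]; linear_combination h5
        rw [h5, map_div₀, map_add, map_one, h2, map_ofNat]
        ring
      rwa [h4] at h3
    apply hP.ne_top
    rw [Ideal.eq_top_iff_one]
    have h6 : ((p * q : ℕ) : 𝓞 K) = 2 * ((p * q / 2 : ℕ) : 𝓞 K) + 1 := by
      have := hpq.mod4
      have h7 : p * q = 2 * (p * q / 2) + 1 := by omega
      have := congrArg (fun z : ℕ => (z : 𝓞 K)) h7
      push_cast at this ⊢
      exact this
    have h7 : (1 : 𝓞 K) = S * S - ((p * q / 2 : ℕ) : 𝓞 K) * 2 := by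
      rw [Int.cast_natCast] at hS2; linear_combination -hS2 - h6
    rw [h7]
    exact P.sub_mem (P.mul_mem_left _ e3) (P.mul_mem_left _ e2))
  simpa using this

theorem MF.uI (h : MF p q K t s) (hpq : PQ p q) (hg : Quad k K g) (h1 : g t = -t) (h2 : g s = -s)
    (hr : Module.finrank ℚ k = 2) (hc : IsTotallyComplex k) : uI g = 1 := by
  rw [TC.uI, Subgroup.relIndex_eq_one]
  rintro x ⟨hx1, hx2⟩
  refine ⟨?_, hx2⟩
  obtain ⟨u, hu⟩ := (ker_pr x).1 hx2
  have hxu : (x : K) = algebraMap (𝓞 K) K u := by rw [← hu]; rfl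
  have hgx : g (x : K) = x := congrArg (fun y : Kˣ => (y : K)) hx1
  have hu2 : u ∈ fixS (gE g) := by
    rw [mem_fixS]
    apply Units.ext
    apply ringInt_inj
    rw [← hxu, ← hgx, hxu]
    exact coe_oi g _
  rw [hg.fixE] at hu2
  obtain ⟨v, rfl⟩ := hu2
  have hv : (x : K) = algebraMap k K (algebraMap (𝓞 k) k v) := by
    rw [hxu]; rfl
  obtain ⟨w, hw⟩ := units_imq hr hc (fun y hy => h.no_i hpq (algebraMap k K y) (by rw [← map_pow, hy]; simp)) v
  set W : K := algebraMap k K (algebraMap (𝓞 k) k w) with hW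
  have hW0 : W ≠ 0 := by
    rw [hW, Ne, map_eq_zero, map_eq_zero_iff _ (ringInt_inj (K := k))]
    exact w.ne_zero
  have hgW : g W = W := hg.comm _
  obtain ⟨y, hy⟩ : ∃ y : K, y * g y = x := by
    rcases hw with hw | hw
    · refine ⟨W, ?_⟩
      rw [hgW, hv, hw, hW, Units.val_pow_eq_pow_val, map_pow, map_pow]; ring
    · obtain ⟨z, hz⟩ := h.norm_neg hpq h1 h2
      refine ⟨z * W, ?_⟩
      rw [map_mul, hgW, hv, hw]
      have : algebraMap k K (algebraMap (𝓞 k) k ((-w ^ 2 : (𝓞 k)ˣ) : 𝓞 k)) = - W ^ 2 := by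
        rw [hW]; simp
      rw [this]
      linear_combination W ^ 2 * hz
  have hy0 : y ≠ 0 := by
    rintro rfl
    rw [zero_mul] at hy
    exact x.ne_zero hy.symm
  exact ⟨Units.mk0 y hy0, Units.ext hy⟩

theorem MF.base (h : MF p q K t s) (hpq : PQ p q) : ∃ (E : IntermediateField ℚ K) (w : E),
    Module.finrank ℚ E = 2 ∧ w ^ 2 = -2 * ((p * q : ℕ) : E) ∧
    Nat.card (tw (ClassGroup (𝓞 E))) = 2 * Nat.card (tw (ClassGroup (𝓞 K))) := by
  obtain ⟨E, w, g, -, hr, hw, hg, h1, h2⟩ := h.subW hpq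
  obtain ⟨F1, t1, σ, hF1, -, hσ, hσt, hσs⟩ := h.subT hpq
  obtain ⟨F2, s2, τ, hF2, -, hτ, hτt, hτs⟩ := h.subS hpq
  have hw2 : w ^ 2 = -2 * ((p * q : ℕ) : E) := by
    have hw : algebraMap E K w = t * s := hw
    apply (algebraMap E K).injective
    rw [map_pow, hw, map_mul, map_neg, map_ofNat, map_natCast, mul_pow, h.tsq, h.sq]
  have hpos : (0 : ℚ) < ((p * q : ℕ) : ℚ) := by exact_mod_cast hpq.pos
  have hcE : IsTotallyComplex E := TC_of (x := w) (a := -2 * ((p * q : ℕ) : ℚ)) (by linarith) (by rw [hw2]; push_cast; ring)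
  have hcK : IsTotallyComplex K := h.tc
  refine ⟨E, w, hr, hw2, ?_⟩
  have hcount := hg.count (e := 1) (by rw [pow_one]; exact hg.h1_TC)
  rw [h.uI hpq hg h1 h2 hr hcE, h.tI hpq hg h1 h2] at hcount
  have hcomp : g = σ.comp τ := by
    apply hom_eq_of_top (h.top hpq)
    rintro y (rfl | rfl)
    · rw [h1, RingHom.comp_apply, hτt, map_neg, hσt]
    · rw [h2, RingHom.comp_apply, hτs, hσs]
  have hle : tw (ClassGroup (𝓞 K)) ≤ fixS (extC g) := by
    intro c hc
    obtain ⟨m, hm⟩ := mem_tw.1 hc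
    rw [mem_fixS, hcomp, ← extC_comp, hτ.inv_of_odd (hF2.odd hpq) c hm, map_inv, hσ.inv_of_odd hF1.odd c hm, inv_inv]
  obtain ⟨m1, hm1, e1⟩ := card_eq_tw hle
  obtain ⟨m2, hm2, e2⟩ := card_eq_tw (S := (⊤ : Subgroup (ClassGroup (𝓞 E)))) le_top
  obtain ⟨k1, hk1⟩ := card_tw_pow (ClassGroup (𝓞 K))
  obtain ⟨k2, hk2⟩ := card_tw_pow (ClassGroup (𝓞 E))
  rw [Subgroup.card_top] at e2
  rw [aC, e1, e2, hk1, hk2] at hcount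
  rw [hk1, hk2]
  have e3 : 2 ^ (k1 + 1) * m1 = 2 ^ k2 * m2 := by rw [pow_succ]; linarith
  have d1 : 2 ^ (k1 + 1) ∣ 2 ^ k2 := by
    apply (Nat.Coprime.pow_left (k1 + 1) (Nat.coprime_two_left.2 hm2)).dvd_of_dvd_mul_right
    rw [← e3]; exact dvd_mul_right _ _
  have d2 : 2 ^ k2 ∣ 2 ^ (k1 + 1) := by
    apply (Nat.Coprime.pow_left k2 (Nat.coprime_two_left.2 hm1)).dvd_of_dvd_mul_right
    rw [e3]; exact dvd_mul_right _ _
  rw [Nat.dvd_antisymm d2 d1, pow_succ]; ring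

theorem MF.card_ne (h : MF p q K t s) (hpq : PQ p q) : Nat.card (tw (ClassGroup (𝓞 K))) ≠ 1 := by
  intro h1
  obtain ⟨P, hP, -⟩ := h.two hpq
  obtain ⟨N, k, hN, hM, -⟩ := exists_N (Nat.card (ClassGroup (𝓞 K))) (card_cl_ne (K := K))
  have h2 := pow_N_mem hM (ClassGroup.mk0 (nz P hP))
  have h3 : tw (ClassGroup (𝓞 K)) = ⊥ := Subgroup.card_eq_one.1 h1
  rw [h3, Subgroup.mem_bot] at h2
  exact two_not_sq hpq h.sq (a := -2) (y := t) (by norm_num) (by rw [h.tsq]; simp) hP hN 1 (by rw [h2, one_pow])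

/-- the structure of the 2-class group, given its order -/
theorem LF.struct (h : LF p q (n + 1) K ζ s) (hpq : PQ p q) {m : ℕ}
    (hm : Nat.card (tw (ClassGroup (𝓞 K))) = 2 ^ (m + 1)) :
    Nonempty (tw (ClassGroup (𝓞 K)) ≃* Multiplicative (ZMod (2 ^ m) × ZMod 2)) := by
  obtain ⟨P, hP, hφ⟩ := h.two hpq
  obtain ⟨N, k, hN, hM, -⟩ := exists_N (Nat.card (ClassGroup (𝓞 K))) (card_cl_ne (K := K))
  exact struct_two (h.T1 hpq) (h.cls hpq hP hφ hM)
    (fun a => two_not_sq hpq h.sq (a := -1) (by norm_num) (sq_root h.prim) hP hN a) hm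

end

theorem LF.card {p q : ℕ} (hpq : PQ p q) (n : ℕ) : ∀ {K : Type} [Field K] [NumberField K] {ζ s : K},
    LF p q (n + 1) K ζ s → ∃ (k : Type) (_ : Field k) (_ : NumberField k) (w : k),
    Module.finrank ℚ k = 2 ∧ w ^ 2 = -2 * ((p * q : ℕ) : k) ∧
    Nat.card (tw (ClassGroup (𝓞 K))) = 2 ^ n * Nat.card (tw (ClassGroup (𝓞 k))) ∧
    ∃ a, Nat.card (tw (ClassGroup (𝓞 k))) = 2 ^ (a + 2) := by
  induction n with
  | zero =>
    intro K _ _ ζ s h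
    obtain ⟨M, t, s', hM, e1⟩ := h.towerM hpq
    obtain ⟨k, w, hr, hw, e2⟩ := hM.base hpq
    refine ⟨k, inferInstance, inferInstance, w, hr, hw, ?_, ?_⟩
    · rw [e1, e2]; simp
    · obtain ⟨b, hb⟩ := card_tw_pow (ClassGroup (𝓞 M))
      have := hM.card_ne hpq
      rw [hb] at this
      rw [e2, hb]
      obtain _ | b := b
      · simp at this
      · exact ⟨b, by ring⟩
  | succ n ih =>
    intro K _ _ ζ s h
    obtain ⟨E, z, s', hE, e1⟩ := h.tower hpq
    obtain ⟨k, i1, i2, w, hr, hw, e2, e3⟩ := ih hE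
    exact ⟨k, i1, i2, w, hr, hw, by rw [e1, e2]; ring, e3⟩

end TC

namespace TC
set_option linter.unusedSectionVars false
set_option linter.style.haveILetI false

/-! ### The concrete fields inside `ℂ` -/

theorem card_tw_le {k K : Type} [Field k] [NumberField k] [Field K] [NumberField K] (e : k ≃+* K) :
    Nat.card (tw (ClassGroup (𝓞 k))) ≤ Nat.card (tw (ClassGroup (𝓞 K))) := by
  refine Nat.card_le_card_of_injective (fun c => (⟨extC e.toRingHom c.1, ?_⟩ : tw (ClassGroup (𝓞 K)))) ?_
  · obtain ⟨m, hm⟩ := mem_tw.1 c.2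
    exact mem_tw.2 ⟨m, by rw [← map_pow, hm, map_one]⟩
  · intro a b hab
    have h1 : extC e.toRingHom a.1 = extC e.toRingHom b.1 := congrArg Subtype.val hab
    have h2 := congrArg (extC e.symm.toRingHom) h1
    have h3 : e.symm.toRingHom.comp e.toRingHom = RingHom.id k := RingHom.ext fun x => e.symm_apply_apply x
    rw [extC_comp, extC_comp, h3, extC_id, extC_id] at h2
    exact Subtype.ext h2

theorem card_quad {k : Type} [Field k] [NumberField k] (hr : Module.finrank ℚ k = 2) {w : k} {m : ℤ}
    (hm : m < 0) (hw : w ^ 2 = (m : k)) :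
    h2 m = Nat.card (tw (ClassGroup (𝓞 k))) := by
  have hn := not_rat (a := (m : ℚ)) (by exact_mod_cast hm) (x := w) (by rw [hw]; simp)
  have htop : ℚ⟮w⟯ = ⊤ := top_of_finrank (by rw [finrank_sqrt (m : ℚ) (by rw [hw]; simp) hn, hr])
  let f : k →ₐ[ℚ] ℂ := IsAlgClosed.lift
  have hf2 : f w ^ 2 = (m : ℂ) := by rw [← map_pow, hw, map_intCast]
  have hrange : f.fieldRange = quadField m := by
    rw [AlgHom.fieldRange_eq_map, ← htop, IntermediateField.adjoin_map, Set.image_singleton]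
    apply le_antisymm
    · exact IntermediateField.adjoin.mono _ _ _ (by rintro _ rfl; exact hf2)
    · refine IntermediateField.adjoin_le_iff.2 ?_
      intro z hz
      have hz : z ^ 2 = (m : ℂ) := hz
      have h3 : (z - f w) * (z + f w) = 0 := by linear_combination hz - hf2
      have hmem : f w ∈ ℚ⟮f w⟯ := mem_adjoin_simple_self ℚ _
      rcases mul_eq_zero.1 h3 with h4 | h4
      · rw [sub_eq_zero.1 h4]; exact hmem
      · rw [eq_neg_of_add_eq_zero_left h4]; exact neg_mem hmem
  let e : k ≃ₐ[ℚ] quadField m := (AlgEquiv.ofInjectiveField f).trans (IntermediateField.equivOfEq hrange)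
  haveI : NumberField (quadField m) := NumberField.of_ringEquiv k (quadField m) e.toRingEquiv
  have := le_antisymm (card_tw_le e.toRingEquiv.symm) (card_tw_le e.toRingEquiv)
  exact this

theorem pair_top {F L : Type} [Field F] [Field L] [Algebra F L] {z s : L}
    {z' s' : IntermediateField.adjoin F {z, s}} (h1 : (z' : L) = z) (h2 : (s' : L) = s) :
    IntermediateField.adjoin F {z', s'} = ⊤ := by
  apply IntermediateField.lift_injective
  rw [IntermediateField.lift_adjoin, IntermediateField.lift_top, Set.image_insert_eq, Set.image_singleton, h1, h2]

theorem alg_top {L : Type} [Field L] (i j : Algebra ℚ L) {S : Set L}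
    (h : @IntermediateField.adjoin ℚ _ L _ i S = ⊤) : @IntermediateField.adjoin ℚ _ L _ j S = ⊤ := by
  obtain rfl : i = j := Subsingleton.elim _ _
  exact h

theorem Lfield_LF {p q : ℕ} (hpq : PQ p q) (n : ℕ) : ∃ (_ : NumberField (Lfield n ((p : ℤ) * q)))
    (ζ s : Lfield n ((p : ℤ) * q)), LF p q n (Lfield n ((p : ℤ) * q)) ζ s := by
  obtain ⟨z, hz⟩ : ∃ z : ℂ, IsPrimitiveRoot z (2 ^ (n + 2)) := ⟨_, Complex.isPrimitiveRoot_exp (2 ^ (n + 2)) (by positivity)⟩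
  obtain ⟨s, hs⟩ : ∃ s : ℂ, s ^ 2 = ((p * q : ℕ) : ℂ) := IsAlgClosed.exists_pow_nat_eq _ (by norm_num)
  have hE : Lfield n ((p : ℤ) * q) = IntermediateField.adjoin ℚ {z, s} := by
    have hz' : z ∈ IntermediateField.adjoin ℚ {z, s} := IntermediateField.subset_adjoin ℚ _ (Or.inl rfl)
    have hs' : s ∈ IntermediateField.adjoin ℚ {z, s} := IntermediateField.subset_adjoin ℚ _ (Or.inr rfl)
    apply le_antisymm
    · refine IntermediateField.adjoin_le_iff.2 ?_
      rintro y (hy | hy)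
      · haveI : NeZero (2 ^ (n + 2)) := ⟨by positivity⟩
        obtain ⟨i, -, rfl⟩ := hz.eq_pow_of_pow_eq_one hy
        exact pow_mem hz' i
      · have hy : y ^ 2 = (((p : ℤ) * q : ℤ) : ℂ) := hy
        have h3 : (y - s) * (y + s) = 0 := by push_cast at hy hs; linear_combination hy - hs
        rcases mul_eq_zero.1 h3 with h4 | h4
        · rw [sub_eq_zero.1 h4]; exact hs'
        · rw [eq_neg_of_add_eq_zero_left h4]; exact neg_mem hs'
    · refine IntermediateField.adjoin.mono _ _ _ ?_
      rintro y (rfl | rfl)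
      · exact Or.inl hz.pow_eq_one
      · refine Or.inr ?_
        change y ^ 2 = (((p : ℤ) * q : ℤ) : ℂ)
        rw [hs]; push_cast; rfl
  have hzi : IsIntegral ℚ z := (hz.isIntegral (by positivity)).tower_top
  have hsi : IsIntegral ℚ s := by
    refine IsIntegral.of_pow (n := 2) (by norm_num) ?_
    rw [hs, ← map_natCast (algebraMap ℚ ℂ)]
    exact isIntegral_algebraMap
  rw [hE]
  have hfd : FiniteDimensional ℚ (IntermediateField.adjoin ℚ {z, s}) := IntermediateField.finiteDimensional_adjoin_pair hzi hsi
  have hnf : NumberField (IntermediateField.adjoin ℚ {z, s}) := ⟨⟩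
  obtain ⟨z', hz'⟩ : ∃ z' : IntermediateField.adjoin ℚ {z, s}, algebraMap _ ℂ z' = z :=
    ⟨⟨z, IntermediateField.subset_adjoin ℚ {z, s} (Set.mem_insert _ _)⟩, rfl⟩
  obtain ⟨s', hs'⟩ : ∃ s' : IntermediateField.adjoin ℚ {z, s}, algebraMap _ ℂ s' = s :=
    ⟨⟨s, IntermediateField.subset_adjoin ℚ {z, s} (Set.mem_insert_of_mem _ rfl)⟩, rfl⟩
  have hp : IsPrimitiveRoot z' (2 ^ (n + 2)) :=
    IsPrimitiveRoot.of_map_of_injective (f := algebraMap (IntermediateField.adjoin ℚ {z, s}) ℂ) (by rw [hz']; exact hz)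
      (FaithfulSMul.algebraMap_injective _ _)
  have hsq : s' ^ 2 = ((p * q : ℕ) : IntermediateField.adjoin ℚ {z, s}) := by
    apply FaithfulSMul.algebraMap_injective _ ℂ
    rw [map_pow, hs', hs, map_natCast]
  refine ⟨hnf, z', s', hp, hsq, ?_⟩
  have htop : IntermediateField.adjoin ℚ {z', s'} = ⊤ := by
    exact alg_top _ _ (pair_top (F := ℚ) (z' := z') (s' := s') hz' hs')
  have hf := finrank_pair ((p * q : ℕ) : ℚ) (by rw [hsq]; simp)
    (s_notMem hpq.hp hpq.ne_two hpq.not_dvd hp (by rw [hsq]; simp))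
  rw [htop, IntermediateField.finrank_top', finrank_zeta hp] at hf
  rw [hf, pow_succ' 2 (n + 1)]

end TC

/-- for two primes `p ≡ q ≡ 3 (mod 8)`, `d = pq` and `2^r = h₂(-2pq)`,
the 2-class group of `L_{n,d}` is `ℤ/2^{n+r-2}ℤ × ℤ/2ℤ` for all `n ≥ 1`. -/
theorem twoClassGroup_Lfield_pq_three_mod_eight
    (p q : ℕ) (hp : p.Prime) (hq : q.Prime)
    (hp8 : p % 8 = 3) (hq8 : q % 8 = 3) (hpq : p ≠ q)
    (r : ℕ) (hr : 2 ^ r = h2 (-2 * ((p : ℤ) * q))) :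
    ∀ n : ℕ, 1 ≤ n →
      Nonempty ((twoClassGroup (Lfield n ((p : ℤ) * q))) ≃*
        Multiplicative (ZMod (2 ^ (n + r - 2)) × ZMod 2)) := by
  intro n hn
  obtain ⟨n, rfl⟩ : ∃ m, n = m + 1 := ⟨n - 1, by omega⟩
  have hPQ : TC.PQ p q := ⟨hp, hq, hp8, hq8, hpq⟩
  obtain ⟨_, ζ, s, h⟩ := TC.Lfield_LF hPQ (n + 1)
  obtain ⟨k, _, _, w, h2', hw, e1, a, e2⟩ := h.card hPQ n
  have hpos := hPQ.pos
  have e3 := TC.card_quad (k := k) h2' (w := w) (m := -2 * ((p : ℤ) * q)) (by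
    have : (0 : ℤ) < (p : ℤ) * q := by exact_mod_cast hpos
    linarith) (by rw [hw]; push_cast; ring)
  rw [← hr, e2] at e3
  have e4 : r = a + 2 := Nat.pow_right_injective le_rfl e3
  refine h.struct hPQ ?_
  rw [e1, e2, ← pow_add]
  congr 1
  omega
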